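/- Let 1 < p < ∞, let Ω ⊆ ℝ² be a nonempty bounded open simply connected set, and let Φ : closure(Ω) → ℝ be continuous. Then there exists a unique function φ : closure(Ω) → ℝ which is continuous on closure(Ω), is p-harmonic on Ω, and agrees with Φ at every point of the frontier of Ω. -/

import Mathlib

open MeasureTheory Set
open scoped RealInnerProductSpace

/-- `φ` is `p`-harmonic on the open set `Ω ⊆ ℝ²`: it is `C¹` on `Ω` and satisfies the
weak form of `div(‖∇φ‖^{p-2} ∇φ) = 0` against all compactly supported `C¹` test
functions supported in `Ω`. -/
def PHarmonicOn (p : ℝ) (Ω : Set (EuclideanSpace ℝ (Fin 2)))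
    (φ : EuclideanSpace ℝ (Fin 2) → ℝ) : Prop :=
  ContDiffOn ℝ 1 φ Ω ∧
  ∀ η : EuclideanSpace ℝ (Fin 2) → ℝ, ContDiff ℝ 1 η → HasCompactSupport η →
    tsupport η ⊆ Ω →
    ∫ x in Ω, ‖gradient φ x‖ ^ (p - 2) * ⟪gradient φ x, gradient η x⟫ = 0

namespace PLaplace

open scoped Gradient Topology
open Filter Metric

/-- The Euclidean plane. -/
abbrev Plane := EuclideanSpace ℝ (Fin 2)

section GradientCalculus

variable {f g : Plane → ℝ} {x : Plane} {U : Set Plane}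

lemma gradient_def (f : Plane → ℝ) (x : Plane) :
    ∇ f x = (InnerProductSpace.toDual ℝ Plane).symm (fderiv ℝ f x) := rfl

lemma norm_gradient (f : Plane → ℝ) (x : Plane) : ‖∇ f x‖ = ‖fderiv ℝ f x‖ := by
  rw [gradient_def, LinearIsometryEquiv.norm_map]

lemma continuous_gradient (hf : ContDiff ℝ 1 f) : Continuous (∇ f) :=
  (InnerProductSpace.toDual ℝ Plane).symm.continuous.comp (hf.continuous_fderiv one_ne_zero)

lemma continuousOn_gradient (hf : ContDiffOn ℝ 1 f U) (hU : IsOpen U) :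
    ContinuousOn (∇ f) U :=
  (InnerProductSpace.toDual ℝ Plane).symm.continuous.comp_continuousOn
    (hf.continuousOn_fderiv_of_isOpen hU le_rfl)

lemma differentiableAt_of_contDiffOn (hf : ContDiffOn ℝ 1 f U) (hU : IsOpen U) (hx : x ∈ U) :
    DifferentiableAt ℝ f x :=
  (hf.differentiableOn one_ne_zero).differentiableAt (hU.mem_nhds hx)

lemma gradient_add (hf : DifferentiableAt ℝ f x) (hg : DifferentiableAt ℝ g x) :
    ∇ (fun y => f y + g y) x = ∇ f x + ∇ g x := by
  simp only [gradient_def, fderiv_fun_add hf hg, map_add]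

lemma gradient_sub (hf : DifferentiableAt ℝ f x) (hg : DifferentiableAt ℝ g x) :
    ∇ (fun y => f y - g y) x = ∇ f x - ∇ g x := by
  simp only [gradient_def, fderiv_fun_sub hf hg, map_sub]

lemma gradient_sub_const (c : ℝ) : ∇ (fun y => f y - c) x = ∇ f x := by
  simp only [gradient_def, fderiv_sub_const]

lemma gradient_add_const (c : ℝ) : ∇ (fun y => f y + c) x = ∇ f x := by
  simp only [gradient_def, fderiv_add_const]

lemma gradient_const (c : ℝ) : ∇ (fun _ : Plane => c) x = 0 := by
  simp [gradient_def]

lemma gradient_neg : ∇ (fun y => -f y) x = -∇ f x := by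
  simp only [gradient_def, fderiv_fun_neg, map_neg]

lemma gradient_const_mul (hf : DifferentiableAt ℝ f x) (c : ℝ) :
    ∇ (fun y => c * f y) x = c • ∇ f x := by
  simp only [gradient_def, fderiv_const_mul hf, map_smulₛₗ]; rfl

lemma gradient_mul (hf : DifferentiableAt ℝ f x) (hg : DifferentiableAt ℝ g x) :
    ∇ (fun y => f y * g y) x = f x • ∇ g x + g x • ∇ f x := by
  simp only [gradient_def, fderiv_fun_mul hf hg, map_add, map_smulₛₗ]; rfl

lemma gradient_comp {k : ℝ → ℝ} {k' : ℝ} (hk : HasDerivAt k k' (f x))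
    (hf : DifferentiableAt ℝ f x) : ∇ (fun y => k (f y)) x = k' • ∇ f x := by
  have := hk.comp_hasFDerivAt x hf.hasFDerivAt
  simp only [gradient_def]
  rw [show (fun y => k (f y)) = k ∘ f from rfl, this.fderiv, map_smulₛₗ]; rfl

lemma gradient_comp_add (f : Plane → ℝ) (h x : Plane) :
    ∇ (fun y => f (y + h)) x = ∇ f (x + h) := by
  simp only [gradient_def, fderiv_comp_add_right]

lemma gradient_congr (h : f =ᶠ[𝓝 x] g) : ∇ f x = ∇ g x := by
  simp only [gradient_def, h.fderiv_eq]

lemma gradient_congr_of_eqOn (hU : IsOpen U) (h : EqOn f g U) (hx : x ∈ U) : ∇ f x = ∇ g x :=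
  gradient_congr (Filter.eventuallyEq_of_mem (hU.mem_nhds hx) h)

lemma gradient_eq_zero_of_notMem_tsupport (hx : x ∉ tsupport f) : ∇ f x = 0 := by
  rw [gradient_congr (notMem_tsupport_iff_eventuallyEq.1 hx)]
  exact gradient_const 0

lemma hasCompactSupport_gradient (hf : HasCompactSupport f) : HasCompactSupport (∇ f) :=
  HasCompactSupport.intro hf fun _ hx => gradient_eq_zero_of_notMem_tsupport hx

lemma tsupport_gradient_subset : tsupport (∇ f) ⊆ tsupport f :=
  closure_minimal (fun _ hx => by
    by_contra h
    exact hx (gradient_eq_zero_of_notMem_tsupport h)) (isClosed_tsupport f)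

lemma fderiv_apply_le (f : Plane → ℝ) (x v : Plane) : |fderiv ℝ f x v| ≤ ‖∇ f x‖ * ‖v‖ := by
  rw [norm_gradient]; exact (fderiv ℝ f x).le_opNorm v

lemma contDiff_mul_of_tsupport_subset (hU : IsOpen U) (hf : ContDiff ℝ 1 f)
    (hg : ContDiffOn ℝ 1 g U) (hs : tsupport f ⊆ U) : ContDiff ℝ 1 (fun y => f y * g y) := by
  rw [contDiff_iff_contDiffAt]
  intro x
  by_cases hx : x ∈ U
  · exact hf.contDiffAt.mul (hg.contDiffAt (hU.mem_nhds hx))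
  · have hx' : x ∉ tsupport f := fun h => hx (hs h)
    have : (fun y => f y * g y) =ᶠ[𝓝 x] fun _ => 0 := by
      filter_upwards [notMem_tsupport_iff_eventuallyEq.1 hx'] with y hy
      simp [hy]
    exact contDiffAt_const.congr_of_eventuallyEq this

end GradientCalculus

lemma _root_.Continuous.integrableOn_ball {F : Type*} [NormedAddCommGroup F] {f : Plane → F}
    (hf : Continuous f) (x : Plane) (r : ℝ) : IntegrableOn f (ball x r) :=
  (hf.continuousOn.integrableOn_compact (isCompact_closedBall x r)).mono_set ball_subset_closedBall

lemma volume_real_ball (x : Plane) {r : ℝ} (hr : 0 ≤ r) :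
    volume.real (ball x r) = Real.pi * r ^ 2 := by
  rw [Measure.real, EuclideanSpace.volume_ball_fin_two]
  simp [ENNReal.toReal_mul, hr, mul_comm]
  exact Or.inl Real.pi_pos.le

/-- Cutoff functions with the natural scaling of their derivatives. -/
lemma exists_cutoff : ∃ C : ℝ, 0 < C ∧ ∀ (x₀ : Plane) (r : ℝ), 0 < r →
    ∃ ζ : Plane → ℝ, ContDiff ℝ 2 ζ ∧ (∀ x, 0 ≤ ζ x) ∧ (∀ x, ζ x ≤ 1) ∧
      (∀ x ∈ closedBall x₀ r, ζ x = 1) ∧ tsupport ζ ⊆ closedBall x₀ (3 / 2 * r) ∧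
      (∀ x, ‖∇ ζ x‖ ≤ C / r) ∧
      ∀ i x, ‖∇ (fun y => (∇ ζ y) i) x‖ ≤ C / r ^ 2 := by
  let b : ContDiffBump (0 : Plane) := ⟨1, 3 / 2, by norm_num, by norm_num⟩
  have hb : ContDiff ℝ 2 (b : Plane → ℝ) := b.contDiff
  have hgr : ContDiff ℝ 1 (∇ (b : Plane → ℝ)) := by
    have h1 : ContDiff ℝ 1 (fderiv ℝ (b : Plane → ℝ)) := hb.fderiv_right (by norm_num)
    exact (InnerProductSpace.toDual ℝ Plane).symm.contDiff.comp h1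
  have hgi : ∀ i, ContDiff ℝ 1 (fun y => (∇ (b : Plane → ℝ) y) i) := fun i =>
    (EuclideanSpace.proj (𝕜 := ℝ) i).contDiff.comp hgr
  have hcb : HasCompactSupport (b : Plane → ℝ) := b.hasCompactSupport
  obtain ⟨C₁, hC₁⟩ := (hasCompactSupport_gradient hcb).exists_bound_of_continuous
    (continuous_gradient (hb.of_le (by norm_num)))
  have hci : ∀ i, HasCompactSupport (fun y => (∇ (b : Plane → ℝ) y) i) := fun i =>
    HasCompactSupport.intro (hasCompactSupport_gradient hcb) fun x hx => by
      rw [image_eq_zero_of_notMem_tsupport hx]; rfl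
  have hex : ∀ i, ∃ C, ∀ x, ‖∇ (fun y => (∇ (b : Plane → ℝ) y) i) x‖ ≤ C := fun i =>
    (hasCompactSupport_gradient (hci i)).exists_bound_of_continuous
      (continuous_gradient (hgi i))
  choose C₂ hC₂ using hex
  have hscale : ∀ (f : Plane → ℝ), Differentiable ℝ f → ∀ (x₀ x : Plane) (r : ℝ),
      ∇ (fun y => f (r⁻¹ • (y - x₀))) x = r⁻¹ • ∇ f (r⁻¹ • (x - x₀)) := by
    intro f hf x₀ x r
    refine HasGradientAt.gradient ?_
    rw [hasGradientAt_iff_hasFDerivAt]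
    have h1 : HasFDerivAt (fun y : Plane => r⁻¹ • (y - x₀))
        (r⁻¹ • ContinuousLinearMap.id ℝ Plane) x :=
      ((hasFDerivAt_id x).sub_const x₀).const_smul r⁻¹
    have h2 := (hf (r⁻¹ • (x - x₀))).hasFDerivAt.comp x h1
    have h3 : InnerProductSpace.toDual ℝ Plane (r⁻¹ • ∇ f (r⁻¹ • (x - x₀))) =
        (fderiv ℝ f (r⁻¹ • (x - x₀))).comp (r⁻¹ • ContinuousLinearMap.id ℝ Plane) := by
      rw [map_smulₛₗ, gradient_def, LinearIsometryEquiv.apply_symm_apply]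
      ext v
      simp
    rw [h3]
    exact h2
  refine ⟨|C₁| + |C₂ 0| + |C₂ 1| + 1, by positivity, fun x₀ r hr => ?_⟩
  have hg1 : ∀ x, ∇ (fun y => b (r⁻¹ • (y - x₀))) x = r⁻¹ • ∇ b (r⁻¹ • (x - x₀)) :=
    fun x => hscale b (hb.differentiable (by norm_num)) x₀ x r
  refine ⟨fun y => b (r⁻¹ • (y - x₀)), ?_, fun x => b.nonneg, fun x => b.le_one, ?_, ?_, ?_, ?_⟩
  · exact hb.comp ((contDiff_id.sub contDiff_const).const_smul _)
  · intro x hx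
    refine b.one_of_mem_closedBall ?_
    rw [mem_closedBall_zero_iff, norm_smul, norm_inv, Real.norm_of_nonneg hr.le]
    rw [mem_closedBall, dist_eq_norm] at hx
    rw [inv_mul_le_iff₀ hr]; simpa [b] using hx
  · refine closure_minimal (fun x hx => ?_) isClosed_closedBall
    by_contra h
    refine hx (b.zero_of_le_dist ?_)
    rw [mem_closedBall, dist_eq_norm, not_le] at h
    rw [dist_zero_right, norm_smul, norm_inv, Real.norm_of_nonneg hr.le, le_inv_mul_iff₀ hr]
    have : b.rOut = 3 / 2 := rfl
    rw [this]; linarith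
  · intro x
    rw [hg1, norm_smul, norm_inv, Real.norm_of_nonneg hr.le, inv_mul_eq_div]
    gcongr
    have := hC₁ (r⁻¹ • (x - x₀))
    have h0 := abs_nonneg (C₂ 0)
    have h1 := abs_nonneg (C₂ 1)
    linarith [le_abs_self C₁]
  · intro i x
    have : (fun y => (∇ (fun y => b (r⁻¹ • (y - x₀))) y) i) =
        fun y => r⁻¹ * (fun z => (∇ b z) i) (r⁻¹ • (y - x₀)) := by
      funext y; rw [hg1]; rfl
    rw [this]
    have hd : Differentiable ℝ (fun z => (∇ b z) i) := (hgi i).differentiable one_ne_zero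
    rw [gradient_const_mul, hscale _ hd, norm_smul, norm_smul, norm_inv,
      Real.norm_of_nonneg hr.le, ← mul_assoc, ← mul_inv, ← sq, inv_mul_eq_div]
    · gcongr
      have := hC₂ i (r⁻¹ • (x - x₀))
      have h0 := abs_nonneg (C₂ 0)
      have h1 := abs_nonneg (C₂ 1)
      have h2 := abs_nonneg C₁
      have h3 : C₂ i ≤ |C₂ 0| + |C₂ 1| := by
        fin_cases i
        · exact (le_abs_self _).trans (by simp)
        · exact (le_abs_self _).trans (by simp)
      linarith
    · exact (hd _).comp x
        (((differentiable_id.sub_const x₀).const_smul r⁻¹ : Differentiable ℝ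
          fun y : Plane => r⁻¹ • (y - x₀)) x)

/-- Radial coefficients `a` whose growth is controlled by that of `t ↦ t ^ (p - 2)`. -/
structure IsKernel (p : ℝ) (a : ℝ → ℝ) : Prop where
  pos : ∀ t, 0 < t → 0 < a t
  cont : ContinuousOn a (Ioi 0)
  incr : 2 ≤ p → ∀ s t, 0 < s → s ≤ t → a s ≤ a t ∧ a t ≤ (t / s) ^ (p - 2) * a s
  decr : p < 2 → ∀ s t, 0 < s → s ≤ t → a t ≤ a s ∧ (t / s) ^ (p - 2) * a s ≤ a t

/-- The vector field `ξ ↦ a(‖ξ‖) ξ`. -/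
noncomputable def flux (a : ℝ → ℝ) (ξ : Plane) : Plane := a ‖ξ‖ • ξ

lemma flux_zero (a : ℝ → ℝ) : flux a 0 = 0 := by simp [flux]

lemma flux_neg (a : ℝ → ℝ) (ξ : Plane) : flux a (-ξ) = -flux a ξ := by simp [flux]

lemma one_sub_rpow_le {m x : ℝ} (hx : 0 < x) (hx1 : x ≤ 1) :
    1 - x ^ m ≤ max 1 m * (1 - x) := by
  rcases le_total 1 m with h | h
  · have := one_add_mul_self_le_rpow_one_add (s := x - 1) (by linarith) h
    rw [max_eq_right h]
    rw [show 1 + (x - 1) = x by ring] at this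
    linarith
  · rw [max_eq_left h]
    have := Real.rpow_le_rpow_of_exponent_ge hx hx1 h
    rw [Real.rpow_one] at this
    linarith

/-- Upper structure constant. -/
noncomputable def cUp (p : ℝ) : ℝ := 1 + max 1 |p - 2|

/-- Lower structure constant. -/
noncomputable def cLow (p : ℝ) : ℝ := min (1 / 2) (p - 1)

lemma cUp_pos (p : ℝ) : 0 < cUp p := by unfold cUp; positivity

lemma cLow_pos {p : ℝ} (hp : 1 < p) : 0 < cLow p := lt_min (by norm_num) (by linarith)

namespace IsKernel

variable {p : ℝ} {a : ℝ → ℝ}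

lemma mul_le_rpow (ha : IsKernel p a) {s t : ℝ} (hs : 0 < s) (hst : s ≤ t) :
    a s * s ≤ a t * t * (s / t) ^ min 1 (p - 1) := by
  have ht : 0 < t := hs.trans_le hst
  have hx : 0 < s / t := by positivity
  have hx1 : s / t ≤ 1 := by rw [div_le_one ht]; exact hst
  rcases le_or_gt 2 p with h | h
  · rw [min_eq_left (by linarith), Real.rpow_one]
    have := (ha.incr h s t hs hst).1
    calc a s * s ≤ a t * s := by gcongr
      _ = a t * t * (s / t) := by field_simp
  · rw [min_eq_right (by linarith)]
    have := (ha.decr h s t hs hst).2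
    have e : (s / t) ^ (p - 1) = (s / t) ^ (p - 2) * (s / t) := by
      rw [← Real.rpow_add_one hx.ne']; ring_nf
    have e2 : (t / s) ^ (p - 2) * (s / t) ^ (p - 2) = 1 := by
      rw [← Real.mul_rpow (by positivity) hx.le]
      rw [div_mul_div_comm, mul_comm t s, div_self (by positivity), Real.one_rpow]
    rw [e]
    calc a s * s = ((t / s) ^ (p - 2) * a s) * ((s / t) ^ (p - 2) * s) := by
            linear_combination (-(a s * s)) * e2
      _ ≤ a t * ((s / t) ^ (p - 2) * s) := by gcongr
      _ = _ := by field_simp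

lemma mul_le_mul (ha : IsKernel p a) (hp : 1 < p) {s t : ℝ} (hs : 0 ≤ s) (hst : s ≤ t) :
    a s * s ≤ a t * t := by
  rcases hs.eq_or_lt with rfl | hs
  · rcases hst.eq_or_lt with rfl | ht
    · rfl
    · have := ha.pos t ht
      rw [mul_zero]; positivity
  have ht : 0 < t := hs.trans_le hst
  refine (ha.mul_le_rpow hs hst).trans ?_
  have h1 : (s / t) ^ min 1 (p - 1) ≤ 1 := Real.rpow_le_one (by positivity)
    (by rw [div_le_one ht]; exact hst) (le_min zero_le_one (by linarith))
  have := ha.pos t ht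
  exact mul_le_of_le_one_right (by positivity) h1

lemma norm_flux (ha : IsKernel p a) (ξ : Plane) : ‖flux a ξ‖ = a ‖ξ‖ * ‖ξ‖ := by
  rcases eq_or_ne ξ 0 with rfl | h
  · simp [flux]
  · rw [flux, norm_smul, Real.norm_of_nonneg (ha.pos _ (norm_pos_iff.2 h)).le]

lemma norm_flux_le (ha : IsKernel p a) (hp : 1 < p) {ξ : Plane} {L : ℝ} (h : ‖ξ‖ ≤ L) :
    ‖flux a ξ‖ ≤ a L * L := by
  rw [ha.norm_flux]; exact ha.mul_le_mul hp (norm_nonneg _) h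

lemma continuous_flux (ha : IsKernel p a) (hp : 1 < p) : Continuous (flux a) := by
  rw [continuous_iff_continuousAt]
  intro ξ
  rcases eq_or_ne ξ 0 with rfl | h
  · have hq : 0 < min 1 (p - 1) := lt_min one_pos (by linarith)
    rw [ContinuousAt, flux_zero]
    refine squeeze_zero_norm' (a := fun ξ : Plane => a 1 * ‖ξ‖ ^ min 1 (p - 1)) ?_ ?_
    · filter_upwards [closedBall_mem_nhds (0 : Plane) one_pos] with ξ hξ
      rw [mem_closedBall_zero_iff] at hξ
      rw [ha.norm_flux]
      rcases eq_or_ne ξ 0 with rfl | h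
      · simp [hq.ne']
      · simpa using ha.mul_le_rpow (norm_pos_iff.2 h) hξ
    · have : Continuous fun ξ : Plane => a 1 * ‖ξ‖ ^ min 1 (p - 1) :=
        continuous_const.mul (continuous_norm.rpow_const fun _ => Or.inr hq.le)
      simpa [hq.ne'] using this.tendsto 0
  · have h1 : ContinuousAt a ‖ξ‖ := ha.cont.continuousAt (Ioi_mem_nhds (norm_pos_iff.2 h))
    exact (h1.comp continuous_norm.continuousAt).smul continuousAt_id

lemma abs_sub_mul_le (ha : IsKernel p a) (hp : 1 < p) {s t : ℝ} (hs : 0 < s) (hst : s ≤ t) :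
    |a t - a s| * s ≤ max 1 |p - 2| * a t * (t - s) := by
  have ht : 0 < t := hs.trans_le hst
  have hat := ha.pos t ht
  have hx : 0 < s / t := by positivity
  have hx1 : s / t ≤ 1 := by rw [div_le_one ht]; exact hst
  have e2 : (t / s) ^ (p - 2) * (s / t) ^ (p - 2) = 1 := by
    rw [← Real.mul_rpow (by positivity) hx.le]
    rw [div_mul_div_comm, mul_comm t s, div_self (by positivity), Real.one_rpow]
  have hst' : t * (1 - s / t) = t - s := by field_simp
  have key : ∀ m : ℝ, m = |p - 2| →
      a t * t * (1 - (s / t) ^ m) ≤ max 1 |p - 2| * a t * (t - s) := by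
    intro m hm'
    have := one_sub_rpow_le (m := m) hx hx1
    rw [← hm']
    calc a t * t * (1 - (s / t) ^ m) ≤ a t * t * (max 1 m * (1 - s / t)) := by gcongr
      _ = max 1 m * a t * (t - s) := by rw [← hst']; ring
  rcases le_or_gt 2 p with h | h
  · obtain ⟨h1, h2⟩ := ha.incr h s t hs hst
    rw [abs_of_nonneg (by linarith)]
    refine le_trans ?_ (key (p - 2) (abs_of_nonneg (by linarith)).symm)
    have h3 : a t * (s / t) ^ (p - 2) ≤ a s := by
      calc a t * (s / t) ^ (p - 2) ≤ ((t / s) ^ (p - 2) * a s) * (s / t) ^ (p - 2) := by gcongr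
        _ = a s := by linear_combination (a s) * e2
    calc (a t - a s) * s ≤ (a t - a s) * t := by gcongr
      _ ≤ (a t - a t * (s / t) ^ (p - 2)) * t := by gcongr
      _ = _ := by ring
  · obtain ⟨h1, h2⟩ := ha.decr h s t hs hst
    rw [abs_of_nonpos (by linarith)]
    refine le_trans ?_ (key (2 - p) (by rw [abs_of_neg (by linarith)]; ring))
    have h3 := ha.mul_le_rpow hs hst
    rw [min_eq_right (by linarith)] at h3
    have h4 : (s / t) ^ (p - 1) * (s / t) ^ (2 - p) = s / t := by
      rw [← Real.rpow_add hx]; ring_nf; simp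
    have h5 : (s / t) ^ (p - 1) ≤ 1 := Real.rpow_le_one hx.le hx1 (by linarith)
    have h6 : 0 ≤ 1 - (s / t) ^ (2 - p) := by
      have := Real.rpow_le_one hx.le hx1 (show 0 ≤ 2 - p by linarith)
      linarith
    calc -(a t - a s) * s = a s * s - a t * t * (s / t) := by field_simp; ring
      _ ≤ a t * t * (s / t) ^ (p - 1) - a t * t * (s / t) := by linarith
      _ = a t * t * ((s / t) ^ (p - 1) * (1 - (s / t) ^ (2 - p))) := by
          linear_combination (a t * t) * h4
      _ ≤ a t * t * (1 * (1 - (s / t) ^ (2 - p))) := by gcongr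
      _ = _ := by ring

private lemma norm_flux_sub_le_aux (ha : IsKernel p a) (hp : 1 < p) (ξ ζ : Plane)
    (h : ‖ζ‖ ≤ ‖ξ‖) : ‖flux a ξ - flux a ζ‖ ≤ cUp p * a ‖ξ‖ * ‖ξ - ζ‖ := by
  have e : flux a ξ - flux a ζ = a ‖ξ‖ • (ξ - ζ) + (a ‖ξ‖ - a ‖ζ‖) • ζ := by
    simp only [flux]; module
  rcases eq_or_ne ζ 0 with rfl | hζ
  · rcases eq_or_ne ξ 0 with rfl | hξ
    · simp
    · have := ha.pos _ (norm_pos_iff.2 hξ)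
      rw [flux_zero, sub_zero, sub_zero, ha.norm_flux]
      have h1 : 1 ≤ cUp p := by
        unfold cUp; linarith [le_max_left 1 |p - 2|]
      calc a ‖ξ‖ * ‖ξ‖ = 1 * a ‖ξ‖ * ‖ξ‖ := by ring
        _ ≤ _ := by gcongr
  have hs := norm_pos_iff.2 hζ
  have hat := ha.pos _ (hs.trans_le h)
  rw [e]
  refine (norm_add_le _ _).trans ?_
  rw [norm_smul, norm_smul, Real.norm_of_nonneg hat.le, Real.norm_eq_abs]
  have h1 := ha.abs_sub_mul_le hp hs h
  have h2 : ‖ξ‖ - ‖ζ‖ ≤ ‖ξ - ζ‖ := norm_sub_norm_le _ _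
  have h3 : max 1 |p - 2| * a ‖ξ‖ * (‖ξ‖ - ‖ζ‖) ≤ max 1 |p - 2| * a ‖ξ‖ * ‖ξ - ζ‖ := by gcongr
  unfold cUp
  linarith

lemma norm_flux_sub_le (ha : IsKernel p a) (hp : 1 < p) (ξ ζ : Plane) :
    ‖flux a ξ - flux a ζ‖ ≤ cUp p * a (max ‖ξ‖ ‖ζ‖) * ‖ξ - ζ‖ := by
  rcases le_total ‖ζ‖ ‖ξ‖ with h | h
  · rw [max_eq_left h]; exact norm_flux_sub_le_aux ha hp ξ ζ h
  · rw [max_eq_right h, norm_sub_rev, norm_sub_rev ξ]; exact norm_flux_sub_le_aux ha hp ζ ξ h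

private lemma le_inner_flux_sub_aux (ha : IsKernel p a) (hp : 1 < p) (ξ ζ : Plane)
    (h : ‖ζ‖ ≤ ‖ξ‖) :
    cLow p * a ‖ξ‖ * ‖ξ - ζ‖ ^ 2 ≤ ⟪flux a ξ - flux a ζ, ξ - ζ⟫ := by
  have e : ⟪flux a ξ - flux a ζ, ξ - ζ⟫ =
      a ‖ξ‖ * ‖ξ‖ ^ 2 + a ‖ζ‖ * ‖ζ‖ ^ 2 - (a ‖ξ‖ + a ‖ζ‖) * ⟪ξ, ζ⟫ := by
    simp only [flux, inner_sub_left, inner_sub_right, inner_smul_left, RCLike.conj_to_real,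
      real_inner_self_eq_norm_sq, real_inner_comm ξ ζ]
    ring
  have e2 : ‖ξ - ζ‖ ^ 2 = ‖ξ‖ ^ 2 + ‖ζ‖ ^ 2 - 2 * ⟪ξ, ζ⟫ := by
    rw [norm_sub_sq_real]; ring
  rcases eq_or_ne ζ 0 with rfl | hζ
  · rcases eq_or_ne ξ 0 with rfl | hξ
    · simp
    · have := ha.pos _ (norm_pos_iff.2 hξ)
      rw [e]
      simp only [sub_zero, norm_zero, inner_zero_right]
      have h1 : cLow p ≤ 1 := (min_le_left _ _).trans (by norm_num)
      have : cLow p * (a ‖ξ‖ * ‖ξ‖ ^ 2) ≤ 1 * (a ‖ξ‖ * ‖ξ‖ ^ 2) := by gcongr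
      linarith
  have hs := norm_pos_iff.2 hζ
  have ht := hs.trans_le h
  have hat := ha.pos _ ht
  have has := ha.pos _ hs
  have hcs := real_inner_le_norm ξ ζ
  rcases le_or_gt 2 p with h2 | h2
  · have h1 := (ha.incr h2 _ _ hs h).1
    have h3 : cLow p ≤ 1 / 2 := min_le_left _ _
    have h4 : cLow p * a ‖ξ‖ * ‖ξ - ζ‖ ^ 2 ≤ 1 / 2 * a ‖ξ‖ * ‖ξ - ζ‖ ^ 2 := by gcongr
    refine h4.trans ?_
    have h5 : 0 ≤ a ‖ζ‖ * ‖ξ - ζ‖ ^ 2 := by positivity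
    have h6 : 0 ≤ (a ‖ξ‖ - a ‖ζ‖) * (‖ξ‖ ^ 2 - ‖ζ‖ ^ 2) :=
      mul_nonneg (by linarith) (by nlinarith)
    rw [e]
    rw [e2] at h5 ⊢
    linarith
  · have h1 := (ha.decr h2 _ _ hs h).1
    have h3 : cLow p ≤ p - 1 := min_le_right _ _
    have h4 : cLow p * a ‖ξ‖ * ‖ξ - ζ‖ ^ 2 ≤ (p - 1) * a ‖ξ‖ * ‖ξ - ζ‖ ^ 2 := by gcongr
    refine h4.trans ?_
    have hm := ha.mul_le_rpow hs h
    rw [min_eq_right (by linarith)] at hm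
    have hb := rpow_one_add_le_one_add_mul_self (s := ‖ζ‖ / ‖ξ‖ - 1) (p := p - 1)
      (by have : 0 < ‖ζ‖ / ‖ξ‖ := by positivity
          linarith) (by linarith) (by linarith)
    rw [show 1 + (‖ζ‖ / ‖ξ‖ - 1) = ‖ζ‖ / ‖ξ‖ by ring] at hb
    have h5 : a ‖ζ‖ * ‖ζ‖ ≤ a ‖ξ‖ * ‖ξ‖ * (1 + (p - 1) * (‖ζ‖ / ‖ξ‖ - 1)) :=
      hm.trans (by gcongr)
    have h6 : a ‖ξ‖ * ‖ξ‖ * (1 + (p - 1) * (‖ζ‖ / ‖ξ‖ - 1)) =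
        a ‖ξ‖ * ‖ξ‖ - (p - 1) * a ‖ξ‖ * (‖ξ‖ - ‖ζ‖) := by field_simp; ring
    rw [h6] at h5
    have h7 : 0 ≤ (a ‖ξ‖ * ‖ξ‖ - (p - 1) * a ‖ξ‖ * (‖ξ‖ - ‖ζ‖) - a ‖ζ‖ * ‖ζ‖) * (‖ξ‖ - ‖ζ‖) :=
      mul_nonneg (by linarith) (by linarith)
    have h8 : 0 ≤ ((a ‖ξ‖ + a ‖ζ‖) - 2 * (p - 1) * a ‖ξ‖) * (‖ξ‖ * ‖ζ‖ - ⟪ξ, ζ⟫) :=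
      mul_nonneg (by nlinarith) (by linarith)
    rw [e, e2]
    linarith

lemma le_inner_flux_sub (ha : IsKernel p a) (hp : 1 < p) (ξ ζ : Plane) :
    cLow p * a (max ‖ξ‖ ‖ζ‖) * ‖ξ - ζ‖ ^ 2 ≤ ⟪flux a ξ - flux a ζ, ξ - ζ⟫ := by
  rcases le_total ‖ζ‖ ‖ξ‖ with h | h
  · rw [max_eq_left h]; exact le_inner_flux_sub_aux ha hp ξ ζ h
  · rw [max_eq_right h, norm_sub_rev, ← inner_neg_neg, neg_sub, neg_sub]
    exact le_inner_flux_sub_aux ha hp ζ ξ h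

lemma inner_flux_sub_pos (ha : IsKernel p a) (hp : 1 < p) {ξ ζ : Plane} (h : ξ ≠ ζ) :
    0 < ⟪flux a ξ - flux a ζ, ξ - ζ⟫ := by
  refine lt_of_lt_of_le ?_ (ha.le_inner_flux_sub hp ξ ζ)
  have h1 : 0 < ‖ξ - ζ‖ := norm_pos_iff.2 (sub_ne_zero.2 h)
  have h2 : 0 < max ‖ξ‖ ‖ζ‖ := by
    by_contra hc
    rw [not_lt, max_le_iff, norm_le_zero_iff, norm_le_zero_iff] at hc
    exact h (hc.1.trans hc.2.symm)
  have := ha.pos _ h2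
  have := cLow_pos hp
  positivity

lemma inner_flux_sub_nonneg (ha : IsKernel p a) (hp : 1 < p) (ξ ζ : Plane) :
    0 ≤ ⟪flux a ξ - flux a ζ, ξ - ζ⟫ := by
  rcases eq_or_ne ξ ζ with rfl | h
  · simp
  · exact (ha.inner_flux_sub_pos hp h).le

lemma le_norm_flux_sub (ha : IsKernel p a) (hp : 1 < p) (ξ ζ : Plane) :
    cLow p * a (max ‖ξ‖ ‖ζ‖) * ‖ξ - ζ‖ ≤ ‖flux a ξ - flux a ζ‖ := by
  rcases eq_or_ne ξ ζ with rfl | h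
  · simp
  have h1 : 0 < ‖ξ - ζ‖ := norm_pos_iff.2 (sub_ne_zero.2 h)
  have := (ha.le_inner_flux_sub hp ξ ζ).trans (real_inner_le_norm _ _)
  rw [sq, ← mul_assoc] at this
  exact le_of_mul_le_mul_right this h1

end IsKernel

lemma isKernel_rpow (p : ℝ) : IsKernel p fun t => t ^ (p - 2) where
  pos t ht := Real.rpow_pos_of_pos ht _
  cont := continuousOn_id.rpow_const fun x hx => Or.inl (ne_of_gt hx)
  incr hp s t hs hst := by
    have ht := hs.trans_le hst
    refine ⟨Real.rpow_le_rpow hs.le hst (by linarith), ?_⟩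
    rw [← Real.mul_rpow (by positivity) hs.le, div_mul_cancel₀ _ hs.ne']
  decr hp s t hs hst := by
    have ht := hs.trans_le hst
    refine ⟨Real.rpow_le_rpow_of_nonpos hs hst (by linarith), ?_⟩
    rw [← Real.mul_rpow (by positivity) hs.le, div_mul_cancel₀ _ hs.ne']

/-- Truncation of `t` to `[ε, 1/ε]`. -/
noncomputable def clampR (ε t : ℝ) : ℝ := max ε (min t ε⁻¹)

/-- The uniformly elliptic regularisation of `t ^ (p - 2)`. -/
noncomputable def clampKernel (p ε t : ℝ) : ℝ := clampR ε t ^ (p - 2)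

lemma clampR_pos {ε : ℝ} (hε : 0 < ε) (t : ℝ) : 0 < clampR ε t := lt_max_of_lt_left hε

lemma clampR_mono (ε : ℝ) {s t : ℝ} (h : s ≤ t) : clampR ε s ≤ clampR ε t :=
  max_le_max le_rfl (min_le_min h le_rfl)

lemma clampR_eq {ε t : ℝ} (h1 : ε ≤ t) (h2 : t ≤ ε⁻¹) : clampR ε t = t := by
  rw [clampR, min_eq_left h2, max_eq_right h1]

lemma clampR_mem {ε : ℝ} (hε : 0 < ε) (hε1 : ε ≤ 1) (t : ℝ) : clampR ε t ∈ Icc ε ε⁻¹ :=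
  ⟨le_max_left _ _, max_le (hε1.trans ((one_le_inv₀ hε).2 hε1)) (min_le_right _ _)⟩

lemma clampR_div_le {ε s t : ℝ} (hε : 0 < ε) (hs : 0 < s) (hst : s ≤ t) :
    clampR ε t / clampR ε s ≤ t / s := by
  rw [div_le_div_iff₀ (clampR_pos hε s) hs]
  have ht := hs.trans_le hst
  have hi : 0 < ε⁻¹ := by positivity
  have h1 : ε * s ≤ t * clampR ε s := by
    rw [mul_comm]
    exact mul_le_mul hst (le_max_left _ _) hε.le ht.le
  have h2 : min t ε⁻¹ * s ≤ t * clampR ε s := by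
    refine le_trans ?_ (mul_le_mul_of_nonneg_left (le_max_right ε (min s ε⁻¹)) ht.le)
    rcases le_total s ε⁻¹ with h | h
    · rw [min_eq_left h]
      exact mul_le_mul_of_nonneg_right (min_le_left _ _) hs.le
    · rw [min_eq_right h, mul_comm t]
      exact mul_le_mul (min_le_right _ _) hst hs.le hi.le
  rcases max_choice ε (min t ε⁻¹) with h | h
  · rw [clampR, h]; exact h1
  · rw [clampR, h]; exact h2

lemma continuous_clampKernel (p : ℝ) {ε : ℝ} (hε : 0 < ε) : Continuous (clampKernel p ε) := by
  refine Continuous.rpow_const ?_ fun x => Or.inl (clampR_pos hε x).ne'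
  exact continuous_const.max (continuous_id.min continuous_const)

lemma clampKernel_pos (p : ℝ) {ε : ℝ} (hε : 0 < ε) (t : ℝ) : 0 < clampKernel p ε t :=
  Real.rpow_pos_of_pos (clampR_pos hε t) _

lemma isKernel_clamp (p : ℝ) {ε : ℝ} (hε : 0 < ε) : IsKernel p (clampKernel p ε) where
  pos t _ := clampKernel_pos p hε t
  cont := (continuous_clampKernel p hε).continuousOn
  incr hp s t hs hst := by
    have h1 := clampR_pos hε s
    have h2 := clampR_pos hε t
    refine ⟨Real.rpow_le_rpow h1.le (clampR_mono ε hst) (by linarith), ?_⟩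
    have h3 : (clampR ε t / clampR ε s) ^ (p - 2) ≤ (t / s) ^ (p - 2) :=
      Real.rpow_le_rpow (by positivity) (clampR_div_le hε hs hst) (by linarith)
    rw [Real.div_rpow h2.le h1.le, div_le_iff₀ (Real.rpow_pos_of_pos h1 _)] at h3
    exact h3
  decr hp s t hs hst := by
    have h1 := clampR_pos hε s
    have h2 := clampR_pos hε t
    refine ⟨Real.rpow_le_rpow_of_nonpos h1 (clampR_mono ε hst) (by linarith), ?_⟩
    have h3 : (t / s) ^ (p - 2) ≤ (clampR ε t / clampR ε s) ^ (p - 2) :=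
      Real.rpow_le_rpow_of_nonpos (by positivity) (clampR_div_le hε hs hst) (by linarith)
    rw [Real.div_rpow h2.le h1.le, le_div_iff₀ (Real.rpow_pos_of_pos h1 _)] at h3
    exact h3

lemma clampKernel_eq (p : ℝ) {ε t : ℝ} (h1 : ε ≤ t) (h2 : t ≤ ε⁻¹) :
    clampKernel p ε t = t ^ (p - 2) := by rw [clampKernel, clampR_eq h1 h2]

lemma exists_clampKernel_bounds (p : ℝ) {ε : ℝ} (hε : 0 < ε) (hε1 : ε ≤ 1) :
    ∃ l L : ℝ, 0 < l ∧ 0 < L ∧ ∀ t, l ≤ clampKernel p ε t ∧ clampKernel p ε t ≤ L := by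
  have hc : ContinuousOn (fun x : ℝ => x ^ (p - 2)) (Icc ε ε⁻¹) :=
    continuousOn_id.rpow_const fun x hx => Or.inl (hε.trans_le hx.1).ne'
  have hne : (Icc ε ε⁻¹).Nonempty := ⟨_, clampR_mem hε hε1 0⟩
  obtain ⟨x, hx, hxm⟩ := isCompact_Icc.exists_isMinOn hne hc
  obtain ⟨y, hy, hym⟩ := isCompact_Icc.exists_isMaxOn hne hc
  exact ⟨_, _, Real.rpow_pos_of_pos (hε.trans_le hx.1) (p - 2),
    Real.rpow_pos_of_pos (hε.trans_le hy.1) (p - 2), fun t =>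
    ⟨hxm (clampR_mem hε hε1 t), hym (clampR_mem hε hε1 t)⟩⟩

lemma norm_flux_clamp_sub_le {p ε : ℝ} (hp : 1 < p) (hε : 0 < ε) (hε1 : ε ≤ 1) {ξ : Plane}
    (h : ‖ξ‖ ≤ ε⁻¹) :
    ‖flux (clampKernel p ε) ξ - flux (fun t => t ^ (p - 2)) ξ‖ ≤ 2 * ε ^ (p - 1) := by
  have hε2 : 0 < ε ^ (p - 1) := Real.rpow_pos_of_pos hε _
  rcases le_total ε ‖ξ‖ with h1 | h1
  · simp only [flux, clampKernel_eq p h1 h, sub_self, norm_zero]; positivity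
  · have e : ε ^ (p - 2) * ε = ε ^ (p - 1) := by
      rw [← Real.rpow_add_one hε.ne']; ring_nf
    have h2 := (isKernel_clamp p hε).norm_flux_le hp h1
    have h3 := (isKernel_rpow p).norm_flux_le hp h1
    rw [clampKernel_eq p le_rfl (hε1.trans ((one_le_inv₀ hε).2 hε1)), e] at h2
    simp only [e] at h3
    exact (norm_sub_le _ _).trans (by linarith)

/-- The convex potential of the flux. -/
noncomputable def energy (a : ℝ → ℝ) (ξ : Plane) : ℝ := ∫ s in (0 : ℝ)..‖ξ‖, a s * s

section Energy

variable {p : ℝ} {a : ℝ → ℝ}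

lemma continuous_energy (ha : Continuous a) : Continuous (energy a) :=
  (intervalIntegral.continuous_primitive
    (fun _ _ => (ha.mul continuous_id).intervalIntegrable _ _) 0).comp continuous_norm

lemma energy_lower {l : ℝ} (hc : Continuous a) (hl : ∀ t, l ≤ a t) (ξ : Plane) :
    l / 2 * ‖ξ‖ ^ 2 ≤ energy a ξ := by
  have h1 : ∫ s in (0 : ℝ)..‖ξ‖, l * s = l / 2 * ‖ξ‖ ^ 2 := by
    rw [intervalIntegral.integral_const_mul, integral_id]; ring
  rw [← h1]
  exact intervalIntegral.integral_mono_on (norm_nonneg _)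
    ((continuous_const.mul continuous_id).intervalIntegrable _ _)
    ((hc.mul continuous_id).intervalIntegrable _ _)
    fun s hs => mul_le_mul_of_nonneg_right (hl s) hs.1

lemma energy_ge_tangent (ha : IsKernel p a) (hp : 1 < p) (hc : Continuous a)
    (h0 : ∀ t, 0 < a t) (ξ ζ : Plane) :
    energy a ζ + ⟪flux a ζ, ξ - ζ⟫ ≤ energy a ξ := by
  have hi : ∀ x y, IntervalIntegrable (fun s => a s * s) volume x y :=
    fun x y => (hc.mul continuous_id).intervalIntegrable _ _
  have e : energy a ξ - energy a ζ = ∫ s in ‖ζ‖..‖ξ‖, a s * s :=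
    intervalIntegral.integral_interval_sub_left (hi _ _) (hi _ _)
  have h1 : a ‖ζ‖ * ‖ζ‖ * (‖ξ‖ - ‖ζ‖) ≤ ∫ s in ‖ζ‖..‖ξ‖, a s * s := by
    rcases le_total ‖ζ‖ ‖ξ‖ with h | h
    · have := intervalIntegral.integral_mono_on (f := fun _ => a ‖ζ‖ * ‖ζ‖) h (by simp) (hi _ _)
        fun s hs => ha.mul_le_mul hp (norm_nonneg ζ) hs.1
      rw [intervalIntegral.integral_const, smul_eq_mul] at this
      linarith
    · have := intervalIntegral.integral_mono_on (g := fun _ => a ‖ζ‖ * ‖ζ‖) h (hi _ _) (by simp)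
        fun s hs => ha.mul_le_mul hp ((norm_nonneg ξ).trans hs.1) hs.2
      rw [intervalIntegral.integral_const, smul_eq_mul] at this
      rw [intervalIntegral.integral_symm]
      linarith
  have h2 : ⟪flux a ζ, ξ - ζ⟫ ≤ a ‖ζ‖ * ‖ζ‖ * (‖ξ‖ - ‖ζ‖) := by
    rw [flux, inner_smul_left, inner_sub_right, real_inner_self_eq_norm_sq]
    simp only [RCLike.conj_to_real]
    have := real_inner_le_norm ζ ξ
    have : a ‖ζ‖ * (⟪ζ, ξ⟫ - ‖ζ‖ ^ 2) ≤ a ‖ζ‖ * (‖ζ‖ * ‖ξ‖ - ‖ζ‖ ^ 2) := by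
      have := h0 ‖ζ‖
      gcongr
    linarith
  linarith

end Energy

/-- `u` is a `C¹` weak solution of `div (a(‖∇u‖) ∇u) = 0` on `U`. -/
def WeakSol (a : ℝ → ℝ) (U : Set Plane) (u : Plane → ℝ) : Prop :=
  ContDiffOn ℝ 1 u U ∧ ∀ η : Plane → ℝ, ContDiff ℝ 1 η → HasCompactSupport η →
    tsupport η ⊆ U → ∫ x, ⟪flux a (∇ u x), ∇ η x⟫ = 0

section Basic

variable {p : ℝ} {a : ℝ → ℝ} {U V : Set Plane} {u v : Plane → ℝ}

lemma weakSol_rpow_iff : WeakSol (fun t => t ^ (p - 2)) U u ↔ PHarmonicOn p U u := by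
  refine and_congr_right fun _ => forall_congr' fun η => forall_congr' fun _ =>
    forall_congr' fun _ => forall_congr' fun hs => ?_
  rw [setIntegral_eq_integral_of_forall_compl_eq_zero]
  · simp only [flux, inner_smul_left, RCLike.conj_to_real]
  · intro x hx
    rw [gradient_eq_zero_of_notMem_tsupport fun h => hx (hs h), inner_zero_right, mul_zero]

lemma continuous_inner_of_tsupport {F G : Plane → Plane} (hU : IsOpen U)
    (hF : ContinuousOn F U) (hG : Continuous G) (hs : tsupport G ⊆ U) :
    Continuous fun x => ⟪F x, G x⟫ := by
  rw [continuous_iff_continuousAt]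
  intro x
  by_cases hx : x ∈ U
  · exact (hF.continuousAt (hU.mem_nhds hx)).inner hG.continuousAt
  · have : (fun y => ⟪F y, G y⟫) =ᶠ[𝓝 x] fun _ => 0 := by
      filter_upwards [notMem_tsupport_iff_eventuallyEq.1 fun h => hx (hs h)] with y hy
      simp [hy]
    exact continuousAt_const.congr this.symm

lemma hasCompactSupport_inner {F G : Plane → Plane} (hG : HasCompactSupport G) :
    HasCompactSupport fun x => ⟪F x, G x⟫ :=
  HasCompactSupport.intro hG fun x hx => by
    rw [image_eq_zero_of_notMem_tsupport hx, inner_zero_right]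

lemma integrable_inner_gradient {F : Plane → Plane} {η : Plane → ℝ} (hU : IsOpen U)
    (hF : ContinuousOn F U) (hη : ContDiff ℝ 1 η) (hc : HasCompactSupport η)
    (hs : tsupport η ⊆ U) : Integrable fun x => ⟪F x, ∇ η x⟫ :=
  (continuous_inner_of_tsupport hU hF (continuous_gradient hη)
    (tsupport_gradient_subset.trans hs)).integrable_of_hasCompactSupport
    (hasCompactSupport_inner (hasCompactSupport_gradient hc))

lemma continuousOn_flux_gradient (ha : IsKernel p a) (hp : 1 < p) (hU : IsOpen U)
    (hu : ContDiffOn ℝ 1 u U) : ContinuousOn (fun x => flux a (∇ u x)) U :=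
  (ha.continuous_flux hp).comp_continuousOn (continuousOn_gradient hu hU)

lemma contDiff_of_eq_zero_off {f : Plane → ℝ} {K : Set Plane} (hU : IsOpen U) (hK : IsClosed K)
    (hKU : K ⊆ U) (hf : ContDiffOn ℝ 1 f U) (h0 : ∀ x ∉ K, f x = 0) : ContDiff ℝ 1 f := by
  rw [contDiff_iff_contDiffAt]
  intro x
  by_cases hx : x ∈ U
  · exact hf.contDiffAt (hU.mem_nhds hx)
  · have : f =ᶠ[𝓝 x] fun _ => 0 :=
      Filter.eventuallyEq_of_mem (hK.isOpen_compl.mem_nhds fun h => hx (hKU h)) h0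
    exact contDiffAt_const.congr_of_eventuallyEq this

lemma WeakSol.mono (hu : WeakSol a U u) (h : V ⊆ U) : WeakSol a V u :=
  ⟨hu.1.mono h, fun η h1 h2 h3 => hu.2 η h1 h2 (h3.trans h)⟩

lemma WeakSol.congr (hu : WeakSol a U u) (hU : IsOpen U) (h : EqOn v u U) : WeakSol a U v := by
  refine ⟨hu.1.congr h, fun η h1 h2 h3 => ?_⟩
  rw [← hu.2 η h1 h2 h3]
  refine integral_congr_ae (Eventually.of_forall fun x => ?_)
  by_cases hx : x ∈ U
  · simp only [gradient_congr_of_eqOn hU h hx]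
  · simp [gradient_eq_zero_of_notMem_tsupport fun h => hx (h3 h)]

lemma WeakSol.add_const (hu : WeakSol a U u) (c : ℝ) : WeakSol a U fun x => u x + c := by
  refine ⟨hu.1.add contDiffOn_const, fun η h1 h2 h3 => ?_⟩
  simpa only [gradient_add_const] using hu.2 η h1 h2 h3

lemma WeakSol.neg (hu : WeakSol a U u) : WeakSol a U fun x => -u x := by
  refine ⟨hu.1.neg, fun η h1 h2 h3 => ?_⟩
  simp only [gradient_neg, flux_neg, inner_neg_left, integral_neg, hu.2 η h1 h2 h3, neg_zero]

lemma hasCompactSupport_comp_add {η : Plane → ℝ} (h : HasCompactSupport η) (z : Plane) :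
    HasCompactSupport fun x => η (x + z) :=
  h.comp_homeomorph (Homeomorph.addRight z)

lemma tsupport_comp_add {η : Plane → ℝ} (z : Plane) :
    tsupport (fun x => η (x + z)) = (fun x => x + z) ⁻¹' tsupport η :=
  tsupport_comp_eq_preimage η (Homeomorph.addRight z)

lemma WeakSol.comp_add (hu : WeakSol a U u) (h : Plane) :
    WeakSol a ((fun x => x + h) ⁻¹' U) fun x => u (x + h) := by
  refine ⟨hu.1.comp (contDiff_id.add contDiff_const).contDiffOn fun x hx => hx,
    fun η h1 h2 h3 => ?_⟩
  have e : ∀ x, ⟪flux a (∇ (fun x => u (x + h)) x), ∇ η x⟫ =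
      (fun y => ⟪flux a (∇ u y), ∇ (fun z => η (z + -h)) y⟫) (x + h) := by
    intro x
    simp only [gradient_comp_add, add_neg_cancel_right]
  simp_rw [e]
  rw [integral_add_right_eq_self (fun y => ⟪flux a (∇ u y), ∇ (fun z => η (z + -h)) y⟫) h]
  refine hu.2 _ (h1.comp (contDiff_id.add contDiff_const)) (hasCompactSupport_comp_add h2 _) ?_
  rw [tsupport_comp_add]
  intro x hx
  simpa using h3 hx

end Basic

/-- A `C¹` version of the positive part with derivative in `[0, 1]`. -/
noncomputable def ramp (s : ℝ) : ℝ := ∫ t in (0 : ℝ)..s, max 0 (min t 1)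

lemma hasDerivAt_ramp (s : ℝ) : HasDerivAt ramp (max 0 (min s 1)) s :=
  ((continuous_const.max (continuous_id.min continuous_const)).integral_hasStrictDerivAt 0 s
    ).hasDerivAt

lemma contDiff_ramp : ContDiff ℝ 1 ramp := by
  rw [contDiff_one_iff_deriv]
  refine ⟨fun s => (hasDerivAt_ramp s).differentiableAt, ?_⟩
  rw [show deriv ramp = fun s => max 0 (min s 1) from funext fun s => (hasDerivAt_ramp s).deriv]
  exact continuous_const.max (continuous_id.min continuous_const)

lemma ramp_of_nonpos {s : ℝ} (hs : s ≤ 0) : ramp s = 0 := by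
  rw [ramp, intervalIntegral.integral_symm, intervalIntegral.integral_congr (g := fun _ => 0)]
  · simp
  · intro t ht
    rw [uIcc_of_le hs] at ht
    exact max_eq_left ((min_le_left _ _).trans ht.2)

lemma ramp_pos {s : ℝ} (hs : 0 < s) : 0 < ramp s :=
  intervalIntegral.intervalIntegral_pos_of_pos_on
    ((continuous_const.max (continuous_id.min continuous_const)).intervalIntegrable _ _)
    (fun _ ht => lt_max_of_lt_right (lt_min ht.1 one_pos)) hs

lemma eq_zero_of_gradient_eq_zero {η : Plane → ℝ} (hη : ContDiff ℝ 1 η)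
    (hc : HasCompactSupport η) (h : ∀ x, ∇ η x = 0) (x : Plane) : η x = 0 := by
  obtain ⟨y, hy⟩ : ∃ y, y ∉ tsupport η := by
    by_contra hcon
    push Not at hcon
    have : IsCompact (univ : Set Plane) := hc.of_isClosed_subset isClosed_univ fun y _ => hcon y
    exact noncompact_univ Plane this
  rw [is_const_of_fderiv_eq_zero (𝕜 := ℝ) (hη.differentiable one_ne_zero) (fun z => ?_) x y]
  · exact image_eq_zero_of_notMem_tsupport hy
  · rw [← norm_eq_zero, ← norm_gradient, h, norm_zero]

lemma eq_zero_of_integral_eq_zero {f : Plane → ℝ} (hf : Continuous f) (hc : HasCompactSupport f)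
    (h0 : ∀ x, 0 ≤ f x) (h : ∫ x, f x = 0) (x : Plane) : f x = 0 := by
  have h1 := (integral_eq_zero_iff_of_nonneg h0 (hf.integrable_of_hasCompactSupport hc)).1 h
  exact congrFun (Continuous.ae_eq_iff_eq volume hf continuous_const |>.1 h1) x

section Comparison

variable {p : ℝ} {a : ℝ → ℝ} {U : Set Plane} {u v : Plane → ℝ}

theorem comparison (ha : IsKernel p a) (hp : 1 < p) (hU : IsOpen U) (hu : WeakSol a U u)
    (hv : WeakSol a U v) (hc : ∀ ε > 0, IsCompact {x ∈ U | ε ≤ u x - v x}) :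
    ∀ x ∈ U, u x ≤ v x := by
  classical
  intro x hx
  refine le_of_forall_pos_le_add fun ε hε => ?_
  let η : Plane → ℝ := fun y => if y ∈ U then ramp (u y - v y - ε) else 0
  have hKU : {x ∈ U | ε ≤ u x - v x} ⊆ U := fun y hy => hy.1
  have hηU : ∀ y ∈ U, η y = ramp (u y - v y - ε) := fun y hy => if_pos hy
  have h0 : ∀ y ∉ {x ∈ U | ε ≤ u x - v x}, η y = 0 := by
    intro y hy
    by_cases hyU : y ∈ U
    · rw [hηU y hyU]
      refine ramp_of_nonpos ?_
      by_contra hcon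
      exact hy ⟨hyU, by linarith⟩
    · exact if_neg hyU
  have hη : ContDiff ℝ 1 η := by
    refine contDiff_of_eq_zero_off hU (hc ε hε).isClosed hKU ?_ h0
    exact (contDiff_ramp.comp_contDiffOn ((hu.1.sub hv.1).sub contDiffOn_const)).congr hηU
  have hηc : HasCompactSupport η := HasCompactSupport.intro (hc ε hε) h0
  have hηs : tsupport η ⊆ U := (closure_minimal (fun y hy => by
    by_contra hcon
    exact hy (h0 y hcon)) (hc ε hε).isClosed).trans hKU
  have hgrad : ∀ y ∈ U, ∇ η y = (max 0 (min (u y - v y - ε) 1)) • (∇ u y - ∇ v y) := by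
    intro y hy
    have hdu := differentiableAt_of_contDiffOn hu.1 hU hy
    have hdv := differentiableAt_of_contDiffOn hv.1 hU hy
    rw [gradient_congr_of_eqOn hU hηU hy,
      gradient_comp (f := fun y => u y - v y - ε) (hasDerivAt_ramp _) ((hdu.sub hdv).sub_const ε),
      gradient_sub_const (f := fun y => u y - v y), gradient_sub hdu hdv]
  let F : Plane → Plane := fun y => flux a (∇ u y) - flux a (∇ v y)
  have hFc : ContinuousOn F U := (continuousOn_flux_gradient ha hp hU hu.1).sub
    (continuousOn_flux_gradient ha hp hU hv.1)
  have hint : ∫ y, ⟪F y, ∇ η y⟫ = 0 := by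
    simp only [F, inner_sub_left]
    rw [integral_sub, hu.2 η hη hηc hηs, hv.2 η hη hηc hηs, sub_zero]
    · exact integrable_inner_gradient hU (continuousOn_flux_gradient ha hp hU hu.1) hη hηc hηs
    · exact integrable_inner_gradient hU (continuousOn_flux_gradient ha hp hU hv.1) hη hηc hηs
  have hzero := eq_zero_of_integral_eq_zero
    (continuous_inner_of_tsupport hU hFc (continuous_gradient hη)
      (tsupport_gradient_subset.trans hηs))
    (hasCompactSupport_inner (hasCompactSupport_gradient hηc)) (fun y => ?_) hint
  · have hg0 : ∀ y, ∇ η y = 0 := by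
      intro y
      by_cases hy : y ∈ U
      · have := hzero y
        rw [hgrad y hy, inner_smul_right] at this
        rw [hgrad y hy]
        rcases mul_eq_zero.1 this with h | h
        · rw [h, zero_smul]
        · by_cases hne : ∇ u y = ∇ v y
          · rw [hne, sub_self, smul_zero]
          · exact absurd h (ha.inner_flux_sub_pos hp hne).ne'
      · exact gradient_eq_zero_of_notMem_tsupport fun h => hy (hηs h)
    have hηx := eq_zero_of_gradient_eq_zero hη hηc hg0 x
    rw [hηU x hx] at hηx
    by_contra hcon
    exact (ramp_pos (s := u x - v x - ε) (by linarith)).ne' hηx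
  · by_cases hy : y ∈ U
    · rw [hgrad y hy, inner_smul_right]
      exact mul_nonneg (le_max_left _ _) (ha.inner_flux_sub_nonneg hp _ _)
    · simp [gradient_eq_zero_of_notMem_tsupport fun h => hy (hηs h)]

theorem comparison_closure (ha : IsKernel p a) (hp : 1 < p) (hU : IsOpen U)
    (hb : Bornology.IsBounded U) (hu : WeakSol a U u) (hv : WeakSol a U v)
    (huc : ContinuousOn u (closure U)) (hvc : ContinuousOn v (closure U))
    (h : ∀ x ∈ frontier U, u x ≤ v x) : ∀ x ∈ closure U, u x ≤ v x := by
  have hcl : ∀ ε > 0, IsCompact {x ∈ U | ε ≤ u x - v x} := by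
    intro ε hε
    have e : {x ∈ U | ε ≤ u x - v x} = closure U ∩ (fun x => u x - v x) ⁻¹' Ici ε := by
      ext x
      refine ⟨fun hx => ⟨subset_closure hx.1, hx.2⟩, fun hx => ⟨?_, hx.2⟩⟩
      by_contra hxU
      have : x ∈ frontier U := ⟨hx.1, by rwa [hU.interior_eq]⟩
      have h1 := h x this
      have h2 : ε ≤ u x - v x := hx.2
      linarith
    rw [e]
    exact hb.isCompact_closure.of_isClosed_subset
      ((huc.sub hvc).preimage_isClosed_of_isClosed isClosed_closure isClosed_Ici)
      inter_subset_left
  intro x hx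
  by_cases hxU : x ∈ U
  · exact comparison ha hp hU hu hv hcl x hxU
  · exact h x ⟨hx, by rwa [hU.interior_eq]⟩

lemma weakSol_const (a : ℝ → ℝ) (U : Set Plane) (c : ℝ) : WeakSol a U fun _ => c := by
  refine ⟨contDiffOn_const, fun η _ _ _ => ?_⟩
  simp [gradient_const, flux_zero]

/-- Maximum principle for directional derivatives of solutions. -/
theorem inner_gradient_le_of_sphere (ha : IsKernel p a) (hp : 1 < p) (hU : IsOpen U)
    (hu : WeakSol a U u) {x₀ : Plane} {r : ℝ} (hr : 0 < r) (hball : closedBall x₀ r ⊆ U)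
    {e : Plane} {k : ℝ} (h : ∀ x ∈ sphere x₀ r, ⟪∇ u x, e⟫ ≤ k) :
    ∀ x ∈ closedBall x₀ r, ⟪∇ u x, e⟫ ≤ k := by
  have hline : ∀ x t, x + t • e ∈ U →
      HasDerivAt (fun t : ℝ => u (x + t • e)) ⟪∇ u (x + t • e), e⟫ t := by
    intro x t hx
    have h1 : HasDerivAt (fun t : ℝ => x + t • e) e t := by
      simpa using ((hasDerivAt_id t).smul_const e).const_add x
    have h2 := (differentiableAt_of_contDiffOn hu.1 hU hx).hasFDerivAt.comp_hasDerivAt t h1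
    rw [gradient_def, InnerProductSpace.toDual_symm_apply]
    exact h2
  intro x hx
  rw [← sphere_union_ball] at hx
  rcases hx with hx | hx
  · exact h x hx
  refine le_of_forall_pos_le_add fun σ hσ => ?_
  have hgc := continuousOn_gradient hu.1 hU
  have hVo : IsOpen (U ∩ {y | ⟪∇ u y, e⟫ < k + σ}) :=
    (hgc.inner (𝕜 := ℝ) (continuousOn_const (c := e))).isOpen_inter_preimage hU isOpen_Iio
  obtain ⟨δ, hδ, hδV⟩ := (isCompact_sphere x₀ r).exists_thickening_subset_open hVo
    fun y hy => ⟨hball (sphere_subset_closedBall hy), by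
      have := h y hy
      simp only [mem_ofPred_eq]; linarith⟩
  obtain ⟨δ', hδ', hδU⟩ := (isCompact_closedBall x₀ r).exists_thickening_subset_open hU hball
  have hev : ∀ᶠ t : ℝ in 𝓝[>] 0, u (x + t • e) - u x ≤ t * (k + σ) := by
    have hsm : ∀ᶠ t : ℝ in 𝓝[>] 0, ‖t • e‖ < min δ δ' := by
      have : ContinuousAt (fun t : ℝ => ‖t • e‖) 0 := by fun_prop
      refine (this.eventually_lt continuousAt_const ?_).filter_mono nhdsWithin_le_nhds
      simp [hδ, hδ']
    filter_upwards [hsm, self_mem_nhdsWithin] with t ht ht0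
    rw [mem_Ioi] at ht0
    rw [lt_min_iff] at ht
    have hthick : ∀ y ∈ closedBall x₀ r, y + t • e ∈ U := fun y hy =>
      hδU (mem_thickening_iff.2 ⟨y, hy, by simpa [dist_eq_norm] using ht.2⟩)
    have hcmp := comparison_closure ha hp (U := ball x₀ r) isOpen_ball isBounded_ball
      (u := fun y => u (y + t • e)) (v := fun y => u y + t * (k + σ))
      ((hu.comp_add (t • e)).mono fun y hy => hthick y (ball_subset_closedBall hy))
      ((hu.add_const _).mono (ball_subset_closedBall.trans hball)) ?_ ?_ ?_ x (subset_closure hx)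
    · linarith
    · rw [closure_ball _ hr.ne']
      exact hu.1.continuousOn.comp (by fun_prop) hthick
    · rw [closure_ball _ hr.ne']
      exact (hu.1.continuousOn.mono hball).add continuousOn_const
    · rw [frontier_ball _ hr.ne']
      intro y hy
      have hmem : ∀ s ∈ Icc 0 t, y + s • e ∈ U ∩ {y | ⟪∇ u y, e⟫ < k + σ} := by
        intro s hs
        refine hδV (mem_thickening_iff.2 ⟨y, hy, ?_⟩)
        rw [dist_eq_norm, add_sub_cancel_left]
        refine lt_of_le_of_lt ?_ ht.1
        rw [norm_smul, norm_smul, Real.norm_of_nonneg hs.1, Real.norm_of_nonneg ht0.le]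
        exact mul_le_mul_of_nonneg_right hs.2 (norm_nonneg _)
      have hmv := (convex_Icc (0 : ℝ) t).image_sub_le_mul_sub_of_deriv_le
        (f := fun s : ℝ => u (y + s • e)) (C := k + σ)
        (fun s hs => (hline y s (hmem s hs).1).continuousAt.continuousWithinAt)
        (fun s hs => (hline y s (hmem s (interior_subset hs)).1).differentiableAt.differentiableWithinAt)
        (fun s hs => by
          rw [(hline y s (hmem s (interior_subset hs)).1).deriv]
          exact (hmem s (interior_subset hs)).2.le)
        0 ⟨le_rfl, ht0.le⟩ t ⟨ht0.le, le_rfl⟩ ht0.le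
      simp only [zero_smul, add_zero, sub_zero] at hmv
      linarith
  have hd := hline x 0 (by simpa using hball (ball_subset_closedBall hx))
  rw [hasDerivAt_iff_tendsto_slope] at hd
  have hd' := hd.mono_left (nhdsWithin_mono (0 : ℝ)
    (show Ioi (0 : ℝ) ⊆ {0}ᶜ from fun t ht => (ne_of_gt ht : t ≠ 0)))
  simp only [zero_smul, add_zero] at hd'
  refine le_of_tendsto hd' ?_
  filter_upwards [hev, self_mem_nhdsWithin] with t ht ht0
  rw [mem_Ioi] at ht0
  rw [slope_def_field, sub_zero, div_le_iff₀ ht0]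
  simp only [zero_smul, add_zero]
  linarith

theorem norm_gradient_sub_le_of_sphere (ha : IsKernel p a) (hp : 1 < p) (hU : IsOpen U)
    (hu : WeakSol a U u) {x₀ : Plane} {r : ℝ} (hr : 0 < r) (hball : closedBall x₀ r ⊆ U)
    {ξ : Plane} {κ : ℝ} (h : ∀ x ∈ sphere x₀ r, ‖∇ u x - ξ‖ ≤ κ) :
    ∀ x ∈ closedBall x₀ r, ‖∇ u x - ξ‖ ≤ κ := by
  intro x hx
  have h1 := inner_gradient_le_of_sphere ha hp hU hu hr hball (e := ∇ u x - ξ)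
    (k := ⟪ξ, ∇ u x - ξ⟫ + κ * ‖∇ u x - ξ‖) (fun y hy => by
      have h2 := real_inner_le_norm (∇ u y - ξ) (∇ u x - ξ)
      rw [inner_sub_left] at h2
      have h3 := mul_le_mul_of_nonneg_right (h y hy) (norm_nonneg (∇ u x - ξ))
      linarith) x hx
  have h2 : ‖∇ u x - ξ‖ ^ 2 = ⟪∇ u x, ∇ u x - ξ⟫ - ⟪ξ, ∇ u x - ξ⟫ := by
    rw [← inner_sub_left, real_inner_self_eq_norm_sq]
  by_contra hcon
  rw [not_le] at hcon
  have hs : (sphere x₀ r).Nonempty := NormedSpace.sphere_nonempty.2 hr.le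
  obtain ⟨y, hy⟩ := hs
  have hκ : 0 ≤ κ := (norm_nonneg _).trans (h y hy)
  nlinarith

end Comparison

section IntervalTools

lemma sq_integral_le {f : ℝ → ℝ} (hf : Continuous f) {a b : ℝ} (hab : a ≤ b) :
    (∫ t in a..b, f t) ^ 2 ≤ (b - a) * ∫ t in a..b, f t ^ 2 := by
  rcases hab.eq_or_lt with rfl | hab
  · simp
  have hba : 0 < b - a := sub_pos.2 hab
  set c := (∫ t in a..b, f t) / (b - a) with hc
  have h0 : 0 ≤ ∫ t in a..b, (f t - c) ^ 2 :=
    intervalIntegral.integral_nonneg hab.le fun t _ => sq_nonneg _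
  have e : ∫ t in a..b, (f t - c) ^ 2 =
      (∫ t in a..b, f t ^ 2) - 2 * c * (∫ t in a..b, f t) + (b - a) * c ^ 2 := by
    have : ∀ t, (f t - c) ^ 2 = f t ^ 2 - 2 * c * f t + c ^ 2 := fun t => by ring
    simp_rw [this]
    rw [intervalIntegral.integral_add, intervalIntegral.integral_sub,
      intervalIntegral.integral_const_mul, intervalIntegral.integral_const, smul_eq_mul]
    all_goals exact Continuous.intervalIntegrable (by fun_prop) _ _
  have hI : (∫ t in a..b, f t) = c * (b - a) := by rw [hc]; field_simp
  rw [e, hI] at h0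
  rw [hI]
  nlinarith

lemma integrableOn_prod_of_continuous {X Y : Type*} [TopologicalSpace X] [TopologicalSpace Y]
    [MeasurableSpace X] [MeasurableSpace Y] [BorelSpace X] [BorelSpace Y]
    [SecondCountableTopology X] [SecondCountableTopology Y] {μ : Measure X} {ν : Measure Y}
    [SFinite μ] [SFinite ν] [IsFiniteMeasureOnCompacts (μ.prod ν)] [T2Space X] [T2Space Y]
    {F : X → Y → ℝ} (hF : Continuous (Function.uncurry F)) {s K : Set X} {t L : Set Y}
    (hK : IsCompact K) (hL : IsCompact L) (hs : s ⊆ K) (ht : t ⊆ L) :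
    Integrable (Function.uncurry F) ((μ.restrict s).prod (ν.restrict t)) := by
  rw [Measure.prod_restrict]
  exact (hF.continuousOn.integrableOn_compact (hK.prod hL)).mono_set (Set.prod_mono hs ht)

lemma interval_swap {F : ℝ → ℝ → ℝ} (hF : Continuous (Function.uncurry F)) {a b c d : ℝ}
    (hcd : c ≤ d) :
    ∫ x in a..b, ∫ y in c..d, F x y = ∫ y in c..d, ∫ x in a..b, F x y := by
  simp only [intervalIntegral.integral_of_le hcd]
  exact intervalIntegral_integral_swap (integrableOn_prod_of_continuous hF isCompact_uIcc
    isCompact_Icc uIoc_subset_uIcc Ioc_subset_Icc_self)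

lemma ball_interval_swap {F : ℝ → Plane → ℝ} (hF : Continuous (Function.uncurry F))
    (x₀ : Plane) (R a b : ℝ) :
    ∫ t in a..b, ∫ x in ball x₀ R, F t x = ∫ x in ball x₀ R, ∫ t in a..b, F t x :=
  intervalIntegral_integral_swap (integrableOn_prod_of_continuous hF isCompact_uIcc
    (isCompact_closedBall x₀ R) uIoc_subset_uIcc ball_subset_closedBall)

end IntervalTools

section Differences

variable {g : Plane → ℝ}

lemma hasDerivAt_line {f : Plane → ℝ} (x h : Plane) (t : ℝ)
    (hf : DifferentiableAt ℝ f (x + t • h)) :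
    HasDerivAt (fun t : ℝ => f (x + t • h)) ⟪∇ f (x + t • h), h⟫ t := by
  have h1 : HasDerivAt (fun t : ℝ => x + t • h) h t := by
    simpa using ((hasDerivAt_id t).smul_const h).const_add x
  have h2 := hf.hasFDerivAt.comp_hasDerivAt t h1
  rw [gradient_def, InnerProductSpace.toDual_symm_apply]
  exact h2

lemma abs_sub_le_integral (hg : ContDiff ℝ 1 g) (x h : Plane) :
    |g (x + h) - g x| ≤ ∫ t in (0 : ℝ)..1, ‖h‖ * ‖∇ g (x + t • h)‖ := by
  have hgc := continuous_gradient hg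
  have hc : Continuous fun t : ℝ => ⟪∇ g (x + t • h), h⟫ :=
    Continuous.inner (by fun_prop) continuous_const
  have e := intervalIntegral.integral_eq_sub_of_hasDerivAt (a := 0) (b := 1)
    (fun t _ => hasDerivAt_line x h t (hg.differentiable one_ne_zero _))
    (hc.intervalIntegrable _ _)
  simp only [one_smul, zero_smul, add_zero] at e
  rw [← e]
  refine (intervalIntegral.abs_integral_le_integral_abs zero_le_one).trans ?_
  refine intervalIntegral.integral_mono_on zero_le_one (hc.abs.intervalIntegrable _ _)
    (Continuous.intervalIntegrable (by fun_prop) _ _) fun t _ => ?_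
  rw [mul_comm]
  exact abs_real_inner_le_norm _ _

lemma sq_sub_le_integral (hg : ContDiff ℝ 1 g) (x h : Plane) :
    (g (x + h) - g x) ^ 2 ≤ ∫ t in (0 : ℝ)..1, ‖h‖ ^ 2 * ‖∇ g (x + t • h)‖ ^ 2 := by
  have hgc := continuous_gradient hg
  have h1 := abs_sub_le_integral hg x h
  have h2 : Continuous fun t : ℝ => ‖h‖ * ‖∇ g (x + t • h)‖ := by fun_prop
  have h3 := sq_integral_le h2 zero_le_one
  rw [← sq_abs]
  refine (pow_le_pow_left₀ (abs_nonneg _) h1 2).trans (h3.trans (le_of_eq ?_))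
  rw [sub_zero, one_mul]
  simp only [mul_pow]

lemma setIntegral_ball_comp_add_le {G : Plane → ℝ} (hG : Continuous G) (h0 : ∀ x, 0 ≤ G x)
    (x₀ z : Plane) {R R' : ℝ} (hR : R + ‖z‖ ≤ R') :
    ∫ x in ball x₀ R, G (x + z) ≤ ∫ x in ball x₀ R', G x := by
  have e : ∫ x in ball x₀ R, G (x + z) = ∫ x in ball (x₀ + z) R, G x := by
    have := (measurePreserving_add_right volume z).setIntegral_preimage_emb
      (measurableEmbedding_addRight z) G (ball (x₀ + z) R)
    rw [← this]
    congr 2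
    ext x
    simp [mem_ball, dist_eq_norm]
  rw [e]
  refine setIntegral_mono_set (hG.integrableOn_ball _ _) (Eventually.of_forall h0) ?_
  refine LE.le.eventuallyLE (ball_subset_ball' ?_)
  rw [dist_eq_norm, add_sub_cancel_left]
  exact hR

private lemma ball_difference_aux {G : Plane → ℝ} (hG : Continuous G) (h0 : ∀ x, 0 ≤ G x)
    (x₀ h : Plane) (R : ℝ) :
    ∫ x in ball x₀ R, ∫ t in (0 : ℝ)..1, G (x + t • h) ≤ ∫ x in ball x₀ (R + ‖h‖), G x := by
  have hF : Continuous (Function.uncurry fun (t : ℝ) (x : Plane) => G (x + t • h)) :=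
    hG.comp (by fun_prop)
  rw [← ball_interval_swap hF]
  have h1 : Continuous fun t : ℝ => ∫ x in ball x₀ R, G (x + t • h) := by
    have : Continuous fun t : ℝ => ∫ x in closedBall x₀ R, G (x + t • h) :=
      continuous_parametric_integral_of_continuous hF (isCompact_closedBall _ _)
    have e : ∀ f : Plane → ℝ, ∫ x in ball x₀ R, f x = ∫ x in closedBall x₀ R, f x := by
      intro f
      refine setIntegral_congr_set ?_
      rw [← ball_union_sphere]
      exact (union_ae_eq_left_of_ae_eq_empty
        (ae_eq_empty.2 (Measure.addHaar_sphere volume x₀ R))).symm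
    simpa only [e] using this
  have h2 := intervalIntegral.integral_mono_on (f := fun t : ℝ => ∫ x in ball x₀ R, G (x + t • h))
    (g := fun _ => ∫ x in ball x₀ (R + ‖h‖), G x) (μ := volume) zero_le_one (h1.intervalIntegrable _ _)
    (continuous_const.intervalIntegrable _ _) fun t ht => setIntegral_ball_comp_add_le hG h0 x₀ (t • h) (by
      rw [norm_smul, Real.norm_of_nonneg ht.1]
      have := mul_le_of_le_one_left (norm_nonneg h) ht.2
      linarith)
  simpa using h2

lemma continuous_line_integral {G : Plane → ℝ} (hG : Continuous G) (h : Plane) :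
    Continuous fun x : Plane => ∫ t in (0 : ℝ)..1, G (x + t • h) :=
  intervalIntegral.continuous_parametric_intervalIntegral_of_continuous'
    (f := fun (x : Plane) (t : ℝ) => G (x + t • h)) (hG.comp (by fun_prop)) 0 1

lemma integral_sq_difference_le (hg : ContDiff ℝ 1 g) (x₀ h : Plane) (R : ℝ) :
    ∫ x in ball x₀ R, (g (x + h) - g x) ^ 2 ≤
      ‖h‖ ^ 2 * ∫ x in ball x₀ (R + ‖h‖), ‖∇ g x‖ ^ 2 := by
  have hgc := continuous_gradient hg
  have hgc0 := hg.continuous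
  have hG : Continuous fun x => ‖h‖ ^ 2 * ‖∇ g x‖ ^ 2 := by fun_prop
  have h1 : ∫ x in ball x₀ R, (g (x + h) - g x) ^ 2 ≤
      ∫ x in ball x₀ R, ∫ t in (0 : ℝ)..1, ‖h‖ ^ 2 * ‖∇ g (x + t • h)‖ ^ 2 :=
    setIntegral_mono (Continuous.integrableOn_ball (by fun_prop) _ _)
      ((continuous_line_integral hG h).integrableOn_ball _ _) fun x => sq_sub_le_integral hg x h
  refine h1.trans ((ball_difference_aux hG (fun x => by positivity) x₀ h R).trans ?_)
  rw [integral_const_mul]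

lemma integral_abs_difference_le (hg : ContDiff ℝ 1 g) (x₀ h : Plane) (R : ℝ) :
    ∫ x in ball x₀ R, |g (x + h) - g x| ≤
      ‖h‖ * ∫ x in ball x₀ (R + ‖h‖), ‖∇ g x‖ := by
  have hgc := continuous_gradient hg
  have hgc0 := hg.continuous
  have hG : Continuous fun x => ‖h‖ * ‖∇ g x‖ := by fun_prop
  have h1 : ∫ x in ball x₀ R, |g (x + h) - g x| ≤
      ∫ x in ball x₀ R, ∫ t in (0 : ℝ)..1, ‖h‖ * ‖∇ g (x + t • h)‖ :=
    setIntegral_mono (Continuous.integrableOn_ball (by fun_prop) _ _)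
      ((continuous_line_integral hG h).integrableOn_ball _ _) fun x => abs_sub_le_integral hg x h
  refine h1.trans ((ball_difference_aux hG (fun x => by positivity) x₀ h R).trans ?_)
  rw [integral_const_mul]

lemma integral_eq_setIntegral_ball {f : Plane → ℝ} {x₀ : Plane} {R : ℝ}
    (h : ∀ x ∉ ball x₀ R, f x = 0) : ∫ x, f x = ∫ x in ball x₀ R, f x :=
  (setIntegral_eq_integral_of_forall_compl_eq_zero h).symm

/-- Poincaré inequality for compactly supported functions. -/
lemma integral_sq_le_of_support (hg : ContDiff ℝ 1 g) {x₀ : Plane} {R : ℝ} (hR : 0 < R)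
    (h : ∀ x ∉ ball x₀ R, g x = 0) :
    ∫ x, g x ^ 2 ≤ (2 * R) ^ 2 * ∫ x, ‖∇ g x‖ ^ 2 := by
  have hc : HasCompactSupport g := HasCompactSupport.intro (isCompact_closedBall x₀ R)
    fun x hx => h x fun hx' => hx (ball_subset_closedBall hx')
  have hgc := continuous_gradient hg
  obtain ⟨z, hz⟩ : ∃ z : Plane, ‖z‖ = 2 * R :=
    exists_norm_eq Plane (by positivity)
  have h1 := integral_sq_difference_le hg x₀ z R
  have e : ∫ x in ball x₀ R, (g (x + z) - g x) ^ 2 = ∫ x in ball x₀ R, g x ^ 2 := by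
    refine setIntegral_congr_fun measurableSet_ball fun x hx => ?_
    rw [mem_ball, dist_eq_norm] at hx
    have : g (x + z) = 0 := h _ fun hxz => by
      rw [mem_ball, dist_eq_norm] at hxz
      have := norm_sub_le (x + z - x₀) (x - x₀)
      rw [show x + z - x₀ - (x - x₀) = z by abel, hz] at this
      linarith
    simp only [this]
    ring
  rw [integral_eq_setIntegral_ball (x₀ := x₀) (R := R) fun x hx => by rw [h x hx]; ring, ← e]
  refine h1.trans ?_
  rw [hz]
  refine mul_le_mul_of_nonneg_left ?_ (by positivity)
  refine setIntegral_le_integral ?_ (Eventually.of_forall fun x => by positivity)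
  refine Continuous.integrable_of_hasCompactSupport (by fun_prop) ?_
  exact HasCompactSupport.intro (hasCompactSupport_gradient hc) fun x hx => by
    rw [image_eq_zero_of_notMem_tsupport hx]; simp

end Differences

section Polar

/-- The unit circle parametrised by angle. -/
noncomputable def circ (θ : ℝ) : Plane := !₂[Real.cos θ, Real.sin θ]

/-- Its derivative. -/
noncomputable def circ' (θ : ℝ) : Plane := !₂[-Real.sin θ, Real.cos θ]

lemma norm_circ (θ : ℝ) : ‖circ θ‖ = 1 := by
  rw [EuclideanSpace.norm_eq]; simp [circ]

lemma norm_circ' (θ : ℝ) : ‖circ' θ‖ = 1 := by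
  rw [EuclideanSpace.norm_eq]; simp [circ']

lemma hasDerivAt_circ (θ : ℝ) : HasDerivAt circ (circ' θ) θ := by
  have h : HasDerivAt (fun θ : ℝ => ![Real.cos θ, Real.sin θ]) ![-Real.sin θ, Real.cos θ] θ := by
    rw [hasDerivAt_pi]
    intro i
    fin_cases i
    · exact Real.hasDerivAt_cos θ
    · exact Real.hasDerivAt_sin θ
  exact (PiLp.hasFDerivAt_toLp (𝕜 := ℝ) 2 ![Real.cos θ, Real.sin θ]).comp_hasDerivAt θ h

@[fun_prop]
lemma continuous_circ : Continuous circ :=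
  continuous_iff_continuousAt.2 fun θ => (hasDerivAt_circ θ).continuousAt

@[fun_prop]
lemma continuous_circ' : Continuous circ' := by
  unfold circ'
  refine (PiLp.continuous_toLp 2 _).comp (continuous_pi fun i => ?_)
  fin_cases i
  · exact Real.continuous_sin.neg
  · exact Real.continuous_cos

lemma exists_circ {x₀ x : Plane} {r : ℝ} (hr : 0 < r) (hx : x ∈ sphere x₀ r) :
    ∃ θ ∈ Icc (-Real.pi) Real.pi, x = x₀ + r • circ θ := by
  let z : ℂ := ⟨(x - x₀) 0, (x - x₀) 1⟩
  have hz : ‖z‖ = r := by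
    rw [mem_sphere, dist_eq_norm, EuclideanSpace.norm_eq] at hx
    rw [Complex.norm_eq_sqrt_sq_add_sq, ← hx]
    simp [z]
  have hz0 : z ≠ 0 := by
    intro h; rw [h, norm_zero] at hz; exact hr.ne hz
  refine ⟨z.arg, ⟨(Complex.neg_pi_lt_arg z).le, Complex.arg_le_pi z⟩, ?_⟩
  ext i
  fin_cases i
  · have : Real.cos z.arg = (x - x₀) 0 / r := by rw [Complex.cos_arg hz0, hz]
    simp only [circ, PiLp.add_apply, PiLp.smul_apply, smul_eq_mul]
    simp [this]
    field_simp
    ring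
  · have : Real.sin z.arg = (x - x₀) 1 / r := by rw [Complex.sin_arg, hz]
    simp only [circ, PiLp.add_apply, PiLp.smul_apply, smul_eq_mul]
    simp [this]
    field_simp
    ring

lemma integral_polar (f : Plane → ℝ) (x₀ : Plane) :
    ∫ x, f x = ∫ q in polarCoord.target, q.1 * f (x₀ + q.1 • circ q.2) := by
  rw [← integral_add_left_eq_self f x₀]
  have hmp : MeasurePreserving ((MeasurableEquiv.toLp 2 (Fin 2 → ℝ)).symm.trans
      (MeasurableEquiv.finTwoArrow (α := ℝ))) volume volume :=
    (EuclideanSpace.volume_preserving_symm_measurableEquiv_toLp (Fin 2)).trans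
      (volume_preserving_finTwoArrow ℝ)
  rw [← hmp.symm.integral_comp' (g := fun x => f (x₀ + x)), ← integral_comp_polarCoord_symm]
  refine integral_congr_ae (Eventually.of_forall fun q => ?_)
  simp only [smul_eq_mul]
  congr 3
  ext i
  fin_cases i
  · simp [circ, polarCoord_symm_apply]
  · simp [circ, polarCoord_symm_apply]

/-- The open annulus. -/
def annulus (x₀ : Plane) (ρ R : ℝ) : Set Plane := {x | ρ < dist x x₀ ∧ dist x x₀ < R}

lemma isOpen_annulus (x₀ : Plane) (ρ R : ℝ) : IsOpen (annulus x₀ ρ R) :=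
  (isOpen_Ioo (a := ρ) (b := R)).preimage (continuous_id.dist continuous_const)

lemma annulus_subset_ball (x₀ : Plane) (ρ R : ℝ) : annulus x₀ ρ R ⊆ ball x₀ R :=
  fun _ hx => hx.2

lemma integral_annulus {f : Plane → ℝ} (hf : Continuous f) (x₀ : Plane) {ρ R : ℝ} (hρ : 0 ≤ ρ)
    (hR : ρ ≤ R) :
    ∫ x in annulus x₀ ρ R, f x =
      ∫ r in ρ..R, ∫ θ in (-Real.pi)..Real.pi, r * f (x₀ + r • circ θ) := by
  have hpi : -Real.pi ≤ Real.pi := by linarith [Real.pi_pos]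
  rw [← integral_indicator (isOpen_annulus x₀ ρ R).measurableSet, integral_polar _ x₀]
  have e1 : ∀ q ∈ polarCoord.target,
      q.1 * (annulus x₀ ρ R).indicator f (x₀ + q.1 • circ q.2) =
        (Ioo ρ R ×ˢ Ioo (-Real.pi) Real.pi).indicator
          (fun q : ℝ × ℝ => q.1 * f (x₀ + q.1 • circ q.2)) q := by
    intro q hq
    rw [polarCoord_target] at hq
    have hq1 : 0 < q.1 := hq.1
    have hd : dist (x₀ + q.1 • circ q.2) x₀ = q.1 := by
      rw [dist_eq_norm, add_sub_cancel_left, norm_smul, norm_circ, mul_one,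
        Real.norm_of_nonneg hq1.le]
    by_cases h : q.1 ∈ Ioo ρ R
    · rw [indicator_of_mem, indicator_of_mem]
      · exact ⟨h, hq.2⟩
      · exact ⟨by rw [hd]; exact h.1, by rw [hd]; exact h.2⟩
    · rw [indicator_of_notMem, indicator_of_notMem, mul_zero]
      · exact fun h' => h h'.1
      · intro h'
        exact h ⟨by have := h'.1; rwa [hd] at this, by have := h'.2; rwa [hd] at this⟩
  rw [setIntegral_congr_fun polarCoord.open_target.measurableSet e1,
    setIntegral_indicator (measurableSet_Ioo.prod measurableSet_Ioo)]
  have e2 : polarCoord.target ∩ Ioo ρ R ×ˢ Ioo (-Real.pi) Real.pi =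
      Ioo ρ R ×ˢ Ioo (-Real.pi) Real.pi := by
    rw [inter_eq_right, polarCoord_target]
    exact Set.prod_mono (fun r hr => hρ.trans_lt hr.1) Subset.rfl
  rw [e2, Measure.volume_eq_prod, setIntegral_prod, intervalIntegral.integral_of_le hR,
    integral_Ioc_eq_integral_Ioo]
  · refine setIntegral_congr_fun measurableSet_Ioo fun r _ => ?_
    simp only
    rw [intervalIntegral.integral_of_le hpi, integral_Ioc_eq_integral_Ioo]
  · refine (ContinuousOn.integrableOn_compact (K := Icc ρ R ×ˢ Icc (-Real.pi) Real.pi)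
      (isCompact_Icc.prod isCompact_Icc) (Continuous.continuousOn ?_)).mono_set
      (Set.prod_mono Ioo_subset_Icc_self Ioo_subset_Icc_self)
    fun_prop

lemma setIntegral_mono_set_of_nonneg {f : Plane → ℝ} (hf : Continuous f) (h0 : ∀ x, 0 ≤ f x)
    {S T : Set Plane} (hST : S ⊆ T) (hT : Bornology.IsBounded T) :
    ∫ x in S, f x ≤ ∫ x in T, f x :=
  setIntegral_mono_set ((hf.continuousOn.integrableOn_compact hT.isCompact_closure).mono_set
    subset_closure) (Eventually.of_forall h0) (LE.le.eventuallyLE hST)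

variable {g : Plane → ℝ}

lemma abs_sub_circ_le (hg : ContDiff ℝ 1 g) (x₀ : Plane) {r : ℝ} (hr : 0 ≤ r) {α β : ℝ}
    (hα : α ∈ Icc (-Real.pi) Real.pi) (hβ : β ∈ Icc (-Real.pi) Real.pi) :
    |g (x₀ + r • circ α) - g (x₀ + r • circ β)| ≤
      ∫ θ in (-Real.pi)..Real.pi, r * ‖∇ g (x₀ + r • circ θ)‖ := by
  have hgc := continuous_gradient hg
  wlog h : β ≤ α generalizing α β
  · rw [abs_sub_comm]; exact this hβ hα (le_of_not_ge h)
  have hd : ∀ θ : ℝ, HasDerivAt (fun θ => g (x₀ + r • circ θ))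
      (fderiv ℝ g (x₀ + r • circ θ) (r • circ' θ)) θ := fun θ =>
    (hg.differentiable one_ne_zero _).hasFDerivAt.comp_hasDerivAt θ
      (((hasDerivAt_circ θ).const_smul r).const_add x₀)
  have hfc : Continuous (fderiv ℝ g) := hg.continuous_fderiv one_ne_zero
  have hc : Continuous fun θ => fderiv ℝ g (x₀ + r • circ θ) (r • circ' θ) := by fun_prop
  have e := intervalIntegral.integral_eq_sub_of_hasDerivAt (a := β) (b := α)
    (fun θ _ => hd θ) (hc.intervalIntegrable _ _)
  rw [← e]
  refine (intervalIntegral.abs_integral_le_integral_abs h).trans ?_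
  have hc2 : Continuous fun θ => r * ‖∇ g (x₀ + r • circ θ)‖ := by fun_prop
  refine (intervalIntegral.integral_mono_on h (hc.abs.intervalIntegrable _ _)
    (hc2.intervalIntegrable _ _) fun θ _ => ?_).trans ?_
  · refine (fderiv_apply_le _ _ _).trans (le_of_eq ?_)
    rw [norm_smul, norm_circ', Real.norm_of_nonneg hr]; ring
  · exact intervalIntegral.integral_mono_interval hβ.1 h hα.2
      (Eventually.of_forall fun θ => by positivity) (hc2.intervalIntegrable _ _)

lemma continuous_circle_integral {f : Plane → ℝ} (hf : Continuous f) (x₀ : Plane) :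
    Continuous fun r : ℝ => ∫ θ in (-Real.pi)..Real.pi, r * f (x₀ + r • circ θ) :=
  intervalIntegral.continuous_parametric_intervalIntegral_of_continuous'
    (f := fun (r : ℝ) (θ : ℝ) => r * f (x₀ + r • circ θ)) (by fun_prop) _ _

lemma le_integral_of_circle_osc (hg : ContDiff ℝ 1 g) (x₀ : Plane) {κ ρ R : ℝ} (hρ : 0 < ρ)
    (hR : ρ ≤ R) (h : ∀ r ∈ Icc ρ R, ∃ x ∈ sphere x₀ r, ∃ y ∈ sphere x₀ r, κ ≤ g x - g y) :
    κ * (R - ρ) ≤ ∫ x in ball x₀ R, ‖∇ g x‖ := by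
  have hgc := continuous_gradient hg
  have hn : Continuous fun x => ‖∇ g x‖ := hgc.norm
  refine le_trans ?_ (setIntegral_mono_set_of_nonneg hn (fun x => norm_nonneg _)
    (annulus_subset_ball x₀ ρ R) isBounded_ball)
  rw [integral_annulus hn x₀ hρ.le hR]
  have := intervalIntegral.integral_mono_on (f := fun _ => κ) (μ := volume) hR (continuous_const.intervalIntegrable _ _)
    ((continuous_circle_integral hn x₀).intervalIntegrable _ _) fun r hr => by
      obtain ⟨x, hx, y, hy, hxy⟩ := h r hr
      have hr0 := hρ.trans_le hr.1
      obtain ⟨α, hα, rfl⟩ := exists_circ hr0 hx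
      obtain ⟨β, hβ, rfl⟩ := exists_circ hr0 hy
      exact hxy.trans ((le_abs_self _).trans (abs_sub_circ_le hg x₀ hr0.le hα hβ))
  rw [intervalIntegral.integral_const, smul_eq_mul] at this
  linarith

lemma sq_mul_log_le_of_circle_osc {g : Fin 2 → Plane → ℝ} (hg : ∀ i, ContDiff ℝ 1 (g i))
    (x₀ : Plane) {κ ρ R : ℝ} (hκ : 0 < κ) (hρ : 0 < ρ) (hR : ρ ≤ R)
    (h : ∀ r ∈ Icc ρ R, ∃ i, ∃ x ∈ sphere x₀ r, ∃ y ∈ sphere x₀ r, κ ≤ g i x - g i y) :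
    κ ^ 2 * Real.log (R / ρ) ≤ 2 * Real.pi * ∑ i, ∫ x in ball x₀ R, ‖∇ (g i) x‖ ^ 2 := by
  have hgc := fun i => continuous_gradient (hg i)
  have hpi := Real.pi_pos
  have hn : ∀ i, Continuous fun x => ‖∇ (g i) x‖ ^ 2 := fun i => (hgc i).norm.pow 2
  have hmono : ∀ i, _ := fun i => setIntegral_mono_set_of_nonneg (hn i) (fun x => by positivity)
    (annulus_subset_ball x₀ ρ R) isBounded_ball
  have hcirc := fun i => continuous_circle_integral (hn i) x₀
  have hle : ∫ r in ρ..R, κ ^ 2 * r⁻¹ ≤ ∫ r in ρ..R, 2 * Real.pi *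
      ∑ i, ∫ θ in (-Real.pi)..Real.pi, r * ‖∇ (g i) (x₀ + r • circ θ)‖ ^ 2 := by
    refine intervalIntegral.integral_mono_on hR ?_
      ((continuous_const.mul (continuous_finsetSum _ fun i _ => hcirc i)).intervalIntegrable _ _) ?_
    · refine ContinuousOn.intervalIntegrable ?_
      rw [uIcc_of_le hR]
      exact continuousOn_const.mul (continuousOn_id.inv₀ fun r hr => (hρ.trans_le hr.1).ne')
    · intro r hr
      obtain ⟨i, x, hx, y, hy, hxy⟩ := h r hr
      have hr0 := hρ.trans_le hr.1
      obtain ⟨α, hα, rfl⟩ := exists_circ hr0 hx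
      obtain ⟨β, hβ, rfl⟩ := exists_circ hr0 hy
      have h1 := hxy.trans ((le_abs_self _).trans (abs_sub_circ_le (hg i) x₀ hr0.le hα hβ))
      have hgi := hgc i
      have h2 := sq_integral_le (f := fun θ => r * ‖∇ (g i) (x₀ + r • circ θ)‖) (by fun_prop)
        (show -Real.pi ≤ Real.pi by linarith)
      have h3 := (pow_le_pow_left₀ hκ.le h1 2).trans h2
      have e : ∫ θ in (-Real.pi)..Real.pi, (r * ‖∇ (g i) (x₀ + r • circ θ)‖) ^ 2 =
          r * ∫ θ in (-Real.pi)..Real.pi, r * ‖∇ (g i) (x₀ + r • circ θ)‖ ^ 2 := by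
        rw [← intervalIntegral.integral_const_mul]
        congr 1; funext θ; ring
      rw [e] at h3
      have h4 : ∫ θ in (-Real.pi)..Real.pi, r * ‖∇ (g i) (x₀ + r • circ θ)‖ ^ 2 ≤
          ∑ i, ∫ θ in (-Real.pi)..Real.pi, r * ‖∇ (g i) (x₀ + r • circ θ)‖ ^ 2 :=
        Finset.single_le_sum
          (f := fun i => ∫ θ in (-Real.pi)..Real.pi, r * ‖∇ (g i) (x₀ + r • circ θ)‖ ^ 2)
          (fun j _ => intervalIntegral.integral_nonneg (by linarith) fun θ _ => by positivity)
          (Finset.mem_univ i)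
      rw [← div_eq_mul_inv, div_le_iff₀ hr0]
      have h5 := mul_le_mul_of_nonneg_left h4 (show 0 ≤ 2 * Real.pi * r by positivity)
      linarith
  rw [intervalIntegral.integral_const_mul, intervalIntegral.integral_const_mul,
    intervalIntegral.integral_finsetSum fun i _ => (hcirc i).intervalIntegrable _ _,
    integral_inv_of_pos hρ (hρ.trans_le hR)] at hle
  refine hle.trans (mul_le_mul_of_nonneg_left (Finset.sum_le_sum fun i _ => ?_) (by positivity))
  rw [← integral_annulus (hn i) x₀ hρ.le hR]
  exact hmono i

/-- Poincaré inequality on the annulus of radii `r` and `2 r`. -/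
lemma annulus_poincare (hg : ContDiff ℝ 1 g) (x₀ : Plane) {r : ℝ} (hr : 0 < r) :
    ∃ c, ∫ x in annulus x₀ r (2 * r), (g x - c) ^ 2 ≤
      (4 * (1 + 8 * Real.pi ^ 2)) * r ^ 2 * ∫ x in annulus x₀ r (2 * r), ‖∇ g x‖ ^ 2 := by
  have hgc := continuous_gradient hg
  have hg0 := hg.continuous
  have hpi := Real.pi_pos
  have hpp : -Real.pi ≤ Real.pi := by linarith
  have hr2 : r ≤ 2 * r := by linarith
  have hn : Continuous fun x => ‖∇ g x‖ ^ 2 := hgc.norm.pow 2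
  set I := ∫ x in annulus x₀ r (2 * r), ‖∇ g x‖ ^ 2 with hI
  have hIe := integral_annulus hn x₀ hr.le hr2
  rw [← hI] at hIe
  set m : ℝ → ℝ := fun s => ∫ θ in (-Real.pi)..Real.pi, s * ‖∇ g (x₀ + s • circ θ)‖ ^ 2 with hm
  have hmc : Continuous m := continuous_circle_integral hn x₀
  obtain ⟨s', hs', hmin⟩ := isCompact_Icc.exists_isMinOn (nonempty_Icc.2 hr2) hmc.continuousOn
  have hs'0 : 0 < s' := hr.trans_le hs'.1
  have hms : r * m s' ≤ I := by
    have := intervalIntegral.integral_mono_on (f := fun _ => m s') (μ := volume) hr2 (continuous_const.intervalIntegrable _ _)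
      (hmc.intervalIntegrable _ _) fun s hs => hmin hs
    rw [intervalIntegral.integral_const, smul_eq_mul, ← hIe] at this
    linarith
  set n : ℝ → ℝ := fun θ => ∫ τ in r..(2 * r), τ * ‖∇ g (x₀ + τ • circ θ)‖ ^ 2 with hn'
  have hnc : Continuous n :=
    intervalIntegral.continuous_parametric_intervalIntegral_of_continuous'
      (f := fun (θ : ℝ) (τ : ℝ) => τ * ‖∇ g (x₀ + τ • circ θ)‖ ^ 2) (by fun_prop) _ _
  have hnI : ∫ θ in (-Real.pi)..Real.pi, n θ = I := by
    rw [hIe, hm, interval_swap (F := fun s θ => s * ‖∇ g (x₀ + s • circ θ)‖ ^ 2) (by fun_prop) hpp]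
  refine ⟨g (x₀ + s' • circ 0), ?_⟩
  set c := g (x₀ + s' • circ 0) with hc
  have hang : ∀ θ ∈ Icc (-Real.pi) Real.pi, (g (x₀ + s' • circ θ) - c) ^ 2 ≤ 4 * Real.pi * I := by
    intro θ hθ
    have h1 := abs_sub_circ_le hg x₀ hs'0.le hθ (β := 0) ⟨by linarith, by linarith⟩
    have h2 := sq_integral_le (f := fun θ => s' * ‖∇ g (x₀ + s' • circ θ)‖) (by fun_prop) hpp
    have h3 := (pow_le_pow_left₀ (abs_nonneg _) h1 2).trans h2
    rw [sq_abs] at h3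
    have e : ∫ θ in (-Real.pi)..Real.pi, (s' * ‖∇ g (x₀ + s' • circ θ)‖) ^ 2 = s' * m s' := by
      rw [hm, ← intervalIntegral.integral_const_mul]
      congr 1; funext θ; ring
    rw [e] at h3
    have hm0 : 0 ≤ m s' := intervalIntegral.integral_nonneg hpp fun θ _ => by positivity
    have h4 : s' * m s' ≤ 2 * r * m s' := mul_le_mul_of_nonneg_right hs'.2 hm0
    refine h3.trans ?_
    nlinarith
  have hrad : ∀ θ, ∀ s ∈ Icc r (2 * r), (g (x₀ + s • circ θ) - g (x₀ + s' • circ θ)) ^ 2 ≤ n θ := by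
    intro θ s hs
    have hcont : Continuous fun τ : ℝ => ⟪∇ g (x₀ + τ • circ θ), circ θ⟫ :=
      Continuous.inner (by fun_prop) continuous_const
    have hcn : Continuous fun τ : ℝ => ‖∇ g (x₀ + τ • circ θ)‖ := by fun_prop
    have key : ∀ s₁ ∈ Icc r (2 * r), ∀ s₂ ∈ Icc r (2 * r), s₁ ≤ s₂ →
        (g (x₀ + s₂ • circ θ) - g (x₀ + s₁ • circ θ)) ^ 2 ≤ n θ := by
      intro s₁ h1 s₂ h2 h12
      have e := intervalIntegral.integral_eq_sub_of_hasDerivAt (a := s₁) (b := s₂)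
        (fun t _ => hasDerivAt_line x₀ (circ θ) t (hg.differentiable one_ne_zero _))
        (hcont.intervalIntegrable _ _)
      have h3 : |∫ τ in s₁..s₂, ⟪∇ g (x₀ + τ • circ θ), circ θ⟫| ≤
          ∫ τ in r..(2 * r), ‖∇ g (x₀ + τ • circ θ)‖ := by
        refine (intervalIntegral.abs_integral_le_integral_abs h12).trans ?_
        refine (intervalIntegral.integral_mono_on h12 (hcont.abs.intervalIntegrable _ _)
          (hcn.intervalIntegrable _ _) fun τ _ => ?_).trans
          (intervalIntegral.integral_mono_interval h1.1 h12 h2.2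
            (Eventually.of_forall fun τ => norm_nonneg _) (hcn.intervalIntegrable _ _))
        have := abs_real_inner_le_norm (∇ g (x₀ + τ • circ θ)) (circ θ)
        rwa [norm_circ, mul_one] at this
      rw [← e, ← sq_abs]
      refine (pow_le_pow_left₀ (abs_nonneg _) h3 2).trans ((sq_integral_le hcn hr2).trans ?_)
      rw [← intervalIntegral.integral_const_mul]
      refine intervalIntegral.integral_mono_on hr2 (Continuous.intervalIntegrable (by fun_prop) _ _)
        (Continuous.intervalIntegrable (by fun_prop) _ _) fun τ hτ => ?_
      refine mul_le_mul_of_nonneg_right ?_ (by positivity)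
      linarith [hτ.1]
    rcases le_total s' s with hss | hss
    · exact key s' hs' s hs hss
    · rw [← neg_sq, neg_sub]; exact key s hs s' hs' hss
  rw [integral_annulus (f := fun x => (g x - c) ^ 2) (by fun_prop) x₀ hr.le hr2]
  have hin : ∀ s ∈ Icc r (2 * r), ∫ θ in (-Real.pi)..Real.pi, s * (g (x₀ + s • circ θ) - c) ^ 2 ≤
      2 * r * (2 * I + 16 * Real.pi ^ 2 * I) := by
    intro s hs
    have hs0 : 0 < s := hr.trans_le hs.1
    have h1 : ∫ θ in (-Real.pi)..Real.pi, s * (g (x₀ + s • circ θ) - c) ^ 2 ≤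
        ∫ θ in (-Real.pi)..Real.pi, (2 * r) * (2 * n θ + 8 * Real.pi * I) := by
      refine intervalIntegral.integral_mono_on hpp (Continuous.intervalIntegrable (by fun_prop) _ _)
        (Continuous.intervalIntegrable (by fun_prop) _ _) fun θ hθ => ?_
      have h2 := hang θ hθ
      have h3 := hrad θ s hs
      have h4 : (g (x₀ + s • circ θ) - c) ^ 2 ≤ 2 * n θ + 8 * Real.pi * I := by
        nlinarith [sq_nonneg ((g (x₀ + s • circ θ) - g (x₀ + s' • circ θ)) -
          (g (x₀ + s' • circ θ) - c))]
      exact mul_le_mul hs.2 h4 (sq_nonneg _) (by linarith)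
    refine h1.trans (le_of_eq ?_)
    rw [intervalIntegral.integral_const_mul, intervalIntegral.integral_add,
      intervalIntegral.integral_const_mul, hnI, intervalIntegral.integral_const, smul_eq_mul]
    · ring
    · exact Continuous.intervalIntegrable (by fun_prop) _ _
    · simp
  have := intervalIntegral.integral_mono_on (g := fun _ => 2 * r * (2 * I + 16 * Real.pi ^ 2 * I))
    (μ := volume) hr2 ((continuous_circle_integral (f := fun x => (g x - c) ^ 2) (by fun_prop)
      x₀).intervalIntegrable _ _) (continuous_const.intervalIntegrable _ _) hin
  refine this.trans (le_of_eq ?_)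
  rw [intervalIntegral.integral_const, smul_eq_mul]
  ring

/-- The fundamental solution field is divergence free. -/
lemma integral_inner_radial {η : Plane → ℝ} (hη : ContDiff ℝ 1 η) (hc : HasCompactSupport η)
    {y : Plane} (hy : y ∉ tsupport η) :
    ∫ x, ⟪(‖x - y‖ ^ 2)⁻¹ • (x - y), ∇ η x⟫ = 0 := by
  have hgc := continuous_gradient hη
  have hcont : Continuous fun x => ⟪(‖x - y‖ ^ 2)⁻¹ • (x - y), ∇ η x⟫ := by
    refine continuous_inner_of_tsupport (U := {y}ᶜ) isOpen_compl_singleton ?_ hgc ?_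
    · have h1 : Continuous fun x : Plane => ‖x - y‖ ^ 2 := by fun_prop
      have h2 : Continuous fun x : Plane => x - y := by fun_prop
      refine (h1.continuousOn.inv₀ fun x hx => ?_).smul h2.continuousOn
      exact pow_ne_zero 2 (norm_ne_zero_iff.2 (sub_ne_zero.2 hx))
    · exact fun x hx hxy => hy (by rw [mem_singleton_iff.1 hxy] at hx
                                   exact tsupport_gradient_subset hx)
  obtain ⟨ρ, hρ, hball⟩ := Metric.isOpen_iff.1 (isClosed_tsupport η).isOpen_compl y hy
  obtain ⟨R, hR, hsub⟩ := hc.isBounded.subset_ball_lt ρ y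
  have hz : ∀ x ∉ annulus y (ρ / 2) R, ⟪(‖x - y‖ ^ 2)⁻¹ • (x - y), ∇ η x⟫ = 0 := by
    intro x hx
    rw [gradient_eq_zero_of_notMem_tsupport, inner_zero_right]
    intro hxs
    refine hx ⟨?_, hsub hxs⟩
    by_contra hcon
    exact hball (mem_ball.2 (by linarith)) hxs
  rw [← setIntegral_eq_integral_of_forall_compl_eq_zero hz,
    integral_annulus hcont y (by positivity) (by linarith),
    interval_swap (F := fun r θ => r * ⟪(‖y + r • circ θ - y‖ ^ 2)⁻¹ • (y + r • circ θ - y),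
      ∇ η (y + r • circ θ)⟫) ?_ (by linarith [Real.pi_pos])]
  · refine intervalIntegral.integral_zero_ae (Eventually.of_forall fun θ _ => ?_)
    have hcl : Continuous fun τ : ℝ => ⟪∇ η (y + τ • circ θ), circ θ⟫ :=
      Continuous.inner (by fun_prop) continuous_const
    have e := intervalIntegral.integral_eq_sub_of_hasDerivAt (a := ρ / 2) (b := R)
      (fun t _ => hasDerivAt_line y (circ θ) t (hη.differentiable one_ne_zero _))
      (hcl.intervalIntegrable _ _)
    have hR0 : 0 < R := hρ.trans hR
    have e1 : η (y + R • circ θ) = 0 := image_eq_zero_of_notMem_tsupport fun h => by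
      have := hsub h
      rw [mem_ball, dist_eq_norm, add_sub_cancel_left, norm_smul, norm_circ, mul_one,
        Real.norm_of_nonneg hR0.le] at this
      exact lt_irrefl _ this
    have e2 : η (y + (ρ / 2) • circ θ) = 0 := image_eq_zero_of_notMem_tsupport fun h =>
      hball (by
        rw [mem_ball, dist_eq_norm, add_sub_cancel_left, norm_smul, norm_circ, mul_one,
          Real.norm_of_nonneg (by positivity)]; linarith) h
    rw [e1, e2, sub_zero] at e
    rw [← e]
    refine intervalIntegral.integral_congr fun r hr => ?_
    rw [uIcc_of_le (by linarith)] at hr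
    have hr0 : 0 < r := by linarith [hr.1]
    simp only [add_sub_cancel_left, norm_smul, norm_circ, mul_one, Real.norm_of_nonneg hr0.le,
      inner_smul_left, RCLike.conj_to_real]
    rw [real_inner_comm]
    field_simp
  · exact continuous_fst.mul (hcont.comp (f := fun q : ℝ × ℝ => y + q.1 • circ q.2) (by fun_prop))

end Polar

/-! ### Mollification -/

/-- The standard nonnegative averaging kernel supported in the ball of radius `r`. -/
noncomputable def bump {r : ℝ} (hr : 0 < r) : ContDiffBump (0 : Plane) :=
  ⟨r / 2, r, by positivity, by linarith⟩

open scoped Convolution in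
/-- The average of `f` at scale `r`. -/
noncomputable def moll {r : ℝ} (hr : 0 < r) (f : Plane → ℝ) : Plane → ℝ :=
  (bump hr).normed volume ⋆[ContinuousLinearMap.lsmul ℝ ℝ, volume] f

section Moll

variable {r : ℝ} (hr : 0 < r) {f g : Plane → ℝ}

lemma moll_eq (f : Plane → ℝ) (x : Plane) :
    moll hr f x = ∫ z, (bump hr).normed volume z * f (x - z) := rfl

lemma bump_eq_zero {z : Plane} (hz : z ∉ ball (0 : Plane) r) :
    (bump hr).normed volume z = 0 := by
  have h := (bump hr).support_normed_eq (μ := (volume : Measure Plane))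
  by_contra hne
  exact hz (h ▸ Function.mem_support.2 hne)

lemma bump_nonneg (z : Plane) : 0 ≤ (bump hr).normed volume z := (bump hr).nonneg_normed z

lemma bump_le (z : Plane) : (bump hr).normed volume z ≤ 4 / (Real.pi * r ^ 2) := by
  have h := (bump hr).normed_le_div_measure_closedBall_rIn volume z
  have e : volume.real (closedBall (0 : Plane) (bump hr).rIn) = Real.pi * (r / 2) ^ 2 := by
    have h1 : (0 : ℝ) ≤ r / 2 := by positivity
    rw [← volume_real_ball 0 h1, measureReal_def, measureReal_def,
      show (bump hr).rIn = r / 2 from rfl, Measure.addHaar_closedBall_eq_addHaar_ball]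
  rw [e] at h
  refine h.trans (le_of_eq ?_)
  have := Real.pi_pos
  field_simp
  norm_num

lemma integrable_bump_mul (hf : Continuous f) (x : Plane) :
    Integrable fun z => (bump hr).normed volume z * f (x - z) := by
  refine Continuous.integrable_of_hasCompactSupport
    ((bump hr).continuous_normed.mul (by fun_prop)) ?_
  exact (bump hr).hasCompactSupport_normed.mul_right

lemma contDiff_moll (hf : Continuous f) : ContDiff ℝ 1 (moll hr f) :=
  (bump hr).hasCompactSupport_normed.contDiff_convolution_left (n := 1) _
    (bump hr).contDiff_normed hf.locallyIntegrable

lemma moll_sub (hf : Continuous f) (hg : Continuous g) (x : Plane) :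
    moll hr (fun y => f y - g y) x = moll hr f x - moll hr g x := by
  rw [moll_eq, moll_eq, moll_eq,
    ← integral_sub (integrable_bump_mul hr hf x) (integrable_bump_mul hr hg x)]
  simp only [mul_sub]

lemma moll_comp_add (f : Plane → ℝ) (h x : Plane) :
    moll hr (fun y => f (y + h)) x = moll hr f (x + h) := by
  rw [moll_eq, moll_eq]
  congr 1; funext z
  rw [show x - z + h = x + h - z by abel]

lemma moll_const (c : ℝ) (x : Plane) : moll hr (fun _ => c) x = c := by
  rw [moll_eq, integral_mul_const, (bump hr).integral_normed, one_mul]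

lemma moll_mono (hf : Continuous f) (hg : Continuous g) {x : Plane}
    (h : ∀ y ∈ ball x r, f y ≤ g y) : moll hr f x ≤ moll hr g x := by
  rw [moll_eq, moll_eq]
  refine integral_mono (integrable_bump_mul hr hf x) (integrable_bump_mul hr hg x) fun z => ?_
  by_cases hz : z ∈ ball (0 : Plane) r
  · refine mul_le_mul_of_nonneg_left (h _ ?_) (bump_nonneg hr z)
    rw [mem_ball, dist_eq_norm]
    simpa using hz
  · simp [bump_eq_zero hr hz]

lemma moll_nonneg (h : ∀ y, 0 ≤ f y) (x : Plane) : 0 ≤ moll hr f x :=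
  integral_nonneg fun z => mul_nonneg (bump_nonneg hr z) (h _)

lemma abs_moll_sub_le (hf : Continuous f) {x : Plane} {c κ : ℝ}
    (h : ∀ y ∈ ball x r, |f y - c| ≤ κ) : |moll hr f x - c| ≤ κ := by
  rw [abs_le]
  constructor
  · have := moll_mono hr (f := fun _ => c - κ) continuous_const hf (x := x)
      fun y hy => by linarith [(abs_le.1 (h y hy)).1]
    rw [moll_const] at this; linarith
  · have := moll_mono hr (g := fun _ => c + κ) hf continuous_const (x := x)
      fun y hy => by linarith [(abs_le.1 (h y hy)).2]
    rw [moll_const] at this; linarith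

lemma sq_moll_le (hf : Continuous f) (x : Plane) :
    (moll hr f x) ^ 2 ≤ moll hr (fun y => f y ^ 2) x := by
  set m := moll hr f x with hm
  have h := moll_nonneg hr (f := fun y => (f y ^ 2 - 2 * m * f y) - (-m ^ 2))
    (fun y => by nlinarith [sq_nonneg (f y - m)]) x
  rw [moll_sub hr (f := fun y => f y ^ 2 - 2 * m * f y) (g := fun _ => -m ^ 2) (by fun_prop)
    continuous_const, moll_const,
    moll_sub hr (f := fun y => f y ^ 2) (g := fun y => 2 * m * f y) (by fun_prop) (by fun_prop)] at h
  have e : moll hr (fun y => 2 * m * f y) x = 2 * m * m := by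
    rw [moll_eq, show (2 * m * m : ℝ) = 2 * m * moll hr f x from rfl, moll_eq,
      ← integral_const_mul (2 * m)]
    congr 1; funext z; ring
  rw [e] at h
  nlinarith

lemma moll_le_setIntegral (hf : Continuous f) (h0 : ∀ y, 0 ≤ f y) (x : Plane) :
    moll hr f x ≤ 4 / (Real.pi * r ^ 2) * ∫ y in ball x r, f y := by
  have e1 : ∫ z, (bump hr).normed volume z * f (x - z) =
      ∫ z in ball (0 : Plane) r, (bump hr).normed volume z * f (x - z) :=
    integral_eq_setIntegral_ball fun z hz => by simp [bump_eq_zero hr hz]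
  have e2 : ∫ y in ball x r, f y = ∫ z in ball (0 : Plane) r, f (x - z) := by
    have := (Measure.measurePreserving_sub_left volume x).setIntegral_preimage_emb
      (MeasurableEquiv.subLeft x).measurableEmbedding f (ball x r)
    rw [← this]
    congr 2
    ext z
    simp [mem_ball, dist_eq_norm]
  rw [moll_eq, e1, e2, ← integral_const_mul]
  refine setIntegral_mono_on (integrable_bump_mul hr hf x).integrableOn
    (Continuous.integrableOn_ball (by fun_prop) _ _) measurableSet_ball fun z _ => ?_
  exact mul_le_mul_of_nonneg_right (bump_le hr z) (h0 _)

lemma setIntegral_moll_le (hf : Continuous f) (h0 : ∀ y, 0 ≤ f y) (x₀ : Plane) (R : ℝ) :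
    ∫ x in ball x₀ R, moll hr f x ≤ ∫ x in ball x₀ (R + r), f x := by
  have e1 : ∀ x, moll hr f x =
      ∫ z in ball (0 : Plane) r, (bump hr).normed volume z * f (x - z) := fun x =>
    integral_eq_setIntegral_ball fun z hz => by simp [bump_eq_zero hr hz]
  have hcb := (bump hr).continuous_normed (μ := (volume : Measure Plane))
  have hF : Continuous (Function.uncurry fun (x z : Plane) =>
      (bump hr).normed volume z * f (x - z)) :=
    (hcb.comp continuous_snd).mul (hf.comp (by fun_prop))
  simp only [e1]
  have hint := integrableOn_prod_of_continuous (μ := (volume : Measure Plane))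
    (ν := (volume : Measure Plane)) hF
    (isCompact_closedBall x₀ R) (isCompact_closedBall 0 r) ball_subset_closedBall
    ball_subset_closedBall
  rw [integral_integral_swap hint]
  have h1 : ∀ z ∈ ball (0 : Plane) r,
      ∫ x in ball x₀ R, (bump hr).normed volume z * f (x - z) ≤
      (bump hr).normed volume z * ∫ x in ball x₀ (R + r), f x := by
    intro z hz
    rw [integral_const_mul]
    refine mul_le_mul_of_nonneg_left ?_ (bump_nonneg hr z)
    simp only [sub_eq_add_neg]
    refine setIntegral_ball_comp_add_le hf h0 x₀ (-z) ?_
    rw [norm_neg]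
    have := mem_ball_zero_iff.1 hz
    linarith
  refine (setIntegral_mono_on hint.integral_prod_right
    (Continuous.integrableOn_ball (by fun_prop) _ _) measurableSet_ball h1).trans (le_of_eq ?_)
  rw [integral_mul_const,
    ← integral_eq_setIntegral_ball (fun z hz => bump_eq_zero hr hz),
    (bump hr).integral_normed, one_mul]

lemma setIntegral_sq_moll_le (hf : Continuous f) (x₀ : Plane) (R : ℝ) :
    ∫ x in ball x₀ R, (moll hr f x) ^ 2 ≤ ∫ x in ball x₀ (R + r), f x ^ 2 := by
  refine le_trans ?_ (setIntegral_moll_le hr (f := fun x => f x ^ 2) (by fun_prop)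
    (fun y => sq_nonneg _) x₀ R)
  have h1 := (contDiff_moll hr hf).continuous
  have h2 := (contDiff_moll hr (f := fun x => f x ^ 2) (by fun_prop)).continuous
  exact setIntegral_mono ((h1.pow 2).integrableOn_ball _ _) (h2.integrableOn_ball _ _)
    fun x => sq_moll_le hr hf x

lemma sq_moll_le_setIntegral (hf : Continuous f) (x : Plane) :
    (moll hr f x) ^ 2 ≤ 4 / (Real.pi * r ^ 2) * ∫ y in ball x r, f y ^ 2 :=
  (sq_moll_le hr hf x).trans
    (moll_le_setIntegral hr (f := fun x => f x ^ 2) (by fun_prop) (fun y => sq_nonneg _) x)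

lemma inner_gradient_moll (hf : ContDiff ℝ 1 f) (hc : HasCompactSupport f) (x e : Plane) :
    ⟪∇ (moll hr f) x, e⟫ = moll hr (fun y => ⟪∇ f y, e⟫) x := by
  have h := hc.hasFDerivAt_convolution_right (ContinuousLinearMap.lsmul ℝ ℝ)
    (((bump hr).continuous_normed (μ := (volume : Measure Plane))).locallyIntegrable
      (μ := volume)) hf x
  have h2 : ⟪∇ (moll hr f) x, e⟫ = fderiv ℝ (moll hr f) x e := by
    rw [gradient_def, InnerProductSpace.toDual_symm_apply]
  rw [h2]
  unfold moll
  rw [h.fderiv, convolution_def, ContinuousLinearMap.integral_apply]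
  · congr 1; funext z
    simp [gradient_def, ContinuousLinearMap.precompR]
  · refine Continuous.integrable_of_hasCompactSupport ?_ ?_
    · have h1 := (bump hr).continuous_normed (μ := (volume : Measure Plane))
      have h3 := hf.continuous_fderiv one_ne_zero
      exact ((ContinuousLinearMap.lsmul ℝ ℝ).precompR Plane).continuous₂.comp₂ h1
        (h3.comp (continuous_const.sub continuous_id))
    · refine (bump hr).hasCompactSupport_normed (μ := (volume : Measure Plane)) |>.mono ?_
      intro z hz
      rw [Function.mem_support] at hz ⊢
      contrapose! hz
      rw [hz]; simp

end Moll

/-- A bound on difference quotients controls the gradient. -/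
lemma integral_gradient_sq_le_of_difference {g : Plane → ℝ} (hg : ContDiff ℝ 1 g) {x₀ : Plane}
    {R δ K : ℝ} (hδ : 0 < δ)
    (h : ∀ h : Plane, ‖h‖ ≤ δ → ∫ x in ball x₀ R, (g (x + h) - g x) ^ 2 ≤ K * ‖h‖ ^ 2) :
    ∫ x in ball x₀ R, ‖∇ g x‖ ^ 2 ≤ 2 * K := by
  have hgc := continuous_gradient hg
  have hg0 := hg.continuous
  obtain ⟨M, hM⟩ := (isCompact_closedBall x₀ (R + δ)).exists_bound_of_continuousOn hgc.continuousOn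
  have hdir : ∀ e : Plane, ‖e‖ = 1 → ∫ x in ball x₀ R, ⟪∇ g x, e⟫ ^ 2 ≤ K := by
    intro e he
    set t : ℕ → ℝ := fun n => δ / (n + 1) with ht
    have htpos : ∀ n, 0 < t n := fun n => by positivity
    have htle : ∀ n, t n ≤ δ := fun n => div_le_self hδ.le (by linarith [n.cast_nonneg (α := ℝ)])
    have htt : Tendsto t atTop (𝓝 0) := by
      have := (tendsto_one_div_add_atTop_nhds_zero_nat (𝕜 := ℝ)).const_mul δ
      simpa [ht, div_eq_mul_inv] using this
    have hlim : Tendsto (fun n => ∫ x in ball x₀ R, ((t n)⁻¹ * (g (x + t n • e) - g x)) ^ 2) atTop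
        (𝓝 (∫ x in ball x₀ R, ⟪∇ g x, e⟫ ^ 2)) := by
      refine tendsto_integral_of_dominated_convergence (fun _ => M ^ 2) (fun n => ?_) ?_ (fun n => ?_) ?_
      · exact Continuous.aestronglyMeasurable (by fun_prop)
      · exact continuous_const.integrableOn_ball _ _
      · refine (ae_restrict_iff' measurableSet_ball).2 (Eventually.of_forall fun x hx => ?_)
        have hsub : |g (x + t n • e) - g x| ≤ M * t n := by
          have := (convex_closedBall x₀ (R + δ)).norm_image_sub_le_of_norm_fderiv_le
            (f := g) (𝕜 := ℝ) (C := M) (fun y _ => hg.differentiable one_ne_zero y)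
            (fun y hy => by rw [← norm_gradient]; exact hM y hy) (x := x) (y := x + t n • e)
            (mem_closedBall.2 (by linarith [mem_ball.1 hx])) (mem_closedBall.2 ?_)
          · rwa [add_sub_cancel_left, norm_smul, he, mul_one, Real.norm_of_nonneg (htpos n).le,
              Real.norm_eq_abs] at this
          · have h1 := dist_triangle (x + t n • e) x x₀
            rw [dist_eq_norm _ x, add_sub_cancel_left, norm_smul, he, mul_one,
              Real.norm_of_nonneg (htpos n).le] at h1
            linarith [mem_ball.1 hx, htle n]
        rw [Real.norm_of_nonneg (sq_nonneg _), ← sq_abs, abs_mul, abs_of_pos (inv_pos.2 (htpos n))]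
        refine pow_le_pow_left₀ (by have := htpos n; positivity) ?_ 2
        rw [inv_mul_le_iff₀ (htpos n)]
        linarith
      · refine Eventually.of_forall fun x => ?_
        have hd := hasDerivAt_line x e 0 (hg.differentiable one_ne_zero _)
        have h1 := (hasDerivAt_iff_tendsto_slope.1 hd).comp
          (f := t) (tendsto_nhdsWithin_iff.2 ⟨htt, Eventually.of_forall fun n => (htpos n).ne'⟩)
        simp only [zero_smul, add_zero] at h1
        refine (h1.congr fun n => ?_).pow 2
        simp [slope]
    refine le_of_tendsto hlim (Eventually.of_forall fun n => ?_)
    simp only [mul_pow]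
    rw [integral_const_mul]
    have h2 := h (t n • e) (by rw [norm_smul, he, mul_one, Real.norm_of_nonneg (htpos n).le]; exact htle n)
    rw [norm_smul, he, mul_one, Real.norm_of_nonneg (htpos n).le] at h2
    rw [inv_pow, inv_mul_le_iff₀ (pow_pos (htpos n) 2)]
    linarith
  have e : ∀ x, ‖∇ g x‖ ^ 2 = ⟪∇ g x, EuclideanSpace.single 0 1⟫ ^ 2 +
      ⟪∇ g x, EuclideanSpace.single 1 1⟫ ^ 2 := by
    intro x
    rw [EuclideanSpace.real_norm_sq_eq, Fin.sum_univ_two, EuclideanSpace.inner_single_right,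
      EuclideanSpace.inner_single_right]
    simp
  simp only [e]
  rw [integral_add]
  · linarith [hdir (EuclideanSpace.single 0 1) (by simp), hdir (EuclideanSpace.single 1 1) (by simp)]
  · exact Continuous.integrableOn_ball ((Continuous.inner hgc continuous_const).pow 2) _ _
  · exact Continuous.integrableOn_ball ((Continuous.inner hgc continuous_const).pow 2) _ _

/-- A pair of continuous functions with `L²` controlled difference quotients has small
oscillation on some circle. -/
lemma exists_circle_osc_lt {W : Fin 2 → Plane → ℝ} (hW : ∀ i, Continuous (W i)) {x₀ : Plane}
    {d K κ ρ : ℝ} (hκ : 0 < κ) (hρ : 0 < ρ) (hρd : ρ ≤ d / 4)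
    (h : ∀ i, ∀ h : Plane, ‖h‖ ≤ d / 8 →
      ∫ x in ball x₀ (d / 2), (W i (x + h) - W i x) ^ 2 ≤ K * ‖h‖ ^ 2)
    (hlog : 32 * Real.pi * K < κ ^ 2 * Real.log (d / 4 / ρ)) :
    ∃ r ∈ Icc ρ (d / 4), ∀ i, ∀ x ∈ sphere x₀ r, ∀ y ∈ sphere x₀ r, W i x - W i y < κ := by
  by_contra! hcon
  have hd : 0 < d := by linarith
  have huc : ∀ i, ∃ δ > 0, ∀ x ∈ closedBall x₀ d, ∀ y ∈ closedBall x₀ d, dist x y < δ →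
      dist (W i x) (W i y) < κ / 4 := fun i =>
    Metric.uniformContinuousOn_iff.1 ((isCompact_closedBall x₀ d).uniformContinuousOn_of_continuous
      (hW i).continuousOn) (κ / 4) (by positivity)
  choose δ hδ0 hδ using huc
  obtain ⟨r, hr0, hr⟩ : ∃ r > 0, r ≤ d / 8 ∧ r < δ 0 ∧ r < δ 1 := by
    refine ⟨min (d / 8) (min (δ 0 / 2) (δ 1 / 2)), ?_, min_le_left _ _, ?_, ?_⟩
    · have := hδ0 0; have := hδ0 1; positivity
    · exact ((min_le_right _ _).trans (min_le_left _ _)).trans_lt (by linarith [hδ0 0])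
    · exact ((min_le_right _ _).trans (min_le_right _ _)).trans_lt (by linarith [hδ0 1])
  have hrδ : ∀ i, r < δ i := by
    intro i; fin_cases i
    · exact hr.2.1
    · exact hr.2.2
  have hclose : ∀ i, ∀ x ∈ closedBall x₀ (d / 4), |moll hr0 (W i) x - W i x| ≤ κ / 4 := by
    intro i x hx
    refine abs_moll_sub_le hr0 (hW i) fun y hy => ?_
    have hx' := mem_closedBall.1 hx
    have := hδ i y (mem_closedBall.2 ((dist_triangle y x x₀).trans
      (by linarith [mem_ball.1 hy, hr.1]))) x (mem_closedBall.2 (by linarith))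
      ((mem_ball.1 hy).trans (hrδ i))
    rw [Real.dist_eq] at this
    exact this.le
  have hmain := sq_mul_log_le_of_circle_osc (g := fun i => moll hr0 (W i))
    (fun i => contDiff_moll hr0 (hW i)) x₀ (κ := κ / 2) (by positivity) hρ hρd (by
      intro s hs
      obtain ⟨i, x, hx, y, hy, hxy⟩ := hcon s hs
      refine ⟨i, x, hx, y, hy, ?_⟩
      have h1 := abs_le.1 (hclose i x (closedBall_subset_closedBall hs.2 (sphere_subset_closedBall hx)))
      have h2 := abs_le.1 (hclose i y (closedBall_subset_closedBall hs.2 (sphere_subset_closedBall hy)))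
      linarith)
  have hb : ∀ i, ∫ x in ball x₀ (d / 4), ‖∇ (moll hr0 (W i)) x‖ ^ 2 ≤ 2 * K := by
    intro i
    refine integral_gradient_sq_le_of_difference (contDiff_moll hr0 (hW i)) (δ := d / 8)
      (by positivity) fun z hz => ?_
    have hWz : Continuous fun y => W i (y + z) := (hW i).comp (by fun_prop)
    have h1 := setIntegral_sq_moll_le hr0 (f := fun y => W i (y + z) - W i y)
      (hWz.sub (hW i)) x₀ (d / 4)
    have e : ∀ x, moll hr0 (fun y => W i (y + z) - W i y) x =
        moll hr0 (W i) (x + z) - moll hr0 (W i) x := by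
      intro x
      rw [moll_sub hr0 hWz (hW i), moll_comp_add]
    simp only [e] at h1
    refine h1.trans (le_trans ?_ (h i z hz))
    exact setIntegral_mono_set_of_nonneg ((hWz.sub (hW i)).pow 2) (fun x => sq_nonneg _)
      (ball_subset_ball (by linarith [hr.1])) isBounded_ball
  have hs : ∑ i, ∫ x in ball x₀ (d / 4), ‖∇ (moll hr0 (W i)) x‖ ^ 2 ≤ 4 * K := by
    rw [Fin.sum_univ_two]; linarith [hb 0, hb 1]
  have := mul_le_mul_of_nonneg_left hs (show 0 ≤ 2 * Real.pi by positivity)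
  nlinarith [this]

/-! ### Difference quotients of solutions -/

section Difference

variable {p : ℝ} {a : ℝ → ℝ} {u : Plane → ℝ} {x₀ : Plane} {d L : ℝ}

lemma contDiff_translate (hu : ContDiff ℝ 1 u) (h : Plane) : ContDiff ℝ 1 fun x => u (x + h) :=
  hu.comp (contDiff_id.add contDiff_const)

lemma contDiff_difference (hu : ContDiff ℝ 1 u) (h : Plane) :
    ContDiff ℝ 1 fun x => u (x + h) - u x :=
  (contDiff_translate hu h).sub hu

lemma gradient_difference (hu : ContDiff ℝ 1 u) (h x : Plane) :
    ∇ (fun x => u (x + h) - u x) x = ∇ u (x + h) - ∇ u x := by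
  rw [gradient_sub ((contDiff_translate hu h).differentiable one_ne_zero x)
    (hu.differentiable one_ne_zero x), gradient_comp_add]

lemma abs_difference_le (hu : ContDiff ℝ 1 u) (hL : ∀ x ∈ ball x₀ d, ‖∇ u x‖ ≤ L)
    {x h : Plane} (hx : x ∈ ball x₀ d) (hxh : x + h ∈ ball x₀ d) :
    |u (x + h) - u x| ≤ L * ‖h‖ := by
  have := (convex_ball x₀ d).norm_image_sub_le_of_norm_fderiv_le
    (f := u) (𝕜 := ℝ) (C := L) (fun y _ => hu.differentiable one_ne_zero y)
    (fun y hy => by rw [← norm_gradient]; exact hL y hy) hx hxh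
  rwa [add_sub_cancel_left, Real.norm_eq_abs] at this

lemma add_mem_ball_of_norm_le {x h : Plane} {R : ℝ} (hx : x ∈ closedBall x₀ R) (hR : R + ‖h‖ < d) :
    x + h ∈ ball x₀ d := by
  rw [mem_ball]
  have h1 := dist_triangle (x + h) x x₀
  rw [dist_eq_norm _ x, add_sub_cancel_left] at h1
  linarith [mem_closedBall.1 hx]

lemma WeakSol.integral_difference (ha : IsKernel p a) (hp : 1 < p) (hu : ContDiff ℝ 1 u)
    (hsol : WeakSol a (ball x₀ d) u) {R : ℝ} {h : Plane} (hh : R + ‖h‖ < d) {η : Plane → ℝ}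
    (hη : ContDiff ℝ 1 η) (hs : tsupport η ⊆ closedBall x₀ R) :
    ∫ x, ⟪flux a (∇ u (x + h)) - flux a (∇ u x), ∇ η x⟫ = 0 := by
  have hc : HasCompactSupport η := (isCompact_closedBall x₀ R).of_isClosed_subset
    (isClosed_tsupport η) hs
  have hfl : Continuous fun x => flux a (∇ u x) := (ha.continuous_flux hp).comp (continuous_gradient hu)
  have hfl' : Continuous fun x => flux a (∇ u (x + h)) := hfl.comp (continuous_id.add continuous_const)
  have h1 := hsol.2 η hη hc fun x hx => mem_ball.2 (by
    linarith [mem_closedBall.1 (hs hx), norm_nonneg h])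
  have hsub : tsupport η ⊆ (fun x => x + h) ⁻¹' ball x₀ d := fun x hx =>
    mem_preimage.2 (add_mem_ball_of_norm_le (hs hx) hh)
  have h2 := (hsol.comp_add h).2 η hη hc hsub
  simp only [gradient_comp_add] at h2
  have i1 : Integrable fun x => ⟪flux a (∇ u (x + h)), ∇ η x⟫ :=
    integrable_inner_gradient isOpen_univ hfl'.continuousOn hη hc (subset_univ _)
  have i2 : Integrable fun x => ⟪flux a (∇ u x), ∇ η x⟫ :=
    integrable_inner_gradient isOpen_univ hfl.continuousOn hη hc (subset_univ _)
  have e := integral_sub i1 i2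
  rw [h1, h2, sub_zero] at e
  rw [← e]
  simp only [inner_sub_left]

lemma IsKernel.sq_norm_flux_sub_le (ha : IsKernel p a) (hp2 : 2 ≤ p) {ξ ζ : Plane} 
    (hξ : ‖ξ‖ ≤ L) (hζ : ‖ζ‖ ≤ L) :
    ‖flux a ξ - flux a ζ‖ ^ 2 ≤ cUp p ^ 2 / cLow p * a L * ⟪flux a ξ - flux a ζ, ξ - ζ⟫ := by
  have hp : 1 < p := by linarith
  rcases eq_or_ne ξ ζ with rfl | hne
  · simp
  have ht : 0 < max ‖ξ‖ ‖ζ‖ := by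
    by_contra hcon
    have h1 := (le_max_left ‖ξ‖ ‖ζ‖).trans (not_lt.1 hcon)
    have h2 := (le_max_right ‖ξ‖ ‖ζ‖).trans (not_lt.1 hcon)
    rw [norm_le_zero_iff] at h1 h2
    exact hne (h1.trans h2.symm)
  set t := max ‖ξ‖ ‖ζ‖
  have hat := (ha.incr hp2 t L ht (max_le hξ hζ)).1
  have hap := ha.pos t ht
  have h1 := ha.norm_flux_sub_le hp ξ ζ
  have h2 := ha.le_inner_flux_sub hp ξ ζ
  have hc := cLow_pos hp
  have hu := cUp_pos p
  have hin := ha.inner_flux_sub_nonneg hp ξ ζ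
  calc ‖flux a ξ - flux a ζ‖ ^ 2 ≤ (cUp p * a t * ‖ξ - ζ‖) ^ 2 :=
        pow_le_pow_left₀ (norm_nonneg _) h1 2
    _ = cUp p ^ 2 / cLow p * a t * (cLow p * a t * ‖ξ - ζ‖ ^ 2) := by field_simp
    _ ≤ cUp p ^ 2 / cLow p * a t * ⟪flux a ξ - flux a ζ, ξ - ζ⟫ :=
        mul_le_mul_of_nonneg_left h2 (by positivity)
    _ ≤ _ := by gcongr

lemma gradient_sq {ζ : Plane → ℝ} (hζ : ContDiff ℝ 1 ζ) (x : Plane) :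
    ∇ (fun y => ζ y * ζ y) x = (2 * ζ x) • ∇ ζ x := by
  rw [gradient_mul (hζ.differentiable one_ne_zero x) (hζ.differentiable one_ne_zero x), ← add_smul,
    two_mul]

lemma gradient_sq_mul {ζ w : Plane → ℝ} (hζ : ContDiff ℝ 1 ζ) (hw : ContDiff ℝ 1 w) (x : Plane) :
    ∇ (fun y => ζ y * ζ y * w y) x = (ζ x * ζ x) • ∇ w x + w x • (2 * ζ x) • ∇ ζ x := by
  rw [gradient_mul (hζ.mul hζ |>.differentiable one_ne_zero x) (hw.differentiable one_ne_zero x),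
    gradient_sq hζ]

lemma tsupport_sq_mul_subset {ζ w : Plane → ℝ} : tsupport (fun y => ζ y * ζ y * w y) ⊆ tsupport ζ :=
  (tsupport_mul_subset_left (f := fun y => ζ y * ζ y) (g := w)).trans
    (tsupport_mul_subset_left (f := ζ) (g := ζ))

/-- For `2 ≤ p` the difference quotients of the flux are controlled. -/
lemma exists_difference_bound_flux (p : ℝ) (hp2 : 2 ≤ p) : ∃ C : ℝ, 0 < C ∧ ∀ (a : ℝ → ℝ)
    (u : Plane → ℝ) (x₀ : Plane) (d L : ℝ), IsKernel p a → 0 < d → 0 < L → ContDiff ℝ 1 u →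
    WeakSol a (ball x₀ d) u → (∀ x ∈ ball x₀ d, ‖∇ u x‖ ≤ L) → ∀ h : Plane, ‖h‖ ≤ d / 8 →
    ∫ x in ball x₀ (d / 2), ‖flux a (∇ u (x + h)) - flux a (∇ u x)‖ ^ 2 ≤
      C * (a L * L) ^ 2 * ‖h‖ ^ 2 := by
  have hp : 1 < p := by linarith
  obtain ⟨Cζ, hCζ, hcut⟩ := exists_cutoff
  set K := cUp p ^ 2 / cLow p with hK
  have hK0 : 0 < K := by have := cUp_pos p; have := cLow_pos hp; positivity
  refine ⟨16 * Real.pi * K ^ 2 * Cζ ^ 2, by positivity, ?_⟩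
  intro a u x₀ d L ha hd hL0 hu hsol hL h hh
  obtain ⟨ζ, hζ2, hζ0, hζ1, hζe, hζs, hζg, -⟩ := hcut x₀ (d / 2) (by positivity)
  have hζ : ContDiff ℝ 1 ζ := hζ2.of_le (by norm_num)
  set w := fun x => u (x + h) - u x with hw
  have hwc : ContDiff ℝ 1 w := contDiff_difference hu h
  set V := fun x => flux a (∇ u (x + h)) - flux a (∇ u x) with hV
  have hfl : Continuous fun x => flux a (∇ u x) := (ha.continuous_flux hp).comp (continuous_gradient hu)
  have hVc : Continuous V := (hfl.comp (continuous_id.add continuous_const)).sub hfl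
  set η := fun y => ζ y * ζ y * w y with hη
  have hηc : ContDiff ℝ 1 η := (hζ.mul hζ).mul hwc
  have hηs : tsupport η ⊆ closedBall x₀ (3 / 2 * (d / 2)) := tsupport_sq_mul_subset.trans hζs
  have hz := hsol.integral_difference ha hp hu (h := h) (by linarith) hηc hηs
  have haL := ha.pos L hL0
  have hζz : ∀ x ∉ closedBall x₀ (3 / 2 * (d / 2)), ζ x = 0 := fun x hx =>
    image_eq_zero_of_notMem_tsupport fun hx' => hx (hζs hx')
  have hzb : ∫ x in ball x₀ d, ⟪V x, ∇ η x⟫ = 0 := by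
    rw [← integral_eq_setIntegral_ball (f := fun x => ⟪V x, ∇ η x⟫)]
    · exact hz
    · intro x hx
      rw [gradient_eq_zero_of_notMem_tsupport fun hx' => hx (closedBall_subset_ball (by linarith) (hηs hx')), inner_zero_right]
  have hgζ := continuous_gradient hζ
  have hgη := continuous_gradient hηc
  have hζc := hζ.continuous
  have hin : Continuous fun x => ⟪V x, ∇ η x⟫ := hVc.inner hgη
  have hpt : ∀ x ∈ ball x₀ d, ζ x ^ 2 * ‖V x‖ ^ 2 ≤ 2 * K * a L * ⟪V x, ∇ η x⟫ +
      4 * K ^ 2 * (a L) ^ 2 * (L * ‖h‖) ^ 2 * (Cζ / (d / 2)) ^ 2 := by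
    intro x hx
    by_cases hxs : x ∈ closedBall x₀ (3 / 2 * (d / 2))
    · have hxh : x + h ∈ ball x₀ d := add_mem_ball_of_norm_le hxs (by linarith)
      have h1 := ha.sq_norm_flux_sub_le hp2 (hL _ hxh) (hL _ hx)
      have h2 := abs_difference_le hu hL hx hxh
      have e : ⟪V x, ∇ η x⟫ = ζ x ^ 2 * ⟪V x, ∇ u (x + h) - ∇ u x⟫ +
          2 * ζ x * w x * ⟪V x, ∇ ζ x⟫ := by
        rw [hη, gradient_sq_mul hζ hwc, gradient_difference hu, inner_add_right, inner_smul_right,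
          inner_smul_right, inner_smul_right]; ring
      have h3 := mul_le_mul_of_nonneg_left h1 (sq_nonneg (ζ x))
      have h4 : |w x * ⟪V x, ∇ ζ x⟫| ≤ (L * ‖h‖ * (Cζ / (d / 2))) * ‖V x‖ := by
        rw [abs_mul]
        calc |w x| * |⟪V x, ∇ ζ x⟫| ≤ (L * ‖h‖) * (‖V x‖ * (Cζ / (d / 2))) :=
              mul_le_mul h2 ((abs_real_inner_le_norm _ _).trans
                (mul_le_mul_of_nonneg_left (hζg x) (norm_nonneg _))) (abs_nonneg _) (by positivity)
          _ = _ := by ring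
      set B := L * ‖h‖ * (Cζ / (d / 2))
      have h5 : -(2 * ζ x * w x * ⟪V x, ∇ ζ x⟫) ≤ 2 * ζ x * (B * ‖V x‖) := by
        have := mul_le_mul_of_nonneg_left ((neg_le_abs _).trans h4) (show 0 ≤ 2 * ζ x by linarith [hζ0 x])
        linarith
      have h6 := mul_le_mul_of_nonneg_left h5 (show 0 ≤ K * a L by positivity)
      have h7 : ζ x ^ 2 * ‖V x‖ ^ 2 ≤ K * a L * ⟪V x, ∇ η x⟫ + K * a L * (2 * ζ x * (B * ‖V x‖)) := by
        rw [e]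
        have : ζ x ^ 2 * ‖V x‖ ^ 2 ≤ ζ x ^ 2 * (K * a L * ⟪V x, ∇ u (x + h) - ∇ u x⟫) := h3
        linarith
      have h8 := sq_nonneg (ζ x * ‖V x‖ - 2 * (K * a L * B))
      have e2 : 4 * K ^ 2 * (a L) ^ 2 * (L * ‖h‖) ^ 2 * (Cζ / (d / 2)) ^ 2 = 4 * (K * a L * B) ^ 2 := by
        ring
      rw [e2]
      nlinarith
    · rw [hζz x hxs, gradient_eq_zero_of_notMem_tsupport fun hx' => hxs (hηs hx'), inner_zero_right]
      simp only [ne_eq, OfNat.ofNat_ne_zero, not_false_eq_true, zero_pow, zero_mul, mul_zero, zero_add]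
      positivity
  have hint := setIntegral_mono_on (μ := volume) (Continuous.integrableOn_ball (by fun_prop) x₀ d)
    (Continuous.integrableOn_ball (by fun_prop) x₀ d) measurableSet_ball hpt
  rw [integral_add (Continuous.integrableOn_ball (by fun_prop) x₀ d)
    (Continuous.integrableOn_ball (by fun_prop) x₀ d), integral_const_mul, hzb, setIntegral_const,
    volume_real_ball x₀ hd.le, smul_eq_mul, mul_zero, zero_add] at hint
  have hlow : ∫ x in ball x₀ (d / 2), ‖V x‖ ^ 2 ≤ ∫ x in ball x₀ d, ζ x ^ 2 * ‖V x‖ ^ 2 := by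
    have e : ∫ x in ball x₀ (d / 2), ‖V x‖ ^ 2 = ∫ x in ball x₀ (d / 2), ζ x ^ 2 * ‖V x‖ ^ 2 :=
      setIntegral_congr_fun measurableSet_ball fun x hx => by
        simp [hζe x (ball_subset_closedBall hx)]
    rw [e]
    exact setIntegral_mono_set_of_nonneg (by fun_prop) (fun x => by positivity)
      (ball_subset_ball (by linarith)) isBounded_ball
  refine hlow.trans (hint.trans (le_of_eq ?_))
  field_simp
  ring

/-- Discrete integration by parts. -/
lemma integral_difference_mul {f ψ : Plane → ℝ} (hf : Continuous f) (hψ : Continuous ψ)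
    (hc : HasCompactSupport ψ) (h : Plane) :
    ∫ x, (f (x + h) - f x) * ψ x = ∫ x, f x * (ψ (x + -h) - ψ x) := by
  have hψ' : HasCompactSupport fun x => ψ (x + -h) := hasCompactSupport_comp_add hc (-h)
  have i1 : Integrable fun x => f (x + h) * ψ x :=
    Continuous.integrable_of_hasCompactSupport (by fun_prop) hc.mul_left
  have i2 : Integrable fun x => f x * ψ x :=
    Continuous.integrable_of_hasCompactSupport (by fun_prop) hc.mul_left
  have i3 : Integrable fun x => f x * ψ (x + -h) :=
    Continuous.integrable_of_hasCompactSupport (by fun_prop) hψ'.mul_left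
  simp only [sub_mul, mul_sub]
  rw [integral_sub i1 i2, integral_sub i3 i2]
  congr 1
  rw [← integral_add_right_eq_self (fun x => f x * ψ (x + -h)) h]
  simp

end Difference

section DifferenceSingular

lemma contDiff_gradient_apply {ζ : Plane → ℝ} (hζ : ContDiff ℝ 2 ζ) (i : Fin 2) :
    ContDiff ℝ 1 fun y => (∇ ζ y) i := by
  have h1 : ContDiff ℝ 1 fun y => fderiv ℝ ζ y := hζ.fderiv_right (by norm_num)
  have h2 : ContDiff ℝ 1 (∇ ζ) := by
    have : ∇ ζ = fun y => (InnerProductSpace.toDual ℝ Plane).symm (fderiv ℝ ζ y) := by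
      funext y; exact gradient_def ζ y
    rw [this]
    exact (InnerProductSpace.toDual ℝ Plane).symm.contDiff.comp h1
  exact (contDiff_euclidean.1 h2) i

lemma abs_apply_le_norm (i : Fin 2) (ξ : Plane) : |ξ i| ≤ ‖ξ‖ := by
  simpa using PiLp.norm_apply_le ξ i

lemma abs_integral_difference_mul_le {f ψ : Plane → ℝ} {x₀ h : Plane} {d R A : ℝ} (hA : 0 ≤ A)
    (hf : Continuous f) (hfA : ∀ x ∈ ball x₀ d, |f x| ≤ A) (hψ : ContDiff ℝ 1 ψ)
    (hs : tsupport ψ ⊆ closedBall x₀ R) (hR : R + ‖h‖ < d) :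
    |∫ x, (f (x + h) - f x) * ψ x| ≤ A * (‖h‖ * ∫ x in ball x₀ d, ‖∇ ψ x‖) := by
  have hcs : HasCompactSupport ψ :=
    (isCompact_closedBall _ _).of_isClosed_subset (isClosed_tsupport _) hs
  have hψ0 := hψ.continuous
  have hd : Continuous fun x => ψ (x + -h) - ψ x := by fun_prop
  have hout : ∀ x ∉ ball x₀ d, ψ (x + -h) - ψ x = 0 := by
    intro x hx
    have hx' : d ≤ dist x x₀ := not_lt.1 fun hcon => hx (mem_ball.2 hcon)
    have z1 : ψ x = 0 := image_eq_zero_of_notMem_tsupport fun hcon => by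
      linarith [mem_closedBall.1 (hs hcon), norm_nonneg h]
    have z2 : ψ (x + -h) = 0 := image_eq_zero_of_notMem_tsupport fun hcon => by
      have h1 := mem_closedBall.1 (hs hcon)
      have h2 := dist_triangle x (x + -h) x₀
      rw [dist_eq_norm x (x + -h), show x - (x + -h) = h by abel] at h2
      linarith
    rw [z1, z2, sub_zero]
  have e2 : ∫ x, f x * (ψ (x + -h) - ψ x) = ∫ x in ball x₀ d, f x * (ψ (x + -h) - ψ x) :=
    integral_eq_setIntegral_ball fun x hx => by rw [hout x hx, mul_zero]
  rw [integral_difference_mul hf hψ0 hcs h, e2]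
  have s1 : |∫ x in ball x₀ d, f x * (ψ (x + -h) - ψ x)| ≤
      ∫ x in ball x₀ d, A * |ψ (x + -h) - ψ x| := by
    refine abs_integral_le_integral_abs.trans (setIntegral_mono_on
      (Continuous.integrableOn_ball (hf.mul hd).abs _ _)
      (Continuous.integrableOn_ball (continuous_const.mul hd.abs) _ _) measurableSet_ball
      fun x hx => ?_)
    rw [abs_mul]
    exact mul_le_mul_of_nonneg_right (hfA x hx) (abs_nonneg _)
  refine s1.trans ?_
  rw [integral_const_mul]
  refine mul_le_mul_of_nonneg_left ?_ hA
  have s2 := integral_abs_difference_le hψ x₀ (-h) d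
  rw [norm_neg] at s2
  refine s2.trans (mul_le_mul_of_nonneg_left ?_ (norm_nonneg _))
  have hz1 : ∀ R', d ≤ R' → ∀ x ∉ ball x₀ R', ‖∇ ψ x‖ = 0 := fun R' hR' x hx => by
    rw [gradient_eq_zero_of_notMem_tsupport, norm_zero]
    intro hcon
    exact hx (mem_ball.2 (by linarith [mem_closedBall.1 (hs hcon), norm_nonneg h]))
  rw [← integral_eq_setIntegral_ball (hz1 _ (by linarith [norm_nonneg h])),
    integral_eq_setIntegral_ball (hz1 d le_rfl)]

lemma norm_gradient_cutoff_mul_le {ζ w : Plane → ℝ} {x : Plane} {d C B : ℝ} (i : Fin 2)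
    (hd : 0 < d) (hC : 0 < C) (hζ2 : ContDiff ℝ 2 ζ) (hw : ContDiff ℝ 1 w) (hζ0 : 0 ≤ ζ x)
    (hζ1 : ζ x ≤ 1) (hgn : ‖∇ ζ x‖ ≤ 2 * C / d)
    (hggn : ‖∇ (fun y => (∇ ζ y) i) x‖ ≤ 4 * C / d ^ 2) (hB : |w x| ≤ B) :
    ‖∇ (fun y => w y * (2 * ζ y * (∇ ζ y) i)) x‖ ≤
      B * ((8 * C ^ 2 + 8 * C) / d ^ 2) + 4 * C / d * (ζ x * ‖∇ w x‖) := by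
  have hζ : ContDiff ℝ 1 ζ := hζ2.of_le (by norm_num)
  have hgi := contDiff_gradient_apply hζ2 i
  have hB0 : 0 ≤ B := (abs_nonneg _).trans hB
  have e : ∇ (fun y => w y * (2 * ζ y * (∇ ζ y) i)) x =
      w x • (∇ (fun y => 2 * ζ y * (∇ ζ y) i) x) + (2 * ζ x * (∇ ζ x) i) • ∇ w x :=
    gradient_mul (hw.differentiable one_ne_zero x)
      (((contDiff_const.mul hζ).mul hgi).differentiable one_ne_zero x)
  have e2 : ∇ (fun y => 2 * ζ y * (∇ ζ y) i) x =
      (2 * ζ x) • ∇ (fun y => (∇ ζ y) i) x + ((∇ ζ x) i) • (2 : ℝ) • ∇ ζ x := by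
    rw [gradient_mul ((contDiff_const.mul hζ).differentiable one_ne_zero x)
      (hgi.differentiable one_ne_zero x),
      gradient_const_mul (hζ.differentiable one_ne_zero x)]
  have hgi' : |(∇ ζ x) i| ≤ 2 * C / d := (abs_apply_le_norm i _).trans hgn
  have hb : ‖∇ (fun y => 2 * ζ y * (∇ ζ y) i) x‖ ≤ (8 * C ^ 2 + 8 * C) / d ^ 2 := by
    rw [e2]
    refine (norm_add_le _ _).trans ?_
    rw [norm_smul, norm_smul, norm_smul, Real.norm_eq_abs, Real.norm_eq_abs, Real.norm_eq_abs,
      abs_of_nonneg (show 0 ≤ 2 * ζ x by linarith), abs_two]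
    have t1 : 2 * ζ x * ‖∇ (fun y => (∇ ζ y) i) x‖ ≤ 2 * (4 * C / d ^ 2) :=
      _root_.mul_le_mul (by linarith) hggn (norm_nonneg _) (by norm_num)
    have t2 : |(∇ ζ x) i| * (2 * ‖∇ ζ x‖) ≤ (2 * C / d) * (2 * (2 * C / d)) :=
      _root_.mul_le_mul hgi' (by linarith) (by positivity) (by positivity)
    refine (add_le_add t1 t2).trans (le_of_eq ?_)
    field_simp
    ring
  rw [e]
  refine (norm_add_le _ _).trans (add_le_add ?_ ?_)
  · rw [norm_smul, Real.norm_eq_abs]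
    exact _root_.mul_le_mul hB hb (norm_nonneg _) hB0
  · rw [norm_smul, Real.norm_eq_abs, abs_mul, abs_of_nonneg (show 0 ≤ 2 * ζ x by linarith)]
    have := mul_le_mul_of_nonneg_left hgi' (show 0 ≤ 2 * ζ x * ‖∇ w x‖ by positivity)
    calc 2 * ζ x * |(∇ ζ x) i| * ‖∇ w x‖ = 2 * ζ x * ‖∇ w x‖ * |(∇ ζ x) i| := by ring
      _ ≤ _ := this
      _ = _ := by ring

set_option maxHeartbeats 1000000 in
/-- For `p < 2` the difference quotients of the gradient are controlled. -/
lemma exists_difference_bound_gradient (p : ℝ) (hp : 1 < p) (hp2 : p < 2) :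
    ∃ C : ℝ, 0 < C ∧ ∀ (a : ℝ → ℝ)
    (u : Plane → ℝ) (x₀ : Plane) (d L : ℝ), IsKernel p a → 0 < d → 0 < L → ContDiff ℝ 1 u →
    WeakSol a (ball x₀ d) u → (∀ x ∈ ball x₀ d, ‖∇ u x‖ ≤ L) → ∀ h : Plane, ‖h‖ ≤ d / 8 →
    ∫ x in ball x₀ (d / 2), ‖∇ u (x + h) - ∇ u x‖ ^ 2 ≤ C * L ^ 2 * ‖h‖ ^ 2 := by
  obtain ⟨Cζ, hCζ, hcut⟩ := exists_cutoff
  set c := cLow p with hc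
  have hc0 : 0 < c := cLow_pos hp
  set C1 : ℝ := 8 * Cζ ^ 2 + 8 * Cζ with hC1
  refine ⟨2 / c * (Real.pi * (2 * C1 + 32 * Cζ ^ 2 / c)), by positivity, ?_⟩
  intro a u x₀ d L ha hd hL0 hu hsol hL h hh
  obtain ⟨ζ, hζ2, hζ0, hζ1, hζe, hζs, hζg, hζgg⟩ := hcut x₀ (d / 2) (by positivity)
  have hζ : ContDiff ℝ 1 ζ := hζ2.of_le (by norm_num)
  set w := fun x => u (x + h) - u x with hw
  have hwc : ContDiff ℝ 1 w := contDiff_difference hu h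
  have hgw : ∀ x, ∇ w x = ∇ u (x + h) - ∇ u x := gradient_difference hu h
  have hgu := continuous_gradient hu
  have hgwc := continuous_gradient hwc
  have hfl : Continuous fun x => flux a (∇ u x) := (ha.continuous_flux hp).comp hgu
  set V := fun x => flux a (∇ u (x + h)) - flux a (∇ u x) with hV
  have hVc : Continuous V := (hfl.comp (continuous_id.add continuous_const)).sub hfl
  set η := fun y => ζ y * ζ y * w y with hη
  have hηc : ContDiff ℝ 1 η := (hζ.mul hζ).mul hwc
  have hηs : tsupport η ⊆ closedBall x₀ (3 / 2 * (d / 2)) := tsupport_sq_mul_subset.trans hζs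
  have hz := hsol.integral_difference ha hp hu (h := h) (by linarith) hηc hηs
  have haL := ha.pos L hL0
  have hζz : ∀ x ∉ closedBall x₀ (3 / 2 * (d / 2)), ζ x = 0 := fun x hx =>
    image_eq_zero_of_notMem_tsupport fun hx' => hx (hζs hx')
  have hgζ := continuous_gradient hζ
  have hgη := continuous_gradient hηc
  have hζc := hζ.continuous
  have hw0 := hwc.continuous
  have hgi := contDiff_gradient_apply hζ2
  set ψ : Fin 2 → Plane → ℝ := fun i y => w y * (2 * ζ y * (∇ ζ y) i) with hψ
  have hψc : ∀ i, ContDiff ℝ 1 (ψ i) := fun i => hwc.mul ((contDiff_const.mul hζ).mul (hgi i))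
  have hψs : ∀ i, tsupport (ψ i) ⊆ closedBall x₀ (3 / 2 * (d / 2)) := by
    intro i
    refine closure_minimal (fun x hx => ?_) isClosed_closedBall
    by_contra hcon
    exact hx (by simp [hψ, hζz x hcon])
  have hψcs : ∀ i, HasCompactSupport (ψ i) := fun i =>
    (isCompact_closedBall _ _).of_isClosed_subset (isClosed_tsupport _) (hψs i)
  have hterm : ∀ i, |∫ x, (V x) i * ψ i x| ≤ a L * L * (‖h‖ * ∫ x in ball x₀ d,
      (L * ‖h‖ * (C1 / d ^ 2) + 4 * Cζ / d * (ζ x * ‖∇ w x‖))) := by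
    intro i
    have hfi : Continuous fun x => (flux a (∇ u x)) i := (PiLp.continuous_apply 2 _ i).comp hfl
    have e := abs_integral_difference_mul_le (A := a L * L) (h := h) (d := d) (by positivity) hfi
      (fun x hx => (abs_apply_le_norm i _).trans (ha.norm_flux_le hp (hL x hx))) (hψc i) (hψs i)
      (by linarith)
    refine e.trans ?_
    refine mul_le_mul_of_nonneg_left (mul_le_mul_of_nonneg_left ?_ (norm_nonneg _))
      (by positivity)
    have hgψ := continuous_gradient (hψc i)
    refine setIntegral_mono_on (Continuous.integrableOn_ball hgψ.norm _ _)
      (Continuous.integrableOn_ball (continuous_const.add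
        (continuous_const.mul (hζc.mul hgwc.norm))) _ _) measurableSet_ball fun x hx => ?_
    by_cases hxs : x ∈ closedBall x₀ (3 / 2 * (d / 2))
    · have hxh : x + h ∈ ball x₀ d := add_mem_ball_of_norm_le hxs (by linarith)
      exact norm_gradient_cutoff_mul_le i hd hCζ hζ2 hwc (hζ0 x) (hζ1 x)
        ((hζg x).trans (le_of_eq (by field_simp)))
        ((hζgg i x).trans (le_of_eq (by field_simp; norm_num))) (abs_difference_le hu hL hx hxh)
    · rw [gradient_eq_zero_of_notMem_tsupport fun hx' => hxs (hψs i hx'), norm_zero]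
      have := hζ0 x
      positivity
  have hpt : ∀ x, c * a L * (ζ x ^ 2 * ‖∇ w x‖ ^ 2) ≤ ⟪V x, ∇ η x⟫ - ((V x) 0 * ψ 0 x + (V x) 1 * ψ 1 x) := by
    intro x
    have e : ⟪V x, ∇ η x⟫ - ((V x) 0 * ψ 0 x + (V x) 1 * ψ 1 x) = ζ x ^ 2 * ⟪V x, ∇ w x⟫ := by
      rw [hη, gradient_sq_mul hζ hwc, inner_add_right, inner_smul_right,
          inner_smul_right, inner_smul_right, PiLp.inner_apply (V x) (∇ ζ x), Fin.sum_univ_two]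
      simp only [hψ, RCLike.inner_apply, conj_trivial]
      ring
    rw [e]
    by_cases hxs : x ∈ closedBall x₀ (3 / 2 * (d / 2))
    · have hxh : x + h ∈ ball x₀ d := add_mem_ball_of_norm_le hxs (by linarith)
      have hx : x ∈ ball x₀ d := closedBall_subset_ball (by linarith) hxs
      have h1 := ha.le_inner_flux_sub hp (∇ u (x + h)) (∇ u x)
      rw [← hgw x] at h1
      have h2 : c * a L * ‖∇ w x‖ ^ 2 ≤ ⟪V x, ∇ w x⟫ := by
        refine le_trans ?_ h1
        rcases eq_or_lt_of_le ((norm_nonneg (∇ u x)).trans (le_max_right ‖∇ u (x + h)‖ ‖∇ u x‖)) with h0 | h0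
        · have : ∇ w x = 0 := by
            have z1 := (le_max_left ‖∇ u (x + h)‖ ‖∇ u x‖).trans h0.ge
            have z2 := (le_max_right ‖∇ u (x + h)‖ ‖∇ u x‖).trans h0.ge
            rw [norm_le_zero_iff] at z1 z2
            rw [hgw, z1, z2, sub_zero]
          simp [this]
        · have := (ha.decr hp2 _ L h0 (max_le (hL _ hxh) (hL _ hx))).1
          gcongr
      have := mul_le_mul_of_nonneg_left h2 (sq_nonneg (ζ x))
      linarith
    · rw [hζz x hxs]; simp
  have hX : ∫ x, c * a L * (ζ x ^ 2 * ‖∇ w x‖ ^ 2) ≤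
      |∫ x, (V x) 0 * ψ 0 x| + |∫ x, (V x) 1 * ψ 1 x| := by
    have hηcs : HasCompactSupport η :=
      (isCompact_closedBall _ _).of_isClosed_subset (isClosed_tsupport _) hηs
    have i0 : Integrable fun x => ⟪V x, ∇ η x⟫ :=
      integrable_inner_gradient isOpen_univ hVc.continuousOn hηc hηcs (subset_univ _)
    have iψ : ∀ i, Integrable fun x => (V x) i * ψ i x := fun i =>
      Continuous.integrable_of_hasCompactSupport
        (((PiLp.continuous_apply 2 _ i).comp hVc).mul (hψc i).continuous) (hψcs i).mul_left
    have iζ : Integrable fun x => c * a L * (ζ x ^ 2 * ‖∇ w x‖ ^ 2) := by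
      refine Continuous.integrable_of_hasCompactSupport (by fun_prop) ?_
      refine HasCompactSupport.intro (isCompact_closedBall x₀ (3 / 2 * (d / 2))) fun x hx => ?_
      rw [hζz x hx]; simp
    have iψs : Integrable fun x => (V x) 0 * ψ 0 x + (V x) 1 * ψ 1 x := (iψ 0).add (iψ 1)
    refine (integral_mono iζ (i0.sub iψs) hpt).trans ?_
    have hz' : ∫ x, ⟪V x, ∇ η x⟫ = 0 := hz
    simp only [Pi.sub_apply]
    rw [integral_sub i0 iψs, hz', integral_add (iψ 0) (iψ 1)]
    linarith [neg_le_abs (∫ x, (V x) 0 * ψ 0 x), neg_le_abs (∫ x, (V x) 1 * ψ 1 x)]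
  have hXball : ∫ x, c * a L * (ζ x ^ 2 * ‖∇ w x‖ ^ 2) =
      c * a L * ∫ x in ball x₀ d, ζ x ^ 2 * ‖∇ w x‖ ^ 2 := by
    rw [integral_const_mul]
    congr 1
    refine integral_eq_setIntegral_ball fun x hx => ?_
    rw [hζz x fun hcon => hx (closedBall_subset_ball (by linarith) hcon)]; simp
  set X := ∫ x in ball x₀ d, ζ x ^ 2 * ‖∇ w x‖ ^ 2 with hXdef
  have hyoung : 2 * (L * ‖h‖ * ∫ x in ball x₀ d,
      (L * ‖h‖ * (C1 / d ^ 2) + 4 * Cζ / d * (ζ x * ‖∇ w x‖))) ≤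
      c / 2 * X + Real.pi * (2 * C1 + 32 * Cζ ^ 2 / c) * L ^ 2 * ‖h‖ ^ 2 := by
    have hpt2 : ∀ x ∈ ball x₀ d, 2 * (L * ‖h‖ *
        (L * ‖h‖ * (C1 / d ^ 2) + 4 * Cζ / d * (ζ x * ‖∇ w x‖))) ≤
        c / 2 * (ζ x ^ 2 * ‖∇ w x‖ ^ 2) + (2 * C1 + 32 * Cζ ^ 2 / c) * L ^ 2 * ‖h‖ ^ 2 / d ^ 2 := by
      intro x _
      have hsq := mul_nonneg (show 0 ≤ c / 2 by positivity)
        (sq_nonneg (ζ x * ‖∇ w x‖ - 8 * Cζ * L * ‖h‖ / (c * d)))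
      have e : c / 2 * (ζ x * ‖∇ w x‖ - 8 * Cζ * L * ‖h‖ / (c * d)) ^ 2 =
          c / 2 * (ζ x ^ 2 * ‖∇ w x‖ ^ 2) + (2 * C1 + 32 * Cζ ^ 2 / c) * L ^ 2 * ‖h‖ ^ 2 / d ^ 2 -
          2 * (L * ‖h‖ * (L * ‖h‖ * (C1 / d ^ 2) + 4 * Cζ / d * (ζ x * ‖∇ w x‖))) := by
        field_simp
        ring
      rw [e] at hsq
      linarith
    have i1 : IntegrableOn (fun x => c / 2 * (ζ x ^ 2 * ‖∇ w x‖ ^ 2)) (ball x₀ d) :=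
      Continuous.integrableOn_ball (by fun_prop) x₀ d
    have i2 : IntegrableOn (fun _ : Plane => (2 * C1 + 32 * Cζ ^ 2 / c) * L ^ 2 * ‖h‖ ^ 2 / d ^ 2)
      (ball x₀ d) := Continuous.integrableOn_ball continuous_const x₀ d
    have hint := setIntegral_mono_on (μ := volume) (Continuous.integrableOn_ball (by fun_prop) x₀ d)
      (i1.add i2) measurableSet_ball hpt2
    have e3 : ∫ x in ball x₀ d, (c / 2 * (ζ x ^ 2 * ‖∇ w x‖ ^ 2) +
        (2 * C1 + 32 * Cζ ^ 2 / c) * L ^ 2 * ‖h‖ ^ 2 / d ^ 2) =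
        c / 2 * X + Real.pi * d ^ 2 * ((2 * C1 + 32 * Cζ ^ 2 / c) * L ^ 2 * ‖h‖ ^ 2 / d ^ 2) := by
      rw [integral_add i1 i2, integral_const_mul, setIntegral_const, volume_real_ball x₀ hd.le,
        smul_eq_mul]
    simp only [Pi.add_apply] at hint
    rw [integral_const_mul, integral_const_mul, e3] at hint
    refine hint.trans (le_of_eq ?_)
    field_simp
  have hfin : c * X ≤ c / 2 * X + Real.pi * (2 * C1 + 32 * Cζ ^ 2 / c) * L ^ 2 * ‖h‖ ^ 2 := by
    rw [hXball] at hX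
    have h1 := hX.trans (add_le_add (hterm 0) (hterm 1))
    refine le_trans ?_ hyoung
    refine le_of_mul_le_mul_left ?_ haL
    linarith
  have hlow : ∫ x in ball x₀ (d / 2), ‖∇ u (x + h) - ∇ u x‖ ^ 2 ≤ X := by
    have e : ∫ x in ball x₀ (d / 2), ‖∇ u (x + h) - ∇ u x‖ ^ 2 =
        ∫ x in ball x₀ (d / 2), ζ x ^ 2 * ‖∇ w x‖ ^ 2 :=
      setIntegral_congr_fun measurableSet_ball fun x hx => by
        simp only [hζe x (ball_subset_closedBall hx), hgw]; ring
    rw [e]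
    exact setIntegral_mono_set_of_nonneg (by fun_prop) (fun x => by positivity)
      (ball_subset_ball (by linarith)) isBounded_ball
  refine hlow.trans ?_
  have h3 : X = 2 / c * (c * X - c / 2 * X) := by field_simp; ring
  rw [h3]
  calc 2 / c * (c * X - c / 2 * X) ≤ 2 / c *
        (Real.pi * (2 * C1 + 32 * Cζ ^ 2 / c) * L ^ 2 * ‖h‖ ^ 2) :=
        mul_le_mul_of_nonneg_left (by linarith) (by positivity)
    _ = _ := by ring

end DifferenceSingular

section GradientModulus

lemma exists_sphere_norm_sub_le {F : Plane → Plane} (hF : Continuous F) {x₀ : Plane}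
    {d K κ ρ : ℝ} (hκ : 0 < κ) (hρ : 0 < ρ) (hρd : ρ ≤ d / 4)
    (h : ∀ h : Plane, ‖h‖ ≤ d / 8 →
      ∫ x in ball x₀ (d / 2), ‖F (x + h) - F x‖ ^ 2 ≤ K * ‖h‖ ^ 2)
    (hlog : 32 * Real.pi * K < κ ^ 2 * Real.log (d / 4 / ρ)) :
    ∃ r ∈ Icc ρ (d / 4), ∀ x ∈ sphere x₀ r, ∀ y ∈ sphere x₀ r, ‖F x - F y‖ ≤ 2 * κ := by
  have hW : ∀ i : Fin 2, Continuous fun x => (F x) i := fun i =>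
    (PiLp.continuous_apply 2 _ i).comp hF
  obtain ⟨r, hr, hrs⟩ := exists_circle_osc_lt hW hκ hρ hρd (fun i z hz => by
    refine le_trans ?_ (h z hz)
    have hWi := hW i
    refine setIntegral_mono_on (Continuous.integrableOn_ball (by fun_prop) _ _)
      (Continuous.integrableOn_ball (by fun_prop) _ _) measurableSet_ball fun x _ => ?_
    rw [← sq_abs]
    exact pow_le_pow_left₀ (abs_nonneg _) (abs_apply_le_norm i (F (x + z) - F x)) 2) hlog
  refine ⟨r, hr, fun x hx y hy => ?_⟩
  have h2 : ∀ i : Fin 2, |(F x - F y) i| ≤ κ := fun i => by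
    rw [abs_le]
    have h1 := hrs i x hx y hy
    have h2 := hrs i y hy x hx
    rw [PiLp.sub_apply]
    constructor <;> linarith
  rw [EuclideanSpace.norm_eq, Fin.sum_univ_two]
  refine Real.sqrt_le_iff.2 ⟨by positivity, ?_⟩
  rw [Real.norm_eq_abs, Real.norm_eq_abs]
  have h0 := pow_le_pow_left₀ (abs_nonneg _) (h2 0) 2
  have h1 := pow_le_pow_left₀ (abs_nonneg _) (h2 1) 2
  nlinarith [sq_nonneg κ]

/-- A bounded gradient has small oscillation on small balls (globally `C¹` functions). -/
lemma exists_gradient_osc_of_contDiff (p : ℝ) (hp : 1 < p) (κ : ℝ) (hκ : 0 < κ) :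
    ∃ τ : ℝ, 0 < τ ∧ τ ≤ 1 / 4 ∧ ∀ (a : ℝ → ℝ) (u : Plane → ℝ) (x₀ : Plane) (d L : ℝ),
    IsKernel p a → 0 < d → 0 < L → ContDiff ℝ 1 u → WeakSol a (ball x₀ d) u →
    (∀ x ∈ ball x₀ d, ‖∇ u x‖ ≤ L) → ∀ x ∈ closedBall x₀ (τ * d), ‖∇ u x - ∇ u x₀‖ ≤ κ * L := by
  -- it suffices to find a circle on which the gradient oscillates little
  suffices H : ∃ τ : ℝ, 0 < τ ∧ τ ≤ 1 / 4 ∧ ∀ (a : ℝ → ℝ) (u : Plane → ℝ) (x₀ : Plane) (d L : ℝ),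
      IsKernel p a → 0 < d → 0 < L → ContDiff ℝ 1 u → WeakSol a (ball x₀ d) u →
      (∀ x ∈ ball x₀ d, ‖∇ u x‖ ≤ L) → ∃ r ∈ Icc (τ * d) (d / 4), ∀ x ∈ sphere x₀ r,
        ∀ y ∈ sphere x₀ r, ‖∇ u x - ∇ u y‖ ≤ κ / 2 * L by
    obtain ⟨τ, hτ, hτ4, H⟩ := H
    refine ⟨τ, hτ, hτ4, fun a u x₀ d L ha hd hL0 hu hsol hL x hx => ?_⟩
    obtain ⟨r, hr, hrs⟩ := H a u x₀ d L ha hd hL0 hu hsol hL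
    have hr0 : 0 < r := (by positivity : 0 < τ * d).trans_le hr.1
    obtain ⟨y, hy⟩ := (NormedSpace.sphere_nonempty (x := x₀) (r := r)).2 hr0.le
    have key := norm_gradient_sub_le_of_sphere ha hp isOpen_ball hsol hr0
      (closedBall_subset_ball (by linarith [hr.2])) (fun z hz => hrs z hz y hy)
    have h1 := key x (closedBall_subset_closedBall hr.1 hx)
    have h2 := key x₀ (mem_closedBall_self hr0.le)
    have e : ∇ u x - ∇ u x₀ = (∇ u x - ∇ u y) - (∇ u x₀ - ∇ u y) := by abel
    rw [e]
    refine (norm_sub_le _ _).trans ?_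
    linarith
  have hlogτ : ∀ (C θ : ℝ), 0 < C → 0 < θ → ∃ τ : ℝ, 0 < τ ∧ τ ≤ 1 / 4 ∧ ∀ d A : ℝ, 0 < d → 0 < A →
      32 * Real.pi * (C * A ^ 2) < (θ * A) ^ 2 * Real.log (d / 4 / (τ * d)) := by
    intro C θ hC hθ
    refine ⟨Real.exp (-(32 * Real.pi * C / θ ^ 2 + 1)) / 4, by positivity, ?_, ?_⟩
    · have : Real.exp (-(32 * Real.pi * C / θ ^ 2 + 1)) ≤ 1 := by
        rw [Real.exp_le_one_iff]
        have : 0 < 32 * Real.pi * C / θ ^ 2 := by positivity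
        linarith
      linarith
    · intro d A hd hA
      have e : d / 4 / (Real.exp (-(32 * Real.pi * C / θ ^ 2 + 1)) / 4 * d) =
          Real.exp (32 * Real.pi * C / θ ^ 2 + 1) := by
        rw [Real.exp_neg]; field_simp
      rw [e, Real.log_exp]
      have e2 : (θ * A) ^ 2 * (32 * Real.pi * C / θ ^ 2 + 1) =
          32 * Real.pi * (C * A ^ 2) + (θ * A) ^ 2 := by field_simp
      rw [e2]
      have : 0 < (θ * A) ^ 2 := by positivity
      linarith
  rcases lt_or_ge p 2 with hp2 | hp2
  · obtain ⟨C, hC, hbd⟩ := exists_difference_bound_gradient p hp hp2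
    obtain ⟨τ, hτ, hτ4, hlog⟩ := hlogτ C (κ / 4) hC (by positivity)
    refine ⟨τ, hτ, hτ4, fun a u x₀ d L ha hd hL0 hu hsol hL => ?_⟩
    obtain ⟨r, hr, hrs⟩ := exists_sphere_norm_sub_le (continuous_gradient hu)
      (show 0 < κ / 4 * L by positivity) (show 0 < τ * d by positivity)
      (by nlinarith) (hbd a u x₀ d L ha hd hL0 hu hsol hL) (hlog d L hd hL0)
    refine ⟨r, hr, fun x hx y hy => (hrs x hx y hy).trans (le_of_eq (by ring))⟩
  · obtain ⟨C, hC, hbd⟩ := exists_difference_bound_flux p hp2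
    have hc0 := cLow_pos hp
    set θ := cLow p * (κ / 4) ^ (p - 2) * κ / 8 with hθ
    have hθ0 : 0 < θ := by positivity
    obtain ⟨τ, hτ, hτ4, hlog⟩ := hlogτ C θ hC hθ0
    refine ⟨τ, hτ, hτ4, fun a u x₀ d L ha hd hL0 hu hsol hL => ?_⟩
    have haL := ha.pos L hL0
    obtain ⟨r, hr, hrs⟩ := exists_sphere_norm_sub_le
      ((ha.continuous_flux hp).comp (continuous_gradient hu))
      (show 0 < θ * (a L * L) by positivity) (show 0 < τ * d by positivity)
      (by nlinarith) (hbd a u x₀ d L ha hd hL0 hu hsol hL) (hlog d (a L * L) hd (by positivity))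
    refine ⟨r, hr, fun x hx y hy => ?_⟩
    by_contra! hcon
    have hsub : sphere x₀ r ⊆ ball x₀ d := sphere_subset_closedBall.trans
      (closedBall_subset_ball (by linarith [hr.2]))
    set m := max ‖∇ u x‖ ‖∇ u y‖ with hm
    have hmL : m ≤ L := max_le (hL x (hsub hx)) (hL y (hsub hy))
    have hmκ : κ / 4 * L ≤ m := by
      have := norm_sub_le (∇ u x) (∇ u y)
      linarith [le_max_left ‖∇ u x‖ ‖∇ u y‖, le_max_right ‖∇ u x‖ ‖∇ u y‖]
    have hm0 : 0 < m := (by positivity : 0 < κ / 4 * L).trans_le hmκ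
    have h1 := (ha.incr hp2 m L hm0 hmL).2
    have h2 : (κ / 4) ^ (p - 2) * a L ≤ a m := by
      have h3 : (κ / 4) ^ (p - 2) * (L / m) ^ (p - 2) ≤ 1 := by
        rw [← Real.mul_rpow (by positivity) (by positivity)]
        refine Real.rpow_le_one (by positivity) ?_ (by linarith)
        rw [← mul_div_assoc]
        exact div_le_one_of_le₀ hmκ hm0.le
      calc (κ / 4) ^ (p - 2) * a L ≤ (κ / 4) ^ (p - 2) * ((L / m) ^ (p - 2) * a m) := by gcongr
        _ = ((κ / 4) ^ (p - 2) * (L / m) ^ (p - 2)) * a m := by ring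
        _ ≤ 1 * a m := mul_le_mul_of_nonneg_right h3 (ha.pos m hm0).le
        _ = a m := one_mul _
    have h4 := ha.le_norm_flux_sub hp (∇ u x) (∇ u y)
    have h5 := hrs x hx y hy
    have h6 : cLow p * ((κ / 4) ^ (p - 2) * a L) * (κ / 2 * L) <
        cLow p * a m * ‖∇ u x - ∇ u y‖ := by
      have h7 : 0 < cLow p * a m := mul_pos hc0 (ha.pos m hm0)
      calc cLow p * ((κ / 4) ^ (p - 2) * a L) * (κ / 2 * L) ≤ cLow p * a m * (κ / 2 * L) := by
            gcongr
        _ < _ := mul_lt_mul_of_pos_left hcon h7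
    have h8 : cLow p * ((κ / 4) ^ (p - 2) * a L) * (κ / 2 * L) = 4 * (θ * (a L * L)) := by
      rw [hθ]; ring
    have h9 : 0 < θ * (a L * L) := by positivity
    simp only [Function.comp_apply] at h5
    linarith

lemma exists_contDiff_eqOn_ball {u : Plane → ℝ} {x₀ : Plane} {d : ℝ} (hd : 0 < d)
    (hu : ContDiffOn ℝ 1 u (ball x₀ d)) :
    ∃ v : Plane → ℝ, ContDiff ℝ 1 v ∧ HasCompactSupport v ∧ EqOn v u (ball x₀ (d / 2)) := by
  obtain ⟨C, -, hcut⟩ := exists_cutoff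
  obtain ⟨ζ, hζ2, -, -, hζe, hζs, -, -⟩ := hcut x₀ (d / 2) (by positivity)
  have hsub : tsupport ζ ⊆ ball x₀ d := hζs.trans (closedBall_subset_ball (by linarith))
  have hcs : HasCompactSupport ζ :=
    (isCompact_closedBall _ _).of_isClosed_subset (isClosed_tsupport _) hζs
  refine ⟨fun y => ζ y * u y, contDiff_mul_of_tsupport_subset isOpen_ball
    (hζ2.of_le (by norm_num)) hu hsub, hcs.mul_right, fun x hx => ?_⟩
  simp only [hζe x (ball_subset_closedBall hx), one_mul]

/-- A weak solution with bounded gradient has small gradient oscillation on small balls, uniformly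
over all kernels of growth `p`. -/
theorem exists_gradient_osc (p : ℝ) (hp : 1 < p) (κ : ℝ) (hκ : 0 < κ) :
    ∃ τ : ℝ, 0 < τ ∧ τ ≤ 1 / 4 ∧ ∀ (a : ℝ → ℝ) (u : Plane → ℝ) (x₀ : Plane) (d L : ℝ),
    IsKernel p a → 0 < d → 0 < L → WeakSol a (ball x₀ d) u →
    (∀ x ∈ ball x₀ d, ‖∇ u x‖ ≤ L) → ∀ x ∈ closedBall x₀ (τ * d), ‖∇ u x - ∇ u x₀‖ ≤ κ * L := by
  obtain ⟨τ, hτ, hτ4, H⟩ := exists_gradient_osc_of_contDiff p hp κ hκ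
  refine ⟨τ / 2, by positivity, by linarith, fun a u x₀ d L ha hd hL0 hsol hL x hx => ?_⟩
  obtain ⟨v, hv, -, hvu⟩ := exists_contDiff_eqOn_ball hd hsol.1
  have hsub : ball x₀ (d / 2) ⊆ ball x₀ d := ball_subset_ball (by linarith)
  have hg : ∀ y ∈ ball x₀ (d / 2), ∇ v y = ∇ u y := fun y hy =>
    gradient_congr_of_eqOn isOpen_ball hvu hy
  have key := H a v x₀ (d / 2) L ha (by positivity) hL0 hv ((hsol.mono hsub).congr isOpen_ball hvu)
    (fun y hy => by rw [hg y hy]; exact hL y (hsub hy)) x (by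
      rwa [show τ * (d / 2) = τ / 2 * d by ring])
  rwa [hg x₀ (mem_ball_self (by positivity)), hg x (closedBall_subset_ball (by nlinarith) hx)] at key

/-- Interior gradient estimate. -/
theorem exists_gradient_bound (p : ℝ) (hp : 1 < p) : ∃ C : ℝ, 0 < C ∧
    ∀ (a : ℝ → ℝ) (u : Plane → ℝ) (x₀ : Plane) (R M : ℝ) (U : Set Plane), IsKernel p a → 0 < R →
    IsOpen U → WeakSol a U u → closedBall x₀ R ⊆ U → (∀ x ∈ closedBall x₀ R, |u x| ≤ M) →
    R * ‖∇ u x₀‖ ≤ C * M := by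
  obtain ⟨τ, hτ, hτ4, H⟩ := exists_gradient_osc p hp (1 / 4) (by norm_num)
  refine ⟨8 / τ, by positivity, fun a u x₀ R M U ha hR hU hsol hsub hM => ?_⟩
  have hgc : ContinuousOn (fun x => (R - dist x x₀) * ‖∇ u x‖) (closedBall x₀ R) :=
    (continuous_const.sub (continuous_id.dist continuous_const)).continuousOn.mul
      ((continuousOn_gradient hsol.1 hU).mono hsub).norm
  obtain ⟨x₁, hx₁, hmax⟩ := (isCompact_closedBall x₀ R).exists_isMaxOn
    ⟨x₀, mem_closedBall_self hR.le⟩ hgc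
  have h0 : R * ‖∇ u x₀‖ ≤ (R - dist x₁ x₀) * ‖∇ u x₁‖ := by
    simpa using hmax (mem_closedBall_self hR.le)
  have hM0 : 0 ≤ M := (abs_nonneg _).trans (hM x₀ (mem_closedBall_self hR.le))
  have hd1 : dist x₁ x₀ ≤ R := mem_closedBall.1 hx₁
  rcases eq_or_lt_of_le (mul_nonneg (sub_nonneg.2 hd1) (norm_nonneg (∇ u x₁))) with hz | hz
  · rw [← hz] at h0
    exact h0.trans (by positivity)
  have hg0 : 0 < ‖∇ u x₁‖ := by
    refine lt_of_le_of_ne (norm_nonneg _) fun h => ?_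
    rw [← h, mul_zero] at hz
    exact lt_irrefl _ hz
  have hd0 : 0 < R - dist x₁ x₀ := by
    by_contra! h
    nlinarith
  set d := (R - dist x₁ x₀) / 2 with hd
  have hdpos : 0 < d := by positivity
  have hball : ball x₁ d ⊆ closedBall x₀ R := fun y hy => by
    rw [mem_ball] at hy
    rw [mem_closedBall]
    linarith [dist_triangle y x₁ x₀]
  have hL : ∀ x ∈ ball x₁ d, ‖∇ u x‖ ≤ 2 * ‖∇ u x₁‖ := by
    intro x hx
    have h1 := hmax (hball hx)
    simp only [mem_ofPred_eq] at h1
    rw [mem_ball] at hx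
    have h2 : d ≤ R - dist x x₀ := by linarith [dist_triangle x x₁ x₀]
    have h3 : d * ‖∇ u x‖ ≤ d * (2 * ‖∇ u x₁‖) :=
      calc d * ‖∇ u x‖ ≤ (R - dist x x₀) * ‖∇ u x‖ := by gcongr
        _ ≤ _ := h1
        _ = d * (2 * ‖∇ u x₁‖) := by rw [hd]; ring
    exact le_of_mul_le_mul_left h3 hdpos
  have hosc := H a u x₁ d (2 * ‖∇ u x₁‖) ha hdpos (by positivity)
    (hsol.mono (hball.trans hsub)) hL
  -- move in the direction of the gradient
  set e := (τ * d / ‖∇ u x₁‖) • ∇ u x₁ with he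
  have hen : ‖e‖ = τ * d := by
    rw [he, norm_smul, Real.norm_of_nonneg (by positivity)]
    field_simp
  have hseg : closedBall x₁ (τ * d) ⊆ closedBall x₀ R := 
    (closedBall_subset_ball (by nlinarith)).trans hball
  have hmv : ‖u (x₁ + e) - u x₁ - (fderiv ℝ u x₁) (x₁ + e - x₁)‖ ≤
      1 / 4 * (2 * ‖∇ u x₁‖) * ‖x₁ + e - x₁‖ := by
    refine (convex_closedBall x₁ (τ * d)).norm_image_sub_le_of_norm_hasFDerivWithin_le'
      (f' := fun x => fderiv ℝ u x)
      (fun x hx => ((differentiableAt_of_contDiffOn hsol.1 hU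
        (hsub (hseg hx))).hasFDerivAt).hasFDerivWithinAt) (fun x hx => ?_)
      (mem_closedBall_self (by positivity)) (by simp [hen])
    have := hosc x hx
    rw [gradient_def, gradient_def, ← map_sub, LinearIsometryEquiv.norm_map] at this
    exact this
  rw [add_sub_cancel_left, hen] at hmv
  have hfd : fderiv ℝ u x₁ e = τ * d * ‖∇ u x₁‖ := by
    have : fderiv ℝ u x₁ e = ⟪∇ u x₁, e⟫ := by
      rw [gradient_def, InnerProductSpace.toDual_symm_apply]
    rw [this, he, inner_smul_right, real_inner_self_eq_norm_sq]
    field_simp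
  rw [hfd, Real.norm_eq_abs, abs_le] at hmv
  have hu1 := abs_le.1 (hM (x₁ + e) (hseg (by simp [hen])))
  have hu2 := abs_le.1 (hM x₁ hx₁)
  have hfin : τ * (R - dist x₁ x₀) * ‖∇ u x₁‖ ≤ 8 * M := by
    have : τ * (R - dist x₁ x₀) * ‖∇ u x₁‖ = 2 * (τ * d * ‖∇ u x₁‖) := by rw [hd]; ring
    rw [this]
    linarith [hmv.1]
  refine h0.trans ?_
  rw [div_mul_eq_mul_div, le_div_iff₀ hτ]
  linarith

end GradientModulus

section Compactness

variable {ι : Type*} {Ω : Set Plane} {f : ι → Plane → ℝ} {v : Plane → ℝ} {G : Plane → Plane}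
  {p : ℝ} {a : ℝ → ℝ}

lemma continuousOn_of_tendsto_prod {l : Filter ι} [l.NeBot] (hΩ : IsOpen Ω)
    {F : ι → Plane → Plane}
    (hG : ∀ x ∈ Ω, Tendsto (fun q : ι × Plane => F q.1 q.2) (l ×ˢ 𝓝 x) (𝓝 (G x))) :
    ContinuousOn G Ω := by
  intro x hx
  refine ContinuousAt.continuousWithinAt ?_
  rw [ContinuousAt, Metric.tendsto_nhds]
  intro ε hε
  have h1 := (hG x hx).eventually (closedBall_mem_nhds (G x) (half_pos hε))
  obtain ⟨P, hP, Q, hQ, hPQ⟩ := eventually_prod_iff.1 h1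
  filter_upwards [hQ, hΩ.mem_nhds hx] with y hy hyΩ
  have h2 : Tendsto (fun n => F n y) l (𝓝 (G y)) :=
    (hG y hyΩ).comp (tendsto_id.prodMk tendsto_const_pure |>.mono_right
      (prod_mono le_rfl (pure_le_nhds y)))
  have h3 : G y ∈ closedBall (G x) (ε / 2) :=
    isClosed_closedBall.mem_of_tendsto h2 (hP.mono fun n hn => hPQ hn hy)
  rw [mem_closedBall] at h3
  linarith

/-- If gradients converge continuously and the functions converge pointwise, then the limit is
continuously differentiable. -/
lemma contDiffOn_of_tendsto {l : Filter ι} [l.NeBot] (hΩ : IsOpen Ω)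
    (hd : ∀ x ∈ Ω, ∀ᶠ q : ι × Plane in l ×ˢ 𝓝 x, DifferentiableAt ℝ (f q.1) q.2)
    (hf : ∀ x ∈ Ω, Tendsto (fun n => f n x) l (𝓝 (v x)))
    (hG : ∀ x ∈ Ω, Tendsto (fun q : ι × Plane => ∇ (f q.1) q.2) (l ×ˢ 𝓝 x) (𝓝 (G x))) :
    ContDiffOn ℝ 1 v Ω ∧ ∀ x ∈ Ω, ∇ v x = G x := by
  have hGc := continuousOn_of_tendsto_prod (F := fun n y => ∇ (f n) y) hΩ hG
  have hderiv : ∀ x ∈ Ω, HasFDerivAt v (InnerProductSpace.toDual ℝ Plane (G x)) x := by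
    intro x hx
    refine hasFDerivAt_of_tendstoUniformlyOnFilter (l := l) (f := f)
      (f' := fun n y => fderiv ℝ (f n) y)
      (g' := fun y => InnerProductSpace.toDual ℝ Plane (G y)) ?_
      ((hd x hx).mono fun q hq => hq.hasFDerivAt)
      (Filter.mem_of_superset (hΩ.mem_nhds hx) hf)
    rw [Metric.tendstoUniformlyOnFilter_iff]
    intro ε hε
    have h1 := (hG x hx).eventually (ball_mem_nhds (G x) (half_pos hε))
    have h2 : ∀ᶠ q : ι × Plane in l ×ˢ 𝓝 x, G q.2 ∈ ball (G x) (ε / 2) :=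
      tendsto_snd.eventually
        ((hGc.continuousAt (hΩ.mem_nhds hx)).eventually (ball_mem_nhds (G x) (half_pos hε)))
    filter_upwards [h1, h2] with q h3 h4
    have e : fderiv ℝ (f q.1) q.2 = InnerProductSpace.toDual ℝ Plane (∇ (f q.1) q.2) := by
      rw [gradient_def, LinearIsometryEquiv.apply_symm_apply]
    rw [e, LinearIsometryEquiv.dist_map]
    rw [mem_ball] at h4
    calc dist (G q.2) (∇ (f q.1) q.2) ≤ dist (G q.2) (G x) + dist (G x) (∇ (f q.1) q.2) :=
          dist_triangle _ _ _
      _ < ε := by rw [dist_comm (G x)]; linarith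
  refine ⟨?_, fun x hx => ?_⟩
  · refine (contDiffOn_succ_iff_fderiv_of_isOpen (n := 0) hΩ).2
      ⟨fun x hx => (hderiv x hx).differentiableAt.differentiableWithinAt, by simp, ?_⟩
    rw [contDiffOn_zero]
    exact ((InnerProductSpace.toDual ℝ Plane).continuous.comp_continuousOn hGc).congr
      fun x hx => (hderiv x hx).fderiv
  · rw [gradient_def, (hderiv x hx).fderiv, LinearIsometryEquiv.symm_apply_apply]

lemma eventually_forall_of_isCompact {l : Filter ι} {K : Set Plane} (hK : IsCompact K)
    {P : ι → Plane → Prop} (h : ∀ x ∈ K, ∀ᶠ q : ι × Plane in l ×ˢ 𝓝 x, P q.1 q.2) :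
    ∀ᶠ n in l, ∀ x ∈ K, P n x := by
  have h1 := hK.mem_prod_nhdsSet_of_forall (s := {q : ι × Plane | P q.1 q.2}) h
  obtain ⟨Q, hQ, R, hR, hQR⟩ := eventually_prod_iff.1 h1
  exact hQ.mono fun n hn x hx => hQR hn (subset_of_mem_nhdsSet hR hx)

/-- Gradient estimates in a form uniform over kernels. -/
lemma exists_gradient_modulus (p : ℝ) (hp : 1 < p) : ∃ C : ℝ, 0 < C ∧ ∀ κ > 0, ∃ τ > 0,
    ∀ (a : ℝ → ℝ) (u : Plane → ℝ) (x₀ : Plane) (R M : ℝ) (U : Set Plane), IsKernel p a → 0 < R →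
    0 < M → IsOpen U → WeakSol a U u → closedBall x₀ (2 * R) ⊆ U → (∀ x ∈ U, |u x| ≤ M) →
    (∀ x ∈ closedBall x₀ R, ‖∇ u x‖ ≤ C * M / R) ∧
    ∀ x ∈ closedBall x₀ (τ * R), ‖∇ u x - ∇ u x₀‖ ≤ κ * M / R := by
  obtain ⟨C, hC, hbd⟩ := exists_gradient_bound p hp
  refine ⟨C, hC, fun κ hκ => ?_⟩
  obtain ⟨τ, hτ, -, H⟩ := exists_gradient_osc p hp (κ / C) (by positivity)
  refine ⟨τ, hτ, fun a u x₀ R M U ha hR hM0 hU hsol hsub hM => ?_⟩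
  have hg : ∀ x ∈ closedBall x₀ R, ‖∇ u x‖ ≤ C * M / R := by
    intro x hx
    have hb : closedBall x R ⊆ U := (closedBall_subset_closedBall' (by
      linarith [mem_closedBall.1 hx])).trans hsub
    have := hbd a u x R M U ha hR hU hsol hb fun y hy => hM y (hb hy)
    rw [le_div_iff₀ hR]
    linarith
  refine ⟨hg, fun x hx => ?_⟩
  have := H a u x₀ R (C * M / R) ha hR (by positivity)
    (hsol.mono ((ball_subset_closedBall.trans
      (closedBall_subset_closedBall (by linarith))).trans hsub))
    (fun y hy => hg y (ball_subset_closedBall hy)) x hx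
  refine this.trans (le_of_eq ?_)
  field_simp

/-- Compactness: bounded weak solutions converge, along an ultrafilter, to a weak solution. -/
theorem exists_weakSol_limit (hp : 1 < p) (l : Ultrafilter ι) {A : ι → ℝ → ℝ}
    (hA : ∀ n, IsKernel p (A n))
    (hconv : ∀ ξ : Plane, Tendsto (fun q : ι × Plane => flux (A q.1) q.2)
      ((l : Filter ι) ×ˢ 𝓝 ξ) (𝓝 (flux a ξ)))
    {U : ι → Set Plane} (hUo : ∀ n, IsOpen (U n)) (hΩ : IsOpen Ω)
    (hex : ∀ x ∈ Ω, ∃ r > 0, ∀ᶠ n in l, closedBall x r ⊆ U n)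
    {u : ι → Plane → ℝ} (hu : ∀ n, WeakSol (A n) (U n) (u n)) {M : ℝ}
    (hM : ∀ n, ∀ x ∈ U n, |u n x| ≤ M) :
    ∃ v : Plane → ℝ, WeakSol a Ω v ∧ ∀ x ∈ Ω, Tendsto (fun n => u n x) l (𝓝 (v x)) := by
  wlog hM0 : 0 < M generalizing M
  · exact this (M := max M 1) (fun n x hx => (hM n x hx).trans (le_max_left _ _)) (by positivity)
  obtain ⟨C, hC, hmod⟩ := exists_gradient_modulus p hp
  have hexists : ∀ x ∈ Ω, (∃ y : ℝ, Tendsto (fun n => u n x) l (𝓝 y)) ∧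
      ∃ ξ : Plane, Tendsto (fun q : ι × Plane => ∇ (u q.1) q.2) ((l : Filter ι) ×ˢ 𝓝 x) (𝓝 ξ) := by
    intro x hx
    obtain ⟨r, hr, hsub⟩ := hex x hx
    have hr2 : 0 < r / 2 := by positivity
    constructor
    · obtain ⟨y, -, hy⟩ := (isCompact_Icc (a := -M) (b := M)).ultrafilter_le_nhds'
        (l.map fun n => u n x) (hsub.mono fun n hn =>
          abs_le.1 (hM n x (hn (mem_closedBall_self hr.le))))
      exact ⟨y, hy⟩
    · obtain ⟨τ₁, hτ₁, H₁⟩ := hmod 1 one_pos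
      obtain ⟨ξ, -, hξ⟩ := (isCompact_closedBall (0 : Plane) (C * M / (r / 2))).ultrafilter_le_nhds'
        (l.map fun n => ∇ (u n) x) (hsub.mono fun n hn => by
          have := (H₁ (A n) (u n) x (r / 2) M (U n) (hA n) hr2 hM0 (hUo n) (hu n)
            (by rwa [show 2 * (r / 2) = r by ring]) (hM n)).1 x (mem_closedBall_self hr2.le)
          simpa using this)
      refine ⟨ξ, Metric.tendsto_nhds.2 fun ε hε => ?_⟩
      obtain ⟨τ, hτ, H⟩ := hmod (ε / 2 * (r / 2) / M) (by positivity)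
      have hξ' : ∀ᶠ n in (l : Filter ι), dist (∇ (u n) x) ξ < ε / 2 :=
        (show Tendsto (fun n => ∇ (u n) x) l (𝓝 ξ) from hξ).eventually
          (ball_mem_nhds ξ (half_pos hε))
      have hball : ∀ᶠ y in 𝓝 x, y ∈ closedBall x (τ * (r / 2)) :=
        closedBall_mem_nhds x (by positivity)
      filter_upwards [(hsub.and hξ').prod_mk hball] with q hq
      obtain ⟨⟨h1, h2⟩, h3⟩ := hq
      have h4 := (H (A q.1) (u q.1) x (r / 2) M (U q.1) (hA _) hr2 hM0 (hUo _) (hu _)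
            (by rwa [show 2 * (r / 2) = r by ring]) (hM _)).2 q.2 h3
      have e : ε / 2 * (r / 2) / M * M / (r / 2) = ε / 2 := by field_simp
      rw [e, ← dist_eq_norm] at h4
      linarith [dist_triangle (∇ (u q.1) q.2) (∇ (u q.1) x) ξ]
  choose! v hv using fun x hx => (hexists x hx).1
  choose! G hG using fun x hx => (hexists x hx).2
  have hin : ∀ x ∈ Ω, ∀ᶠ q : ι × Plane in (l : Filter ι) ×ˢ 𝓝 x, q.2 ∈ U q.1 := by
    intro x hx
    obtain ⟨r, hr, hsub⟩ := hex x hx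
    exact (hsub.prod_mk (closedBall_mem_nhds x hr)).mono fun q hq => hq.1 hq.2
  obtain ⟨hvC, hvG⟩ := contDiffOn_of_tendsto (l := (l : Filter ι)) hΩ
    (fun x hx => (hin x hx).mono fun q hq => differentiableAt_of_contDiffOn (hu q.1).1 (hUo _) hq)
    hv hG
  have hflux : ∀ x ∈ Ω, Tendsto (fun q : ι × Plane => flux (A q.1) (∇ (u q.1) q.2))
      ((l : Filter ι) ×ˢ 𝓝 x) (𝓝 (flux a (∇ v x))) := fun x hx => by
    rw [hvG x hx]
    exact (hconv (G x)).comp (tendsto_fst.prodMk (hG x hx))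
  have hfc : ContinuousOn (fun x => flux a (∇ v x)) Ω :=
    continuousOn_of_tendsto_prod (F := fun n x => flux (A n) (∇ (u n) x)) hΩ hflux
  refine ⟨v, ⟨hvC, fun η hη hcs hs => ?_⟩, hv⟩
  have hgη := continuous_gradient hη
  have hI : Integrable fun x => ‖∇ η x‖ :=
    hgη.norm.integrable_of_hasCompactSupport (hasCompactSupport_gradient hcs).norm
  have hbound : ∀ ε > 0, |∫ x, ⟪flux a (∇ v x), ∇ η x⟫| ≤ ε * ∫ x, ‖∇ η x‖ := by
    intro ε hε
    have hev : ∀ᶠ n in (l : Filter ι), ∀ x ∈ tsupport η, x ∈ U n ∧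
        ‖flux a (∇ v x) - flux (A n) (∇ (u n) x)‖ ≤ ε := by
      refine eventually_forall_of_isCompact hcs fun x hx => (hin x (hs hx)).and ?_
      have h1 := (hflux x (hs hx)).eventually (ball_mem_nhds _ (half_pos hε))
      have h2 : ∀ᶠ q : ι × Plane in (l : Filter ι) ×ˢ 𝓝 x,
          flux a (∇ v q.2) ∈ ball (flux a (∇ v x)) (ε / 2) :=
        tendsto_snd.eventually ((hfc.continuousAt (hΩ.mem_nhds (hs hx))).eventually
          (ball_mem_nhds _ (half_pos hε)))
      filter_upwards [h1, h2] with q h3 h4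
      rw [mem_ball] at h4
      rw [← dist_eq_norm]
      have := dist_triangle_right (flux a (∇ v q.2)) (flux (A q.1) (∇ (u q.1) q.2))
        (flux a (∇ v x))
      linarith
    obtain ⟨n, hn⟩ := hev.exists
    have h0 := (hu n).2 η hη hcs fun x hx => (hn x hx).1
    have i1 : Integrable fun x => ⟪flux a (∇ v x), ∇ η x⟫ :=
      integrable_inner_gradient hΩ hfc hη hcs hs
    have i2 : Integrable fun x => ⟪flux (A n) (∇ (u n) x), ∇ η x⟫ :=
      integrable_inner_gradient (hUo n) (continuousOn_flux_gradient (hA n) hp (hUo n) (hu n).1)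
        hη hcs fun x hx => (hn x hx).1
    have e : ∫ x, ⟪flux a (∇ v x), ∇ η x⟫ =
        ∫ x, (⟪flux a (∇ v x), ∇ η x⟫ - ⟪flux (A n) (∇ (u n) x), ∇ η x⟫) := by
      rw [integral_sub i1 i2, h0, sub_zero]
    rw [e, ← integral_const_mul]
    refine abs_integral_le_integral_abs.trans (integral_mono (i1.sub i2).abs
      (hI.const_mul ε) fun x => ?_)
    simp only [← inner_sub_left]
    by_cases hx : x ∈ tsupport η
    · exact (abs_real_inner_le_norm _ _).trans
        (mul_le_mul_of_nonneg_right (hn x hx).2 (norm_nonneg _))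
    · simp [gradient_eq_zero_of_notMem_tsupport hx]
  have hI0 : 0 ≤ ∫ x, ‖∇ η x‖ := integral_nonneg fun x => norm_nonneg _
  by_contra hne
  have hpos := abs_pos.2 hne
  have := hbound (|∫ x, ⟪flux a (∇ v x), ∇ η x⟫| / (2 * ((∫ x, ‖∇ η x‖) + 1))) (by positivity)
  rw [div_mul_eq_mul_div, le_div_iff₀ (by positivity)] at this
  nlinarith

lemma tendsto_flux_const {l : Filter ι} (ha : IsKernel p a) (hp : 1 < p) (ξ : Plane) :
    Tendsto (fun q : ι × Plane => flux a q.2) (l ×ˢ 𝓝 ξ) (𝓝 (flux a ξ)) :=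
  (ha.continuous_flux hp).continuousAt.tendsto.comp tendsto_snd

lemma tendsto_flux_clamp {l : Filter ι} (hp : 1 < p) {ε : ι → ℝ} (hε : ∀ n, 0 < ε n)
    (hε1 : ∀ n, ε n ≤ 1) (hlim : Tendsto ε l (𝓝 0)) (ξ : Plane) :
    Tendsto (fun q : ι × Plane => flux (clampKernel p (ε q.1)) q.2) (l ×ˢ 𝓝 ξ)
      (𝓝 (flux (fun t => t ^ (p - 2)) ξ)) := by
  have h1 : Tendsto (fun q : ι × Plane => flux (clampKernel p (ε q.1)) q.2 -
      flux (fun t => t ^ (p - 2)) q.2) (l ×ˢ 𝓝 ξ) (𝓝 0) := by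
    have hz : Tendsto (fun q : ι × Plane => 2 * ε q.1 ^ (p - 1)) (l ×ˢ 𝓝 ξ) (𝓝 0) := by
      have : Tendsto (fun s : ℝ => 2 * s ^ (p - 1)) (𝓝 0) (𝓝 (2 * 0 ^ (p - 1))) :=
        ((Real.continuous_rpow_const (by linarith)).const_mul 2).tendsto 0 
      rw [Real.zero_rpow (by linarith), mul_zero] at this
      exact this.comp (hlim.comp tendsto_fst)
    refine squeeze_zero_norm' ?_ hz
    have h2 : ∀ᶠ n in l, ε n < (‖ξ‖ + 1)⁻¹ := hlim.eventually (gt_mem_nhds (by positivity))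
    have h3 : ∀ᶠ y in 𝓝 ξ, ‖y‖ < ‖ξ‖ + 1 :=
      continuous_norm.continuousAt.eventually (gt_mem_nhds (by linarith))
    filter_upwards [h2.prod_mk h3] with q hq
    refine norm_flux_clamp_sub_le hp (hε _) (hε1 _) ?_
    have := (lt_inv_comm₀ (hε q.1) (by positivity)).1 hq.1
    linarith [hq.2]
  have h2 := h1.add (tendsto_flux_const (l := l) (isKernel_rpow p) hp ξ)
  simpa using h2

end Compactness

/-- A strongly monotone Lipschitz field. -/
structure StrongMono (F : Plane → Plane) (m N : ℝ) : Prop where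
  pos : 0 < m
  pos' : 0 < N
  mono : ∀ ξ ζ, m * ‖ξ - ζ‖ ^ 2 ≤ ⟪F ξ - F ζ, ξ - ζ⟫
  lip : ∀ ξ ζ, ‖F ξ - F ζ‖ ≤ N * ‖ξ - ζ‖

/-- `u` solves `div F(∇ u) = 0` on `D` up to a defect `δ`. -/
def AlmostSol (F : Plane → Plane) (D : Set Plane) (δ : ℝ) (u : Plane → ℝ) : Prop :=
  ∀ η : Plane → ℝ, ContDiff ℝ 1 η → HasCompactSupport η → tsupport η ⊆ D →
    |∫ x, ⟪F (∇ u x), ∇ η x⟫| ≤ δ * (1 + ∫ x, ‖∇ η x‖ ^ 2)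

variable {F : Plane → Plane} {m N δ : ℝ} {D : Set Plane} {u : Plane → ℝ} {x₀ : Plane}

lemma StrongMono.continuous (hF : StrongMono F m N) : Continuous F := by
  have : LipschitzWith ⟨N, hF.pos'.le⟩ F := LipschitzWith.of_dist_le_mul fun ξ ζ => by
    rw [dist_eq_norm, dist_eq_norm]; exact hF.lip ξ ζ
  exact this.continuous

lemma AlmostSol.difference (hF : StrongMono F m N) (hu : ContDiff ℝ 1 u) (hs : AlmostSol F D δ u)
    {R d : ℝ} {h : Plane} (hd : ball x₀ d ⊆ D) (hh : R + ‖h‖ < d) {η : Plane → ℝ}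
    (hη : ContDiff ℝ 1 η) (hηs : tsupport η ⊆ closedBall x₀ R) :
    |∫ x, ⟪F (∇ u (x + h)) - F (∇ u x), ∇ η x⟫| ≤ 2 * δ * (1 + ∫ x, ‖∇ η x‖ ^ 2) := by
  have hc : HasCompactSupport η := (isCompact_closedBall x₀ R).of_isClosed_subset
    (isClosed_tsupport η) hηs
  have hfl : Continuous fun x => F (∇ u x) := hF.continuous.comp (continuous_gradient hu)
  have hfl' : Continuous fun x => F (∇ u (x + h)) := hfl.comp (continuous_id.add continuous_const)
  have h1 := hs η hη hc fun x hx => hd (mem_ball.2 (by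
    linarith [mem_closedBall.1 (hηs hx), norm_nonneg h]))
  have h2 := hs (fun x => η (x + -h)) (contDiff_translate hη _) (hasCompactSupport_comp_add hc _) (by
    rw [tsupport_comp_add]
    intro x hx
    have := add_mem_ball_of_norm_le (hηs hx) hh
    rw [neg_add_cancel_right] at this
    exact hd this)
  have e1 : ∫ x, ⟪F (∇ u x), ∇ (fun x => η (x + -h)) x⟫ = ∫ x, ⟪F (∇ u (x + h)), ∇ η x⟫ := by
    rw [← integral_add_right_eq_self (fun x => ⟪F (∇ u x), ∇ (fun x => η (x + -h)) x⟫) h]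
    simp only [gradient_comp_add, add_neg_cancel_right]
  have e2 : ∫ x, ‖∇ (fun x => η (x + -h)) x‖ ^ 2 = ∫ x, ‖∇ η x‖ ^ 2 := by
    simp only [gradient_comp_add]
    exact integral_add_right_eq_self (fun x => ‖∇ η x‖ ^ 2) (-h)
  rw [e1, e2] at h2
  have i1 : Integrable fun x => ⟪F (∇ u (x + h)), ∇ η x⟫ :=
    integrable_inner_gradient isOpen_univ hfl'.continuousOn hη hc (subset_univ _)
  have i2 : Integrable fun x => ⟪F (∇ u x), ∇ η x⟫ :=
    integrable_inner_gradient isOpen_univ hfl.continuousOn hη hc (subset_univ _)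
  have e := integral_sub i1 i2
  simp only [inner_sub_left]
  rw [e]
  refine (abs_sub _ _).trans ?_
  linarith

lemma caccioppoli_pointwise (hF : StrongMono F m N) {ξ ξ' g : Plane} {z w : ℝ} (hz0 : 0 ≤ z)
    (hz1 : z ≤ 1) :
    3 * m / 4 * (z ^ 2 * ‖ξ - ξ'‖ ^ 2) ≤
        ⟪F ξ - F ξ', (z * z) • (ξ - ξ') + w • (2 * z) • g⟫ + 4 * N ^ 2 / m * (w ^ 2 * ‖g‖ ^ 2) ∧
      ‖(z * z) • (ξ - ξ') + w • (2 * z) • g‖ ^ 2 ≤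
        2 * (z ^ 2 * ‖ξ - ξ'‖ ^ 2) + 8 * (w ^ 2 * ‖g‖ ^ 2) := by
  have hm := hF.pos
  have hN := hF.pos'
  constructor
  · rw [inner_add_right, inner_smul_right, inner_smul_right, inner_smul_right]
    have h1 := mul_le_mul_of_nonneg_left (hF.mono ξ ξ') (sq_nonneg z)
    have h2 : |w * (2 * z * ⟪F ξ - F ξ', g⟫)| ≤ |w| * (2 * z * (N * ‖ξ - ξ'‖ * ‖g‖)) := by
      rw [abs_mul, abs_mul, abs_of_nonneg (by positivity : 0 ≤ 2 * z)]
      gcongr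
      exact (abs_real_inner_le_norm _ _).trans (by gcongr; exact hF.lip ξ ξ')
    have h3 := neg_abs_le (w * (2 * z * ⟪F ξ - F ξ', g⟫))
    have h4 : |w| * (2 * z * (N * ‖ξ - ξ'‖ * ‖g‖)) ≤
        m / 4 * (z ^ 2 * ‖ξ - ξ'‖ ^ 2) + 4 * N ^ 2 / m * (w ^ 2 * ‖g‖ ^ 2) := by
      rw [← sq_abs w]
      have h5 : m / 4 * (z ^ 2 * ‖ξ - ξ'‖ ^ 2) + 4 * N ^ 2 / m * (|w| ^ 2 * ‖g‖ ^ 2) -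
          |w| * (2 * z * (N * ‖ξ - ξ'‖ * ‖g‖)) =
          (m * (z * ‖ξ - ξ'‖) / 2 - 2 * N * (|w| * ‖g‖)) ^ 2 / m := by
        field_simp; ring
      have h6 : 0 ≤ (m * (z * ‖ξ - ξ'‖) / 2 - 2 * N * (|w| * ‖g‖)) ^ 2 / m := by positivity
      linarith
    linarith
  · have h1 : ‖(z * z) • (ξ - ξ') + w • (2 * z) • g‖ ≤ z * ‖ξ - ξ'‖ + 2 * (|w| * ‖g‖) := by
      refine (norm_add_le _ _).trans ?_
      rw [norm_smul, norm_smul, norm_smul, Real.norm_eq_abs, Real.norm_eq_abs, Real.norm_eq_abs,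
        abs_of_nonneg (mul_nonneg hz0 hz0), abs_of_nonneg (by positivity : 0 ≤ 2 * z)]
      have h2 : z * z * ‖ξ - ξ'‖ ≤ z * 1 * ‖ξ - ξ'‖ := by gcongr
      have h3 : |w| * (2 * z * ‖g‖) ≤ |w| * (2 * 1 * ‖g‖) := by gcongr
      linarith
    have h2 := pow_le_pow_left₀ (norm_nonneg _) h1 2
    have h3 := sq_nonneg (z * ‖ξ - ξ'‖ - 2 * (|w| * ‖g‖))
    rw [← sq_abs w]
    nlinarith

lemma gradient_eq_zero_of_eq_max {ζ : Plane → ℝ} {c : ℝ} (h : ∀ x, ζ x ≤ c) {x : Plane}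
    (hx : ζ x = c) : ∇ ζ x = 0 := by
  have : IsLocalMax ζ x := Eventually.of_forall fun y => hx ▸ h y
  rw [gradient_def, this.fderiv_eq_zero, map_zero]

/-- Caccioppoli inequality for differences of almost solutions. -/
lemma exists_caccioppoli (hF : StrongMono F m N) : ∃ K : ℝ, 0 < K ∧ ∀ (D : Set Plane) (δ : ℝ)
    (u : Plane → ℝ) (x₀ h : Plane) (r d c : ℝ), ContDiff ℝ 1 u → AlmostSol F D δ u → 0 ≤ δ →
    δ ≤ m / 16 → 0 < r → ball x₀ d ⊆ D → 3 / 2 * r + ‖h‖ < d →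
    ∫ x in ball x₀ r, ‖∇ u (x + h) - ∇ u x‖ ^ 2 ≤
      4 * δ / m + K / r ^ 2 * ∫ x in annulus x₀ r (2 * r), (u (x + h) - u x - c) ^ 2 := by
  obtain ⟨Cζ, hCζ, hcut⟩ := exists_cutoff
  have hm := hF.pos
  have hN := hF.pos'
  refine ⟨(2 + 8 * N ^ 2 / m ^ 2) * Cζ ^ 2, by positivity, ?_⟩
  intro D δ u x₀ h r d c hu hs hδ hδm hr hd hh
  obtain ⟨ζ, hζ2, hζ0, hζ1, hζe, hζs, hζg, -⟩ := hcut x₀ r hr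
  have hζ : ContDiff ℝ 1 ζ := hζ2.of_le (by norm_num)
  set w := fun x => u (x + h) - u x - c with hw
  have hwc : ContDiff ℝ 1 w := (contDiff_difference hu h).sub contDiff_const
  have hgw : ∀ x, ∇ w x = ∇ u (x + h) - ∇ u x := fun x => by
    rw [← gradient_difference hu h x, hw, gradient_sub_const]
  set V := fun x => F (∇ u (x + h)) - F (∇ u x) with hV
  have hgu := continuous_gradient hu
  have hfl : Continuous fun x => F (∇ u x) := hF.continuous.comp hgu
  have hVc : Continuous V := (hfl.comp (continuous_id.add continuous_const)).sub hfl
  set η := fun y => ζ y * ζ y * w y with hη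
  have hηc : ContDiff ℝ 1 η := (hζ.mul hζ).mul hwc
  have hηs : tsupport η ⊆ closedBall x₀ (3 / 2 * r) := tsupport_sq_mul_subset.trans hζs
  have hz := hs.difference hF hu hd hh hηc hηs
  have hsub : closedBall x₀ (3 / 2 * r) ⊆ ball x₀ (2 * r) := closedBall_subset_ball (by linarith)
  have hη0 : ∀ x ∉ ball x₀ (2 * r), ∇ η x = 0 := fun x hx =>
    gradient_eq_zero_of_notMem_tsupport fun hx' => hx (hsub (hηs hx'))
  rw [integral_eq_setIntegral_ball (x₀ := x₀) (R := 2 * r) (f := fun x => ‖∇ η x‖ ^ 2)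
      (fun x hx => by simp [hη0 x hx]),
    integral_eq_setIntegral_ball (x₀ := x₀) (R := 2 * r)
      (f := fun x => ⟪F (∇ u (x + h)) - F (∇ u x), ∇ η x⟫) (fun x hx => by simp [hη0 x hx])] at hz
  have hz' := (le_abs_self _).trans hz
  have hgη := continuous_gradient hηc
  have hgζ := continuous_gradient hζ
  have hζc := hζ.continuous
  have hwcc := hwc.continuous
  have hgrad : ∀ x, ∇ η x = (ζ x * ζ x) • (∇ u (x + h) - ∇ u x) + w x • (2 * ζ x) • ∇ ζ x :=
    fun x => by rw [← hgw]; exact gradient_sq_mul hζ hwc x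
  have iA : IntegrableOn (fun x => ζ x ^ 2 * ‖∇ u (x + h) - ∇ u x‖ ^ 2) (ball x₀ (2 * r)) :=
    Continuous.integrableOn_ball (by fun_prop) x₀ _
  have iB : IntegrableOn (fun x => w x ^ 2 * ‖∇ ζ x‖ ^ 2) (ball x₀ (2 * r)) :=
    Continuous.integrableOn_ball (by fun_prop) x₀ _
  have iV : IntegrableOn (fun x => ⟪V x, ∇ η x⟫) (ball x₀ (2 * r)) :=
    Continuous.integrableOn_ball (hVc.inner hgη) x₀ _
  have iE : IntegrableOn (fun x => ‖∇ η x‖ ^ 2) (ball x₀ (2 * r)) :=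
    Continuous.integrableOn_ball (by fun_prop) x₀ _
  have hp1 := setIntegral_mono_on (iA.const_mul (3 * m / 4)) (iV.add (iB.const_mul (4 * N ^ 2 / m)))
    measurableSet_ball fun x _ => by
      have := (caccioppoli_pointwise hF (ξ := ∇ u (x + h)) (ξ' := ∇ u x) (g := ∇ ζ x) (w := w x)
        (hζ0 x) (hζ1 x)).1
      rw [← hgrad] at this
      exact this
  have hp2 := setIntegral_mono_on iE ((iA.const_mul 2).add (iB.const_mul 8))
    measurableSet_ball fun x _ => by
      have := (caccioppoli_pointwise hF (ξ := ∇ u (x + h)) (ξ' := ∇ u x) (g := ∇ ζ x) (w := w x)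
        (hζ0 x) (hζ1 x)).2
      rw [← hgrad] at this
      exact this
  simp only [Pi.add_apply] at hp1 hp2
  rw [integral_add iV (iB.const_mul (4 * N ^ 2 / m)), integral_const_mul, integral_const_mul] at hp1
  rw [integral_add (iA.const_mul 2) (iB.const_mul 8), integral_const_mul, integral_const_mul] at hp2
  have hB : ∫ x in ball x₀ (2 * r), w x ^ 2 * ‖∇ ζ x‖ ^ 2 ≤
      (Cζ / r) ^ 2 * ∫ x in annulus x₀ r (2 * r), w x ^ 2 := by
    have e : ∫ x in ball x₀ (2 * r), w x ^ 2 * ‖∇ ζ x‖ ^ 2 =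
        ∫ x in annulus x₀ r (2 * r), w x ^ 2 * ‖∇ ζ x‖ ^ 2 := by
      refine setIntegral_eq_of_subset_of_forall_sdiff_eq_zero measurableSet_ball
        (annulus_subset_ball _ _ _) fun x hx => ?_
      have : x ∈ closedBall x₀ r := by
        by_contra hcon
        exact hx.2 ⟨not_le.1 hcon, hx.1⟩
      rw [gradient_eq_zero_of_eq_max hζ1 (hζe x this)]; simp
    rw [e, ← integral_const_mul]
    refine setIntegral_mono_on (iB.mono_set (annulus_subset_ball _ _ _))
      ((Continuous.integrableOn_ball (by fun_prop) x₀ (2 * r)).mono_set (annulus_subset_ball _ _ _))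
      (isOpen_annulus _ _ _).measurableSet fun x _ => ?_
    rw [mul_comm]
    gcongr
    exact hζg x
  have hlow : ∫ x in ball x₀ r, ‖∇ u (x + h) - ∇ u x‖ ^ 2 ≤
      ∫ x in ball x₀ (2 * r), ζ x ^ 2 * ‖∇ u (x + h) - ∇ u x‖ ^ 2 := by
    have e : ∫ x in ball x₀ r, ‖∇ u (x + h) - ∇ u x‖ ^ 2 =
        ∫ x in ball x₀ r, ζ x ^ 2 * ‖∇ u (x + h) - ∇ u x‖ ^ 2 :=
      setIntegral_congr_fun measurableSet_ball fun x hx => by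
        simp [hζe x (ball_subset_closedBall hx)]
    rw [e]
    exact setIntegral_mono_set_of_nonneg (by fun_prop) (fun x => by positivity)
      (ball_subset_ball (by linarith)) isBounded_ball
  set A := ∫ x in ball x₀ (2 * r), ζ x ^ 2 * ‖∇ u (x + h) - ∇ u x‖ ^ 2
  set B := ∫ x in ball x₀ (2 * r), w x ^ 2 * ‖∇ ζ x‖ ^ 2
  set E := ∫ x in ball x₀ (2 * r), ‖∇ η x‖ ^ 2
  have hA0 : 0 ≤ A := integral_nonneg fun x => by positivity
  have hB0 : 0 ≤ B := integral_nonneg fun x => by positivity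
  have h1 : 2 * δ * (1 + E) ≤ 2 * δ * (1 + (2 * A + 8 * B)) := by gcongr
  have h2 : δ * A ≤ m / 16 * A := by gcongr
  have h3 : δ * B ≤ m / 16 * B := by gcongr
  have h4 : m / 2 * A ≤ 2 * δ + (m + 4 * N ^ 2 / m) * B := by
    have : ∫ x in ball x₀ (2 * r), ⟪V x, ∇ η x⟫ ≤ 2 * δ * (1 + E) := hz'
    linarith
  have h5 : A ≤ 4 * δ / m + (2 + 8 * N ^ 2 / m ^ 2) * B := by
    have : A = (m / 2 * A) * (2 / m) := by field_simp
    rw [this]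
    calc _ ≤ (2 * δ + (m + 4 * N ^ 2 / m) * B) * (2 / m) := by gcongr
      _ = _ := by field_simp; ring
  calc _ ≤ A := hlow
    _ ≤ _ := h5
    _ ≤ 4 * δ / m + (2 + 8 * N ^ 2 / m ^ 2) * ((Cζ / r) ^ 2 * ∫ x in annulus x₀ r (2 * r), w x ^ 2) := by
      gcongr
    _ = _ := by rw [div_pow]; ring

lemma le_geometric_of_le {J : ℕ → ℝ} {θ e : ℝ} (hθ : 0 ≤ θ) (hθ1 : θ < 1) (he : 0 ≤ e)
    (h : ∀ i, J (i + 1) ≤ θ * J i + e) (i : ℕ) : J i ≤ θ ^ i * J 0 + e / (1 - θ) := by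
  have h1 : 0 < 1 - θ := by linarith
  induction i with
  | zero => have : 0 ≤ e / (1 - θ) := by positivity
            simp; linarith
  | succ i ih =>
    have h2 : θ * (e / (1 - θ)) + e = e / (1 - θ) := by field_simp; ring
    have h3 := mul_le_mul_of_nonneg_left ih hθ
    calc _ ≤ _ := h i
      _ ≤ θ ^ (i + 1) * J 0 + (θ * (e / (1 - θ)) + e) := by rw [pow_succ]; linarith
      _ = _ := by rw [h2]

/-- Hole filling: decay of the `L²` norms of differences of gradients of almost solutions. -/
lemma exists_hole_filling (hF : StrongMono F m N) : ∃ C θ : ℝ, 0 < C ∧ 0 < θ ∧ θ < 1 ∧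
    ∀ (D : Set Plane) (δ : ℝ) (u : Plane → ℝ) (x₀ h : Plane) (R : ℝ), ContDiff ℝ 1 u →
    AlmostSol F D δ u → 0 ≤ δ → δ ≤ m / 16 → 0 < R → ball x₀ (4 * R) ⊆ D → ‖h‖ ≤ R → ∀ i : ℕ,
    ∫ x in ball x₀ (R / 2 ^ i), ‖∇ u (x + h) - ∇ u x‖ ^ 2 ≤
      C * (θ ^ i * (‖h‖ ^ 2 / R ^ 2 * ∫ x in ball x₀ (4 * R), ‖∇ u x‖ ^ 2) + δ) := by
  obtain ⟨K, hK, hcac⟩ := exists_caccioppoli hF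
  have hm := hF.pos
  set K₁ := K * (4 * (1 + 8 * Real.pi ^ 2)) with hK₁
  have hK₁0 : 0 < K₁ := by positivity
  set θ := K₁ / (1 + K₁) with hθ
  have hθ0 : 0 < θ := by positivity
  have hθ1 : θ < 1 := by rw [hθ, div_lt_one (by positivity)]; linarith
  have h1θ : 0 < 1 - θ := by linarith
  refine ⟨K + 4 / m + 4 / m / (1 - θ), θ, by positivity, hθ0, hθ1, ?_⟩
  intro D δ u x₀ h R hu hs hδ hδm hR hD hh i
  have hgu := continuous_gradient hu
  have hcont : Continuous fun x => ‖∇ u (x + h) - ∇ u x‖ ^ 2 := by fun_prop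
  set I := fun r => ∫ x in ball x₀ r, ‖∇ u (x + h) - ∇ u x‖ ^ 2 with hI
  have hpi : ∀ i : ℕ, R / 2 ^ i ≤ R := fun i =>
    div_le_self hR.le (one_le_pow₀ (by norm_num))
  have hstep : ∀ i : ℕ, I (R / 2 ^ (i + 1)) ≤ θ * I (R / 2 ^ i) + 4 * δ / m := by
    intro i
    set r := R / 2 ^ (i + 1) with hr
    have hr0 : 0 < r := by positivity
    have h2r : R / 2 ^ i = 2 * r := by rw [hr, pow_succ]; field_simp
    have hrR : r ≤ R := hpi _
    obtain ⟨c, hc⟩ := annulus_poincare (contDiff_difference hu h) x₀ hr0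
    have h1 := hcac D δ u x₀ h r (4 * R) c hu hs hδ hδm hr0 hD (by linarith)
    simp only [gradient_difference hu h] at hc
    have h2 : ∫ x in annulus x₀ r (2 * r), ‖∇ u (x + h) - ∇ u x‖ ^ 2 ≤ I (2 * r) - I r := by
      have hd : Disjoint (annulus x₀ r (2 * r)) (ball x₀ r) := by
        rw [Set.disjoint_left]; intro x hx hx'; exact (hx.1.trans hx').false
      have i1 : IntegrableOn (fun x => ‖∇ u (x + h) - ∇ u x‖ ^ 2) (ball x₀ (2 * r)) :=
        hcont.integrableOn_ball _ _
      have h3 := setIntegral_union hd measurableSet_ball (i1.mono_set (annulus_subset_ball _ _ _))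
        (hcont.integrableOn_ball x₀ r)
      have h4 : ∫ x in annulus x₀ r (2 * r) ∪ ball x₀ r, ‖∇ u (x + h) - ∇ u x‖ ^ 2 ≤ I (2 * r) :=
        setIntegral_mono_set_of_nonneg hcont (fun x => by positivity)
          (union_subset (annulus_subset_ball _ _ _) (ball_subset_ball (by linarith))) isBounded_ball
      rw [h3] at h4
      have : I r = ∫ x in ball x₀ r, ‖∇ u (x + h) - ∇ u x‖ ^ 2 := rfl
      linarith
    have h3 : I r ≤ 4 * δ / m + K₁ * (I (2 * r) - I r) := by
      calc I r ≤ _ := h1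
        _ ≤ 4 * δ / m + K / r ^ 2 * ((4 * (1 + 8 * Real.pi ^ 2)) * r ^ 2 * (I (2 * r) - I r)) := by
          have := hc.trans (mul_le_mul_of_nonneg_left h2 (by positivity))
          gcongr
        _ = _ := by rw [hK₁]; field_simp
    rw [h2r]
    have h4 : I r * (1 + K₁) ≤ 4 * δ / m + K₁ * I (2 * r) := by linarith
    have h5 : I r ≤ (4 * δ / m + K₁ * I (2 * r)) / (1 + K₁) := by
      rwa [le_div_iff₀ (by positivity)]
    have h6 : 4 * δ / m / (1 + K₁) ≤ 4 * δ / m := div_le_self (by positivity) (by linarith)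
    calc I r ≤ _ := h5
      _ = θ * I (2 * r) + 4 * δ / m / (1 + K₁) := by rw [hθ]; ring
      _ ≤ _ := by linarith
  have h0 : I R ≤ 4 * δ / m + K * (‖h‖ ^ 2 / R ^ 2 * ∫ x in ball x₀ (4 * R), ‖∇ u x‖ ^ 2) := by
    have h1 := hcac D δ u x₀ h R (4 * R) 0 hu hs hδ hδm hR hD (by linarith)
    have hcu : Continuous fun x => u (x + h) - u x := (contDiff_difference hu h).continuous
    have h2 : ∫ x in annulus x₀ R (2 * R), (u (x + h) - u x - 0) ^ 2 ≤
        ‖h‖ ^ 2 * ∫ x in ball x₀ (4 * R), ‖∇ u x‖ ^ 2 := by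
      simp only [sub_zero]
      calc _ ≤ ∫ x in ball x₀ (2 * R), (u (x + h) - u x) ^ 2 :=
            setIntegral_mono_set_of_nonneg (hcu.pow 2) (fun x => sq_nonneg _)
              (annulus_subset_ball _ _ _) isBounded_ball
        _ ≤ _ := integral_sq_difference_le hu x₀ h (2 * R)
        _ ≤ _ := mul_le_mul_of_nonneg_left (setIntegral_mono_set_of_nonneg (by fun_prop)
            (fun x => by positivity) (ball_subset_ball (by linarith)) isBounded_ball) (by positivity)
    calc I R ≤ _ := h1
      _ ≤ 4 * δ / m + K / R ^ 2 * (‖h‖ ^ 2 * ∫ x in ball x₀ (4 * R), ‖∇ u x‖ ^ 2) := by gcongr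
      _ = _ := by ring
  have hfin := le_geometric_of_le (J := fun i => I (R / 2 ^ i)) hθ0.le hθ1 (by positivity) hstep i
  simp only [pow_zero, div_one] at hfin
  set Q := ‖h‖ ^ 2 / R ^ 2 * ∫ x in ball x₀ (4 * R), ‖∇ u x‖ ^ 2
  have hQ : 0 ≤ Q := mul_nonneg (by positivity) (integral_nonneg fun x => by positivity)
  have hθi : θ ^ i ≤ 1 := pow_le_one₀ hθ0.le hθ1.le
  have hθi0 : 0 < θ ^ i := by positivity
  calc I (R / 2 ^ i) ≤ _ := hfin
    _ ≤ θ ^ i * (4 * δ / m + K * Q) + 4 * δ / m / (1 - θ) := by gcongr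
    _ ≤ 1 * (4 * δ / m) + K * (θ ^ i * Q) + 4 * δ / m / (1 - θ) := by
      have : θ ^ i * (4 * δ / m) ≤ 1 * (4 * δ / m) := by gcongr
      linarith
    _ = K * (θ ^ i * Q) + (4 / m + 4 / m / (1 - θ)) * δ := by ring
    _ ≤ K * (θ ^ i * Q) + (4 / m + 4 / m / (1 - θ)) * δ +
        ((4 / m + 4 / m / (1 - θ)) * (θ ^ i * Q) + K * δ) := le_add_of_nonneg_right (by positivity)
    _ = _ := by ring

section MollDifference
variable {r s : ℝ} (hr : 0 < r) {f : Plane → ℝ}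

lemma sq_moll_sub_le (hf : Continuous f) (x : Plane) (c : ℝ) :
    (moll hr f x - c) ^ 2 ≤ moll hr (fun y => (f y - c) ^ 2) x := by
  have h := sq_moll_le hr (f := fun y => f y - c) (by fun_prop) x
  rwa [moll_sub hr hf continuous_const, moll_const] at h

lemma setIntegral_sq_moll_sub_le (hf : Continuous f) {x₀ : Plane} {R K : ℝ}
    (h : ∀ z : Plane, ‖z‖ ≤ r → ∫ x in ball x₀ R, (f (x + z) - f x) ^ 2 ≤ K) :
    ∫ x in ball x₀ R, (moll hr f x - f x) ^ 2 ≤ K := by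
  have e1 : ∀ x, moll hr (fun y => (f y - f x) ^ 2) x =
      ∫ z in ball (0 : Plane) r, (bump hr).normed volume z * (f (x - z) - f x) ^ 2 := fun x =>
    integral_eq_setIntegral_ball fun z hz => by simp [bump_eq_zero hr hz]
  have hcb := (bump hr).continuous_normed (μ := (volume : Measure Plane))
  have hF : Continuous (Function.uncurry fun (x z : Plane) =>
      (bump hr).normed volume z * (f (x - z) - f x) ^ 2) :=
    (hcb.comp continuous_snd).mul (((hf.comp (by fun_prop)).sub (hf.comp continuous_fst)).pow 2)
  have hint := integrableOn_prod_of_continuous (μ := (volume : Measure Plane))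
    (ν := (volume : Measure Plane)) hF
    (isCompact_closedBall x₀ R) (isCompact_closedBall 0 r) ball_subset_closedBall
    ball_subset_closedBall
  have hm := (contDiff_moll hr hf).continuous
  have i1 : IntegrableOn (fun x => (moll hr f x - f x) ^ 2) (ball x₀ R) :=
    Continuous.integrableOn_ball (by fun_prop) _ _
  have hle := setIntegral_mono_on i1 hint.integral_prod_left measurableSet_ball fun x _ => by
    have := sq_moll_sub_le hr hf x (f x)
    rw [e1] at this
    exact this
  refine hle.trans ?_
  simp only [Function.uncurry_apply_pair]
  rw [integral_integral_swap hint]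
  have h1 : ∀ z ∈ ball (0 : Plane) r,
      ∫ x in ball x₀ R, (bump hr).normed volume z * (f (x - z) - f x) ^ 2 ≤
      (bump hr).normed volume z * K := by
    intro z hz
    rw [integral_const_mul]
    refine mul_le_mul_of_nonneg_left ?_ (bump_nonneg hr z)
    simp only [sub_eq_add_neg _ z]
    exact h (-z) (by rw [norm_neg]; exact (mem_ball_zero_iff.1 hz).le)
  refine (setIntegral_mono_on hint.integral_prod_right
    (Continuous.integrableOn_ball (by fun_prop) _ _) measurableSet_ball h1).trans (le_of_eq ?_)
  rw [integral_mul_const,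
    ← integral_eq_setIntegral_ball (fun z hz => bump_eq_zero hr hz),
    (bump hr).integral_normed, one_mul]

lemma setIntegral_double_difference_le (hr : 0 < r) (hf : Continuous f) {x₀ : Plane} {K : ℝ}
    (h : ∀ z : Plane, ‖z‖ ≤ 2 * r → ∫ x in ball x₀ r, (f (x + z) - f x) ^ 2 ≤ K) :
    ∫ y in ball x₀ r, ∫ z in ball x₀ r, (f z - f y) ^ 2 ≤ 4 * Real.pi * r ^ 2 * K := by
  have hF : Continuous (Function.uncurry fun (y z : Plane) => (f (y + z) - f y) ^ 2) :=
    ((hf.comp (continuous_fst.add continuous_snd)).sub (hf.comp continuous_fst)).pow 2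
  have hF' : Continuous (Function.uncurry fun (y z : Plane) => (f z - f y) ^ 2) :=
    ((hf.comp continuous_snd).sub (hf.comp continuous_fst)).pow 2
  have hint := integrableOn_prod_of_continuous (μ := (volume : Measure Plane))
    (ν := (volume : Measure Plane)) hF
    (isCompact_closedBall x₀ r) (isCompact_closedBall 0 (2 * r)) ball_subset_closedBall
    ball_subset_closedBall
  have hint' := integrableOn_prod_of_continuous (μ := (volume : Measure Plane))
    (ν := (volume : Measure Plane)) hF'
    (isCompact_closedBall x₀ r) (isCompact_closedBall x₀ r) ball_subset_closedBall
    ball_subset_closedBall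
  have h1 : ∀ y ∈ ball x₀ r, ∫ z in ball x₀ r, (f z - f y) ^ 2 ≤
      ∫ z in ball (0 : Plane) (2 * r), (f (y + z) - f y) ^ 2 := by
    intro y hy
    have := (measurePreserving_add_left volume y).setIntegral_preimage_emb
      (measurableEmbedding_addLeft y) (fun z => (f z - f y) ^ 2) (ball x₀ r)
    rw [← this]
    refine setIntegral_mono_set_of_nonneg (by fun_prop) (fun x => by positivity) ?_ isBounded_ball
    intro z hz
    rw [mem_preimage, mem_ball, dist_eq_norm] at hz
    rw [mem_ball, dist_eq_norm] at hy
    rw [mem_ball_zero_iff]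
    calc ‖z‖ = ‖(y + z - x₀) - (y - x₀)‖ := by congr 1; abel
      _ ≤ _ := norm_sub_le _ _
      _ < _ := by linarith
  refine (setIntegral_mono_on hint'.integral_prod_left hint.integral_prod_left
    measurableSet_ball h1).trans ?_
  simp only [Function.uncurry_apply_pair]
  rw [integral_integral_swap hint]
  have i2 : IntegrableOn (fun _ => K) (ball (0 : Plane) (2 * r)) :=
    Continuous.integrableOn_ball continuous_const _ _
  refine (setIntegral_mono_on hint.integral_prod_right i2 measurableSet_ball
    fun z hz => h z (mem_ball_zero_iff.1 hz).le).trans (le_of_eq ?_)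
  rw [setIntegral_const, volume_real_ball _ (by positivity), smul_eq_mul]
  ring

lemma sq_moll_sub_moll_le (hs : 0 < s) (hsr : s ≤ r) (hf : Continuous f) {x : Plane} {K : ℝ}
    (h : ∀ z : Plane, ‖z‖ ≤ 2 * r → ∫ y in ball x r, (f (y + z) - f y) ^ 2 ≤ K) :
    (moll hs f x - moll hr f x) ^ 2 ≤ 64 / (Real.pi * s ^ 2) * K := by
  set c := moll hr f x with hc
  have h1 : (moll hs f x - c) ^ 2 ≤ 4 / (Real.pi * s ^ 2) * ∫ y in ball x s, (f y - c) ^ 2 :=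
    (sq_moll_sub_le hs hf x c).trans
      (moll_le_setIntegral hs (f := fun y => (f y - c) ^ 2) (by fun_prop) (fun y => sq_nonneg _) x)
  have h2 : ∫ y in ball x s, (f y - c) ^ 2 ≤ ∫ y in ball x r, (f y - c) ^ 2 :=
    setIntegral_mono_set_of_nonneg (by fun_prop) (fun y => sq_nonneg _) (ball_subset_ball hsr)
      isBounded_ball
  have hF' : Continuous (Function.uncurry fun (y z : Plane) => (f z - f y) ^ 2) :=
    ((hf.comp continuous_snd).sub (hf.comp continuous_fst)).pow 2
  have hint' := integrableOn_prod_of_continuous (μ := (volume : Measure Plane))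
    (ν := (volume : Measure Plane)) hF'
    (isCompact_closedBall x r) (isCompact_closedBall x r) ball_subset_closedBall
    ball_subset_closedBall
  have i1 : IntegrableOn (fun y => (f y - c) ^ 2) (ball x r) :=
    Continuous.integrableOn_ball (by fun_prop) _ _
  have h3 := setIntegral_mono_on i1 (hint'.integral_prod_left.const_mul (4 / (Real.pi * r ^ 2)))
    measurableSet_ball fun y _ => by
      have := (sq_moll_sub_le hr hf x (f y)).trans
        (moll_le_setIntegral hr (f := fun z => (f z - f y) ^ 2) (by fun_prop)
          (fun y => sq_nonneg _) x)
      rw [← hc] at this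
      rw [show (f y - c) ^ 2 = (c - f y) ^ 2 by ring]
      exact this
  rw [integral_const_mul] at h3
  simp only [Function.uncurry_apply_pair] at h3
  have h4 := setIntegral_double_difference_le hr hf h
  calc _ ≤ _ := h1
    _ ≤ 4 / (Real.pi * s ^ 2) * (4 / (Real.pi * r ^ 2) * (4 * Real.pi * r ^ 2 * K)) := by
      refine mul_le_mul_of_nonneg_left (h2.trans (h3.trans ?_)) (by positivity)
      exact mul_le_mul_of_nonneg_left h4 (by positivity)
    _ = _ := by field_simp; ring

lemma sq_inner_le (ξ e : Plane) : ⟪ξ, e⟫ ^ 2 ≤ ‖ξ‖ ^ 2 * ‖e‖ ^ 2 := by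
  rw [← mul_pow, ← sq_abs]
  exact pow_le_pow_left₀ (abs_nonneg _) (abs_real_inner_le_norm _ _) 2

lemma sq_norm_le_of_inner {X : Plane} {B : ℝ} (hB : 0 ≤ B) (h : ∀ e, ⟪X, e⟫ ^ 2 ≤ B * ‖e‖ ^ 2) :
    ‖X‖ ^ 2 ≤ B := by
  have h1 := h X
  rw [real_inner_self_eq_norm_sq] at h1
  rcases (sq_nonneg ‖X‖).eq_or_lt' with h0 | h0
  · rw [h0]; exact hB
  · rw [pow_two (‖X‖ ^ 2)] at h1
    exact le_of_mul_le_mul_right h1 h0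


lemma sq_norm_gradient_moll_sub_le (hf : ContDiff ℝ 1 f)
    (hc : HasCompactSupport f) (hs : 0 < s) (hsr : s ≤ r) {x : Plane} {K : ℝ}
    (h : ∀ z : Plane, ‖z‖ ≤ 2 * r → ∫ y in ball x r, ‖∇ f (y + z) - ∇ f y‖ ^ 2 ≤ K) :
    ‖∇ (moll hs f) x - ∇ (moll hr f) x‖ ^ 2 ≤ 64 / (Real.pi * s ^ 2) * K := by
  have hg := continuous_gradient hf
  have hK : 0 ≤ K := (integral_nonneg fun x => sq_nonneg _).trans (h 0 (by simp; positivity))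
  refine sq_norm_le_of_inner (by positivity) fun e => ?_
  rw [inner_sub_left, inner_gradient_moll hs hf hc, inner_gradient_moll hr hf hc, mul_assoc]
  refine sq_moll_sub_moll_le hr hs hsr (by fun_prop) fun z hz => ?_
  refine le_trans ?_ (mul_le_mul_of_nonneg_right (h z hz) (sq_nonneg ‖e‖))
  rw [← integral_mul_const]
  refine setIntegral_mono_on (Continuous.integrableOn_ball (by fun_prop) _ _)
    (Continuous.integrableOn_ball (by fun_prop) _ _) measurableSet_ball fun y _ => ?_
  rw [← inner_sub_left]
  exact sq_inner_le _ _

lemma sq_norm_gradient_moll_le (hf : ContDiff ℝ 1 f)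
    (hc : HasCompactSupport f) (x : Plane) :
    ‖∇ (moll hr f) x‖ ^ 2 ≤ 4 / (Real.pi * r ^ 2) * ∫ y, ‖∇ f y‖ ^ 2 := by
  have hg := continuous_gradient hf
  have hi : Integrable fun y => ‖∇ f y‖ ^ 2 :=
    Continuous.integrable_of_hasCompactSupport (by fun_prop)
      ((hasCompactSupport_gradient hc).norm.comp_left (g := fun t => t ^ 2) (by simp))
  refine sq_norm_le_of_inner (mul_nonneg (by positivity) (integral_nonneg fun x => sq_nonneg _))
    fun e => ?_
  rw [inner_gradient_moll hr hf hc, mul_assoc]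
  refine (sq_moll_le_setIntegral hr (by fun_prop) x).trans ?_
  refine mul_le_mul_of_nonneg_left ?_ (by positivity)
  calc _ ≤ ∫ y in ball x r, ‖∇ f y‖ ^ 2 * ‖e‖ ^ 2 :=
        setIntegral_mono_on (Continuous.integrableOn_ball (by fun_prop) _ _)
          (Continuous.integrableOn_ball (by fun_prop) _ _) measurableSet_ball fun y _ =>
            sq_inner_le _ _
    _ = (∫ y in ball x r, ‖∇ f y‖ ^ 2) * ‖e‖ ^ 2 := integral_mul_const _ _
    _ ≤ _ := mul_le_mul_of_nonneg_right
      (setIntegral_le_integral hi (Eventually.of_forall fun x => sq_nonneg _)) (by positivity)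

lemma setIntegral_sq_norm_gradient_moll_sub_le (hf : ContDiff ℝ 1 f)
    (hc : HasCompactSupport f) {x₀ : Plane} {R K : ℝ}
    (h : ∀ z : Plane, ‖z‖ ≤ r → ∫ x in ball x₀ R, ‖∇ f (x + z) - ∇ f x‖ ^ 2 ≤ K) :
    ∫ x in ball x₀ R, ‖∇ (moll hr f) x - ∇ f x‖ ^ 2 ≤ 2 * K := by
  have hg := continuous_gradient hf
  have hm := contDiff_moll hr hf.continuous
  have hgm := continuous_gradient hm
  have key : ∀ i : Fin 2, ∫ x in ball x₀ R, ((∇ (moll hr f) x - ∇ f x) i) ^ 2 ≤ K := by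
    intro i
    have e1 : ∀ ξ : Plane, ⟪ξ, EuclideanSpace.single i (1 : ℝ)⟫ = ξ i := fun ξ => by
      rw [EuclideanSpace.inner_single_right]; simp
    have e2 : ∀ x, ∇ (moll hr f) x i = moll hr (fun y => (∇ f y) i) x := fun x => by
      rw [← e1, inner_gradient_moll hr hf hc]; simp only [e1]
    simp only [PiLp.sub_apply, e2]
    refine setIntegral_sq_moll_sub_le hr (f := fun y => (∇ f y) i) (by fun_prop) fun z hz => ?_
    refine le_trans ?_ (h z hz)
    refine setIntegral_mono_on (Continuous.integrableOn_ball (by fun_prop) _ _)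
      (Continuous.integrableOn_ball (by fun_prop) _ _) measurableSet_ball fun y _ => ?_
    rw [← PiLp.sub_apply, ← sq_abs]
    exact pow_le_pow_left₀ (abs_nonneg _) (abs_apply_le_norm i _) 2
  have e : ∀ x, ‖∇ (moll hr f) x - ∇ f x‖ ^ 2 =
      ((∇ (moll hr f) x - ∇ f x) 0) ^ 2 + ((∇ (moll hr f) x - ∇ f x) 1) ^ 2 := fun x => by
    rw [EuclideanSpace.norm_sq_eq]; simp
  have i0 : ∀ i : Fin 2, IntegrableOn (fun x => ((∇ (moll hr f) x - ∇ f x) i) ^ 2) (ball x₀ R) :=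
    fun i => Continuous.integrableOn_ball (by fun_prop) _ _
  simp only [e]
  rw [integral_add (i0 0) (i0 1)]
  linarith [key 0, key 1]

end MollDifference

/-- A function with small mean square and small gradient on a ball is small. -/
lemma abs_le_of_setIntegral_sq_le {f : Plane → ℝ} (hf : ContDiff ℝ 1 f) {x₀ x : Plane}
    {ρ A B : ℝ} (hρ : 0 < ρ) (hB : 0 ≤ B) (h1 : ∫ y in ball x₀ ρ, f y ^ 2 ≤ Real.pi * ρ ^ 2 * B ^ 2)
    (h2 : ∀ y ∈ ball x₀ ρ, ‖∇ f y‖ ≤ A) (hx : x ∈ ball x₀ ρ) : |f x| ≤ B + 2 * ρ * A := by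
  by_contra hcon
  rw [not_le] at hcon
  have hA : 0 ≤ A := (norm_nonneg _).trans (h2 x hx)
  set t := |f x| - 2 * ρ * A with ht
  have htB : B < t := by linarith
  have h3 : ∀ y ∈ ball x₀ ρ, t ^ 2 ≤ f y ^ 2 := by
    intro y hy
    have hd := (convex_ball x₀ ρ).norm_image_sub_le_of_norm_fderiv_le
      (f := f) (𝕜 := ℝ) (C := A) (fun y _ => hf.differentiable one_ne_zero y)
      (fun y hy => by rw [← norm_gradient]; exact h2 y hy) hy hx
    have hxy : ‖x - y‖ ≤ 2 * ρ := by
      rw [← dist_eq_norm]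
      have := dist_triangle_right x y x₀
      rw [mem_ball] at hx hy
      linarith
    have hd2 : |f x - f y| ≤ A * (2 * ρ) := hd.trans (by gcongr)
    have hd3 := abs_sub_abs_le_abs_sub (f x) (f y)
    rw [← sq_abs (f y)]
    exact pow_le_pow_left₀ (by linarith) (by linarith) 2
  have i1 : IntegrableOn (fun _ => t ^ 2) (ball x₀ ρ) :=
    Continuous.integrableOn_ball continuous_const _ _
  have i2 : IntegrableOn (fun y => f y ^ 2) (ball x₀ ρ) :=
    Continuous.integrableOn_ball (hf.continuous.pow 2) _ _
  have h4 := setIntegral_mono_on i1 i2 measurableSet_ball h3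
  rw [setIntegral_const, volume_real_ball _ hρ.le, smul_eq_mul] at h4
  have h5 : B ^ 2 < t ^ 2 := pow_lt_pow_left₀ htB hB two_ne_zero
  have := mul_lt_mul_of_pos_left h5 (by positivity : 0 < Real.pi * ρ ^ 2)
  linarith

/-- A sequence of almost solutions which is rapidly Cauchy in energy. -/
structure ApproxSeq (F : Plane → Plane) (m N : ℝ) (D : Set Plane) (A : ℝ)
    (u : ℕ → Plane → ℝ) : Prop where
  mono : StrongMono F m N
  contDiff : ∀ j, ContDiff ℝ 1 (u j)
  compact : ∀ j, HasCompactSupport (u j)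
  nonneg : 0 ≤ A
  almost : ∀ j, AlmostSol F D (m / 16 / 64 ^ j) (u j)
  bound : ∀ j, ∫ x, ‖∇ (u j) x‖ ^ 2 ≤ A
  cauchy_grad : ∀ j, ∫ x, ‖∇ (fun y => u (j + 1) y - u j y) x‖ ^ 2 ≤ A / 64 ^ j
  cauchy : ∀ j, ∫ x, (u (j + 1) x - u j x) ^ 2 ≤ A / 64 ^ j

lemma inv_two_pow_pos (j : ℕ) : (0 : ℝ) < 1 / 2 ^ j := by positivity

/-- Mollification at the scale `2 ^ (-j)`. -/
noncomputable def dyadicMoll (u : ℕ → Plane → ℝ) (j : ℕ) : Plane → ℝ :=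
  moll (inv_two_pow_pos j) (u j)

variable {F : Plane → Plane} {m N A : ℝ} {D : Set Plane} {u : ℕ → Plane → ℝ} {x₀ : Plane}

lemma ApproxSeq.contDiff_dyadicMoll (h : ApproxSeq F m N D A u) (j : ℕ) :
    ContDiff ℝ 1 (dyadicMoll u j) := contDiff_moll _ (h.contDiff j).continuous

lemma integrable_sq_norm_gradient {f : Plane → ℝ} (hf : ContDiff ℝ 1 f)
    (hc : HasCompactSupport f) : Integrable fun y => ‖∇ f y‖ ^ 2 := by
  have hg := continuous_gradient hf
  exact Continuous.integrable_of_hasCompactSupport (by fun_prop)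
    ((hasCompactSupport_gradient hc).norm.comp_left (g := fun t => t ^ 2) (by simp))

lemma integrable_sq_of_compactSupport {f : Plane → ℝ} (hf : Continuous f)
    (hc : HasCompactSupport f) : Integrable fun y => f y ^ 2 :=
  Continuous.integrable_of_hasCompactSupport (by fun_prop)
    (hc.comp_left (g := fun t => t ^ 2) (by simp))

lemma ApproxSeq.setIntegral_le (h : ApproxSeq F m N D A u) (j : ℕ) (S : Set Plane) :
    ∫ x in S, ‖∇ (u j) x‖ ^ 2 ≤ A :=
  (setIntegral_le_integral (integrable_sq_norm_gradient (h.contDiff j) (h.compact j))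
    (Eventually.of_forall fun _ => sq_nonneg _)).trans (h.bound j)

/-- Geometric decay of the increments of the gradients of the mollified sequence. -/
lemma ApproxSeq.exists_gradient_decay (h : ApproxSeq F m N D A u) : ∃ θ : ℝ, 1 / 4 ≤ θ ∧ θ < 1 ∧
    ∀ k : ℕ, ∃ B : ℝ, 0 ≤ B ∧ ∀ x : Plane, ball x (4 * (1 / 2 ^ k)) ⊆ D → ∀ i : ℕ, 1 ≤ i →
    ‖∇ (dyadicMoll u (k + i + 1)) x - ∇ (dyadicMoll u (k + i)) x‖ ^ 2 ≤ B * θ ^ i := by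
  obtain ⟨C, θ, hC, hθ0, hθ1, hhole⟩ := exists_hole_filling h.mono
  have hm := h.mono.pos
  have hA := h.nonneg
  refine ⟨max θ (1 / 4), le_max_right _ _, max_lt hθ1 (by norm_num), fun k => ?_⟩
  set q := max θ (1 / 4) with hq
  have hqθ : θ ≤ q := le_max_left _ _
  have hq4 : 1 / 4 ≤ q := le_max_right _ _
  set R : ℝ := 1 / 2 ^ k with hR
  have hR0 : 0 < R := inv_two_pow_pos k
  refine ⟨2 * (16 * A / (Real.pi * R ^ 2)) + 2 * (256 * C / (Real.pi * R ^ 2) * (4 * A + m / 16)),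
    by positivity, ?_⟩
  intro x hx i hi
  set j := k + i with hj
  have hr : (1 : ℝ) / 2 ^ j = R / 2 ^ i := by rw [hj, hR, pow_add]; field_simp
  have hs : (1 : ℝ) / 2 ^ (j + 1) = R / 2 ^ i / 2 := by rw [pow_succ, ← hr]; field_simp
  have h4i : ((2 : ℝ) ^ i) ^ 2 = 4 ^ i := by rw [← pow_mul, mul_comm, pow_mul]; norm_num
  have h64 : (1 : ℝ) / 64 ^ j ≤ 1 / (4 ^ i * 4 ^ i) := by
    rw [← mul_pow, hj, pow_add]
    refine one_div_le_one_div_of_le (by positivity) ?_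
    calc ((4 : ℝ) * 4) ^ i ≤ 64 ^ i := pow_le_pow_left₀ (by norm_num) (by norm_num) _
      _ ≤ 64 ^ k * 64 ^ i := le_mul_of_one_le_left (by positivity) (one_le_pow₀ (by norm_num))
  have hqi : (1 : ℝ) / 4 ^ i ≤ q ^ i := by
    rw [← one_div_pow]; exact pow_le_pow_left₀ (by norm_num) hq4 i
  have hθi : θ ^ i ≤ q ^ i := pow_le_pow_left₀ hθ0.le hqθ i
  have hp4 : (0 : ℝ) < 4 ^ i := by positivity
  set M := moll (inv_two_pow_pos (j + 1)) (u j) with hM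
  have hsub : dyadicMoll u (j + 1) = fun y => M y + moll (inv_two_pow_pos (j + 1))
      (fun y => u (j + 1) y - u j y) y := by
    funext y
    rw [moll_sub _ (h.contDiff _).continuous (h.contDiff _).continuous]
    simp [dyadicMoll, hM]
  have hcd : ContDiff ℝ 1 fun y => u (j + 1) y - u j y := (h.contDiff _).sub (h.contDiff _)
  have hcs : HasCompactSupport fun y => u (j + 1) y - u j y := (h.compact _).sub (h.compact _)
  have hgr : ∇ (dyadicMoll u (j + 1)) x = ∇ M x + ∇ (moll (inv_two_pow_pos (j + 1))
      (fun y => u (j + 1) y - u j y)) x := by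
    rw [hsub]
    exact gradient_add
      ((contDiff_moll _ (h.contDiff _).continuous).differentiable one_ne_zero x)
      ((contDiff_moll _ hcd.continuous).differentiable one_ne_zero x)
  have h1 := sq_norm_gradient_moll_le (inv_two_pow_pos (j + 1)) hcd hcs x
  have h1' : ‖∇ (moll (inv_two_pow_pos (j + 1)) (fun y => u (j + 1) y - u j y)) x‖ ^ 2 ≤
      16 * A / (Real.pi * R ^ 2) * q ^ i := by
    calc _ ≤ _ := h1
      _ ≤ 4 / (Real.pi * (1 / 2 ^ (j + 1)) ^ 2) * (A * (1 / (4 ^ i * 4 ^ i))) := by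
        refine mul_le_mul_of_nonneg_left ((h.cauchy_grad j).trans ?_) (by positivity)
        rw [div_eq_mul_one_div]
        exact mul_le_mul_of_nonneg_left h64 hA
      _ = 16 * A / (Real.pi * R ^ 2) * (1 / 4 ^ i) := by
        rw [hs, div_pow, div_pow, h4i]; field_simp; ring
      _ ≤ _ := mul_le_mul_of_nonneg_left hqi (by positivity)
  have h2i : (2 : ℝ) ≤ 2 ^ i := by
    calc (2 : ℝ) = 2 ^ 1 := by norm_num
      _ ≤ 2 ^ i := pow_le_pow_right₀ (by norm_num) hi
  have hdj : (0 : ℝ) ≤ m / 16 / 64 ^ j := by positivity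
  have h2 := sq_norm_gradient_moll_sub_le (inv_two_pow_pos j) (h.contDiff j) (h.compact j)
    (inv_two_pow_pos (j + 1)) (by rw [hs, hr]; linarith [show 0 < R / 2 ^ i by positivity]) (x := x)
    (K := C * (θ ^ i * (4 / 4 ^ i * A) + m / 16 * (1 / (4 ^ i * 4 ^ i)))) (by
      intro z hz
      rw [hr] at hz ⊢
      have hzR : ‖z‖ ≤ R := by
        refine hz.trans ?_
        rw [← mul_div_assoc, div_le_iff₀ (by positivity), mul_comm]
        exact mul_le_mul_of_nonneg_left h2i hR0.le
      refine (hhole D _ (u j) x z R (h.contDiff j) (h.almost j) hdj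
        (div_le_self (by positivity) (one_le_pow₀ (by norm_num))) hR0 hx hzR i).trans ?_
      refine mul_le_mul_of_nonneg_left (add_le_add ?_ ?_) hC.le
      · refine mul_le_mul_of_nonneg_left ?_ (by positivity)
        refine mul_le_mul ?_ (h.setIntegral_le j _) (integral_nonneg fun x => sq_nonneg _)
          (by positivity)
        rw [div_le_iff₀ (by positivity)]
        calc ‖z‖ ^ 2 ≤ (2 * (R / 2 ^ i)) ^ 2 := pow_le_pow_left₀ (norm_nonneg _) hz 2
          _ = _ := by rw [mul_pow, div_pow, h4i]; ring
      · rw [div_eq_mul_one_div]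
        exact mul_le_mul_of_nonneg_left h64 (by positivity))
  have h2' : ‖∇ M x - ∇ (dyadicMoll u j) x‖ ^ 2 ≤
      256 * C / (Real.pi * R ^ 2) * (4 * A + m / 16) * q ^ i := by
    calc _ ≤ _ := h2
      _ = 256 * C / (Real.pi * R ^ 2) * (θ ^ i * (4 * A) + m / 16 * (1 / 4 ^ i)) := by
        rw [hs, div_pow, div_pow, h4i]; field_simp; norm_num
      _ ≤ 256 * C / (Real.pi * R ^ 2) * (q ^ i * (4 * A) + m / 16 * q ^ i) := by gcongr
      _ = _ := by ring
  have e : ∇ (dyadicMoll u (j + 1)) x - ∇ (dyadicMoll u j) x =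
      ∇ (moll (inv_two_pow_pos (j + 1)) (fun y => u (j + 1) y - u j y)) x +
        (∇ M x - ∇ (dyadicMoll u j) x) := by rw [hgr]; abel
  rw [e]
  set X := ∇ (moll (inv_two_pow_pos (j + 1)) (fun y => u (j + 1) y - u j y)) x
  set Y := ∇ M x - ∇ (dyadicMoll u j) x
  have h3 := pow_le_pow_left₀ (norm_nonneg _) (norm_add_le X Y) 2
  nlinarith [sq_nonneg (‖X‖ - ‖Y‖)]

lemma ApproxSeq.setIntegral_sq_moll_sub_le (h : ApproxSeq F m N D A u) (j : ℕ) {r : ℝ} (hr : 0 < r)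
    (x₀ : Plane) (R : ℝ) : ∫ x in ball x₀ R, (moll hr (u j) x - u j x) ^ 2 ≤ r ^ 2 * A := by
  refine PLaplace.setIntegral_sq_moll_sub_le hr (h.contDiff j).continuous fun z hz => ?_
  refine (integral_sq_difference_le (h.contDiff j) x₀ z R).trans ?_
  exact mul_le_mul (pow_le_pow_left₀ (norm_nonneg _) hz 2) (h.setIntegral_le j _)
    (integral_nonneg fun x => sq_nonneg _) (by positivity)

lemma ApproxSeq.setIntegral_sq_dyadicMoll_sub_le (h : ApproxSeq F m N D A u) (j : ℕ)
    (x₀ : Plane) (R : ℝ) :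
    ∫ x in ball x₀ R, (dyadicMoll u (j + 1) x - dyadicMoll u j x) ^ 2 ≤ 9 * A * (1 / 4 ^ j) := by
  have hA := h.nonneg
  set s1 := inv_two_pow_pos (j + 1)
  set s0 := inv_two_pow_pos j
  have hcd : ContDiff ℝ 1 fun y => u (j + 1) y - u j y := (h.contDiff _).sub (h.contDiff _)
  have hcs : HasCompactSupport fun y => u (j + 1) y - u j y := (h.compact _).sub (h.compact _)
  have hu := (h.contDiff j).continuous
  have hm1 := (contDiff_moll s1 hu).continuous
  have hm0 := (contDiff_moll s0 hu).continuous
  have hm2 := (contDiff_moll s1 hcd.continuous).continuous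
  have i1 : IntegrableOn (fun x => (moll s1 (fun y => u (j + 1) y - u j y) x) ^ 2) (ball x₀ R) :=
    Continuous.integrableOn_ball (by fun_prop) _ _
  have i2 : IntegrableOn (fun x => (moll s1 (u j) x - u j x) ^ 2) (ball x₀ R) :=
    Continuous.integrableOn_ball (by fun_prop) _ _
  have i3 : IntegrableOn (fun x => (moll s0 (u j) x - u j x) ^ 2) (ball x₀ R) :=
    Continuous.integrableOn_ball (by fun_prop) _ _
  have hv1 := (h.contDiff_dyadicMoll (j + 1)).continuous
  have hv0 := (h.contDiff_dyadicMoll j).continuous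
  have i0 : IntegrableOn (fun x => (dyadicMoll u (j + 1) x - dyadicMoll u j x) ^ 2) (ball x₀ R) :=
    Continuous.integrableOn_ball (by fun_prop) _ _
  have i12 : IntegrableOn (fun x => 3 * (moll s1 (fun y => u (j + 1) y - u j y) x) ^ 2 +
      3 * (moll s1 (u j) x - u j x) ^ 2) (ball x₀ R) := (i1.const_mul 3).add (i2.const_mul 3)
  have hle := setIntegral_mono_on i0 (i12.add (i3.const_mul 3))
    measurableSet_ball fun x _ => by
      simp only [Pi.add_apply]
      have e : dyadicMoll u (j + 1) x - dyadicMoll u j x = moll s1 (fun y => u (j + 1) y - u j y) x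
          + (moll s1 (u j) x - u j x) - (moll s0 (u j) x - u j x) := by
        rw [moll_sub _ (h.contDiff _).continuous (h.contDiff _).continuous]
        simp [dyadicMoll]
      rw [e]
      set a := moll s1 (fun y => u (j + 1) y - u j y) x
      set b := moll s1 (u j) x - u j x
      set c := moll s0 (u j) x - u j x
      nlinarith [sq_nonneg (a - b), sq_nonneg (a + c), sq_nonneg (b + c)]
  simp only [Pi.add_apply] at hle
  rw [integral_add i12 (i3.const_mul 3), integral_add (i1.const_mul 3) (i2.const_mul 3), integral_const_mul, integral_const_mul,
    integral_const_mul] at hle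
  have h1 := (setIntegral_sq_moll_le s1 hcd.continuous x₀ R).trans
    ((setIntegral_le_integral (integrable_sq_of_compactSupport hcd.continuous hcs)
      (Eventually.of_forall fun x => sq_nonneg _)).trans (h.cauchy j))
  have h2 := h.setIntegral_sq_moll_sub_le j s1 x₀ R
  have h3 := h.setIntegral_sq_moll_sub_le j s0 x₀ R
  have h4j : ((2 : ℝ) ^ j) ^ 2 = 4 ^ j := by rw [← pow_mul, mul_comm, pow_mul]; norm_num
  have e0 : ((1 : ℝ) / 2 ^ j) ^ 2 = 1 / 4 ^ j := by rw [div_pow, h4j, one_pow]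
  have e1 : ((1 : ℝ) / 2 ^ (j + 1)) ^ 2 ≤ 1 / 4 ^ j := by
    rw [← e0]
    exact pow_le_pow_left₀ (by positivity) (one_div_le_one_div_of_le (by positivity)
      (pow_le_pow_right₀ (by norm_num) (by omega))) 2
  have e2 : A / 64 ^ j ≤ 1 / 4 ^ j * A := by
    rw [div_eq_mul_one_div, mul_comm]
    exact mul_le_mul_of_nonneg_right (one_div_le_one_div_of_le (by positivity)
      (pow_le_pow_left₀ (by norm_num) (by norm_num) _)) hA
  rw [e0] at h3
  have h2' := h2.trans (mul_le_mul_of_nonneg_right e1 hA)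
  linarith

variable {F : Plane → Plane} {m N A : ℝ} {D : Set Plane} {u : ℕ → Plane → ℝ} {x₀ : Plane}

lemma exists_dyadic_ball_subset (hD : IsOpen D) (hx : x₀ ∈ D) :
    ∃ k : ℕ, ball x₀ (8 * (1 / 2 ^ k)) ⊆ D := by
  obtain ⟨ε, hε, hb⟩ := Metric.isOpen_iff.1 hD x₀ hx
  obtain ⟨k, hk⟩ := exists_pow_lt_of_lt_one (show 0 < ε / 8 by positivity)
    (show (1 / 2 : ℝ) < 1 by norm_num)
  refine ⟨k, (ball_subset_ball ?_).trans hb⟩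
  rw [one_div_pow] at hk
  linarith

lemma ApproxSeq.exists_local_decay (h : ApproxSeq F m N D A u) {k : ℕ}
    (hk : ball x₀ (8 * (1 / 2 ^ k)) ⊆ D) : ∃ B Q : ℝ, 0 ≤ B ∧ 0 ≤ Q ∧ Q < 1 ∧ ∀ n : ℕ,
    ∀ x ∈ ball x₀ (1 / 2 ^ k),
      ‖∇ (dyadicMoll u (k + 1 + n + 1)) x - ∇ (dyadicMoll u (k + 1 + n)) x‖ ≤ B * Q ^ n ∧
      |dyadicMoll u (k + 1 + n + 1) x - dyadicMoll u (k + 1 + n) x| ≤ B * Q ^ n := by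
  obtain ⟨θ, hθ4, hθ1, hdec⟩ := h.exists_gradient_decay
  obtain ⟨B₀, hB₀, hdec⟩ := hdec k
  have hA := h.nonneg
  set R : ℝ := 1 / 2 ^ k with hR
  have hR0 : 0 < R := inv_two_pow_pos k
  have hθ0 : 0 ≤ θ := by linarith
  set Q := √θ with hQ
  have hQ0 : 0 ≤ Q := Real.sqrt_nonneg _
  have hQ1 : Q < 1 := by rw [hQ, Real.sqrt_lt' one_pos]; simpa using hθ1
  have hQ2 : Q ^ 2 = θ := Real.sq_sqrt hθ0
  set b := √(9 * A / (Real.pi * R ^ 2)) with hb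
  have hb0 : 0 ≤ b := Real.sqrt_nonneg _
  have hs0 : 0 ≤ √B₀ := Real.sqrt_nonneg _
  have hgrad : ∀ n : ℕ, ∀ x ∈ ball x₀ R,
      ‖∇ (dyadicMoll u (k + 1 + n + 1)) x - ∇ (dyadicMoll u (k + 1 + n)) x‖ ≤ √B₀ * Q ^ n := by
    intro n x hx
    have h1 := hdec x ((ball_subset_ball' (by
      have := mem_ball.1 hx
      linarith)).trans hk) (n + 1) (by omega)
    rw [show k + (n + 1) = k + 1 + n by ring] at h1
    refine abs_le_of_sq_le_sq' ?_ (by positivity) |>.2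
    refine h1.trans ?_
    rw [mul_pow, Real.sq_sqrt hB₀, ← pow_mul, mul_comm n 2, pow_mul, hQ2]
    exact mul_le_mul_of_nonneg_left (pow_le_pow_of_le_one hθ0 hθ1.le (by omega)) hB₀
  refine ⟨√B₀ + (b + 2 * R * √B₀), Q, by positivity, hQ0, hQ1, fun n x hx => ⟨?_, ?_⟩⟩
  · refine (hgrad n x hx).trans ?_
    have := pow_nonneg hQ0 n
    gcongr
    linarith [show 0 ≤ b + 2 * R * √B₀ by positivity]
  · have hcd : ContDiff ℝ 1 fun y => dyadicMoll u (k + 1 + n + 1) y - dyadicMoll u (k + 1 + n) y :=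
      (h.contDiff_dyadicMoll _).sub (h.contDiff_dyadicMoll _)
    have h2 := abs_le_of_setIntegral_sq_le hcd hR0 (B := b * Q ^ n) (A := √B₀ * Q ^ n) (x := x)
      (x₀ := x₀) (by positivity) (by
        refine (h.setIntegral_sq_dyadicMoll_sub_le (k + 1 + n) x₀ R).trans ?_
        rw [mul_pow, hb, Real.sq_sqrt (by positivity), ← pow_mul, mul_comm n 2, pow_mul, hQ2]
        have e : Real.pi * R ^ 2 * (9 * A / (Real.pi * R ^ 2) * θ ^ n) = 9 * A * θ ^ n := by
          field_simp
        rw [e]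
        refine mul_le_mul_of_nonneg_left ?_ (by positivity)
        rw [← one_div_pow]
        calc (1 / 4 : ℝ) ^ (k + 1 + n) ≤ (1 / 4) ^ n :=
              pow_le_pow_of_le_one (by norm_num) (by norm_num) (by omega)
          _ ≤ _ := pow_le_pow_left₀ (by norm_num) hθ4 n)
      (fun y hy => by
        rw [gradient_sub ((h.contDiff_dyadicMoll _).differentiable one_ne_zero y)
          ((h.contDiff_dyadicMoll _).differentiable one_ne_zero y)]
        exact hgrad n y hy) hx
    refine h2.trans ?_
    have := mul_nonneg hs0 (pow_nonneg hQ0 n)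
    calc _ = (b + 2 * R * √B₀) * Q ^ n := by ring
      _ ≤ _ := mul_le_mul_of_nonneg_right (by linarith) (pow_nonneg hQ0 n)

lemma ApproxSeq.tendsto_setIntegral_gradient (h : ApproxSeq F m N D A u) {k : ℕ}
    (hk : ball x₀ (8 * (1 / 2 ^ k)) ⊆ D) :
    Tendsto (fun j => ∫ x in ball x₀ (1 / 2 ^ k), ‖∇ (dyadicMoll u j) x - ∇ (u j) x‖ ^ 2) atTop
      (𝓝 0) := by
  obtain ⟨C, θ, hC, -, -, hhole⟩ := exists_hole_filling h.mono
  have hA := h.nonneg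
  have hm := h.mono.pos
  set R : ℝ := 1 / 2 ^ k with hR
  have hR0 : 0 < R := inv_two_pow_pos k
  have hlim : Tendsto (fun j : ℕ => 2 * (C * (((1 / 4 : ℝ) ^ j) / R ^ 2 * A + m / 16 * (1 / 64) ^ j)))
      atTop (𝓝 (2 * (C * (0 / R ^ 2 * A + m / 16 * 0)))) := by
    have h1 := tendsto_pow_atTop_nhds_zero_of_lt_one (show (0 : ℝ) ≤ 1 / 4 by norm_num) (by norm_num)
    have h2 := tendsto_pow_atTop_nhds_zero_of_lt_one (show (0 : ℝ) ≤ 1 / 64 by norm_num) (by norm_num)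
    exact ((((h1.div_const _).mul_const _).add (h2.const_mul _)).const_mul _).const_mul _
  simp only [zero_div, zero_mul, mul_zero, add_zero] at hlim
  refine squeeze_zero' (Eventually.of_forall fun j => integral_nonneg fun x => sq_nonneg _) ?_ hlim
  filter_upwards [eventually_ge_atTop k] with j hj
  refine setIntegral_sq_norm_gradient_moll_sub_le (inv_two_pow_pos j) (h.contDiff j) (h.compact j)
    fun z hz => ?_
  have hzR : ‖z‖ ≤ R := hz.trans (one_div_le_one_div_of_le (by positivity)
    (pow_le_pow_right₀ (by norm_num) hj))
  have h1 := hhole D _ (u j) x₀ z R (h.contDiff j) (h.almost j) (by positivity)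
    (div_le_self (by positivity) (one_le_pow₀ (by norm_num))) hR0
    ((ball_subset_ball (by linarith)).trans hk) hzR 0
  simp only [pow_zero, div_one, one_mul] at h1
  refine h1.trans (mul_le_mul_of_nonneg_left (add_le_add ?_ ?_) hC.le)
  · refine mul_le_mul ?_ (h.setIntegral_le j _) (integral_nonneg fun x => sq_nonneg _)
      (by positivity)
    gcongr
    calc ‖z‖ ^ 2 ≤ (1 / 2 ^ j) ^ 2 := pow_le_pow_left₀ (norm_nonneg _) hz 2
      _ = _ := by rw [div_pow, one_pow, ← pow_mul, mul_comm, pow_mul, one_div_pow]; norm_num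
  · rw [one_div_pow]; exact le_of_eq (by ring)

lemma ApproxSeq.tendsto_setIntegral (h : ApproxSeq F m N D A u) (x₀ : Plane) (R : ℝ) :
    Tendsto (fun j => ∫ x in ball x₀ R, (dyadicMoll u j x - u j x) ^ 2) atTop (𝓝 0) := by
  have hlim : Tendsto (fun j : ℕ => ((1 / 4 : ℝ) ^ j) * A) atTop (𝓝 (0 * A)) :=
    (tendsto_pow_atTop_nhds_zero_of_lt_one (show (0 : ℝ) ≤ 1 / 4 by norm_num)
      (by norm_num)).mul_const _
  rw [zero_mul] at hlim
  refine squeeze_zero (fun j => integral_nonneg fun x => sq_nonneg _) (fun j => ?_) hlim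
  refine (h.setIntegral_sq_moll_sub_le j (inv_two_pow_pos j) x₀ R).trans (le_of_eq ?_)
  rw [div_pow, one_pow, ← pow_mul, mul_comm j, pow_mul, one_div_pow]; norm_num

/-- Uniform convergence upgrades mean square convergence. -/
lemma tendsto_setIntegral_sq_norm_sub {E : Type*} [NormedAddCommGroup E] {f g : ℕ → Plane → E}
    {l : Plane → E} {R : ℝ} {ε : ℕ → ℝ} (hf : ∀ j, Continuous (f j))
    (hg : ∀ j, Continuous (g j)) (hε : Tendsto ε atTop (𝓝 0))
    (h1 : ∀ᶠ j in atTop, ∀ x ∈ ball x₀ R, ‖f j x - l x‖ ≤ ε j)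
    (h2 : Tendsto (fun j => ∫ x in ball x₀ R, ‖f j x - g j x‖ ^ 2) atTop (𝓝 0)) :
    Tendsto (fun j => ∫ x in ball x₀ R, ‖g j x - l x‖ ^ 2) atTop (𝓝 0) := by
  have hlim : Tendsto (fun j => volume.real (ball x₀ R) * (2 * ε j ^ 2) +
      2 * ∫ x in ball x₀ R, ‖f j x - g j x‖ ^ 2) atTop
      (𝓝 (volume.real (ball x₀ R) * (2 * 0 ^ 2) + 2 * 0)) :=
    (((hε.pow 2).const_mul _).const_mul _).add (h2.const_mul _)
  simp only [ne_eq, OfNat.ofNat_ne_zero, not_false_eq_true, zero_pow, mul_zero, add_zero] at hlim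
  refine squeeze_zero' (Eventually.of_forall fun j => integral_nonneg fun x => sq_nonneg _) ?_ hlim
  filter_upwards [h1] with j hj
  have hfc := hf j
  have hgc := hg j
  have i1 : IntegrableOn (fun _ => 2 * ε j ^ 2) (ball x₀ R) :=
    Continuous.integrableOn_ball continuous_const _ _
  have i2 : IntegrableOn (fun x => 2 * ‖f j x - g j x‖ ^ 2) (ball x₀ R) :=
    Continuous.integrableOn_ball (by fun_prop) _ _
  have hle := integral_mono_of_nonneg (μ := volume.restrict (ball x₀ R))
    (f := fun x => ‖g j x - l x‖ ^ 2) (Eventually.of_forall fun x => sq_nonneg _)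
    (i1.add i2) (by
      filter_upwards [ae_restrict_mem measurableSet_ball] with x hx
      simp only [Pi.add_apply]
      have h3 : ‖g j x - l x‖ ≤ ε j + ‖f j x - g j x‖ := by
        calc ‖g j x - l x‖ = ‖(f j x - l x) - (f j x - g j x)‖ := by congr 1; abel
          _ ≤ _ := norm_sub_le _ _
          _ ≤ _ := by gcongr; exact hj x hx
      have h4 := pow_le_pow_left₀ (norm_nonneg _) h3 2
      nlinarith [sq_nonneg (ε j - ‖f j x - g j x‖)])
  refine hle.trans (le_of_eq ?_)
  simp only [Pi.add_apply]
  rw [integral_add i1 i2, setIntegral_const, smul_eq_mul, integral_const_mul]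

/-- The mollified sequence converges together with its gradients; the limit is also the mean
square limit of the original sequence. -/
lemma ApproxSeq.exists_limit (h : ApproxSeq F m N D A u) (hD : IsOpen D) :
    ∃ v : Plane → ℝ, ContDiffOn ℝ 1 v D ∧ ∀ x ∈ D, ∃ ρ > 0, closedBall x ρ ⊆ D ∧
      Tendsto (fun j => ∫ y in ball x ρ, ‖∇ (u j) y - ∇ v y‖ ^ 2) atTop (𝓝 0) ∧
      Tendsto (fun j => ∫ y in ball x ρ, (u j y - v y) ^ 2) atTop (𝓝 0) := by
  have hloc : ∀ x ∈ D, ∃ k : ℕ, ball x (8 * (1 / 2 ^ k)) ⊆ D := fun x hx =>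
    exists_dyadic_ball_subset hD hx
  have hconv : ∀ (x : Plane) (k : ℕ), ball x (8 * (1 / 2 ^ k)) ⊆ D → ∃ ε : ℕ → ℝ,
      Tendsto ε atTop (𝓝 0) ∧ ∀ y ∈ ball x (1 / 2 ^ k), ∃ (t : ℝ) (G : Plane),
        ∀ j, k + 1 ≤ j → ‖∇ (dyadicMoll u j) y - G‖ ≤ ε j ∧ ‖dyadicMoll u j y - t‖ ≤ ε j := by
    intro x k hk
    obtain ⟨B, Q, hB, hQ0, hQ1, hdec⟩ := h.exists_local_decay hk
    refine ⟨fun j => B * Q ^ (j - (k + 1)) / (1 - Q), ?_, fun y hy => ?_⟩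
    · have h1 : Tendsto (fun j => j - (k + 1)) atTop atTop := tendsto_sub_atTop_nat (k + 1)
      have := (((tendsto_pow_atTop_nhds_zero_of_lt_one hQ0 hQ1).comp h1).const_mul B).div_const (1 - Q)
      simpa using this
    · have h1 : ∀ n, dist (∇ (dyadicMoll u (k + 1 + n)) y) (∇ (dyadicMoll u (k + 1 + (n + 1))) y) ≤
          B * Q ^ n := fun n => by
        rw [dist_comm, dist_eq_norm]; exact (hdec n y hy).1
      have h2 : ∀ n, dist (dyadicMoll u (k + 1 + n) y) (dyadicMoll u (k + 1 + (n + 1)) y) ≤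
          B * Q ^ n := fun n => by
        rw [dist_comm, Real.dist_eq]; exact (hdec n y hy).2
      obtain ⟨G, hG⟩ := cauchySeq_tendsto_of_complete (cauchySeq_of_le_geometric Q B hQ1 h1)
      obtain ⟨t, ht⟩ := cauchySeq_tendsto_of_complete (cauchySeq_of_le_geometric Q B hQ1 h2)
      refine ⟨t, G, fun j hj => ?_⟩
      obtain ⟨n, rfl⟩ := Nat.exists_eq_add_of_le hj
      simp only [add_tsub_cancel_left]
      rw [← dist_eq_norm, ← dist_eq_norm]
      exact ⟨dist_le_of_le_geometric_of_tendsto Q B hQ1 h1 hG n,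
        dist_le_of_le_geometric_of_tendsto Q B hQ1 h2 ht n⟩
  have hpt : ∀ x, ∃ (t : ℝ) (G : Plane), x ∈ D →
      Tendsto (fun j => dyadicMoll u j x) atTop (𝓝 t) ∧
      Tendsto (fun j => ∇ (dyadicMoll u j) x) atTop (𝓝 G) := by
    intro x
    by_cases hx : x ∈ D
    · obtain ⟨k, hk⟩ := hloc x hx
      obtain ⟨ε, hε, hy⟩ := hconv x k hk
      obtain ⟨t, G, htG⟩ := hy x (mem_ball_self (inv_two_pow_pos k))
      refine ⟨t, G, fun _ => ⟨?_, ?_⟩⟩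
      · refine tendsto_iff_norm_sub_tendsto_zero.2 (squeeze_zero'
          (Eventually.of_forall fun j => norm_nonneg _) ?_ hε)
        filter_upwards [eventually_ge_atTop (k + 1)] with j hj using (htG j hj).2
      · refine tendsto_iff_norm_sub_tendsto_zero.2 (squeeze_zero'
          (Eventually.of_forall fun j => norm_nonneg _) ?_ hε)
        filter_upwards [eventually_ge_atTop (k + 1)] with j hj using (htG j hj).1
    · exact ⟨0, 0, fun hx' => absurd hx' hx⟩
  choose v G hvG using hpt
  have hunif : ∀ (x : Plane) (k : ℕ), ball x (8 * (1 / 2 ^ k)) ⊆ D → ∃ ε : ℕ → ℝ,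
      Tendsto ε atTop (𝓝 0) ∧ ∀ j, k + 1 ≤ j → ∀ y ∈ ball x (1 / 2 ^ k),
        ‖∇ (dyadicMoll u j) y - G y‖ ≤ ε j ∧ ‖dyadicMoll u j y - v y‖ ≤ ε j := by
    intro x k hk
    obtain ⟨ε, hε, hy⟩ := hconv x k hk
    refine ⟨ε, hε, fun j hj y hyb => ?_⟩
    obtain ⟨t, G', htG⟩ := hy y hyb
    have hyD : y ∈ D := hk (ball_subset_ball (by
      have := inv_two_pow_pos k
      linarith) hyb)
    have e1 : G' = G y := by
      refine tendsto_nhds_unique (tendsto_iff_norm_sub_tendsto_zero.2 (squeeze_zero'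
          (Eventually.of_forall fun j => norm_nonneg _) ?_ hε)) (hvG y hyD).2
      filter_upwards [eventually_ge_atTop (k + 1)] with j hj using (htG j hj).1
    have e2 : t = v y := by
      refine tendsto_nhds_unique (tendsto_iff_norm_sub_tendsto_zero.2 (squeeze_zero'
          (Eventually.of_forall fun j => norm_nonneg _) ?_ hε)) (hvG y hyD).1
      filter_upwards [eventually_ge_atTop (k + 1)] with j hj using (htG j hj).2
    rw [← e1, ← e2]
    exact htG j hj
  have hjoint : ∀ x ∈ D, Tendsto (fun q : ℕ × Plane => ∇ (dyadicMoll u q.1) q.2)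
      (atTop ×ˢ 𝓝 x) (𝓝 (G x)) := by
    intro x hx
    obtain ⟨k, hk⟩ := hloc x hx
    obtain ⟨ε, hε, hu⟩ := hunif x k hk
    rw [Metric.tendsto_nhds]
    intro τ hτ
    have hτ4 : 0 < τ / 4 := by positivity
    have hev := (Metric.tendsto_nhds.1 hε (τ / 4) hτ4)
    obtain ⟨J, hJ1, hJ2⟩ := (hev.and (eventually_ge_atTop (k + 1))).exists
    have hcJ := (continuous_gradient (h.contDiff_dyadicMoll J)).continuousAt (x := x)
    have hn := (Metric.tendsto_nhds.1 hcJ.tendsto (τ / 4) hτ4)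
    have hball : ∀ᶠ y in 𝓝 x, y ∈ ball x (1 / 2 ^ k) := ball_mem_nhds x (inv_two_pow_pos k)
    filter_upwards [(hev.and (eventually_ge_atTop (k + 1))).prod_mk (hn.and hball)]
    rintro ⟨j, y⟩ ⟨⟨hj1, hj2⟩, hy1, hy2⟩
    simp only at hj1 hj2 hy1 hy2 ⊢
    rw [Real.dist_0_eq_abs] at hj1 hJ1
    have a1 := (hu j hj2 y hy2).1
    have a2 := (hu J hJ2 y hy2).1
    have a3 := (hu J hJ2 x (mem_ball_self (inv_two_pow_pos k))).1
    rw [← dist_eq_norm] at a1 a2 a3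
    have b1 := dist_triangle4 (∇ (dyadicMoll u j) y) (G y) (∇ (dyadicMoll u J) y) (G x)
    have b2 := dist_triangle (∇ (dyadicMoll u J) y) (∇ (dyadicMoll u J) x) (G x)
    rw [dist_comm (G y)] at b1
    linarith [le_abs_self (ε j), le_abs_self (ε J)]
  obtain ⟨hvc, hvg⟩ := contDiffOn_of_tendsto (l := atTop) (f := dyadicMoll u) hD
    (fun x _ => Eventually.of_forall fun q =>
      (h.contDiff_dyadicMoll q.1).differentiable one_ne_zero q.2) (fun x hx => (hvG x hx).1) hjoint
  refine ⟨v, hvc, fun x hx => ?_⟩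
  obtain ⟨k, hk⟩ := hloc x hx
  obtain ⟨ε, hε, hu⟩ := hunif x k hk
  have hk0 := inv_two_pow_pos k
  have hsubD : closedBall x (1 / 2 ^ k) ⊆ D := (closedBall_subset_ball (by linarith)).trans hk
  refine ⟨1 / 2 ^ k, hk0, hsubD, ?_, ?_⟩
  · refine tendsto_setIntegral_sq_norm_sub (f := fun j => ∇ (dyadicMoll u j))
      (fun j => continuous_gradient (h.contDiff_dyadicMoll j))
      (fun j => continuous_gradient (h.contDiff j)) hε ?_ (h.tendsto_setIntegral_gradient hk)
    filter_upwards [eventually_ge_atTop (k + 1)] with j hj y hy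
    rw [hvg y (hsubD (ball_subset_closedBall hy))]
    exact (hu j hj y hy).1
  · have := tendsto_setIntegral_sq_norm_sub (f := dyadicMoll u) (g := u) (l := v) (x₀ := x)
      (R := 1 / 2 ^ k) (fun j => (h.contDiff_dyadicMoll j).continuous)
      (fun j => (h.contDiff j).continuous) hε
      (by filter_upwards [eventually_ge_atTop (k + 1)] with j hj y hy using (hu j hj y hy).2)
      (by simpa [Real.norm_eq_abs, sq_abs] using h.tendsto_setIntegral x (1 / 2 ^ k))
    simpa [Real.norm_eq_abs, sq_abs] using this

section Minimizing

variable {F : Plane → Plane} {E : Plane → ℝ} {m N l : ℝ} {D : Set Plane}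

lemma integrable_comp_gradient {G : Plane → ℝ} (hG : Continuous G) (h0 : G 0 = 0) {w : Plane → ℝ}
    (hw : ContDiff ℝ 1 w) (hc : HasCompactSupport w) : Integrable fun x => G (∇ w x) :=
  (hG.comp (continuous_gradient hw)).integrable_of_hasCompactSupport
    ((hasCompactSupport_gradient hc).comp_left (g := G) h0)

lemma integrable_inner_comp_gradient {G : Plane → Plane} (hG : Continuous G) {w η : Plane → ℝ}
    (hw : ContDiff ℝ 1 w) (hη : ContDiff ℝ 1 η) (hc : HasCompactSupport η) :
    Integrable fun x => ⟪G (∇ w x), ∇ η x⟫ :=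
  integrable_inner_gradient isOpen_univ (hG.comp (continuous_gradient hw)).continuousOn hη hc
    (subset_univ _)

lemma hasCompactSupport_const_mul {η : Plane → ℝ} (hc : HasCompactSupport η) (t : ℝ) :
    HasCompactSupport fun x => t * η x :=
  hc.comp_left (g := fun s => t * s) (by simp)

/-- First variation of the energy. -/
lemma integral_energy_sub_le (hF : StrongMono F m N) (hE : Continuous E) (h0 : E 0 = 0)
    (hT : ∀ ξ ζ, E ζ + ⟪F ζ, ξ - ζ⟫ ≤ E ξ) {u η : Plane → ℝ} (hu : ContDiff ℝ 1 u)
    (huc : HasCompactSupport u) (hη : ContDiff ℝ 1 η) (hc : HasCompactSupport η) (t : ℝ) :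
    ∫ x, E (∇ (fun y => u y + t * η y) x) ≤ (∫ x, E (∇ u x)) + t * (∫ x, ⟪F (∇ u x), ∇ η x⟫) +
      t ^ 2 * N * ∫ x, ‖∇ η x‖ ^ 2 := by
  have htη : ContDiff ℝ 1 fun y => t * η y := contDiff_const.mul hη
  have htc := hasCompactSupport_const_mul hc t
  have hg : ∀ x, ∇ (fun y => u y + t * η y) x = ∇ u x + t • ∇ η x := fun x => by
    rw [gradient_add (hu.differentiable one_ne_zero x) (htη.differentiable one_ne_zero x),
      gradient_const_mul (hη.differentiable one_ne_zero x)]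
  have i1 := integrable_comp_gradient hE h0 hu huc
  have i2 : Integrable fun x => t * ⟪F (∇ u x), ∇ η x⟫ :=
    (integrable_inner_comp_gradient hF.continuous hu hη hc).const_mul t
  have i3 : Integrable fun x => t ^ 2 * N * ‖∇ η x‖ ^ 2 :=
    (integrable_sq_norm_gradient hη hc).const_mul (t ^ 2 * N)
  have i12 : Integrable fun x => E (∇ u x) + t * ⟪F (∇ u x), ∇ η x⟫ := i1.add i2
  rw [← integral_const_mul, ← integral_const_mul, ← integral_add i1 i2, ← integral_add i12 i3]
  refine integral_mono (integrable_comp_gradient hE h0 (hu.add htη) (huc.add htc)) (i12.add i3)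
    fun x => ?_
  simp only [hg]
  have h1 := hT (∇ u x) (∇ u x + t • ∇ η x)
  have h2 : ⟪F (∇ u x + t • ∇ η x), ∇ u x - (∇ u x + t • ∇ η x)⟫ =
      -(t * ⟪F (∇ u x), ∇ η x⟫) - ⟪F (∇ u x + t • ∇ η x) - F (∇ u x), t • ∇ η x⟫ := by
    rw [sub_add_cancel_left, inner_neg_right, inner_sub_left, inner_smul_right, inner_smul_right]
    ring
  have h3 := real_inner_le_norm (F (∇ u x + t • ∇ η x) - F (∇ u x)) (t • ∇ η x)
  have h4 := mul_le_mul_of_nonneg_right (hF.lip (∇ u x + t • ∇ η x) (∇ u x))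
    (norm_nonneg (t • ∇ η x))
  rw [add_sub_cancel_left] at h4
  have h5 : N * ‖t • ∇ η x‖ * ‖t • ∇ η x‖ = t ^ 2 * N * ‖∇ η x‖ ^ 2 := by
    rw [norm_smul, Real.norm_eq_abs]
    calc N * (|t| * ‖∇ η x‖) * (|t| * ‖∇ η x‖) = |t| ^ 2 * N * ‖∇ η x‖ ^ 2 := by ring
      _ = _ := by rw [sq_abs]
  linarith

/-- Almost minimizers of the energy almost solve the Euler equation. -/
lemma almostSol_of_almost_minimal (hF : StrongMono F m N) (hE : Continuous E) (h0 : E 0 = 0)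
    (hT : ∀ ξ ζ, E ζ + ⟪F ζ, ξ - ζ⟫ ≤ E ξ) {u : Plane → ℝ} (hu : ContDiff ℝ 1 u)
    (huc : HasCompactSupport u) {δ : ℝ} (hδ : 0 < δ)
    (hmin : ∀ η : Plane → ℝ, ContDiff ℝ 1 η → HasCompactSupport η → tsupport η ⊆ D →
      ∫ x, E (∇ u x) ≤ (∫ x, E (∇ (fun y => u y + η y) x)) + δ ^ 2 / N) :
    AlmostSol F D δ u := by
  intro η hη hc hs
  have hN := hF.pos'
  have key : ∀ t : ℝ, -(δ ^ 2 / N) ≤ t * (∫ x, ⟪F (∇ u x), ∇ η x⟫) +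
      t ^ 2 * N * ∫ x, ‖∇ η x‖ ^ 2 := by
    intro t
    have h1 := integral_energy_sub_le hF hE h0 hT hu huc hη hc t
    have h2 := hmin (fun y => t * η y) (contDiff_const.mul hη) (hasCompactSupport_const_mul hc t)
      ((tsupport_mul_subset_right).trans hs)
    linarith
  have k1 := key (δ / N)
  have k2 := key (-(δ / N))
  set I := ∫ x, ⟪F (∇ u x), ∇ η x⟫
  set X := ∫ x, ‖∇ η x‖ ^ 2
  have e1 : δ ^ 2 / N = δ / N * δ := by ring
  have e2 : (δ / N) ^ 2 * N * X = δ / N * (δ * X) := by field_simp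
  have e3 : (-(δ / N)) ^ 2 * N * X = δ / N * (δ * X) := by rw [neg_sq, e2]
  have hpos : 0 < δ / N := by positivity
  rw [e1, e2] at k1
  rw [e1, e3] at k2
  rw [abs_le]
  constructor
  · have : 0 ≤ δ / N * (I + δ * (1 + X)) := by linarith
    have := (mul_nonneg_iff_of_pos_left hpos).1 this
    linarith
  · have : 0 ≤ δ / N * (δ * (1 + X) - I) := by linarith
    have := (mul_nonneg_iff_of_pos_left hpos).1 this
    linarith

/-- Two almost solutions with the same boundary data are close in energy. -/
lemma AlmostSol.integral_sq_gradient_sub_le (hF : StrongMono F m N) {u w : Plane → ℝ} {δ : ℝ}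
    (hu : ContDiff ℝ 1 u) (hw : ContDiff ℝ 1 w) (hδ : δ ≤ m / 16) (hδ0 : 0 ≤ δ)
    (hus : AlmostSol F D δ u) (hws : AlmostSol F D δ w)
    (hc : HasCompactSupport fun y => w y - u y) (hs : tsupport (fun y => w y - u y) ⊆ D) :
    ∫ x, ‖∇ (fun y => w y - u y) x‖ ^ 2 ≤ 4 * δ / m := by
  have hm := hF.pos
  have hη := hw.sub hu
  have h1 := hus _ hη hc hs
  have h2 := hws _ hη hc hs
  have i1 := integrable_inner_comp_gradient hF.continuous hu hη hc
  have i2 := integrable_inner_comp_gradient hF.continuous hw hη hc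
  have h3 : m * (∫ x, ‖∇ (fun y => w y - u y) x‖ ^ 2) ≤
      (∫ x, ⟪F (∇ w x), ∇ (fun y => w y - u y) x⟫) -
        ∫ x, ⟪F (∇ u x), ∇ (fun y => w y - u y) x⟫ := by
    rw [← integral_const_mul, ← integral_sub i2 i1]
    refine integral_mono ((integrable_sq_norm_gradient hη hc).const_mul m) (i2.sub i1) fun x => ?_
    simp only
    rw [← inner_sub_left, gradient_sub (hw.differentiable one_ne_zero x)
      (hu.differentiable one_ne_zero x)]
    exact hF.mono _ _
  set X := ∫ x, ‖∇ (fun y => w y - u y) x‖ ^ 2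
  have hX : 0 ≤ X := integral_nonneg fun x => sq_nonneg _
  have h4 := (abs_le.1 h1).1
  have h5 := (abs_le.1 h2).2
  rw [le_div_iff₀ hm]
  nlinarith [mul_le_mul_of_nonneg_right hδ hX]

theorem exists_approxSeq (hF : StrongMono F m N) (hE : Continuous E) (h0 : E 0 = 0)
    (hT : ∀ ξ ζ, E ζ + ⟪F ζ, ξ - ζ⟫ ≤ E ξ) (hl : 0 < l) (hlow : ∀ ξ, l / 2 * ‖ξ‖ ^ 2 ≤ E ξ)
    (hD : Bornology.IsBounded D) {Φ : Plane → ℝ} (hΦ : ContDiff ℝ 1 Φ)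
    (hΦc : HasCompactSupport Φ) :
    ∃ (A : ℝ) (u : ℕ → Plane → ℝ), ApproxSeq F m N D A u ∧
      ∀ j, HasCompactSupport (fun x => u j x - Φ x) ∧ tsupport (fun x => u j x - Φ x) ⊆ D := by
  have hm := hF.pos
  have hN := hF.pos'
  set S : Set ℝ := {s | ∃ η : Plane → ℝ, ContDiff ℝ 1 η ∧ HasCompactSupport η ∧ tsupport η ⊆ D ∧
    s = ∫ x, E (∇ (fun y => Φ y + η y) x)} with hS
  have hE0 : ∀ ξ, 0 ≤ E ξ := fun ξ => le_trans (by positivity) (hlow ξ)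
  have hbdd : BddBelow S := ⟨0, by
    rintro s ⟨η, -, -, -, rfl⟩
    exact integral_nonneg fun x => hE0 _⟩
  have hne : S.Nonempty := ⟨_, fun _ => 0, contDiff_const, HasCompactSupport.zero, by
    simp [tsupport, Function.support], rfl⟩
  set δ : ℕ → ℝ := fun j => m / 16 / 64 ^ j with hδ
  have hδ0 : ∀ j, 0 < δ j := fun j => by positivity
  have hδ1 : ∀ j, δ j ≤ m / 16 := fun j =>
    div_le_self (by positivity) (one_le_pow₀ (by norm_num))
  have hex : ∀ j, ∃ η : Plane → ℝ, ContDiff ℝ 1 η ∧ HasCompactSupport η ∧ tsupport η ⊆ D ∧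
      ∫ x, E (∇ (fun y => Φ y + η y) x) < sInf S + δ j ^ 2 / N := by
    intro j
    obtain ⟨s, ⟨η, h1, h2, h3, rfl⟩, h4⟩ := Real.lt_sInf_add_pos hne
      (show 0 < δ j ^ 2 / N from div_pos (pow_pos (hδ0 j) 2) hN)
    exact ⟨η, h1, h2, h3, h4⟩
  choose η hη hηc hηs hmin using hex
  set u : ℕ → Plane → ℝ := fun j y => Φ y + η j y with hu
  have huC : ∀ j, ContDiff ℝ 1 (u j) := fun j => hΦ.add (hη j)
  have huc : ∀ j, HasCompactSupport (u j) := fun j => hΦc.add (hηc j)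
  have hal : ∀ j, AlmostSol F D (δ j) (u j) := fun j =>
    almostSol_of_almost_minimal hF hE h0 hT (huC j) (huc j) (hδ0 j) fun ψ h1 h2 h3 => by
      have h4 : sInf S ≤ ∫ x, E (∇ (fun y => Φ y + (η j y + ψ y)) x) :=
        csInf_le hbdd ⟨_, (hη j).add h1, (hηc j).add h2,
          (tsupport_add _ _).trans (union_subset (hηs j) h3), rfl⟩
      simp only [← add_assoc] at h4
      linarith [hmin j]
  obtain ⟨R, hR0, hR⟩ : ∃ R : ℝ, 0 < R ∧ D ⊆ ball 0 R := by
    obtain ⟨R, hR⟩ := hD.subset_ball 0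
    exact ⟨max R 1, by positivity, hR.trans (ball_subset_ball (le_max_left _ _))⟩
  have hsub : ∀ j, (fun y => u (j + 1) y - u j y) = fun y => η (j + 1) y - η j y := fun j => by
    funext y; simp only [hu]; ring
  have hsc : ∀ j, HasCompactSupport fun y => u (j + 1) y - u j y := fun j =>
    (hsub j).symm ▸ (hηc (j + 1)).sub (hηc j)
  have hss : ∀ j, tsupport (fun y => u (j + 1) y - u j y) ⊆ D := fun j =>
    (hsub j).symm ▸ (tsupport_sub _ _).trans (union_subset (hηs (j + 1)) (hηs j))
  have hX : ∀ j, ∫ x, ‖∇ (fun y => u (j + 1) y - u j y) x‖ ^ 2 ≤ 1 / 64 ^ j := fun j => by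
    have hw : AlmostSol F D (δ j) (u (j + 1)) := fun ψ h1 h2 h3 => by
      refine (hal (j + 1) ψ h1 h2 h3).trans (mul_le_mul_of_nonneg_right ?_ (by positivity))
      exact div_le_div_of_nonneg_left (by positivity) (by positivity)
        (pow_le_pow_right₀ (by norm_num) (by omega))
    refine (AlmostSol.integral_sq_gradient_sub_le hF (huC j) (huC (j + 1)) (hδ1 j) (hδ0 j).le
      (hal j) hw (hsc j) (hss j)).trans ?_
    simp only [hδ]
    rw [show 4 * (m / 16 / 64 ^ j) / m = 1 / 4 * (1 / 64 ^ j : ℝ) by field_simp; norm_num]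
    have : (0 : ℝ) ≤ 1 / 64 ^ j := by positivity
    linarith
  set A : ℝ := 1 + (2 * R) ^ 2 + 2 / l * (sInf S + δ 0 ^ 2 / N) with hA
  have hI0 : 0 ≤ sInf S := le_csInf hne (by
    rintro s ⟨η, -, -, -, rfl⟩
    exact integral_nonneg fun x => hE0 _)
  have hA2 : 0 ≤ 2 / l * (sInf S + δ 0 ^ 2 / N) := by positivity
  have hR2 : 0 ≤ (2 * R) ^ 2 := sq_nonneg _
  refine ⟨A, u, ⟨hF, huC, huc, by positivity, hal, fun j => ?_, fun j => ?_, fun j => ?_⟩,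
    fun j => ?_⟩
  · have h1 : l / 2 * ∫ x, ‖∇ (u j) x‖ ^ 2 ≤ ∫ x, E (∇ (u j) x) := by
      rw [← integral_const_mul]
      exact integral_mono ((integrable_sq_norm_gradient (huC j) (huc j)).const_mul _)
        (integrable_comp_gradient hE h0 (huC j) (huc j)) fun x => hlow _
    have h2 : δ j ^ 2 / N ≤ δ 0 ^ 2 / N := by
      refine div_le_div_of_nonneg_right (pow_le_pow_left₀ (hδ0 j).le ?_ 2) hN.le
      simpa [hδ] using hδ1 j
    have h3 : ∫ x, ‖∇ (u j) x‖ ^ 2 ≤ 2 / l * (sInf S + δ 0 ^ 2 / N) := by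
      rw [div_mul_eq_mul_div, le_div_iff₀ hl]
      have := hmin j
      linarith
    linarith
  · refine (hX j).trans (div_le_div_of_nonneg_right ?_ (by positivity))
    linarith
  · refine (integral_sq_le_of_support ((huC (j + 1)).sub (huC j)) hR0 fun x hx =>
      image_eq_zero_of_notMem_tsupport (f := fun y => u (j + 1) y - u j y)
        fun h => hx (hR (hss j h))).trans ?_
    refine (mul_le_mul_of_nonneg_left (hX j) hR2).trans ?_
    rw [mul_one_div]
    refine div_le_div_of_nonneg_right ?_ (by positivity)
    linarith
  · have : (fun x => u j x - Φ x) = η j := by funext y; simp only [hu]; ring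
    rw [this]
    exact ⟨hηc j, hηs j⟩

end Minimizing

section StrongLimit

variable {F : Plane → Plane} {m N A p : ℝ} {a : ℝ → ℝ} {D : Set Plane} {u : ℕ → Plane → ℝ}
  {x₀ : Plane}

lemma tendsto_lintegral_of_locally {f : ℕ → Plane → ENNReal} {K : Set Plane} (hK : IsCompact K)
    (h : ∀ x ∈ K, ∃ ρ > 0, Tendsto (fun j => ∫⁻ y in ball x ρ, f j y) atTop (𝓝 0)) :
    Tendsto (fun j => ∫⁻ y in K, f j y) atTop (𝓝 0) := by
  refine hK.induction_on (p := fun s => Tendsto (fun j => ∫⁻ y in s, f j y) atTop (𝓝 0))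
    (by simp) (fun s t hst ht => ?_) (fun s t hs ht => ?_) (fun x hx => ?_)
  · exact tendsto_of_tendsto_of_tendsto_of_le_of_le tendsto_const_nhds ht (fun _ => zero_le)
      fun j => lintegral_mono_set hst
  · have := hs.add ht
    rw [add_zero] at this
    exact tendsto_of_tendsto_of_tendsto_of_le_of_le tendsto_const_nhds this (fun _ => zero_le)
      fun j => lintegral_union_le _ _ _
  · obtain ⟨ρ, hρ, ht⟩ := h x hx
    exact ⟨ball x ρ, mem_nhdsWithin_of_mem_nhds (ball_mem_nhds x hρ), ht⟩

lemma tendsto_setIntegral_of_sq {f : ℕ → Plane → ℝ} {S : Set Plane} (hS : volume S ≠ ⊤)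
    (h0 : ∀ j x, 0 ≤ f j x) (hf : ∀ j, IntegrableOn (fun x => f j x ^ 2) S)
    (h : Tendsto (fun j => ∫ x in S, f j x ^ 2) atTop (𝓝 0)) :
    Tendsto (fun j => ∫ x in S, f j x) atTop (𝓝 0) := by
  rw [Metric.tendsto_nhds]
  intro κ hκ
  set V := volume.real S
  have hV : 0 ≤ V := measureReal_nonneg
  set s : ℝ := κ / (2 * (V + 1)) with hs
  have hs0 : 0 < s := by positivity
  filter_upwards [h.eventually (gt_mem_nhds (show (0 : ℝ) < s * (κ / 2) by positivity))] with j hj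
  rw [Real.dist_0_eq_abs, abs_of_nonneg (integral_nonneg fun x => h0 j x)]
  have i1 : IntegrableOn (fun _ : Plane => s) S := integrableOn_const hS
  have i2 : IntegrableOn (fun x => s⁻¹ * f j x ^ 2) S := (hf j).const_mul _
  have hle := integral_mono_of_nonneg (μ := volume.restrict S) (f := f j)
    (Eventually.of_forall fun x => h0 j x) (i1.add i2) (Eventually.of_forall fun x => by
      simp only [Pi.add_apply]
      rw [← mul_le_mul_iff_right₀ hs0, mul_add, mul_inv_cancel_left₀ hs0.ne']
      nlinarith [sq_nonneg (s - f j x), h0 j x])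
  simp only [Pi.add_apply] at hle
  rw [integral_add i1 i2, setIntegral_const, integral_const_mul, smul_eq_mul] at hle
  have h1 : V * s ≤ κ / 2 := by
    rw [hs, ← mul_div_assoc, div_le_div_iff₀ (by positivity) (by norm_num)]
    nlinarith
  have h2 : s⁻¹ * (∫ x in S, f j x ^ 2) < κ / 2 := by
    rwa [inv_mul_lt_iff₀ hs0]
  linarith

lemma tendsto_lintegral_enorm {f : ℕ → Plane → Plane} {R : ℝ}
    (hf : ∀ j, ContinuousOn (f j) (closedBall x₀ R))
    (h : Tendsto (fun j => ∫ x in ball x₀ R, ‖f j x‖ ^ 2) atTop (𝓝 0)) :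
    Tendsto (fun j => ∫⁻ x in ball x₀ R, ‖f j x‖ₑ) atTop (𝓝 0) := by
  have i1 : ∀ j, IntegrableOn (fun x => ‖f j x‖) (ball x₀ R) := fun j =>
    ((hf j).norm.integrableOn_compact (isCompact_closedBall _ _)).mono_set ball_subset_closedBall
  have i2 : ∀ j, IntegrableOn (fun x => ‖f j x‖ ^ 2) (ball x₀ R) := fun j =>
    (((hf j).norm.pow 2).integrableOn_compact (isCompact_closedBall _ _)).mono_set
      ball_subset_closedBall
  have h1 := tendsto_setIntegral_of_sq (f := fun j x => ‖f j x‖) measure_ball_lt_top.ne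
    (fun j x => norm_nonneg _) i2 h
  have h2 := ENNReal.tendsto_ofReal h1
  rw [ENNReal.ofReal_zero] at h2
  refine h2.congr fun j => ?_
  rw [ofReal_integral_eq_lintegral_ofReal (i1 j) (Eventually.of_forall fun x => norm_nonneg _)]
  simp only [ofReal_norm]

/-- The limit of a sequence of almost solutions is a solution. -/
lemma integral_inner_eq_zero_of_tendsto (hF : StrongMono F m N) (hD : IsOpen D)
    (hu : ∀ j, ContDiff ℝ 1 (u j)) {δ : ℕ → ℝ} (hal : ∀ j, AlmostSol F D (δ j) (u j))
    (hδ : Tendsto δ atTop (𝓝 0)) {v : Plane → ℝ} (hv : ContDiffOn ℝ 1 v D)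
    (hlim : ∀ x ∈ D, ∃ ρ > 0, closedBall x ρ ⊆ D ∧
      Tendsto (fun j => ∫ y in ball x ρ, ‖∇ (u j) y - ∇ v y‖ ^ 2) atTop (𝓝 0))
    {η : Plane → ℝ} (hη : ContDiff ℝ 1 η) (hc : HasCompactSupport η) (hs : tsupport η ⊆ D) :
    ∫ x, ⟪F (∇ v x), ∇ η x⟫ = 0 := by
  have hvg : ContinuousOn (∇ v) D := continuousOn_gradient hv hD
  have i1 : ∀ j, Integrable fun x => ⟪F (∇ (u j) x), ∇ η x⟫ := fun j =>
    integrable_inner_comp_gradient hF.continuous (hu j) hη hc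
  have i2 : Integrable fun x => ⟪F (∇ v x), ∇ η x⟫ :=
    integrable_inner_gradient hD (hF.continuous.comp_continuousOn hvg) hη hc hs
  obtain ⟨B, hB⟩ : ∃ B : ℝ, ∀ x, ‖∇ η x‖ ≤ B :=
    (continuous_gradient hη).bounded_above_of_compact_support (hasCompactSupport_gradient hc)
  have hB0 : 0 ≤ B := (norm_nonneg _).trans (hB 0)
  have hN := hF.pos'
  have hK := tendsto_lintegral_of_locally (f := fun j x => ‖∇ (u j) x - ∇ v x‖ₑ) hc.isCompact
    fun x hx => by
      obtain ⟨ρ, hρ, hsub, ht⟩ := hlim x (hs hx)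
      exact ⟨ρ, hρ, tendsto_lintegral_enorm
        (fun j => (continuous_gradient (hu j)).continuousOn.sub (hvg.mono hsub)) ht⟩
  have hconv : Tendsto (fun j => ∫ x, ⟪F (∇ (u j) x), ∇ η x⟫) atTop
      (𝓝 (∫ x, ⟪F (∇ v x), ∇ η x⟫)) := by
    refine tendsto_integral_of_L1 _ i2.aestronglyMeasurable (Eventually.of_forall i1) ?_
    have h1 := ENNReal.Tendsto.const_mul (a := ENNReal.ofReal (N * B)) hK
      (Or.inr ENNReal.ofReal_ne_top)
    rw [mul_zero] at h1
    refine tendsto_of_tendsto_of_tendsto_of_le_of_le tendsto_const_nhds h1 (fun _ => zero_le)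
      fun j => ?_
    simp only
    rw [← lintegral_const_mul' _ _ ENNReal.ofReal_ne_top,
      ← lintegral_indicator (isClosed_tsupport η).measurableSet]
    refine lintegral_mono fun x => ?_
    by_cases hx : x ∈ tsupport η
    · rw [indicator_of_mem hx, ← ofReal_norm, ← ofReal_norm, ← ENNReal.ofReal_mul (by positivity),
        ← inner_sub_left]
      refine ENNReal.ofReal_le_ofReal ((norm_inner_le_norm _ _).trans ?_)
      calc _ ≤ (N * ‖∇ (u j) x - ∇ v x‖) * B :=
            _root_.mul_le_mul (hF.lip _ _) (hB x) (norm_nonneg _) (by positivity)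
        _ = _ := by ring
    · rw [gradient_eq_zero_of_notMem_tsupport hx]
      simp
  have hz : Tendsto (fun j => ∫ x, ⟪F (∇ (u j) x), ∇ η x⟫) atTop (𝓝 0) := by
    have h1 := hδ.mul_const (1 + ∫ x, ‖∇ η x‖ ^ 2)
    rw [zero_mul] at h1
    exact squeeze_zero_norm (fun j => hal j η hη hc hs) h1
  exact tendsto_nhds_unique hconv hz

lemma abs_ramp_sub_le (s t : ℝ) : |ramp s - ramp t| ≤ |s - t| := by
  have := convex_univ.norm_image_sub_le_of_norm_hasDerivWithin_le (f := ramp) (C := 1)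
    (fun x _ => (hasDerivAt_ramp x).hasDerivWithinAt) (fun x _ => by
      rw [Real.norm_of_nonneg (le_max_left _ _)]
      exact max_le zero_le_one (min_le_right _ _)) (mem_univ t) (mem_univ s)
  simpa using this

/-- Energy estimate for an almost solution lying above a solution. -/
lemma AlmostSol.exists_ramp (ha : IsKernel p a) (hp : 1 < p) (hF : StrongMono (flux a) m N)
    (hD : IsOpen D) {u b Φ : Plane → ℝ} {δ R : ℝ} (hδ : δ ≤ m / 16)
    (hal : AlmostSol (flux a) D δ u) (hu : ContDiff ℝ 1 u) (hb : WeakSol a D b)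
    (hc : HasCompactSupport fun x => u x - Φ x) (hs : tsupport (fun x => u x - Φ x) ⊆ D)
    (hΦb : ∀ x ∈ D, Φ x ≤ b x) (hR : 0 < R) (hDR : D ⊆ ball 0 R) :
    ∃ g : Plane → ℝ, Continuous g ∧ HasCompactSupport g ∧ (∀ x ∈ D, g x = ramp (u x - b x)) ∧
      ∫ x, g x ^ 2 ≤ (2 * R) ^ 2 * (2 * δ / m) := by
  classical
  have hm := hF.pos
  set K := tsupport (fun x => u x - Φ x) with hK
  set g : Plane → ℝ := fun x => if x ∈ D then ramp (u x - b x) else 0 with hg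
  have hgD : ∀ x ∈ D, g x = ramp (u x - b x) := fun x hx => if_pos hx
  have hg0 : ∀ x ∉ K, g x = 0 := by
    intro x hx
    by_cases hxD : x ∈ D
    · rw [hgD x hxD]
      have h1 : u x - Φ x = 0 := image_eq_zero_of_notMem_tsupport (f := fun x => u x - Φ x) hx
      exact ramp_of_nonpos (by linarith [hΦb x hxD])
    · exact if_neg hxD
  have hub : ContDiffOn ℝ 1 (fun x => u x - b x) D := hu.contDiffOn.sub hb.1
  have hgC : ContDiff ℝ 1 g := contDiff_of_eq_zero_off hD (isClosed_tsupport _) hs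
    ((contDiff_ramp.comp_contDiffOn hub).congr hgD) hg0
  have hgK : tsupport g ⊆ K := closure_minimal
    (fun x hx => by_contra fun h => hx (hg0 x h)) (isClosed_tsupport _)
  have hgc : HasCompactSupport g := HasCompactSupport.of_support_subset_isCompact hc
    ((subset_tsupport g).trans hgK)
  have hgs : tsupport g ⊆ D := hgK.trans hs
  have hpt : ∀ x, m * ‖∇ g x‖ ^ 2 ≤ ⟪flux a (∇ u x), ∇ g x⟫ - ⟪flux a (∇ b x), ∇ g x⟫ := by
    intro x
    by_cases hx : x ∈ tsupport g
    · have hxD := hgs hx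
      have hbd := differentiableAt_of_contDiffOn hb.1 hD hxD
      have hud := hu.differentiable one_ne_zero x
      have e : ∇ g x = (max 0 (min (u x - b x) 1)) • (∇ u x - ∇ b x) := by
        rw [gradient_congr_of_eqOn hD hgD hxD, ← gradient_sub hud hbd]
        exact gradient_comp (hasDerivAt_ramp _) (hud.sub hbd)
      set ρ := max 0 (min (u x - b x) 1)
      have hρ0 : 0 ≤ ρ := le_max_left _ _
      have hρ1 : ρ ≤ 1 := max_le zero_le_one (min_le_right _ _)
      rw [← inner_sub_left, e, inner_smul_right, norm_smul, Real.norm_of_nonneg hρ0, mul_pow]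
      have h1 := mul_le_mul_of_nonneg_left (hF.mono (∇ u x) (∇ b x)) hρ0
      have h2 : ρ ^ 2 * (m * ‖∇ u x - ∇ b x‖ ^ 2) ≤ ρ * (m * ‖∇ u x - ∇ b x‖ ^ 2) :=
        mul_le_mul_of_nonneg_right (by nlinarith) (by positivity)
      linarith
    · rw [gradient_eq_zero_of_notMem_tsupport hx]
      simp
  have i1 := integrable_inner_comp_gradient hF.continuous hu hgC hgc
  have i2 : Integrable fun x => ⟪flux a (∇ b x), ∇ g x⟫ :=
    integrable_inner_gradient hD (continuousOn_flux_gradient ha hp hD hb.1) hgC hgc hgs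
  have h1 : m * ∫ x, ‖∇ g x‖ ^ 2 ≤ δ * (1 + ∫ x, ‖∇ g x‖ ^ 2) := by
    rw [← integral_const_mul]
    refine (integral_mono ((integrable_sq_norm_gradient hgC hgc).const_mul m) (i1.sub i2)
      hpt).trans ?_
    simp only [Pi.sub_apply]
    rw [integral_sub i1 i2, hb.2 g hgC hgc hgs, sub_zero]
    exact (le_abs_self _).trans (hal g hgC hgc hgs)
  have hX : 0 ≤ ∫ x, ‖∇ g x‖ ^ 2 := integral_nonneg fun x => sq_nonneg _
  refine ⟨g, hgC.continuous, hgc, hgD, (integral_sq_le_of_support hgC hR fun x hx =>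
    image_eq_zero_of_notMem_tsupport fun h => hx (hDR (hgs h))).trans
      (mul_le_mul_of_nonneg_left ?_ (sq_nonneg _))⟩
  rw [le_div_iff₀ hm]
  nlinarith [mul_le_mul_of_nonneg_right hδ hX]

lemma eq_zero_of_setIntegral_le_zero {f : Plane → ℝ} {ρ : ℝ} (hρ : 0 < ρ)
    (hf : ContinuousOn f (closedBall x₀ ρ)) (h0 : ∀ x ∈ closedBall x₀ ρ, 0 ≤ f x)
    (h : ∫ x in ball x₀ ρ, f x ≤ 0) : f x₀ = 0 := by
  have hi : IntegrableOn f (ball x₀ ρ) :=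
    (hf.integrableOn_compact (isCompact_closedBall _ _)).mono_set ball_subset_closedBall
  have hn : 0 ≤ᵐ[volume.restrict (ball x₀ ρ)] f := by
    filter_upwards [ae_restrict_mem measurableSet_ball] with x hx
    exact h0 x (ball_subset_closedBall hx)
  have hz := (setIntegral_eq_zero_iff_of_nonneg_ae hn hi).1 (le_antisymm h (integral_nonneg_of_ae hn))
  exact Measure.eqOn_open_of_ae_eq hz isOpen_ball (hf.mono ball_subset_closedBall)
    continuousOn_const (mem_ball_self hρ)

/-- Limits of almost solutions lie below every solution dominating the boundary data. -/
lemma le_of_barrier (ha : IsKernel p a) (hp : 1 < p) (hF : StrongMono (flux a) m N)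
    (hD : IsOpen D) (hDb : Bornology.IsBounded D) (hu : ∀ j, ContDiff ℝ 1 (u j)) {δ : ℕ → ℝ}
    (hal : ∀ j, AlmostSol (flux a) D (δ j) (u j)) (hδ1 : ∀ j, δ j ≤ m / 16)
    (hδ : Tendsto δ atTop (𝓝 0)) {v b Φ : Plane → ℝ} (hv : ContDiffOn ℝ 1 v D)
    (hlim : ∀ x ∈ D, ∃ ρ > 0, closedBall x ρ ⊆ D ∧
      Tendsto (fun j => ∫ y in ball x ρ, (u j y - v y) ^ 2) atTop (𝓝 0))
    (hc : ∀ j, HasCompactSupport fun x => u j x - Φ x)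
    (hs : ∀ j, tsupport (fun x => u j x - Φ x) ⊆ D) (hb : WeakSol a D b)
    (hΦb : ∀ x ∈ D, Φ x ≤ b x) : ∀ x ∈ D, v x ≤ b x := by
  intro x hx
  obtain ⟨R, hR0, hR⟩ : ∃ R : ℝ, 0 < R ∧ D ⊆ ball 0 R := by
    obtain ⟨R, hR⟩ := hDb.subset_ball 0
    exact ⟨max R 1, by positivity, hR.trans (ball_subset_ball (le_max_left _ _))⟩
  obtain ⟨ρ, hρ, hsub, ht⟩ := hlim x hx
  choose g hgc hgs hgD hgi using fun j => AlmostSol.exists_ramp ha hp hF hD (hδ1 j) (hal j) (hu j)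
    hb (hc j) (hs j) hΦb hR0 hR
  have hcv : ContinuousOn v (closedBall x ρ) := hv.continuousOn.mono hsub
  have hcb : ContinuousOn b (closedBall x ρ) := hb.1.continuousOn.mono hsub
  have hcr : ContinuousOn (fun y => ramp (v y - b y) ^ 2) (closedBall x ρ) :=
    (contDiff_ramp.continuous.comp_continuousOn (hcv.sub hcb)).pow 2
  have hle : ∀ j, ∫ y in ball x ρ, ramp (v y - b y) ^ 2 ≤
      2 * (∫ y in ball x ρ, (u j y - v y) ^ 2) + 2 * ((2 * R) ^ 2 * (2 * δ j / m)) := by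
    intro j
    have i1 : IntegrableOn (fun y => 2 * (u j y - v y) ^ 2) (ball x ρ) :=
      ((continuousOn_const.mul (((hu j).continuous.continuousOn.sub hcv).pow 2)).integrableOn_compact
        (isCompact_closedBall _ _)).mono_set ball_subset_closedBall
    have i2 : IntegrableOn (fun y => 2 * g j y ^ 2) (ball x ρ) :=
      Continuous.integrableOn_ball (continuous_const.mul ((hgc j).pow 2)) _ _
    have i3 : IntegrableOn (fun y => ramp (v y - b y) ^ 2) (ball x ρ) :=
      (hcr.integrableOn_compact (isCompact_closedBall _ _)).mono_set ball_subset_closedBall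
    have h1 : ∫ y in ball x ρ, g j y ^ 2 ≤ ∫ y, g j y ^ 2 :=
      setIntegral_le_integral (integrable_sq_of_compactSupport (hgc j) (hgs j))
        (Eventually.of_forall fun y => sq_nonneg _)
    calc _ ≤ ∫ y in ball x ρ, (2 * (u j y - v y) ^ 2 + 2 * g j y ^ 2) := by
          refine setIntegral_mono_on i3 (i1.add i2) measurableSet_ball fun y hy => ?_
          rw [hgD j y (hsub (ball_subset_closedBall hy))]
          have h2 := abs_ramp_sub_le (v y - b y) (u j y - b y)
          rw [sub_sub_sub_cancel_right, abs_sub_comm (v y)] at h2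
          have h3 := sq_le_sq' (by linarith [abs_nonneg (ramp (v y - b y) - ramp (u j y - b y))]) h2
          rw [sq_abs, sq_abs] at h3
          nlinarith [sq_nonneg (ramp (v y - b y) - 2 * ramp (u j y - b y))]
      _ = 2 * (∫ y in ball x ρ, (u j y - v y) ^ 2) + 2 * ∫ y in ball x ρ, g j y ^ 2 := by
          rw [integral_add i1 i2, integral_const_mul, integral_const_mul]
      _ ≤ _ := by linarith [hgi j]
  have hlim0 : Tendsto (fun j => 2 * (∫ y in ball x ρ, (u j y - v y) ^ 2) +
      2 * ((2 * R) ^ 2 * (2 * δ j / m))) atTop (𝓝 (2 * 0 + 2 * ((2 * R) ^ 2 * (2 * 0 / m)))) :=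
    (ht.const_mul 2).add ((((hδ.const_mul 2).div_const m).const_mul _).const_mul 2)
  simp only [mul_zero, zero_div, add_zero] at hlim0
  have h0 := eq_zero_of_setIntegral_le_zero hρ hcr (fun y _ => sq_nonneg _)
    (ge_of_tendsto' hlim0 hle)
  by_contra hcon
  rw [not_le] at hcon
  have := ramp_pos (sub_pos.2 hcon)
  exact absurd h0 (by positivity)

lemma AlmostSol.neg {u : Plane → ℝ} {δ : ℝ} (h : AlmostSol (flux a) D δ u) :
    AlmostSol (flux a) D δ fun x => -u x := by
  intro η hη hc hs
  have : ∀ x, ⟪flux a (∇ (fun x => -u x) x), ∇ η x⟫ = -⟪flux a (∇ u x), ∇ η x⟫ := fun x => by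
    rw [gradient_neg, flux_neg, inner_neg_left]
  simp only [this]
  rw [integral_neg, abs_neg]
  exact h η hη hc hs

lemma strongMono_flux (ha : IsKernel p a) (hp : 1 < p) {l L : ℝ} (hl : 0 < l) (hL : 0 < L)
    (h : ∀ t, l ≤ a t ∧ a t ≤ L) : StrongMono (flux a) (cLow p * l) (cUp p * L) where
  pos := mul_pos (cLow_pos hp) hl
  pos' := mul_pos (cUp_pos p) hL
  mono ξ ζ := by
    refine le_trans ?_ (ha.le_inner_flux_sub hp ξ ζ)
    refine mul_le_mul_of_nonneg_right ?_ (sq_nonneg _)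
    exact mul_le_mul_of_nonneg_left (h _).1 (cLow_pos hp).le
  lip ξ ζ := by
    refine (ha.norm_flux_sub_le hp ξ ζ).trans ?_
    refine mul_le_mul_of_nonneg_right ?_ (norm_nonneg _)
    exact mul_le_mul_of_nonneg_left (h _).2 (cUp_pos p).le

/-- Solvability of the uniformly elliptic problem, in the sense of barriers. -/
theorem exists_weakSol_barrier (hp : 1 < p) {ε : ℝ} (hε : 0 < ε) (hε1 : ε ≤ 1) (hD : IsOpen D)
    (hDb : Bornology.IsBounded D) {Φ : Plane → ℝ} (hΦ : ContDiff ℝ 1 Φ)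
    (hΦc : HasCompactSupport Φ) : ∃ v, WeakSol (clampKernel p ε) D v ∧
      (∀ b, WeakSol (clampKernel p ε) D b → (∀ x ∈ D, Φ x ≤ b x) → ∀ x ∈ D, v x ≤ b x) ∧
      ∀ b, WeakSol (clampKernel p ε) D b → (∀ x ∈ D, b x ≤ Φ x) → ∀ x ∈ D, b x ≤ v x := by
  obtain ⟨l, L, hl, hL, hb⟩ := exists_clampKernel_bounds p hε hε1
  have ha := isKernel_clamp p hε
  have hac := continuous_clampKernel p hε
  have hF := strongMono_flux ha hp hl hL hb
  obtain ⟨A, u, hu, hus⟩ := exists_approxSeq (E := energy (clampKernel p ε)) hF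
    (continuous_energy hac) (by simp [energy])
    (energy_ge_tangent ha hp hac (clampKernel_pos p hε)) hl
    (energy_lower hac fun t => (hb t).1) hDb hΦ hΦc
  obtain ⟨v, hv, hlim⟩ := hu.exists_limit hD
  have hm := hF.pos
  set m := cLow p * l
  have hδ : Tendsto (fun j : ℕ => m / 16 / 64 ^ j) atTop (𝓝 0) :=
    tendsto_const_nhds.div_atTop (tendsto_pow_atTop_atTop_of_one_lt (by norm_num))
  have hδ1 : ∀ j : ℕ, m / 16 / 64 ^ j ≤ m / 16 := fun j =>
    div_le_self (by positivity) (one_le_pow₀ (by norm_num))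
  refine ⟨v, ⟨hv, fun η h1 h2 h3 => integral_inner_eq_zero_of_tendsto hF hD hu.contDiff hu.almost hδ
    hv (fun x hx => ?_) h1 h2 h3⟩, fun b h1 h2 => ?_, fun b h1 h2 x hx => ?_⟩
  · obtain ⟨ρ, h1, h2, h3, -⟩ := hlim x hx
    exact ⟨ρ, h1, h2, h3⟩
  · refine le_of_barrier ha hp hF hD hDb hu.contDiff hu.almost hδ1 hδ hv (fun x hx => ?_)
      (fun j => (hus j).1) (fun j => (hus j).2) h1 h2
    obtain ⟨ρ, h1, h2, -, h3⟩ := hlim x hx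
    exact ⟨ρ, h1, h2, h3⟩
  · have e : ∀ j, (fun x => -u j x - -Φ x) = fun x => -(u j x - Φ x) := fun j => by
      funext y; ring
    have := le_of_barrier (u := fun j x => -u j x) (v := fun x => -v x) (Φ := fun x => -Φ x) ha hp hF
      hD hDb (fun j => (hu.contDiff j).neg) (fun j => (hu.almost j).neg) hδ1 hδ hv.neg
      (fun x hx => ?_) (fun j => ?_) (fun j => ?_) h1.neg (fun y hy => neg_le_neg (h2 y hy)) x hx
    · linarith
    · obtain ⟨ρ, h1, h2, -, h3⟩ := hlim x hx
      refine ⟨ρ, h1, h2, h3.congr fun j => ?_⟩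
      congr 1; funext y; ring
    · rw [e]; exact (hus j).1.comp_left (g := fun t => -t) (by simp)
    · rw [e]
      have : tsupport (fun x => -(u j x - Φ x)) = tsupport fun x => u j x - Φ x := by
        simp only [tsupport]
        congr 1
        ext y; simp only [Function.mem_support, ne_eq, neg_eq_zero]
      rw [this]; exact (hus j).2

end StrongLimit

section Radial

variable {p : ℝ} {a : ℝ → ℝ} {D : Set Plane}

/-- Profile of the radial solution, as a function of the squared distance to the centre. -/
noncomputable def radialProfile (p A s : ℝ) : ℝ :=
  ∫ t in A..s, 1 / 2 * t ^ (-(p / (2 * (p - 1))))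

lemma radialProfile_self (p A : ℝ) : radialProfile p A A = 0 := intervalIntegral.integral_same

lemma continuousAt_radialProfile_deriv (p : ℝ) {t : ℝ} (ht : 0 < t) :
    ContinuousAt (fun t : ℝ => 1 / 2 * t ^ (-(p / (2 * (p - 1))))) t :=
  continuousAt_const.mul (Real.continuousAt_rpow_const _ _ (Or.inl ht.ne'))

lemma intervalIntegrable_radialProfile (p : ℝ) {A s : ℝ} (hA : 0 < A) (hs : 0 < s) :
    IntervalIntegrable (fun t : ℝ => 1 / 2 * t ^ (-(p / (2 * (p - 1))))) volume A s :=
  ContinuousOn.intervalIntegrable fun _ ht => (continuousAt_radialProfile_deriv p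
    ((lt_min hA hs).trans_le ht.1)).continuousWithinAt

lemma hasDerivAt_radialProfile (p : ℝ) {A s : ℝ} (hA : 0 < A) (hs : 0 < s) :
    HasDerivAt (radialProfile p A) (1 / 2 * s ^ (-(p / (2 * (p - 1))))) s :=
  intervalIntegral.integral_hasDerivAt_right (intervalIntegrable_radialProfile p hA hs)
    (ContinuousOn.stronglyMeasurableAtFilter isOpen_Ioi
      (fun _ ht => (continuousAt_radialProfile_deriv p ht).continuousWithinAt) s hs)
    (continuousAt_radialProfile_deriv p hs)

lemma contDiffOn_radialProfile (p : ℝ) {A : ℝ} (hA : 0 < A) :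
    ContDiffOn ℝ 1 (radialProfile p A) (Ioi 0) := by
  rw [show (1 : WithTop ℕ∞) = 0 + 1 from (zero_add 1).symm,
    contDiffOn_succ_iff_deriv_of_isOpen isOpen_Ioi]
  refine ⟨fun _ ht => (hasDerivAt_radialProfile p hA ht).differentiableAt.differentiableWithinAt,
    by simp, ?_⟩
  rw [contDiffOn_zero]
  refine ContinuousOn.congr (f := fun t : ℝ => 1 / 2 * t ^ (-(p / (2 * (p - 1)))))
    (fun _ ht => (continuousAt_radialProfile_deriv p ht).continuousWithinAt) fun t ht => ?_
  exact (hasDerivAt_radialProfile p hA ht).deriv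

lemma radialProfile_pos (p : ℝ) {A s : ℝ} (hA : 0 < A) (hs : A < s) : 0 < radialProfile p A s :=
  intervalIntegral.intervalIntegral_pos_of_pos_on
    (intervalIntegrable_radialProfile p hA (hA.trans hs)) (fun t ht => by
      have : 0 < t := hA.trans ht.1
      positivity) hs

lemma gradient_norm_sub_sq (y x : Plane) : ∇ (fun z => ‖z - y‖ ^ 2) x = (2 : ℝ) • (x - y) := by
  have h := (hasStrictFDerivAt_norm_sq (x - y)).hasFDerivAt.comp x
    ((hasFDerivAt_id x).sub_const y)
  have h2 : fderiv ℝ (fun z => ‖z - y‖ ^ 2) x = 2 • innerSL ℝ (x - y) := by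
    rw [show (fun z : Plane => ‖z - y‖ ^ 2) = (fun x => ‖x‖ ^ 2) ∘ fun z => id z - y from rfl,
      h.fderiv]
    ext; simp
  rw [gradient_def, h2, LinearIsometryEquiv.symm_apply_eq]
  ext z
  simp

lemma rpow_radial {r : ℝ} (hr : 0 < r) (hp : 1 < p) :
    (r ^ 2) ^ (-(p / (2 * (p - 1)))) * r = r ^ (-(1 / (p - 1))) := by
  have h1 : p - 1 ≠ 0 := by linarith
  rw [← Real.rpow_natCast, ← Real.rpow_mul hr.le]
  nth_rewrite 2 [← Real.rpow_one r]
  rw [← Real.rpow_add hr]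
  congr 1
  push_cast
  field_simp
  ring

lemma gradient_radial (c C : ℝ) {A : ℝ} (hA : 0 < A) {x y : Plane} (h : x ≠ y) :
    ∇ (fun z => c + C * radialProfile p A (‖z - y‖ ^ 2)) x =
      (C * (‖x - y‖ ^ 2) ^ (-(p / (2 * (p - 1))))) • (x - y) := by
  have hr : 0 < ‖x - y‖ ^ 2 := by
    have := norm_pos_iff.2 (sub_ne_zero.2 h)
    positivity
  have hd : DifferentiableAt ℝ (fun z : Plane => ‖z - y‖ ^ 2) x :=
    (((contDiff_id.sub contDiff_const).norm_sq ℝ).differentiable one_ne_zero) x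
  have hk : HasDerivAt (fun s => c + C * radialProfile p A s)
      (C * (1 / 2 * (‖x - y‖ ^ 2) ^ (-(p / (2 * (p - 1)))))) (‖x - y‖ ^ 2) :=
    ((hasDerivAt_radialProfile p hA hr).const_mul C).const_add c
  rw [gradient_comp (f := fun z => ‖z - y‖ ^ 2) hk hd, gradient_norm_sub_sq, smul_smul]
  congr 1
  ring

lemma contDiffOn_radial (p c C : ℝ) {A : ℝ} (hA : 0 < A) (y : Plane) :
    ContDiffOn ℝ 1 (fun z => c + C * radialProfile p A (‖z - y‖ ^ 2)) {y}ᶜ := by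
  refine contDiffOn_const.add (contDiffOn_const.mul ?_)
  refine (contDiffOn_radialProfile p hA).comp
    ((contDiff_id.sub contDiff_const).norm_sq ℝ).contDiffOn fun x hx => ?_
  have := norm_pos_iff.2 (sub_ne_zero.2 (show x ≠ y from hx))
  exact mem_Ioi.2 (by simpa using pow_pos this 2)

lemma weakSol_radial (hp : 1 < p) (c : ℝ) {C A : ℝ} (hC : 0 < C) (hA : 0 < A) {y : Plane}
    (hy : y ∉ D) (h : ∀ x ∈ D, a (C * ‖x - y‖ ^ (-(1 / (p - 1)))) =
      (C * ‖x - y‖ ^ (-(1 / (p - 1)))) ^ (p - 2)) :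
    WeakSol a D fun z => c + C * radialProfile p A (‖z - y‖ ^ 2) := by
  refine ⟨(contDiffOn_radial p c C hA y).mono fun x hx hxy => hy (hxy ▸ hx), fun η h1 h2 h3 => ?_⟩
  have key : ∀ x, ⟪flux a (∇ (fun z => c + C * radialProfile p A (‖z - y‖ ^ 2)) x), ∇ η x⟫ =
      C ^ (p - 1) * ⟪(‖x - y‖ ^ 2)⁻¹ • (x - y), ∇ η x⟫ := by
    intro x
    by_cases hx : x ∈ tsupport η
    · have hxy : x ≠ y := fun e => hy (e ▸ h3 hx)
      have hr : 0 < ‖x - y‖ := norm_pos_iff.2 (sub_ne_zero.2 hxy)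
      rw [gradient_radial c C hA hxy, flux, norm_smul, Real.norm_of_nonneg (by positivity),
        mul_assoc, rpow_radial hr hp, h x (h3 hx), smul_smul, ← real_inner_smul_left, smul_smul]
      congr 2
      have e1 : (‖x - y‖ ^ 2) ^ (-(p / (2 * (p - 1)))) =
          ‖x - y‖ ^ (-(1 / (p - 1))) * ‖x - y‖⁻¹ := by
        rw [← rpow_radial hr hp, mul_inv_cancel_right₀ hr.ne']
      rw [e1, ← mul_assoc C, ← mul_assoc]
      set q := ‖x - y‖ ^ (-(1 / (p - 1))) with hq
      have hq0 : 0 < q := by positivity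
      have e2 : (C * q) ^ (p - 2) * (C * q) = C ^ (p - 1) * q ^ (p - 1) := by
        rw [← Real.mul_rpow hC.le hq0.le, ← Real.rpow_add_one (by positivity)]
        congr 1; ring
      have e3 : q ^ (p - 1) = ‖x - y‖⁻¹ := by
        rw [hq, ← Real.rpow_mul hr.le, ← Real.rpow_neg_one]
        congr 1
        have : p - 1 ≠ 0 := by linarith
        field_simp
      rw [e2, e3]
      field_simp
    · rw [gradient_eq_zero_of_notMem_tsupport hx]
      simp
  simp only [key]
  rw [integral_const_mul, integral_inner_radial h1 h2 fun e => hy (h3 e), mul_zero]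

lemma exists_barrier (hp : 1 < p) (hDb : Bornology.IsBounded D) {Φ : Plane → ℝ}
    (hΦ : Continuous Φ) {M : ℝ} (hM : ∀ x, |Φ x| ≤ M) {x₀ y : Plane} {R : ℝ} (hR : 0 < R)
    (hx₀ : ‖x₀ - y‖ = R) (hout : ∀ x ∈ closure D, x ≠ x₀ → R < ‖x - y‖) (hx₀D : x₀ ∉ D)
    {σ : ℝ} (hσ : 0 < σ) : ∃ b : Plane → ℝ, ContinuousAt b x₀ ∧ b x₀ = Φ x₀ + σ ∧
      (∀ x ∈ D, Φ x ≤ b x) ∧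
      ∃ ε₀ > 0, ∀ ε, 0 < ε → ε ≤ ε₀ → WeakSol (clampKernel p ε) D b := by
  have hRD : ∀ x ∈ D, R < ‖x - y‖ := fun x hx =>
    hout x (subset_closure hx) fun e => hx₀D (e ▸ hx)
  have hyD : y ∉ D := fun h => by
    have := hRD y h
    simp at this
    linarith
  have hA : 0 < R ^ 2 := by positivity
  obtain ⟨r, hr, hrΦ⟩ := Metric.continuousAt_iff.1 (hΦ.continuousAt (x := x₀)) σ hσ
  have hK : IsCompact (closure D \ ball x₀ r) :=
    (hDb.isCompact_closure).diff isOpen_ball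
  have hcp : ContinuousOn (fun z => radialProfile p (R ^ 2) (‖z - y‖ ^ 2)) {y}ᶜ := by
    have := (contDiffOn_radial p 0 1 hA y).continuousOn
    simpa using this
  have hKx : ∀ x ∈ closure D \ ball x₀ r, R < ‖x - y‖ := fun x hx =>
    hout x hx.1 fun e => hx.2 (e ▸ mem_ball_self hr)
  obtain ⟨μ, hμ, hμK⟩ := hK.exists_forall_le' (a := 0) (hcp.mono fun x hx hxy => by
      have := hKx x hx
      rw [show x = y from hxy] at this
      simp at this
      linarith) fun x hx => radialProfile_pos p hA (pow_lt_pow_left₀ (hKx x hx) hR.le two_ne_zero)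
  have hM0 : 0 ≤ M := (abs_nonneg _).trans (hM 0)
  set C : ℝ := (2 * M + 1) / μ with hCdef
  have hC : 0 < C := by positivity
  refine ⟨fun z => (Φ x₀ + σ) + C * radialProfile p (R ^ 2) (‖z - y‖ ^ 2), ?_, ?_, ?_, ?_⟩
  · refine (contDiffOn_radial p _ C hA y).continuousOn.continuousAt
      (isOpen_compl_singleton.mem_nhds fun e => ?_)
    rw [show x₀ = y from e] at hx₀
    simp at hx₀
    linarith
  · simp only [hx₀, radialProfile_self, mul_zero, add_zero]
  · intro x hx
    have hpos := radialProfile_pos p hA (pow_lt_pow_left₀ (hRD x hx) hR.le two_ne_zero)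
    have hCpos := mul_pos hC hpos
    by_cases hxr : x ∈ ball x₀ r
    · have h1 := hrΦ (mem_ball.1 hxr)
      rw [Real.dist_eq] at h1
      linarith [(abs_lt.1 h1).2]
    · have h1 := mul_le_mul_of_nonneg_left (hμK x ⟨subset_closure hx, hxr⟩) hC.le
      rw [hCdef, div_mul_cancel₀ _ hμ.ne'] at h1
      have h2 := (abs_le.1 (hM x)).2
      have h3 := (abs_le.1 (hM x₀)).1
      linarith
  · obtain ⟨R', hR', hDR'⟩ : ∃ R' : ℝ, 0 < R' ∧ D ⊆ ball y R' := by
      obtain ⟨R', h⟩ := hDb.subset_ball y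
      exact ⟨max R' 1, by positivity, h.trans (ball_subset_ball (le_max_left _ _))⟩
    have he : -(1 / (p - 1)) ≤ 0 := by
      have : 0 < 1 / (p - 1) := one_div_pos.2 (by linarith)
      linarith
    refine ⟨min (C * R' ^ (-(1 / (p - 1)))) (C * R ^ (-(1 / (p - 1))))⁻¹, by positivity,
      fun ε hε hε0 => weakSol_radial hp _ hC hA hyD fun x hx => clampKernel_eq p ?_ ?_⟩
    · refine (hε0.trans (min_le_left _ _)).trans (mul_le_mul_of_nonneg_left ?_ hC.le)
      refine Real.rpow_le_rpow_of_nonpos (hR.trans (hRD x hx)) ?_ he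
      have := hDR' hx
      rw [mem_ball, dist_eq_norm] at this
      exact this.le
    · have h1 := hε0.trans (min_le_right _ _)
      rw [le_inv_comm₀ hε (by positivity)] at h1
      refine le_trans (mul_le_mul_of_nonneg_left ?_ hC.le) h1
      exact Real.rpow_le_rpow_of_nonpos hR (hRD x hx).le he

end Radial

section Smooth

variable {p : ℝ} {D : Set Plane}

/-- Gluing a function on an open set with its boundary values. -/
lemma continuousOn_closure_of_eventually {v Φ : Plane → ℝ} (hD : IsOpen D)
    (hv : ContinuousOn v D) (hΦ : ContinuousOn Φ (closure D))
    (h : ∀ x₀ ∈ frontier D, ∀ κ > 0, ∀ᶠ x in 𝓝[D] x₀, |v x - Φ x₀| ≤ κ) {u : Plane → ℝ}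
    (huv : ∀ x ∈ D, u x = v x) (huΦ : ∀ x ∉ D, u x = Φ x) : ContinuousOn u (closure D) := by
  intro x₀ hx₀
  by_cases hx : x₀ ∈ D
  · exact (((hv.congr huv).continuousAt (hD.mem_nhds hx))).continuousWithinAt
  · have hf : x₀ ∈ frontier D := ⟨hx₀, by rwa [hD.interior_eq]⟩
    rw [Metric.continuousWithinAt_iff']
    intro κ hκ
    have h1 := h x₀ hf (κ / 2) (by positivity)
    have h2 := Metric.continuousWithinAt_iff'.1 (hΦ x₀ hx₀) κ hκ
    rw [eventually_nhdsWithin_iff] at h1 h2 ⊢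
    filter_upwards [h1, h2] with x hx1 hx2 hxc
    rw [huΦ x₀ hx]
    by_cases hxD : x ∈ D
    · rw [huv x hxD, Real.dist_eq]
      linarith [hx1 hxD]
    · rw [huΦ x hxD]
      exact hx2 hxc

theorem exists_solution_of_exterior_ball (hp : 1 < p) (hD : IsOpen D)
    (hDb : Bornology.IsBounded D) {Φ : Plane → ℝ} (hΦ : ContDiff ℝ 1 Φ)
    (hΦc : HasCompactSupport Φ)
    (hext : ∀ x₀ ∈ frontier D, ∃ (y : Plane) (R : ℝ), 0 < R ∧ ‖x₀ - y‖ = R ∧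
      ∀ x ∈ closure D, x ≠ x₀ → R < ‖x - y‖) :
    ∃ u, ContinuousOn u (closure D) ∧ WeakSol (fun t => t ^ (p - 2)) D u ∧
      (∀ x ∉ D, u x = Φ x) := by
  classical
  set ε : ℕ → ℝ := fun n => 1 / ((n : ℝ) + 1) with hεd
  have hε : ∀ n, 0 < ε n := fun n => by positivity
  have hε1 : ∀ n, ε n ≤ 1 := fun n => by
    rw [hεd]
    simp only
    rw [div_le_one (by positivity)]
    linarith [Nat.cast_nonneg (α := ℝ) n]
  choose v hv hup hlo using fun n => exists_weakSol_barrier hp (hε n) (hε1 n) hD hDb hΦ hΦc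
  obtain ⟨M, hM⟩ : ∃ M : ℝ, ∀ x, |Φ x| ≤ M := by
    obtain ⟨M, hM⟩ := hΦ.continuous.bounded_above_of_compact_support hΦc
    exact ⟨M, hM⟩
  set l : Ultrafilter ℕ := hyperfilter ℕ
  have hlt : (l : Filter ℕ) ≤ atTop := Nat.hyperfilter_le_atTop
  have hεl : Tendsto ε l (𝓝 0) := tendsto_one_div_add_atTop_nhds_zero_nat.mono_left hlt
  obtain ⟨w, hw, hwl⟩ := exists_weakSol_limit hp l (fun n => isKernel_clamp p (hε n))
    (tendsto_flux_clamp hp hε hε1 hεl) (U := fun _ => D) (fun _ => hD) hD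
    (fun x hx => by
      obtain ⟨r, hr, hrD⟩ := Metric.nhds_basis_closedBall.mem_iff.1 (hD.mem_nhds hx)
      exact ⟨r, hr, Eventually.of_forall fun _ => hrD⟩) hv (M := M) (fun n x hx => by
      rw [abs_le]
      exact ⟨hlo n _ (weakSol_const _ _ (-M)) (fun z _ => (abs_le.1 (hM z)).1) x hx,
        hup n _ (weakSol_const _ _ M) (fun z _ => (abs_le.1 (hM z)).2) x hx⟩)
  have hle : ∀ b : Plane → ℝ, (∀ x ∈ D, Φ x ≤ b x) →
      (∃ ε₀ > 0, ∀ ε, 0 < ε → ε ≤ ε₀ → WeakSol (clampKernel p ε) D b) → ∀ x ∈ D, w x ≤ b x := by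
    rintro b hb ⟨ε₀, hε₀, hbs⟩ x hx
    refine le_of_tendsto (hwl x hx) ?_
    filter_upwards [hεl.eventually (ge_mem_nhds hε₀)] with n hn
    exact hup n b (hbs _ (hε n) hn) hb x hx
  have hge : ∀ b : Plane → ℝ, (∀ x ∈ D, -Φ x ≤ b x) →
      (∃ ε₀ > 0, ∀ ε, 0 < ε → ε ≤ ε₀ → WeakSol (clampKernel p ε) D b) →
      ∀ x ∈ D, -b x ≤ w x := by
    rintro b hb ⟨ε₀, hε₀, hbs⟩ x hx
    refine ge_of_tendsto (hwl x hx) ?_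
    filter_upwards [hεl.eventually (ge_mem_nhds hε₀)] with n hn
    exact hlo n _ (hbs _ (hε n) hn).neg (fun z hz => by linarith [hb z hz]) x hx
  have hbd : ∀ x₀ ∈ frontier D, ∀ κ > 0, ∀ᶠ x in 𝓝[D] x₀, |w x - Φ x₀| ≤ κ := by
    intro x₀ hx₀ κ hκ
    obtain ⟨y, R, hR, hx₀y, hout⟩ := hext x₀ hx₀
    have hx₀D : x₀ ∉ D := by
      have := hx₀.2
      rwa [hD.interior_eq] at this
    obtain ⟨b, hbc, hb0, hb1, hb2⟩ := exists_barrier hp hDb hΦ.continuous hM hR hx₀y hout hx₀D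
      (half_pos hκ)
    obtain ⟨b', hbc', hb0', hb1', hb2'⟩ := exists_barrier (Φ := fun x => -Φ x) hp hDb
      hΦ.continuous.neg (fun x => by rw [abs_neg]; exact hM x) hR hx₀y hout hx₀D (half_pos hκ)
    have e1 := hbc.eventually (ge_mem_nhds (show b x₀ < Φ x₀ + κ by linarith))
    have e2 := hbc'.eventually (ge_mem_nhds (show b' x₀ < -Φ x₀ + κ by linarith))
    rw [eventually_nhdsWithin_iff]
    filter_upwards [e1, e2] with x h1 h2 hx
    rw [abs_le]
    constructor
    · linarith [hge b' hb1' hb2' x hx]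
    · linarith [hle b hb1 hb2 x hx]
  refine ⟨fun x => if x ∈ D then w x else Φ x, ?_, ?_, fun x hx => if_neg hx⟩
  · exact continuousOn_closure_of_eventually hD hw.1.continuousOn hΦ.continuous.continuousOn hbd
      (fun x hx => if_pos hx) fun x hx => if_neg hx
  · exact hw.congr hD fun x hx => if_pos hx

end Smooth

section PosPart

lemma hasDerivAt_max_rpow {m : ℝ} (hm : 1 < m) (s : ℝ) :
    HasDerivAt (fun s : ℝ => max s 0 ^ m) (m * max s 0 ^ (m - 1)) s := by
  rcases lt_trichotomy s 0 with hs | rfl | hs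
  · rw [max_eq_right hs.le, Real.zero_rpow (by linarith), mul_zero]
    refine (hasDerivAt_const s (0 : ℝ)).congr_of_eventuallyEq ?_
    filter_upwards [Iio_mem_nhds hs] with t ht
    rw [max_eq_right (le_of_lt ht), Real.zero_rpow (by linarith)]
  · rw [max_self, Real.zero_rpow (by linarith), mul_zero, hasDerivAt_iff_isLittleO]
    have h := hasDerivAt_iff_isLittleO.1 (hasDerivAt_abs_rpow 0 hm)
    refine Asymptotics.IsBigO.trans_isLittleO (Asymptotics.IsBigO.of_bound 1 ?_) h
    refine Eventually.of_forall fun t => ?_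
    simp only [max_self, abs_zero, Real.zero_rpow (show m ≠ 0 by linarith), smul_zero, mul_zero,
      sub_zero, one_mul]
    rw [Real.norm_of_nonneg (by positivity), Real.norm_of_nonneg (by positivity)]
    exact Real.rpow_le_rpow (le_max_right _ _) (max_le (le_abs_self _) (abs_nonneg _))
      (by linarith)
  · rw [max_eq_left hs.le]
    refine (Real.hasDerivAt_rpow_const (Or.inl hs.ne')).congr_of_eventuallyEq ?_
    filter_upwards [Ioi_mem_nhds hs] with t ht
    rw [max_eq_left (le_of_lt ht)]

lemma contDiff_max_rpow {m : ℝ} (hm : 1 < m) : ContDiff ℝ 1 fun s : ℝ => max s 0 ^ m := by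
  rw [contDiff_one_iff_deriv]
  refine ⟨fun s => (hasDerivAt_max_rpow hm s).differentiableAt, ?_⟩
  rw [show deriv (fun s : ℝ => max s 0 ^ m) = fun s => m * max s 0 ^ (m - 1) from
    funext fun s => (hasDerivAt_max_rpow hm s).deriv]
  exact continuous_const.mul ((continuous_id.max continuous_const).rpow_const
    fun _ => Or.inr (by linarith))

lemma max_rpow_le_one {m s : ℝ} (hm : 0 ≤ m) (hs : s ≤ 1) : max s 0 ^ m ≤ 1 :=
  Real.rpow_le_one (le_max_right _ _) (max_le hs zero_le_one) hm

variable {p σ : ℝ}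

/-- The exponent making the logarithmic estimate exact. -/
noncomputable def logExp (p : ℝ) : ℝ := (p + 1) / (p - 1)

lemma one_lt_logExp (hp : 1 < p) : 1 < logExp p := by
  rw [logExp, one_lt_div (by linarith)]
  linarith

lemma logExp_sub_one_mul (hp : 1 < p) : (logExp p - 1) * (p - 1) = 2 := by
  have : p - 1 ≠ 0 := by linarith
  rw [logExp]
  field_simp
  ring

/-- The truncated distance to the upper obstacle. -/
noncomputable def gap (p σ s : ℝ) : ℝ := 1 + σ - max s 0 ^ logExp p

lemma gap_pos (hp : 1 < p) (hσ : 0 < σ) {s : ℝ} (hs : s ≤ 1) : 0 < gap p σ s := by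
  have := max_rpow_le_one (by linarith [one_lt_logExp hp] : 0 ≤ logExp p) hs
  rw [gap]
  linarith

lemma gap_of_nonpos (hp : 1 < p) {s : ℝ} (hs : s ≤ 0) : gap p σ s = 1 + σ := by
  rw [gap, max_eq_right hs, Real.zero_rpow (by linarith [one_lt_logExp hp]), sub_zero]

lemma hasDerivAt_gap (hp : 1 < p) (s : ℝ) :
    HasDerivAt (gap p σ) (-(logExp p * max s 0 ^ (logExp p - 1))) s :=
  (hasDerivAt_max_rpow (one_lt_logExp hp) s).const_sub (1 + σ)

lemma contDiff_gap (hp : 1 < p) : ContDiff ℝ 1 (gap p σ) :=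
  contDiff_const.sub (contDiff_max_rpow (one_lt_logExp hp))

/-- The logarithmic transform. -/
noncomputable def logGap (p σ s : ℝ) : ℝ := Real.log (1 + σ) - Real.log (gap p σ s)

lemma logGap_of_nonpos (hp : 1 < p) {s : ℝ} (hs : s ≤ 0) : logGap p σ s = 0 := by
  rw [logGap, gap_of_nonpos hp hs, sub_self]

lemma hasDerivAt_logGap (hp : 1 < p) (hσ : 0 < σ) {s : ℝ} (hs : s ≤ 1) :
    HasDerivAt (logGap p σ) (logExp p * max s 0 ^ (logExp p - 1) / gap p σ s) s := by
  have h := ((hasDerivAt_gap (σ := σ) hp s).log (gap_pos hp hσ hs).ne').const_sub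
    (Real.log (1 + σ))
  rwa [neg_div, neg_neg] at h

/-- The nonlinear test function. -/
noncomputable def gapTest (p σ s : ℝ) : ℝ := max s 0 ^ (2 : ℝ) * gap p σ s ^ (1 - p)

noncomputable def gapTestDeriv (p σ s : ℝ) : ℝ :=
  2 * max s 0 ^ ((2 : ℝ) - 1) * gap p σ s ^ (1 - p) +
    max s 0 ^ (2 : ℝ) *
      (-(logExp p * max s 0 ^ (logExp p - 1)) * (1 - p) * gap p σ s ^ (1 - p - 1))

lemma gapTest_of_nonpos {s : ℝ} (hs : s ≤ 0) : gapTest p σ s = 0 := by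
  rw [gapTest, max_eq_right hs, Real.zero_rpow two_ne_zero, zero_mul]

lemma hasDerivAt_gapTest (hp : 1 < p) (hσ : 0 < σ) {s : ℝ} (hs : s ≤ 1) :
    HasDerivAt (gapTest p σ) (gapTestDeriv p σ s) s :=
  (hasDerivAt_max_rpow one_lt_two s).mul
    ((hasDerivAt_gap (σ := σ) hp s).rpow_const (Or.inl (gap_pos hp hσ hs).ne'))

variable {s z X : ℝ}

lemma gapTest_nonneg (hp : 1 < p) (hσ : 0 < σ) (hs : s ≤ 1) : 0 ≤ gapTest p σ s := by
  have := gap_pos hp hσ hs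
  have h0 : 0 ≤ max s 0 := le_max_right _ _
  rw [gapTest]
  positivity

lemma gapTest_mul_eq (hp : 1 < p) (hσ : 0 < σ) (hs : s ≤ 1) (hz : 0 ≤ z) (hX : 0 ≤ X) :
    z ^ (p - 1) * gapTest p σ s * X ^ (p - 1) = logExp p ^ (1 - p) *
      (z * (logExp p * max s 0 ^ (logExp p - 1) / gap p σ s) * X) ^ (p - 1) := by
  have hQ := gap_pos hp hσ hs
  have hm := one_lt_logExp hp
  have hm0 : 0 < logExp p := by linarith
  have h0 : 0 ≤ max s 0 := le_max_right _ _
  rw [Real.mul_rpow (by positivity) hX, Real.mul_rpow hz (by positivity),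
    Real.div_rpow (by positivity) hQ.le, Real.mul_rpow hm0.le (by positivity),
    ← Real.rpow_mul h0, logExp_sub_one_mul hp, gapTest, show 1 - p = -(p - 1) by ring,
    Real.rpow_neg hQ.le, Real.rpow_neg hm0.le]
  have h1 : logExp p ^ (p - 1) ≠ 0 := (Real.rpow_pos_of_pos hm0 _).ne'
  have h2 : gap p σ s ^ (p - 1) ≠ 0 := (Real.rpow_pos_of_pos hQ _).ne'
  field_simp

lemma le_gapTestDeriv_mul (hp : 1 < p) (hσ : 0 < σ) (hs : s ≤ 1) (hz : 0 ≤ z) (hX : 0 ≤ X) :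
    (p - 1) * (logExp p ^ (1 - p) *
      (z * (logExp p * max s 0 ^ (logExp p - 1) / gap p σ s) * X) ^ p) ≤
      z ^ p * gapTestDeriv p σ s * X ^ p := by
  have hQ := gap_pos hp hσ hs
  have hm := one_lt_logExp hp
  have hm0 : 0 < logExp p := by linarith
  have h0 : 0 ≤ max s 0 := le_max_right _ _
  have e1 : max s 0 ^ (2 : ℝ) * max s 0 ^ (logExp p - 1) = (max s 0 ^ (logExp p - 1)) ^ p := by
    rw [← Real.rpow_add_of_nonneg h0 zero_le_two (by linarith), ← Real.rpow_mul h0]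
    congr 1
    linarith [logExp_sub_one_mul hp]
  have e2 : logExp p ^ (1 - p) * logExp p ^ p = logExp p := by
    rw [← Real.rpow_add hm0, sub_add_cancel, Real.rpow_one]
  have h1 : (p - 1) * logExp p * (max s 0 ^ (logExp p - 1)) ^ p / gap p σ s ^ p ≤
      gapTestDeriv p σ s := by
    rw [gapTestDeriv, ← e1, show 1 - p - 1 = -p by ring, Real.rpow_neg hQ.le]
    have : 0 ≤ 2 * max s 0 ^ ((2 : ℝ) - 1) * gap p σ s ^ (1 - p) := by positivity
    rw [div_eq_mul_inv]
    generalize max s 0 ^ (2 : ℝ) = A at *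
    generalize max s 0 ^ (logExp p - 1) = B at *
    generalize (gap p σ s ^ p)⁻¹ = Q at *
    nlinarith
  rw [Real.mul_rpow (by positivity) hX, Real.mul_rpow hz (by positivity),
    Real.div_rpow (by positivity) hQ.le, Real.mul_rpow hm0.le (by positivity)]
  have h2 := mul_le_mul_of_nonneg_left h1 (show 0 ≤ z ^ p * X ^ p by positivity)
  have e3 : (p - 1) * (logExp p ^ (1 - p) * (z ^ p * (logExp p ^ p *
      (max s 0 ^ (logExp p - 1)) ^ p / gap p σ s ^ p) * X ^ p)) = z ^ p * X ^ p *
      ((p - 1) * (logExp p ^ (1 - p) * logExp p ^ p) * (max s 0 ^ (logExp p - 1)) ^ p /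
        gap p σ s ^ p) := by ring
  rw [e3, e2]
  linarith

/-- Young-type inequality behind the logarithmic estimate. -/
lemma exists_young (hp : 1 < p) (C : ℝ) (hC : 0 ≤ C) : ∃ c : ℝ, 0 < c ∧ ∀ τ α : ℝ, 0 ≤ τ →
    α ≤ C → τ ≤ c + ((p - 1) * τ ^ p - p * α * τ ^ (p - 1)) := by
  have hp1 : 0 < p - 1 := by linarith
  set T : ℝ := max 1 (max (2 * p * C / (p - 1)) ((2 / (p - 1)) ^ (1 / (p - 1)))) with hT
  have hT0 : 0 < T := lt_of_lt_of_le one_pos (le_max_left _ _)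
  refine ⟨T + p * C * T ^ (p - 1), by positivity, fun τ α hτ hα => ?_⟩
  have h1 : 0 ≤ τ ^ (p - 1) := by positivity
  have h2 : p * α * τ ^ (p - 1) ≤ p * C * τ ^ (p - 1) := by gcongr
  have h3 : 0 ≤ p * C * T ^ (p - 1) := by positivity
  rcases le_total τ T with h | h
  · have h4 : p * C * τ ^ (p - 1) ≤ p * C * T ^ (p - 1) := by gcongr
    have h5 : 0 ≤ (p - 1) * τ ^ p := by positivity
    linarith
  · have hτ0 : 0 < τ := hT0.trans_le h
    have e : τ ^ p = τ ^ (p - 1) * τ := by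
      rw [← Real.rpow_add_one hτ0.ne', sub_add_cancel]
    have h4 : 2 * p * C ≤ (p - 1) * τ := by
      have : 2 * p * C / (p - 1) ≤ τ := ((le_max_left _ _).trans (le_max_right _ _)).trans h
      rw [div_le_iff₀ hp1] at this
      linarith
    have h5 : 2 / (p - 1) ≤ τ ^ (p - 1) := by
      have h6 : (2 / (p - 1)) ^ (1 / (p - 1)) ≤ τ :=
        ((le_max_right _ _).trans (le_max_right _ _)).trans h
      have h7 := Real.rpow_le_rpow (by positivity) h6 hp1.le
      rwa [← Real.rpow_mul (by positivity), one_div_mul_cancel hp1.ne', Real.rpow_one] at h7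
    rw [div_le_iff₀ hp1] at h5
    have h6 := mul_le_mul_of_nonneg_right h5 hτ
    have h7 := mul_le_mul_of_nonneg_right h4 h1
    rw [e]
    nlinarith

end PosPart

section LogEstimate

variable {p σ : ℝ} {D : Set Plane} {w ζ : Plane → ℝ} {x x₀ : Plane}

lemma rpow_sub_two_mul (hp : 1 < p) {t : ℝ} (ht : 0 ≤ t) : t ^ (p - 2) * t = t ^ (p - 1) := by
  rcases ht.eq_or_lt with rfl | ht
  · rw [mul_zero, Real.zero_rpow (by linarith)]
  · rw [← Real.rpow_add_one ht.ne']
    congr 1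
    ring

lemma norm_flux_rpow (hp : 1 < p) (ξ : Plane) :
    ‖flux (fun t => t ^ (p - 2)) ξ‖ = ‖ξ‖ ^ (p - 1) := by
  rw [flux, norm_smul, Real.norm_of_nonneg (by positivity), rpow_sub_two_mul hp (norm_nonneg _)]

lemma inner_flux_rpow_self (hp : 1 < p) (ξ : Plane) :
    ⟪flux (fun t => t ^ (p - 2)) ξ, ξ⟫ = ‖ξ‖ ^ p := by
  rw [flux, real_inner_smul_left, real_inner_self_eq_norm_sq, sq, ← mul_assoc,
    rpow_sub_two_mul hp (norm_nonneg _)]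
  rcases (norm_nonneg ξ).eq_or_lt with h | h
  · rw [← h, mul_zero, Real.zero_rpow (by linarith)]
  · rw [← Real.rpow_add_one h.ne', sub_add_cancel]

lemma le_inner_flux_gapTest (hp : 1 < p) (hσ : 0 < σ) (hw : DifferentiableAt ℝ w x)
    (hζ : DifferentiableAt ℝ ζ x) (hz : 0 ≤ ζ x) (hs : w x ≤ 1) {t : ℝ}
    (ht : t = ζ x * (logExp p * max (w x) 0 ^ (logExp p - 1) / gap p σ (w x)) * ‖∇ w x‖) :
    logExp p ^ (1 - p) * ((p - 1) * t ^ p - p * ‖∇ ζ x‖ * t ^ (p - 1)) ≤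
      ⟪flux (fun t => t ^ (p - 2)) (∇ w x),
        ∇ (fun y => ζ y ^ p * gapTest p σ (w y)) x⟫ := by
  have hk := Real.hasDerivAt_rpow_const (x := ζ x) (p := p) (Or.inr hp.le)
  have hg := hasDerivAt_gapTest hp hσ hs
  have d1 : DifferentiableAt ℝ (fun y => ζ y ^ p) x := hk.differentiableAt.comp x hζ
  have d2 : DifferentiableAt ℝ (fun y => gapTest p σ (w y)) x := hg.differentiableAt.comp x hw
  rw [gradient_mul d1 d2, gradient_comp (f := ζ) hk hζ, gradient_comp (f := w) hg hw,
    inner_add_right, real_inner_smul_right, real_inner_smul_right, real_inner_smul_right,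
    real_inner_smul_right, inner_flux_rpow_self hp]
  have h1 := le_gapTestDeriv_mul hp hσ hs hz (norm_nonneg (∇ w x))
  have h2 := gapTest_mul_eq hp hσ hs hz (norm_nonneg (∇ w x))
  rw [← ht] at h1 h2
  have h3 : -(‖∇ w x‖ ^ (p - 1) * ‖∇ ζ x‖) ≤ ⟪flux (fun t => t ^ (p - 2)) (∇ w x), ∇ ζ x⟫ := by
    have := abs_real_inner_le_norm (flux (fun t => t ^ (p - 2)) (∇ w x)) (∇ ζ x)
    rw [norm_flux_rpow hp] at this
    exact (abs_le.1 this).1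
  have h4 : 0 ≤ p * (ζ x ^ (p - 1) * gapTest p σ (w x)) := by
    have := gapTest_nonneg hp hσ hs
    positivity
  have h5 := mul_le_mul_of_nonneg_left h3 h4
  have h6 : p * (ζ x ^ (p - 1) * gapTest p σ (w x)) * -(‖∇ w x‖ ^ (p - 1) * ‖∇ ζ x‖) =
      -(p * ‖∇ ζ x‖ * (logExp p ^ (1 - p) * t ^ (p - 1))) := by rw [← h2]; ring
  nlinarith

lemma mul_le_add_inner_flux_gapTest (hp : 1 < p) (hσ : 0 < σ) (hw : DifferentiableAt ℝ w x)
    (hζ : DifferentiableAt ℝ ζ x) (hz : 0 ≤ ζ x) (hs : w x ≤ 1) {t ρ c C : ℝ} (hρ : 0 < ρ)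
    (ht : t = ζ x * (logExp p * max (w x) 0 ^ (logExp p - 1) / gap p σ (w x)) * ‖∇ w x‖)
    (hC : ρ * ‖∇ ζ x‖ ≤ C) (hc : ∀ τ α : ℝ, 0 ≤ τ →
      α ≤ C → τ ≤ c + ((p - 1) * τ ^ p - p * α * τ ^ (p - 1))) :
    ρ * t ≤ c + ρ ^ p * logExp p ^ (p - 1) * ⟪flux (fun t => t ^ (p - 2)) (∇ w x),
        ∇ (fun y => ζ y ^ p * gapTest p σ (w y)) x⟫ := by
  have hm0 : 0 < logExp p := by linarith [one_lt_logExp hp]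
  have hQ := gap_pos hp hσ hs
  have h0 : 0 ≤ max (w x) 0 := le_max_right _ _
  have ht0 : 0 ≤ t := by rw [ht]; positivity
  have h1 := hc (ρ * t) (ρ * ‖∇ ζ x‖) (by positivity) hC
  rw [Real.mul_rpow hρ.le ht0, Real.mul_rpow hρ.le ht0] at h1
  have h2 := mul_le_mul_of_nonneg_left (le_inner_flux_gapTest hp hσ hw hζ hz hs ht)
    (show 0 ≤ ρ ^ p * logExp p ^ (p - 1) by positivity)
  have e1 : logExp p ^ (p - 1) * logExp p ^ (1 - p) = 1 := by
    rw [← Real.rpow_add hm0, sub_add_sub_cancel, sub_self, Real.rpow_zero]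
  have e2 : ρ ^ (p - 1) * ρ = ρ ^ p := by rw [← Real.rpow_add_one hρ.ne', sub_add_cancel]
  have e3 : ρ ^ p * logExp p ^ (p - 1) * (logExp p ^ (1 - p) *
      ((p - 1) * t ^ p - p * ‖∇ ζ x‖ * t ^ (p - 1))) =
      (p - 1) * (ρ ^ p * t ^ p) - p * (ρ * ‖∇ ζ x‖) * (ρ ^ (p - 1) * t ^ (p - 1)) := by
    calc _ = (logExp p ^ (p - 1) * logExp p ^ (1 - p)) * (ρ ^ p *
          ((p - 1) * t ^ p - p * ‖∇ ζ x‖ * t ^ (p - 1))) := by ring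
      _ = _ := by rw [e1, ← e2]; ring
  linarith

lemma contDiffOn_gapTest {U : Set Plane} (hp : 1 < p) (hσ : 0 < σ) (hw : ContDiffOn ℝ 1 w U)
    (hs : ∀ x ∈ U, w x ≤ 1) : ContDiffOn ℝ 1 (fun x => gapTest p σ (w x)) U := by
  have h1 : ContDiffOn ℝ 1 (fun x => gap p σ (w x)) U := (contDiff_gap hp).comp_contDiffOn hw
  exact ((contDiff_max_rpow one_lt_two).comp_contDiffOn hw).mul
    (h1.rpow_const_of_ne fun x hx => (gap_pos hp hσ (hs x hx)).ne')

lemma contDiffOn_logGap {U : Set Plane} (hp : 1 < p) (hσ : 0 < σ) (hw : ContDiffOn ℝ 1 w U)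
    (hs : ∀ x ∈ U, w x ≤ 1) : ContDiffOn ℝ 1 (fun x => logGap p σ (w x)) U := by
  have h1 : ContDiffOn ℝ 1 (fun x => gap p σ (w x)) U := (contDiff_gap hp).comp_contDiffOn hw
  exact contDiffOn_const.sub (h1.log fun x hx => (gap_pos hp hσ (hs x hx)).ne')

end LogEstimate

section LogEstimate

variable {p σ : ℝ} {D : Set Plane} {w ζ : Plane → ℝ} {x x₀ : Plane}

set_option maxHeartbeats 1000000 in
lemma exists_integral_norm_gradient_logGap_le (hp : 1 < p) (hσ : 0 < σ) (hD : IsOpen D)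
    (hwc : ContinuousOn w (closure D)) (hw : WeakSol (fun t => t ^ (p - 2)) D w) {ρ c C : ℝ}
    (hρ : 0 < ρ) (hfr : ∀ x ∈ frontier D, x ∈ closedBall x₀ (2 * ρ) → w x < 0)
    (hle : ∀ x ∈ D, x ∈ ball x₀ (2 * ρ) → w x ≤ 1) (hζ : ContDiff ℝ 1 ζ) (hζ0 : ∀ x, 0 ≤ ζ x)
    (hζ1 : ∀ x ∈ closedBall x₀ ρ, ζ x = 1) (hζs : tsupport ζ ⊆ closedBall x₀ (3 / 2 * ρ))
    (hζC : ∀ x, ‖∇ ζ x‖ ≤ C / ρ) (hc0 : 0 < c) (hc : ∀ τ α : ℝ, 0 ≤ τ →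
      α ≤ C → τ ≤ c + ((p - 1) * τ ^ p - p * α * τ ^ (p - 1))) :
    ∃ L : Plane → ℝ, ContDiff ℝ 1 L ∧ (∀ x ∈ D, x ∈ closedBall x₀ ρ → L x = logGap p σ (w x)) ∧
      (∀ x ∉ D, L x = 0) ∧ ∫ x in ball x₀ ρ, ‖∇ L x‖ ≤ 4 * Real.pi * c * ρ := by
  set U : Set Plane := D ∩ ball x₀ (2 * ρ) with hU
  have hUo : IsOpen U := hD.inter isOpen_ball
  set K : Set Plane := closedBall x₀ (3 / 2 * ρ) ∩ (closure D ∩ w ⁻¹' Ici 0) with hK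
  have hKc : IsClosed K :=
    isClosed_closedBall.inter (hwc.preimage_isClosed_of_isClosed isClosed_closure isClosed_Ici)
  have hKcp : IsCompact K := (isCompact_closedBall x₀ (3 / 2 * ρ)).inter_right
    (hwc.preimage_isClosed_of_isClosed isClosed_closure isClosed_Ici)
  have hKU : K ⊆ U := by
    rintro x ⟨hx1, hx2, hx3⟩
    have hx4 : x ∈ ball x₀ (2 * ρ) := closedBall_subset_ball (by linarith) hx1
    refine ⟨by_contra fun hxD => ?_, hx4⟩
    have := hfr x (by rw [hD.frontier_eq]; exact ⟨hx2, hxD⟩) (ball_subset_closedBall hx4)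
    exact absurd hx3 (not_le.2 this)
  have hwU : ContDiffOn ℝ 1 w U := hw.1.mono inter_subset_left
  have hs : ∀ x ∈ U, w x ≤ 1 := fun x hx => hle x hx.1 hx.2
  have hzero : ∀ (f : Plane → ℝ), (∀ x, ζ x = 0 ∨ w x ≤ 0 → f x = 0) →
      ∀ x ∉ K, D.indicator f x = 0 := by
    intro f hf x hx
    by_cases hxD : x ∈ D
    · rw [indicator_of_mem hxD]
      refine hf x ?_
      by_contra! hcon
      refine hx ⟨?_, subset_closure hxD, hcon.2.le⟩
      exact hζs (subset_tsupport _ hcon.1)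
    · exact indicator_of_notMem hxD _
  set L : Plane → ℝ := D.indicator fun x => ζ x * logGap p σ (w x) with hL
  set η : Plane → ℝ := D.indicator fun x => ζ x ^ p * gapTest p σ (w x) with hη
  have hL0 : ∀ x ∉ K, L x = 0 := hzero _ fun x hx => by
    rcases hx with h | h
    · rw [h, zero_mul]
    · rw [logGap_of_nonpos hp h, mul_zero]
  have hη0 : ∀ x ∉ K, η x = 0 := hzero _ fun x hx => by
    rcases hx with h | h
    · rw [h, Real.zero_rpow (by linarith), zero_mul]
    · rw [gapTest_of_nonpos h, mul_zero]
  have hLU : EqOn L (fun x => ζ x * logGap p σ (w x)) U := fun x hx => indicator_of_mem hx.1 _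
  have hηU : EqOn η (fun x => ζ x ^ p * gapTest p σ (w x)) U := fun x hx =>
    indicator_of_mem hx.1 _
  have hLd : ContDiff ℝ 1 L := contDiff_of_eq_zero_off hUo hKc hKU
    ((hζ.contDiffOn.mul (contDiffOn_logGap hp hσ hwU hs)).congr hLU) hL0
  have hζp : ContDiff ℝ 1 fun x => ζ x ^ p := hζ.rpow_const_of_le (by exact_mod_cast hp.le)
  have hηd : ContDiff ℝ 1 η := contDiff_of_eq_zero_off hUo hKc hKU
    ((hζp.contDiffOn.mul (contDiffOn_gapTest hp hσ hwU hs)).congr hηU) hη0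
  have hηs : tsupport η ⊆ K := closure_minimal
    (fun x hx => by_contra fun h => hx (hη0 x h)) hKc
  have hLs : tsupport L ⊆ K := closure_minimal
    (fun x hx => by_contra fun h => hx (hL0 x h)) hKc
  have hηc : HasCompactSupport η := HasCompactSupport.intro hKcp hη0
  set E : Plane → ℝ := fun x => ⟪flux (fun t => t ^ (p - 2)) (∇ w x), ∇ η x⟫ with hE
  have hEc : Continuous E := continuous_inner_of_tsupport hUo
    (continuousOn_flux_gradient (isKernel_rpow p) hp hUo hwU) (continuous_gradient hηd)
    (tsupport_gradient_subset.trans (hηs.trans hKU))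
  have hE0 : ∀ x ∉ K, E x = 0 := fun x hx => by
    rw [hE]
    simp only
    rw [gradient_eq_zero_of_notMem_tsupport fun h => hx (hηs h), inner_zero_right]
  have hEint : ∫ x, E x = 0 := hw.2 η hηd hηc (hηs.trans (hKU.trans inter_subset_left))
  set Λ : ℝ := ρ ^ p * logExp p ^ (p - 1) with hΛ
  have hmain : ∀ x ∈ U, ρ * (ζ x * (logExp p * max (w x) 0 ^ (logExp p - 1) /
      gap p σ (w x)) * ‖∇ w x‖) ≤ c + Λ * E x := by
    intro x hx
    have h := mul_le_add_inner_flux_gapTest hp hσ (differentiableAt_of_contDiffOn hwU hUo hx)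
      (hζ.differentiable one_ne_zero x) (hζ0 x) (hs x hx) hρ rfl
      (by have := hζC x; rw [le_div_iff₀ hρ] at this; linarith) hc
    rw [hE]
    simp only
    rwa [gradient_congr_of_eqOn hUo hηU hx]
  have hpos : ∀ x, 0 ≤ c + Λ * E x := by
    intro x
    by_cases hx : x ∈ U
    · refine le_trans ?_ (hmain x hx)
      have := gap_pos hp hσ (hs x hx)
      have h0 : 0 ≤ max (w x) 0 := le_max_right _ _
      have := hζ0 x
      have : 0 < logExp p := by linarith [one_lt_logExp hp]
      positivity
    · rw [hE0 x fun h => hx (hKU h), mul_zero, add_zero]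
      exact hc0.le
  have hgrad : ∀ x ∈ ball x₀ ρ, ρ * ‖∇ L x‖ ≤ c + Λ * E x := by
    intro x hx
    by_cases hxD : x ∈ D
    · have hxU : x ∈ U := ⟨hxD, ball_subset_ball (by linarith) hx⟩
      have hop : IsOpen (D ∩ ball x₀ ρ) := hD.inter isOpen_ball
      have heq : EqOn L (fun x => logGap p σ (w x)) (D ∩ ball x₀ ρ) := fun y hy => by
        rw [hL, indicator_of_mem hy.1, hζ1 y (ball_subset_closedBall hy.2), one_mul]
      have h1 := hmain x hxU
      rw [hζ1 x (ball_subset_closedBall hx), one_mul] at h1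
      rw [gradient_congr_of_eqOn hop heq ⟨hxD, hx⟩, gradient_comp (f := w)
        (hasDerivAt_logGap hp hσ (hs x hxU)) (differentiableAt_of_contDiffOn hwU hUo hxU),
        norm_smul, Real.norm_of_nonneg]
      · exact h1
      · have := gap_pos hp hσ (hs x hxU)
        have h0 : 0 ≤ max (w x) 0 := le_max_right _ _
        have : 0 < logExp p := by linarith [one_lt_logExp hp]
        positivity
    · rw [gradient_eq_zero_of_notMem_tsupport fun h => hxD (hKU (hLs h)).1, norm_zero, mul_zero]
      exact hpos x
  have hcont : Continuous fun x => c + Λ * E x := continuous_const.add (continuous_const.mul hEc)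
  refine ⟨L, hLd, fun x hxD hx => ?_, fun x hx => indicator_of_notMem hx _, ?_⟩
  · rw [hL, indicator_of_mem hxD, hζ1 x hx, one_mul]
  have i1 : IntegrableOn (fun x => ρ * ‖∇ L x‖) (ball x₀ ρ) :=
    (continuous_const.mul (continuous_gradient hLd).norm).integrableOn_ball x₀ ρ
  have h1 : ∫ x in ball x₀ ρ, ρ * ‖∇ L x‖ ≤ ∫ x in ball x₀ ρ, (c + Λ * E x) :=
    setIntegral_mono_on i1 (hcont.integrableOn_ball x₀ ρ) measurableSet_ball hgrad
  have h2 : ∫ x in ball x₀ ρ, (c + Λ * E x) ≤ ∫ x in ball x₀ (2 * ρ), (c + Λ * E x) :=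
    setIntegral_mono_set_of_nonneg hcont hpos (ball_subset_ball (by linarith)) isBounded_ball
  have i2 : IntegrableOn (fun _ : Plane => c) (ball x₀ (2 * ρ)) :=
    continuous_const.integrableOn_ball x₀ _
  have i3 : IntegrableOn (fun x => Λ * E x) (ball x₀ (2 * ρ)) :=
    (continuous_const.mul hEc).integrableOn_ball x₀ _
  have h3 : ∫ x in ball x₀ (2 * ρ), E x = 0 := by
    rw [← integral_eq_setIntegral_ball (fun x hx => hE0 x fun h => hx (hKU h).2), hEint]
  rw [integral_add i2 i3, integral_const_mul, h3, mul_zero, add_zero, setIntegral_const,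
    volume_real_ball _ (by positivity), smul_eq_mul] at h2
  rw [integral_const_mul] at h1
  have h4 : ρ * ∫ x in ball x₀ ρ, ‖∇ L x‖ ≤ ρ * (4 * Real.pi * c * ρ) := by
    refine (h1.trans h2).trans (le_of_eq ?_)
    ring
  exact le_of_mul_le_mul_left h4 hρ

end LogEstimate

section BoundaryDecay

variable {p : ℝ}

lemma le_of_logGap_le (hp : 1 < p) {σ κ s : ℝ} (hσ : 0 < σ) (hs : s ≤ 1)
    (h : logGap p σ s ≤ κ) : max s 0 ^ logExp p ≤ 1 - Real.exp (-κ) + σ := by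
  have hQ := gap_pos hp hσ hs
  have h1 : Real.exp (-κ) ≤ gap p σ s := by
    rw [← Real.le_log_iff_exp_le hQ]
    rw [logGap] at h
    have : 0 ≤ Real.log (1 + σ) := Real.log_nonneg (by linarith)
    linarith
  rw [gap] at h1
  linarith

lemma le_rpow_inv_of_max_rpow_le {m s b : ℝ} (hm : 0 < m) (h : max s 0 ^ m ≤ b) :
    s ≤ b ^ m⁻¹ := by
  have h0 : 0 ≤ max s 0 := le_max_right _ _
  have h1 := Real.rpow_le_rpow (by positivity) h (inv_nonneg.2 hm.le)
  rw [← Real.rpow_mul h0, mul_inv_cancel₀ hm.ne', Real.rpow_one] at h1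
  exact (le_max_left _ _).trans h1

lemma max_rpow_le_of_le_rpow_inv {m s b : ℝ} (hm : 0 < m) (hb : 0 ≤ b) (h : s ≤ b ^ m⁻¹) :
    max s 0 ^ m ≤ b := by
  have h1 : max s 0 ≤ b ^ m⁻¹ := max_le h (by positivity)
  have h2 := Real.rpow_le_rpow (le_max_right _ _) h1 hm.le
  rwa [← Real.rpow_mul hb, inv_mul_cancel₀ hm.ne', Real.rpow_one] at h2

/-- A solution which is negative on the boundary near `x₀` and at most one stays away from one
near `x₀`, provided circles around `x₀` leave the domain. -/
theorem exists_boundary_decay_normalized (hp : 1 < p) : ∃ γ : ℝ, 0 < γ ∧ γ < 1 ∧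
    ∀ (D : Set Plane) (w : Plane → ℝ) (x₀ : Plane) (ρ : ℝ), IsOpen D → Bornology.IsBounded D →
      ContinuousOn w (closure D) → WeakSol (fun t => t ^ (p - 2)) D w → 0 < ρ →
      (∀ r ∈ Icc (ρ / 2) ρ, ∃ y ∈ sphere x₀ r, y ∉ D) →
      (∀ x ∈ frontier D, x ∈ closedBall x₀ (2 * ρ) → w x < 0) →
      (∀ x ∈ D, x ∈ ball x₀ (2 * ρ) → w x ≤ 1) →
      ∀ x ∈ D, x ∈ ball x₀ (ρ / 2) → w x ≤ γ := by
  obtain ⟨C, hC, hcut⟩ := exists_cutoff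
  obtain ⟨c, hc0, hc⟩ := exists_young hp C hC.le
  set κ : ℝ := 8 * Real.pi * c + 1 with hκ
  have hκ0 : 0 < κ := by positivity
  have hm : 0 < logExp p := by linarith [one_lt_logExp hp]
  have he : Real.exp (-κ) < 1 := by
    rw [← Real.exp_zero]
    exact Real.exp_lt_exp.2 (by linarith)
  have he0 := Real.exp_pos (-κ)
  refine ⟨(1 - Real.exp (-κ)) ^ (logExp p)⁻¹, Real.rpow_pos_of_pos (by linarith) _,
    Real.rpow_lt_one (by linarith) (by linarith) (inv_pos.2 hm), ?_⟩
  intro D w x₀ ρ hD hDb hwc hw hρ hcirc hfr hle x hxD hx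
  obtain ⟨ζ, hζ, hζ0, -, hζ1, hζs, hζC, -⟩ := hcut x₀ ρ hρ
  refine le_rpow_inv_of_max_rpow_le hm (le_of_forall_pos_le_add fun σ hσ => ?_)
  obtain ⟨L, hLd, hLw, hL0, hLint⟩ := exists_integral_norm_gradient_logGap_le hp hσ hD hwc hw hρ
    hfr hle (hζ.of_le one_le_two) hζ0 hζ1 hζs hζC hc0 hc
  obtain ⟨r, hr, hosc⟩ : ∃ r ∈ Icc (ρ / 2) ρ, ∀ y ∈ sphere x₀ r, ∀ z ∈ sphere x₀ r,
      L y - L z < κ := by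
    by_contra! hcon
    have h := le_integral_of_circle_osc hLd x₀ (half_pos hρ) (by linarith) hcon
    have : κ * (ρ - ρ / 2) = 4 * Real.pi * c * ρ + ρ / 2 := by rw [hκ]; ring
    linarith
  obtain ⟨z, hz, hzD⟩ := hcirc r hr
  have hb : 0 ≤ 1 - Real.exp (-κ) + σ := by linarith
  refine max_rpow_le_of_le_rpow_inv hm hb ?_
  have hVo : IsOpen (D ∩ ball x₀ r) := hD.inter isOpen_ball
  refine comparison_closure (isKernel_rpow p) hp hVo (hDb.subset inter_subset_left)
    (hw.mono inter_subset_left) (weakSol_const _ _ ((1 - Real.exp (-κ) + σ) ^ (logExp p)⁻¹))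
    (hwc.mono (closure_mono inter_subset_left)) continuousOn_const ?_ x
    (subset_closure ⟨hxD, ball_subset_ball hr.1 hx⟩)
  intro y hy
  rw [hVo.frontier_eq] at hy
  have hy1 : y ∈ closure D := closure_mono inter_subset_left hy.1
  have hy2 : y ∈ closedBall x₀ r := closure_ball_subset_closedBall
    (closure_mono inter_subset_right hy.1)
  by_cases hyD : y ∈ D
  · have hys : y ∈ sphere x₀ r := by
      have : ¬ dist y x₀ < r := fun h => hy.2 ⟨hyD, h⟩
      exact le_antisymm hy2 (not_lt.1 this)
    have h1 := hosc y hys z hz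
    rw [hL0 z hzD, sub_zero, hLw y hyD (closedBall_subset_closedBall hr.2 hy2)] at h1
    refine le_rpow_inv_of_max_rpow_le hm (le_of_logGap_le hp hσ (hle y hyD ?_) h1.le)
    exact closedBall_subset_ball (by linarith [hr.2]) hy2
  · refine (hfr y (by rw [hD.frontier_eq]; exact ⟨hy1, hyD⟩) ?_).le.trans (by positivity)
    exact closedBall_subset_closedBall (by linarith [hr.2]) hy2

lemma flux_rpow_smul {c : ℝ} (hc : 0 < c) (ξ : Plane) :
    flux (fun t => t ^ (p - 2)) (c • ξ) =
      (c ^ (p - 2) * c) • flux (fun t => t ^ (p - 2)) ξ := by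
  simp only [flux, norm_smul, Real.norm_of_nonneg hc.le, smul_smul]
  rw [Real.mul_rpow hc.le (norm_nonneg _)]
  congr 1
  ring

lemma WeakSol.const_mul {U : Set Plane} {u : Plane → ℝ} (hU : IsOpen U)
    (hu : WeakSol (fun t => t ^ (p - 2)) U u) {c : ℝ} (hc : 0 < c) :
    WeakSol (fun t => t ^ (p - 2)) U fun x => c * u x := by
  refine ⟨contDiffOn_const.mul hu.1, fun η hη hηc hηs => ?_⟩
  have : (fun x => ⟪flux (fun t => t ^ (p - 2)) (∇ (fun x => c * u x) x), ∇ η x⟫) =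
      fun x => (c ^ (p - 2) * c) * ⟪flux (fun t => t ^ (p - 2)) (∇ u x), ∇ η x⟫ := by
    funext x
    by_cases hx : x ∈ U
    · rw [gradient_const_mul (differentiableAt_of_contDiffOn hu.1 hU hx), flux_rpow_smul hc,
        real_inner_smul_left]
    · rw [gradient_eq_zero_of_notMem_tsupport fun h => hx (hηs h), inner_zero_right,
        inner_zero_right, mul_zero]
  rw [this, integral_const_mul, hu.2 η hη hηc hηs, mul_zero]

/-- Iterated boundary decay. -/
theorem exists_boundary_decay (hp : 1 < p) : ∃ γ : ℝ, 0 < γ ∧ γ < 1 ∧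
    ∀ (D : Set Plane) (u : Plane → ℝ) (x₀ : Plane) (R k M : ℝ), IsOpen D →
      Bornology.IsBounded D →
      ContinuousOn u (closure D) → WeakSol (fun t => t ^ (p - 2)) D u → 0 < R → 0 < M →
      (∀ r, 0 < r → ∃ y ∈ sphere x₀ r, y ∉ D) →
      (∀ x ∈ frontier D, x ∈ closedBall x₀ R → u x < k) →
      (∀ x ∈ D, x ∈ ball x₀ R → u x ≤ k + M) →
      ∀ n : ℕ, ∀ x ∈ D, x ∈ ball x₀ (R / 4 ^ n) → u x ≤ k + γ ^ n * M := by
  obtain ⟨γ, hγ0, hγ1, H⟩ := exists_boundary_decay_normalized hp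
  refine ⟨γ, hγ0, hγ1, fun D u x₀ R k M hD hDb huc hu hR hM hcirc hfr hle n => ?_⟩
  induction n with
  | zero => simpa using hle
  | succ n ih =>
    intro x hxD hx
    set N : ℝ := γ ^ n * M with hN
    have hN0 : 0 < N := by positivity
    have h := H D (fun x => N⁻¹ * (u x + -k)) x₀ (R / 4 ^ n / 2) hD hDb
      (continuousOn_const.mul (huc.add continuousOn_const))
      ((hu.add_const (-k)).const_mul hD (inv_pos.2 hN0)) (by positivity)
      (fun r hr => hcirc r (lt_of_lt_of_le (by positivity) hr.1)) ?_ ?_ x hxD ?_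
    · rw [inv_mul_le_iff₀ hN0] at h
      rw [pow_succ]
      linarith
    · intro y hy hyb
      have : u y < k := by
        refine hfr y hy (closedBall_subset_closedBall ?_ hyb)
        rw [mul_div_cancel₀ _ two_ne_zero]
        exact div_le_self hR.le (one_le_pow₀ (by norm_num))
      exact mul_neg_of_pos_of_neg (inv_pos.2 hN0) (by linarith)
    · intro y hyD hyb
      rw [mul_div_cancel₀ _ two_ne_zero] at hyb
      rw [inv_mul_le_iff₀ hN0]
      linarith [ih y hyD hyb]
    · convert hx using 2
      rw [pow_succ]
      ring

end BoundaryDecay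

lemma eq_add_of_exp_eq {F : ℝ → ℂ} (hF : Continuous F) {r : ℝ}
    (h : ∀ θ : ℝ, Complex.exp (F θ) = r * Complex.exp (θ * Complex.I)) (θ : ℝ) :
    F θ = F 0 + θ * Complex.I := by
  have h1 : Continuous fun θ : ℝ => F 0 + θ * Complex.I := by fun_prop
  refine congrFun (Complex.isCoveringMap_exp.eq_of_comp_eq hF h1 ?_ 0 (by simp)) θ
  funext t
  refine Subtype.ext ?_
  simp only [Function.comp_apply]
  rw [h, Complex.exp_add, h]
  simp

/-- A circle around a point outside a simply connected plane domain leaves the domain. -/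
theorem exists_sphere_notMem {Ω : Set Plane} (hΩo : IsOpen Ω) (hΩsc : SimplyConnectedSpace Ω)
    {x₀ : Plane} (hx₀ : x₀ ∉ Ω) {r : ℝ} (hr : 0 < r) : ∃ y ∈ sphere x₀ r, y ∉ Ω := by
  by_contra! hcon
  set g : Plane → ℂ := fun x => ((x 0 - x₀ 0 : ℝ) : ℂ) + ((x 1 - x₀ 1 : ℝ) : ℂ) * Complex.I
    with hg
  have hgc : Continuous g := by fun_prop
  have hg0 : 0 ∉ g '' Ω := by
    rintro ⟨x, hx, h⟩
    have h0 := congrArg Complex.re h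
    have h1 := congrArg Complex.im h
    simp [hg] at h0 h1
    refine hx₀ ?_
    have : x = x₀ := by
      ext i
      fin_cases i
      · simpa using sub_eq_zero.1 h0
      · simpa using sub_eq_zero.1 h1
    rwa [← this]
  obtain ⟨f, hf, hfg⟩ := Complex.exists_continuousOn_eqOn_exp_comp (U := Ω) hΩsc hΩo
    hgc.continuousOn hg0
  have hmem : ∀ θ, x₀ + r • circ θ ∈ Ω := fun θ => hcon _ (by
    rw [mem_sphere_iff_norm, add_sub_cancel_left, norm_smul, norm_circ, mul_one,
      Real.norm_of_nonneg hr.le])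
  have hF : Continuous fun θ => f (x₀ + r • circ θ) :=
    hf.comp_continuous (by fun_prop) hmem
  have hexp : ∀ θ : ℝ, Complex.exp (f (x₀ + r • circ θ)) = r * Complex.exp (θ * Complex.I) := by
    intro θ
    have := hfg (hmem θ)
    simp only [Function.comp_apply] at this
    rw [this, Complex.exp_mul_I, hg]
    simp [circ]
    ring
  have h := eq_add_of_exp_eq hF hexp (2 * Real.pi)
  have hc : circ (2 * Real.pi) = circ 0 := by simp [circ]
  rw [hc] at h
  simp [Real.pi_ne_zero] at h

section Exhaustion

variable {p : ℝ} {Ω D : Set Plane} {u Φ : Plane → ℝ} {x₀ : Plane}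

lemma exists_contDiff_approx {K : Set Plane} (hK : IsCompact K) (hΦ : ContinuousOn Φ K) {ε : ℝ}
    (hε : 0 < ε) : ∃ Ψ : Plane → ℝ, ContDiff ℝ 1 Ψ ∧ HasCompactSupport Ψ ∧
      ∀ x ∈ K, |Ψ x - Φ x| ≤ ε := by
  obtain ⟨g, hg⟩ := ContinuousMap.exists_restrict_eq hK.isClosed
    ⟨K.domRestrict Φ, continuousOn_iff_continuous_domRestrict.1 hΦ⟩
  obtain ⟨r, hr, hKr⟩ := hK.isBounded.subset_closedBall_lt 0 0
  obtain ⟨C, -, hcut⟩ := exists_cutoff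
  obtain ⟨ζ, hζ, -, -, hζ1, hζs, -⟩ := hcut 0 r hr
  have hζc : HasCompactSupport ζ := HasCompactSupport.of_support_subset_isCompact
    (isCompact_closedBall 0 (3 / 2 * r)) ((subset_tsupport _).trans hζs)
  have hf : Continuous fun x => ζ x * g x := hζ.continuous.mul g.continuous
  obtain ⟨h, hh, hd⟩ := (hζc.mul_right.uniformContinuous_of_continuous hf).exists_contDiff_dist_le hε
  refine ⟨fun x => ζ x * h x, (hζ.of_le one_le_two).mul (hh.of_le (by exact_mod_cast le_top)),
    hζc.mul_right, fun x hx => ?_⟩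
  have h1 := hd x
  have h2 : g x = Φ x := congrArg (fun F : C(K, ℝ) => F ⟨x, hx⟩) hg
  rw [Pi.mul_apply, hζ1 x (hKr hx), one_mul, h2, Real.dist_eq] at h1
  simp only
  rw [hζ1 x (hKr hx), one_mul]
  exact h1.le

/-- The set of points at distance more than `δ` from the complement of `Ω`. -/
def innerSet (Ω : Set Plane) (δ : ℝ) : Set Plane := {x | δ < infDist x Ωᶜ}

lemma isOpen_innerSet (Ω : Set Plane) (δ : ℝ) : IsOpen (innerSet Ω δ) :=
  isOpen_lt continuous_const (continuous_infDist_pt _)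

lemma innerSet_subset {δ : ℝ} (hδ : 0 ≤ δ) : innerSet Ω δ ⊆ Ω := by
  intro x hx
  by_contra h
  have : infDist x Ωᶜ = 0 := infDist_zero_of_mem h
  rw [innerSet, mem_ofPred_eq, this] at hx
  exact absurd hx (not_lt.2 hδ)

lemma closedBall_subset_innerSet {x : Plane} {δ r : ℝ} (h : δ + r < infDist x Ωᶜ) :
    closedBall x r ⊆ innerSet Ω δ := by
  intro y hy
  have h1 : infDist x Ωᶜ ≤ infDist y Ωᶜ + dist x y := infDist_le_infDist_add_dist
  rw [mem_closedBall, dist_comm] at hy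
  rw [innerSet, mem_ofPred_eq]
  linarith

lemma exterior_ball_innerSet (hΩo : IsOpen Ω) (hne : Ωᶜ.Nonempty) {δ : ℝ} (hδ : 0 < δ)
    (hx₀ : x₀ ∈ frontier (innerSet Ω δ)) : ∃ (y : Plane) (R : ℝ), 0 < R ∧ ‖x₀ - y‖ = R ∧
      ∀ x ∈ closure (innerSet Ω δ), x ≠ x₀ → R < ‖x - y‖ := by
  have h0 : δ = infDist x₀ Ωᶜ :=
    frontier_lt_subset_eq continuous_const (continuous_infDist_pt _) hx₀
  obtain ⟨y, hy, hd⟩ := hΩo.isClosed_compl.exists_infDist_eq_dist hne x₀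
  rw [← h0, dist_eq_norm] at hd
  have e1 : x₀ - (1 / 2 : ℝ) • (x₀ + y) = (1 / 2 : ℝ) • (x₀ - y) := by module
  refine ⟨(1 / 2 : ℝ) • (x₀ + y), δ / 2, half_pos hδ, ?_, fun x hx hne => ?_⟩
  · rw [e1, norm_smul, ← hd, Real.norm_of_nonneg (by norm_num)]
    ring
  · have h1 : δ ≤ ‖x - y‖ := by
      have h2 : δ ≤ infDist x Ωᶜ :=
        closure_lt_subset_le continuous_const (continuous_infDist_pt _) hx
      rw [← dist_eq_norm]
      exact h2.trans (infDist_le_dist_of_mem hy)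
    by_contra! hle
    have hpar := parallelogram_law_with_norm ℝ (x - (1 / 2 : ℝ) • (x₀ + y))
      ((1 / 2 : ℝ) • (x₀ - y))
    have e2 : x - (1 / 2 : ℝ) • (x₀ + y) + (1 / 2 : ℝ) • (x₀ - y) = x - y := by module
    have e3 : x - (1 / 2 : ℝ) • (x₀ + y) - (1 / 2 : ℝ) • (x₀ - y) = x - x₀ := by module
    have e4 : ‖(1 / 2 : ℝ) • (x₀ - y)‖ = δ / 2 := by
      rw [norm_smul, ← hd, Real.norm_of_nonneg (by norm_num)]
      ring
    rw [e2, e3, e4] at hpar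
    have h3 : 0 < ‖x - x₀‖ := norm_pos_iff.2 (sub_ne_zero.2 hne)
    have h4 := norm_nonneg (x - (1 / 2 : ℝ) • (x₀ + y))
    nlinarith

/-- Uniform one-sided modulus of continuity at boundary points. -/
lemma exists_uniform_upper_bound (hp : 1 < p) (hΩo : IsOpen Ω) (hΩsc : SimplyConnectedSpace Ω)
    (hΦ : ContinuousOn Φ (closure Ω)) (hx₀ : x₀ ∈ frontier Ω) {κ M : ℝ} (hκ : 0 < κ) :
    ∃ R > 0, ∀ (D : Set Plane) (u : Plane → ℝ), IsOpen D → Bornology.IsBounded D → D ⊆ Ω →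
      ContinuousOn u (closure D) → WeakSol (fun t => t ^ (p - 2)) D u →
      (∀ x ∈ frontier D, u x ≤ Φ x + κ / 4) → (∀ x ∈ D, u x ≤ M) →
      ∀ x ∈ D, x ∈ ball x₀ R → u x ≤ Φ x₀ + κ := by
  obtain ⟨γ, hγ0, hγ1, H⟩ := exists_boundary_decay hp
  have hx₀Ω : x₀ ∉ Ω := by
    rw [hΩo.frontier_eq] at hx₀
    exact hx₀.2
  obtain ⟨ε, hε, hcl⟩ := Metric.continuousWithinAt_iff.1
    (hΦ x₀ (frontier_subset_closure hx₀)) (κ / 4) (by positivity)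
  set k : ℝ := Φ x₀ + κ / 2 with hk
  set N : ℝ := |M| + |k| + 1 with hN
  have hN0 : 0 < N := by positivity
  obtain ⟨m, hm⟩ := exists_pow_lt_of_lt_one (show 0 < κ / 2 / N by positivity) hγ1
  rw [lt_div_iff₀ hN0] at hm
  refine ⟨ε / 2 / 4 ^ m, by positivity, fun D u hD hDb hDΩ huc hu hfr hM x hxD hx => ?_⟩
  have h := H D u x₀ (ε / 2) k N hD hDb huc hu (half_pos hε) hN0 ?_ ?_ ?_ m x hxD hx
  · linarith
  · intro r hr
    obtain ⟨y, hy, hyΩ⟩ := exists_sphere_notMem hΩo hΩsc hx₀Ω hr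
    exact ⟨y, hy, fun h => hyΩ (hDΩ h)⟩
  · intro y hy hyb
    have h1 := hcl (closure_mono hDΩ (frontier_subset_closure hy))
      (lt_of_le_of_lt hyb (by linarith))
    rw [Real.dist_eq] at h1
    linarith [hfr y hy, (abs_lt.1 h1).2]
  · intro y hy _
    linarith [hM y hy, le_abs_self M, neg_abs_le k]

lemma exists_uniform_bound (hp : 1 < p) (hΩo : IsOpen Ω) (hΩsc : SimplyConnectedSpace Ω)
    (hΦ : ContinuousOn Φ (closure Ω)) (hx₀ : x₀ ∈ frontier Ω) {κ M : ℝ} (hκ : 0 < κ) :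
    ∃ R > 0, ∀ (D : Set Plane) (u : Plane → ℝ), IsOpen D → Bornology.IsBounded D → D ⊆ Ω →
      ContinuousOn u (closure D) → WeakSol (fun t => t ^ (p - 2)) D u →
      (∀ x ∈ frontier D, |u x - Φ x| ≤ κ / 4) → (∀ x ∈ D, |u x| ≤ M) →
      ∀ x ∈ D, x ∈ ball x₀ R → |u x - Φ x₀| ≤ κ := by
  obtain ⟨R₁, hR₁, H₁⟩ := exists_uniform_upper_bound hp hΩo hΩsc hΦ hx₀ (M := M) hκ
  obtain ⟨R₂, hR₂, H₂⟩ := exists_uniform_upper_bound hp hΩo hΩsc hΦ.neg hx₀ (M := M) hκ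
  refine ⟨min R₁ R₂, lt_min hR₁ hR₂, fun D u hD hDb hDΩ huc hu hfr hM x hxD hx => ?_⟩
  have h1 := H₁ D u hD hDb hDΩ huc hu (fun y hy => by linarith [(abs_le.1 (hfr y hy)).2])
    (fun y hy => (abs_le.1 (hM y hy)).2) x hxD (ball_subset_ball (min_le_left _ _) hx)
  have h2 := H₂ D (fun x => -u x) hD hDb hDΩ huc.neg hu.neg
    (fun y hy => by simp only [Pi.neg_apply]; linarith [(abs_le.1 (hfr y hy)).1])
    (fun y hy => by linarith [(abs_le.1 (hM y hy)).1]) x hxD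
    (ball_subset_ball (min_le_right _ _) hx)
  simp only [Pi.neg_apply] at h2
  exact abs_le.2 ⟨by linarith, by linarith⟩

lemma abs_le_of_frontier (hp : 1 < p) (hD : IsOpen D) (hDb : Bornology.IsBounded D)
    (huc : ContinuousOn u (closure D)) (hu : WeakSol (fun t => t ^ (p - 2)) D u) {M : ℝ}
    (h : ∀ x ∈ frontier D, |u x| ≤ M) : ∀ x ∈ D, |u x| ≤ M := by
  intro x hx
  refine abs_le.2 ⟨?_, ?_⟩
  · exact comparison_closure (isKernel_rpow p) hp hD hDb (weakSol_const _ _ (-M)) hu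
      continuousOn_const huc (fun y hy => (abs_le.1 (h y hy)).1) x (subset_closure hx)
  · exact comparison_closure (isKernel_rpow p) hp hD hDb hu (weakSol_const _ _ M)
      huc continuousOn_const (fun y hy => (abs_le.1 (h y hy)).2) x (subset_closure hx)

theorem exists_solution (hp : 1 < p) (hΩo : IsOpen Ω) (hΩb : Bornology.IsBounded Ω)
    (hΩsc : SimplyConnectedSpace Ω) (hΦ : ContinuousOn Φ (closure Ω)) :
    ∃ u : Plane → ℝ, ContinuousOn u (closure Ω) ∧ WeakSol (fun t => t ^ (p - 2)) Ω u ∧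
      ∀ x ∉ Ω, u x = Φ x := by
  classical
  have hcomp : IsCompact (closure Ω) := hΩb.isCompact_closure
  have hne : Ωᶜ.Nonempty := by
    rw [nonempty_compl]
    intro h
    exact hcomp.ne_univ (by rw [h, closure_univ])
  obtain ⟨B, hB⟩ := hcomp.exists_bound_of_continuousOn hΦ
  set δ : ℕ → ℝ := fun n => 1 / ((n : ℝ) + 1) with hδ
  have hδ0 : ∀ n, 0 < δ n := fun n => by rw [hδ]; positivity
  have hδ1 : ∀ n, δ n ≤ 1 := fun n => by
    rw [hδ]
    exact div_le_one_of_le₀ (by linarith [n.cast_nonneg (α := ℝ)]) (by positivity)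
  have hδt : Tendsto δ atTop (𝓝 0) := tendsto_one_div_add_atTop_nhds_zero_nat
  set D : ℕ → Set Plane := fun n => innerSet Ω (δ n) with hD
  have hDo : ∀ n, IsOpen (D n) := fun n => isOpen_innerSet _ _
  have hDΩ : ∀ n, D n ⊆ Ω := fun n => innerSet_subset (hδ0 n).le
  have hDb : ∀ n, Bornology.IsBounded (D n) := fun n => hΩb.subset (hDΩ n)
  have hex : ∀ n, ∃ u : Plane → ℝ, ContinuousOn u (closure (D n)) ∧
      WeakSol (fun t => t ^ (p - 2)) (D n) u ∧ ∀ x ∈ frontier (D n), |u x - Φ x| ≤ δ n := by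
    intro n
    obtain ⟨Ψ, hΨ, hΨc, hΨd⟩ := exists_contDiff_approx hcomp hΦ (hδ0 n)
    obtain ⟨u, huc, hu, huΨ⟩ := exists_solution_of_exterior_ball hp (hDo n) (hDb n) hΨ hΨc
      fun x₀ hx₀ => exterior_ball_innerSet hΩo hne (hδ0 n) hx₀
    refine ⟨u, huc, hu, fun x hx => ?_⟩
    have hxD : x ∉ D n := by
      rw [(hDo n).frontier_eq] at hx
      exact hx.2
    rw [huΨ x hxD]
    exact hΨd x (closure_mono (hDΩ n) (frontier_subset_closure hx))
  choose u huc hu hufr using hex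
  have hM : ∀ n, ∀ x ∈ D n, |u n x| ≤ B + 1 := fun n =>
    abs_le_of_frontier hp (hDo n) (hDb n) (huc n) (hu n) fun x hx => by
      have h1 := hB x (closure_mono (hDΩ n) (frontier_subset_closure hx))
      rw [Real.norm_eq_abs] at h1
      have h2 := abs_sub_abs_le_abs_sub (u n x) (Φ x)
      linarith [hufr n x hx, hδ1 n]
  have hex : ∀ x ∈ Ω, ∃ r > 0, ∀ᶠ n in (hyperfilter ℕ : Filter ℕ), closedBall x r ⊆ D n := by
    intro x hx
    have hd : 0 < infDist x Ωᶜ := (hΩo.isClosed_compl.notMem_iff_infDist_pos hne).1 fun h => h hx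
    refine ⟨infDist x Ωᶜ / 2, half_pos hd, Nat.hyperfilter_le_atTop ?_⟩
    filter_upwards [hδt.eventually (gt_mem_nhds (half_pos hd))] with n hn
    exact closedBall_subset_innerSet (by linarith)
  obtain ⟨v, hv, hlim⟩ := exists_weakSol_limit hp (hyperfilter ℕ) (fun _ => isKernel_rpow p)
    (tendsto_flux_const (isKernel_rpow p) hp) hDo hΩo hex hu hM
  have heq : EqOn (Ω.piecewise v Φ) v Ω := fun x hx => piecewise_eq_of_mem _ _ _ hx
  refine ⟨Ω.piecewise v Φ, ?_, hv.congr hΩo heq, fun x hx => piecewise_eq_of_notMem _ _ _ hx⟩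
  refine continuousOn_closure_of_eventually hΩo hv.1.continuousOn hΦ ?_ heq
    fun x hx => piecewise_eq_of_notMem _ _ _ hx
  intro x₀ hx₀ κ hκ
  obtain ⟨R, hR, H⟩ := exists_uniform_bound hp hΩo hΩsc hΦ hx₀ (M := B + 1) hκ
  filter_upwards [self_mem_nhdsWithin, mem_nhdsWithin_of_mem_nhds (ball_mem_nhds x₀ hR)]
    with x hxΩ hxR
  obtain ⟨r, hr, hev⟩ := hex x hxΩ
  refine le_of_tendsto ((hlim x hxΩ).sub_const (Φ x₀)).abs ?_
  filter_upwards [hev, Nat.hyperfilter_le_atTop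
    (hδt.eventually (gt_mem_nhds (show 0 < κ / 4 by positivity)))] with n hn hδn
  exact H (D n) (u n) (hDo n) (hDb n) (hDΩ n) (huc n) (hu n)
    (fun y hy => (hufr n y hy).trans (le_of_lt hδn)) (hM n) x (hn (mem_closedBall_self hr.le)) hxR

end Exhaustion

end PLaplace

/-- Solvability and uniqueness of the continuous Dirichlet problem for the
`p`-Laplacian on a bounded simply connected plane domain, with continuous boundary
data `Φ`. -/
theorem pharmonic_dirichlet_problem
    (p : ℝ) (hp : 1 < p)
    (Ω : Set (EuclideanSpace ℝ (Fin 2))) (hΩne : Ω.Nonempty)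
    (hΩb : Bornology.IsBounded Ω) (hΩo : IsOpen Ω) (hΩsc : SimplyConnectedSpace Ω)
    (Φ : EuclideanSpace ℝ (Fin 2) → ℝ) (hΦ : ContinuousOn Φ (closure Ω)) :
    ∃ φ : EuclideanSpace ℝ (Fin 2) → ℝ,
      (ContinuousOn φ (closure Ω) ∧ PHarmonicOn p Ω φ ∧ EqOn φ Φ (frontier Ω)) ∧
      ∀ ψ : EuclideanSpace ℝ (Fin 2) → ℝ,
        (ContinuousOn ψ (closure Ω) ∧ PHarmonicOn p Ω ψ ∧ EqOn ψ Φ (frontier Ω)) →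
        EqOn ψ φ (closure Ω) := by
  have ha := PLaplace.isKernel_rpow p
  obtain ⟨φ, hφc, hφ, hφΦ⟩ := PLaplace.exists_solution hp hΩo hΩb hΩsc hΦ
  have hfr : EqOn φ Φ (frontier Ω) := fun x hx => hφΦ x (by
    rw [hΩo.frontier_eq] at hx
    exact hx.2)
  refine ⟨φ, ⟨hφc, PLaplace.weakSol_rpow_iff.1 hφ, hfr⟩, fun ψ hψ x hx => ?_⟩
  obtain ⟨hψc, hψ, hψΦ⟩ := hψ
  have hψ' := PLaplace.weakSol_rpow_iff.2 hψ
  have heq : EqOn ψ φ (frontier Ω) := fun y hy => (hψΦ hy).trans (hfr hy).symm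
  exact le_antisymm
    (PLaplace.comparison_closure ha hp hΩo hΩb hψ' hφ hψc hφc (fun y hy => (heq hy).le) x hx)
    (PLaplace.comparison_closure ha hp hΩo hΩb hφ hψ' hφc hψc (fun y hy => (heq hy).ge) x hx)
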